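/- Let ψ be a positive, continuously differentiable function on [−1,1] and define Ψ on [−1,1]² by Ψ(cos θ, cos φ) := ψ(cos(θ−φ)) · ψ(cos(θ+φ)) for θ, φ ∈ [0,π]. Let α, β > −1 and define on [−1,1]² the weight 𝒲_{α,β}(x,y) := Ψ(x,y) |x−y|^{2α+1} |x+y|^{2β+1} (1−x²)^{−1/2} (1−y²)^{−1/2}. If 2 − 2/(2·max{α,β}+3) < p < 2 + 2/(2·max{α,β}+1), then there exists a constant c > 0 such that ‖S_n(𝒲_{α,β}; f)‖_{𝒲_{α,β},p} ≤ c ‖f‖_{𝒲_{α,β},p} for all n ≥ 0 and all f with ‖f‖_{𝒲_{α,β},p} < ∞. -/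

import Mathlib

open MeasureTheory Real Set Filter
open scoped ENNReal

noncomputable section

/-- The parabolic-type domain `Ω`, the image of the triangle `-1 < x < y < 1`
under `(x, y) ↦ (x + y, x y)`. -/
def omegaDom : Set (ℝ × ℝ) :=
  {q | ∃ x y : ℝ, -1 < x ∧ x < y ∧ y < 1 ∧ q = (x + y, x * y)}

/-- The square `[-1,1]²`. -/
def sqDom : Set (ℝ × ℝ) := Icc (-1 : ℝ) 1 ×ˢ Icc (-1 : ℝ) 1

/-- The open triangle `-1 < x < y < 1`. -/
def triDom : Set (ℝ × ℝ) := {q | -1 < q.1 ∧ q.1 < q.2 ∧ q.2 < 1}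

/-- The smaller root `x(u,v)` of `t² - u t + v = 0`. -/
def xRoot (q : ℝ × ℝ) : ℝ := (q.1 - Real.sqrt (q.1 ^ 2 - 4 * q.2)) / 2

/-- The larger root `y(u,v)` of `t² - u t + v = 0`. -/
def yRoot (q : ℝ × ℝ) : ℝ := (q.1 + Real.sqrt (q.1 ^ 2 - 4 * q.2)) / 2

/-- Evaluation of a two-variable polynomial at a point of `ℝ²`. -/
def evalP (P : MvPolynomial (Fin 2) ℝ) (q : ℝ × ℝ) : ℝ :=
  MvPolynomial.eval ![q.1, q.2] P

/-- The space `V_n(W)` of orthogonal polynomials of degree `n` for the weight `W`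
on the domain `D`: polynomials of exact total degree `n` orthogonal to all
polynomials of lower degree. -/
def Vpoly (D : Set (ℝ × ℝ)) (W : ℝ × ℝ → ℝ) (n : ℕ) : Set (MvPolynomial (Fin 2) ℝ) :=
  {P | P.totalDegree = n ∧ ∀ Q : MvPolynomial (Fin 2) ℝ, Q.totalDegree < n →
    (∫ q in D, evalP P q * evalP Q q * W q) = 0}

/-- `Q 0, …, Q n` is an orthonormal basis of `V_n(W)` on `D`. -/
def isONBVn (D : Set (ℝ × ℝ)) (W : ℝ × ℝ → ℝ) (n : ℕ)
    (Q : ℕ → MvPolynomial (Fin 2) ℝ) : Prop :=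
  (∀ k, k ≤ n → Q k ∈ Vpoly D W n) ∧
  (∀ k, k ≤ n → ∀ j, j ≤ n →
    (∫ q in D, evalP (Q k) q * evalP (Q j) q * W q) = if k = j then 1 else 0) ∧
  (∀ R ∈ Vpoly D W n, R ∈ Submodule.span ℝ (Q '' Set.Iic n))

/-- `K` is the reproducing kernel of `Π_n²` in `L²(W)` on the domain `D`:
it is a polynomial function, for each fixed `x ∈ D` it is a polynomial of total
degree `≤ n` in the second variable, and it reproduces every polynomial of total
degree `≤ n`. -/
def IsRK (D : Set (ℝ × ℝ)) (W : ℝ × ℝ → ℝ) (n : ℕ) (K : ℝ × ℝ → ℝ × ℝ → ℝ) : Prop :=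
  (∃ KP : MvPolynomial (Fin 4) ℝ,
    ∀ x y : ℝ × ℝ, K x y = MvPolynomial.eval ![x.1, x.2, y.1, y.2] KP) ∧
  (∀ x ∈ D, ∃ P : MvPolynomial (Fin 2) ℝ, P.totalDegree ≤ n ∧ ∀ y, K x y = evalP P y) ∧
  (∀ P : MvPolynomial (Fin 2) ℝ, P.totalDegree ≤ n →
    ∀ x ∈ D, (∫ y in D, K x y * evalP P y * W y) = evalP P x)

/-- `p` is the sequence of orthonormal polynomials with respect to the weight `w`
on `[-1,1]`: `p n` has degree exactly `n`, positive leading coefficient, and the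
`p n` are orthonormal in `L²(w)`. -/
def IsONPS (w : ℝ → ℝ) (p : ℕ → Polynomial ℝ) : Prop :=
  (∀ n, (p n).natDegree = n) ∧ (∀ n, 0 < (p n).leadingCoeff) ∧
  (∀ n m, (∫ x in Icc (-1:ℝ) 1, (p n).eval x * (p m).eval x * w x)
    = if n = m then 1 else 0)

/-- The Christoffel–Darboux kernel `k_n(x,y) = ∑_{j=0}^n p_j(x) p_j(y)`. -/
def CDK (p : ℕ → Polynomial ℝ) (n : ℕ) (x y : ℝ) : ℝ :=
  ∑ j ∈ Finset.range (n + 1), (p j).eval x * (p j).eval y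

/-- The Jacobi factor `J_{a,b}(x) = (1-x)^a (1+x)^b`. -/
def Jw (a b : ℝ) (x : ℝ) : ℝ := (1 - x) ^ a * (1 + x) ^ b

/-- The factor `J*_{a,b}(u,v) = (1-u+v)^a (1+u+v)^b` on `Ω`. -/
def JstarW (a b : ℝ) (q : ℝ × ℝ) : ℝ := (1 - q.1 + q.2) ^ a * (1 + q.1 + q.2) ^ b

/-- Modulus of continuity of `ψ` on `[-1,1]`. -/
def modCont (ψ : ℝ → ℝ) (t : ℝ) : ℝ :=
  sSup {d : ℝ | ∃ x ∈ Icc (-1:ℝ) 1, ∃ y ∈ Icc (-1:ℝ) 1, |x - y| ≤ t ∧ d = |ψ x - ψ y|}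

/-- The generalized Jacobi class `GJ`. -/
def IsGJ (w : ℝ → ℝ) : Prop :=
  ∃ (r : ℕ) (ψ : ℝ → ℝ) (γ₀ γ₁ : ℝ) (γs xs : Fin r → ℝ),
    -1 < γ₀ ∧ -1 < γ₁ ∧ (∀ i, -1 < γs i) ∧
    StrictMono xs ∧ (∀ i, xs i ∈ Ioo (-1:ℝ) 1) ∧
    ContinuousOn ψ (Icc (-1:ℝ) 1) ∧ (∀ x ∈ Icc (-1:ℝ) 1, 0 < ψ x) ∧
    IntegrableOn (fun t => modCont ψ t / t) (Ioc (0:ℝ) 1) ∧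
    (∀ x : ℝ, |x| ≤ 1 → w x = ψ x * (1 - x) ^ γ₀ * (1 + x) ^ γ₁ * ∏ i, |x - xs i| ^ γs i) ∧
    (∀ x : ℝ, 1 < |x| → w x = 0)

/-- The `L^p`-norm `‖f‖_{w,e}` on `[-1,1]` (as an extended nonnegative real). -/
def lpnormI (w : ℝ → ℝ) (e : ℝ) (f : ℝ → ℝ) : ℝ≥0∞ :=
  (∫⁻ x in Icc (-1:ℝ) 1, ENNReal.ofReal (|f x| ^ e * w x)) ^ (1 / e)

/-- The `L^p`-norm `‖f‖_{W,e}` on a planar domain `D` (as an extended nonnegative real). -/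
def lpnormD (D : Set (ℝ × ℝ)) (W : ℝ × ℝ → ℝ) (e : ℝ) (f : ℝ × ℝ → ℝ) : ℝ≥0∞ :=
  (∫⁻ q in D, ENNReal.ofReal (|f q| ^ e * W q)) ^ (1 / e)

/-- The operator `s_n^{i,j}(w; f, x)` built from the Christoffel–Darboux kernel of the
orthonormal polynomials `pij` of the weight `J_{i,j} w`. -/
def snOp (w : ℝ → ℝ) (pij : ℕ → Polynomial ℝ) (i j : ℝ) (n : ℕ) (f : ℝ → ℝ) (x : ℝ) : ℝ :=
  Jw (i/2) (j/2) x * ∫ y in Icc (-1:ℝ) 1, f y * CDK pij n x y * Jw (i/2) (j/2) y * w y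

/-- Substitution `(x, y) ↦ (2 x y, x² + y² - 1)` on two-variable polynomials. -/
def quadSub (P : MvPolynomial (Fin 2) ℝ) : MvPolynomial (Fin 2) ℝ :=
  MvPolynomial.aeval
    ![2 * MvPolynomial.X 0 * MvPolynomial.X 1,
      MvPolynomial.X 0 ^ 2 + MvPolynomial.X 1 ^ 2 - 1] P

/-- A one-variable polynomial viewed as a polynomial in the first variable. -/
def polyX (q : Polynomial ℝ) : MvPolynomial (Fin 2) ℝ :=
  Polynomial.aeval (MvPolynomial.X 0) q

/-- A one-variable polynomial viewed as a polynomial in the second variable. -/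
def polyY (q : Polynomial ℝ) : MvPolynomial (Fin 2) ℝ :=
  Polynomial.aeval (MvPolynomial.X 1) q

lemma schur_test {μ : Measure ℝ} [SFinite μ] {p q : ℝ} (hpq : p.HolderConjugate q)
    (k : ℝ → ℝ → ℝ≥0∞) (hk : Measurable (Function.uncurry k))
    (h : ℝ → ℝ≥0∞) (hh : Measurable h) (hh0 : ∀ᵐ x ∂μ, h x ≠ 0 ∧ h x ≠ ⊤)
    (C : ℝ≥0∞)
    (H1 : ∀ᵐ x ∂μ, ∫⁻ y, k x y * h y ^ q ∂μ ≤ C * h x ^ q)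
    (H2 : ∀ᵐ y ∂μ, ∫⁻ x, k x y * h x ^ p ∂μ ≤ C * h y ^ p)
    (f : ℝ → ℝ≥0∞) (hf : Measurable f) :
    ∫⁻ x, (∫⁻ y, k x y * f y ∂μ) ^ p ∂μ ≤ C ^ p * ∫⁻ x, f x ^ p ∂μ := by
  have hp := hpq.pos
  have hq := hpq.symm.pos
  have hpq1 : q⁻¹ + p⁻¹ = 1 := by rw [add_comm]; exact hpq.inv_add_inv_eq_one
  have key : ∀ᵐ x ∂μ, (∫⁻ y, k x y * f y ∂μ) ^ p ≤
      C ^ (p / q) * ∫⁻ y, (h x ^ p * k x y) * (f y ^ p * (h y ^ p)⁻¹) ∂μ := by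
    filter_upwards [H1] with x hx
    have hkx : Measurable (k x) := hk.comp measurable_prodMk_left
    have e1 : ∫⁻ y, k x y * f y ∂μ
        = ∫⁻ y, ((fun y => k x y ^ (1/q) * h y) * (fun y => k x y ^ (1/p) * (f y * (h y)⁻¹))) y ∂μ := by
      apply lintegral_congr_ae
      filter_upwards [hh0] with y hy
      simp only [Pi.mul_apply]
      have : k x y = k x y ^ (1/q) * k x y ^ (1/p) := by
        rw [← ENNReal.rpow_add_of_nonneg _ _ (by positivity) (by positivity)]
        simp [one_div, hpq1]
      calc k x y * f y = (k x y ^ (1/q) * k x y ^ (1/p)) * f y * (h y * (h y)⁻¹) := by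
            rw [ENNReal.mul_inv_cancel hy.1 hy.2, ← this, mul_one]
        _ = _ := by ring
    rw [e1]
    have e2 := ENNReal.lintegral_mul_le_Lp_mul_Lq μ hpq.symm
      (f := fun y => k x y ^ (1/q) * h y) (g := fun y => k x y ^ (1/p) * (f y * (h y)⁻¹))
      (by fun_prop) (by fun_prop)
    refine (ENNReal.rpow_le_rpow e2 hp.le).trans ?_
    rw [ENNReal.mul_rpow_of_nonneg _ _ hp.le, ← ENNReal.rpow_mul, ← ENNReal.rpow_mul,
      one_div_mul_cancel hp.ne', ENNReal.rpow_one]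
    have e3 : ∀ y, (k x y ^ (1/q) * h y) ^ q = k x y * h y ^ q := fun y => by
      rw [ENNReal.mul_rpow_of_nonneg _ _ hq.le, ← ENNReal.rpow_mul, one_div_mul_cancel hq.ne',
        ENNReal.rpow_one]
    have e4 : ∀ y, (k x y ^ (1/p) * (f y * (h y)⁻¹)) ^ p = k x y * (f y ^ p * (h y ^ p)⁻¹) := fun y => by
      rw [ENNReal.mul_rpow_of_nonneg _ _ hp.le, ← ENNReal.rpow_mul, one_div_mul_cancel hp.ne',
        ENNReal.rpow_one, ENNReal.mul_rpow_of_nonneg _ _ hp.le, ENNReal.inv_rpow]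
    simp_rw [e3, e4]
    have e5 : (∫⁻ y, k x y * h y ^ q ∂μ) ^ (1/q*p) ≤ C ^ (p/q) * h x ^ p := by
      refine (ENNReal.rpow_le_rpow hx (by positivity)).trans ?_
      rw [ENNReal.mul_rpow_of_nonneg _ _ (by positivity), ← ENNReal.rpow_mul]
      apply le_of_eq
      congr 2
      · ring
      · field_simp
    refine (mul_le_mul_left e5 _).trans ?_
    rw [mul_assoc, ← lintegral_const_mul _ (by fun_prop)]
    apply le_of_eq; congr 1
    apply lintegral_congr; intro y; ring
  calc _ ≤ ∫⁻ x, C ^ (p / q) * ∫⁻ y, (h x ^ p * k x y) * (f y ^ p * (h y ^ p)⁻¹) ∂μ ∂μ :=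
        lintegral_mono_ae key
    _ = C ^ (p / q) * ∫⁻ x, ∫⁻ y, (h x ^ p * k x y) * (f y ^ p * (h y ^ p)⁻¹) ∂μ ∂μ := by
        rw [lintegral_const_mul]
        apply Measurable.lintegral_prod_right' (f := fun z : ℝ × ℝ => (h z.1 ^ p * k z.1 z.2) * (f z.2 ^ p * (h z.2 ^ p)⁻¹))
        have : Measurable fun z : ℝ × ℝ => k z.1 z.2 := hk
        fun_prop
    _ = C ^ (p / q) * ∫⁻ y, ∫⁻ x, (h x ^ p * k x y) * (f y ^ p * (h y ^ p)⁻¹) ∂μ ∂μ := by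
        rw [lintegral_lintegral_swap]
        have : Measurable fun z : ℝ × ℝ => k z.1 z.2 := hk
        apply Measurable.aemeasurable
        show Measurable fun z : ℝ × ℝ => (h z.1 ^ p * k z.1 z.2) * (f z.2 ^ p * (h z.2 ^ p)⁻¹)
        fun_prop
    _ ≤ C ^ (p / q) * ∫⁻ y, C * f y ^ p ∂μ := by
        refine mul_le_mul_right ?_ _
        apply lintegral_mono_ae
        filter_upwards [H2, hh0] with y hy hy0
        have hky : Measurable fun x => k x y := hk.comp measurable_prodMk_right
        rw [lintegral_mul_const _ (by fun_prop)]
        have : ∫⁻ x, h x ^ p * k x y ∂μ ≤ C * h y ^ p := by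
          refine le_trans (le_of_eq ?_) hy
          apply lintegral_congr; intro y; ring
        refine (mul_le_mul_left this _).trans ?_
        rw [mul_comm (f y ^ p), ← mul_assoc, mul_assoc C, ENNReal.mul_inv_cancel, mul_one]
        · simp [ENNReal.rpow_eq_zero_iff, hy0, hp, hp.le]
        · simp [ENNReal.rpow_eq_top_iff, hy0, hp, hp.le]
    _ = _ := by
        rw [lintegral_const_mul _ (by fun_prop), ← mul_assoc]
        congr 1
        nth_rw 2 [← ENNReal.rpow_one C]
        rw [← ENNReal.rpow_add_of_nonneg _ _ (by positivity) (by positivity)]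
        congr 1
        have : p * (q⁻¹ + p⁻¹) = p := by rw [hpq1, mul_one]
        field_simp at this ⊢
        linarith

def cI : Measure ℝ := volume.restrict (Ioc (-π) π)

instance : IsFiniteMeasure cI := by unfold cI; infer_instance

def ex (x : ℝ) : ℂ := Complex.exp (x * Complex.I)

lemma norm_ex (x : ℝ) : ‖ex x‖ = 1 := Complex.norm_exp_ofReal_mul_I x

lemma ex_add (x y : ℝ) : ex (x + y) = ex x * ex y := by
  unfold ex; rw [← Complex.exp_add]; push_cast; ring_nf

lemma ex_zero : ex 0 = 1 := by simp [ex]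

lemma ex_neg_mul (x : ℝ) : ex (-x) * ex x = 1 := by
  rw [← ex_add]; simp [ex]

lemma ex_ne (x : ℝ) : ex x ≠ 0 := Complex.exp_ne_zero _

lemma ex_eq (x : ℝ) : ex x = (Real.cos x : ℂ) + (Real.sin x : ℂ) * Complex.I := by
  unfold ex; rw [Complex.exp_mul_I]; push_cast; rfl

lemma conj_ex (x : ℝ) : (starRingEnd ℂ) (ex x) = ex (-x) := by
  simp [ex_eq, Complex.ext_iff]

@[fun_prop] lemma continuous_ex : Continuous ex := by unfold ex; fun_prop

@[fun_prop] lemma measurable_ex : Measurable ex := continuous_ex.measurable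

lemma ex_periodic : Function.Periodic ex (2 * π) := by
  intro x; simp [ex_eq]

lemma meanval (f : ℂ → ℂ) (hf : DifferentiableOn ℂ f (Metric.ball 0 1)) (r : ℝ) (hr0 : 0 ≤ r)
    (hr : r < 1) : ∫ x, f (r * ex x) ∂cI = 2 * π * f 0 := by
  have h1 : DiffContOnCl ℂ f (Metric.ball 0 |r|) := by
    apply DifferentiableOn.diffContOnCl
    apply hf.mono
    rw [abs_of_nonneg hr0]
    refine (Metric.closure_ball_subset_closedBall).trans ?_
    exact Metric.closedBall_subset_ball hr
  have h2 := h1.circleAverage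
  rw [Real.circleAverage_def] at h2
  have h3 : ∫ x, f (r * ex x) ∂cI = ∫ x in (0:ℝ)..2*π, f (circleMap 0 r x) := by
    have hper : Function.Periodic (fun x => f (r * ex x)) (2 * π) := by
      intro x; simp only [ex_periodic x]
    have := hper.intervalIntegral_add_eq (-π) 0
    unfold cI
    rw [← intervalIntegral.integral_of_le (by linarith [pi_pos])]
    rw [show -π + 2 * π = π by ring, zero_add] at this
    rw [this]
    simp [circleMap, ex]
  rw [h3, ← h2, Complex.real_smul]
  have : (π : ℂ) ≠ 0 := by simp [pi_ne_zero]
  push_cast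
  field_simp

lemma riesz_pointwise (p : ℝ) (hp1 : 1 < p) (hp2 : p ≤ 2) : ∃ A B : ℝ, 0 ≤ A ∧ 0 ≤ B ∧
    ∀ z : ℂ, 0 < z.re → ‖z‖ ^ p ≤ A * z.re ^ p - B * (z ^ (p : ℂ)).re := by
  have hπ := pi_pos
  set t1 := (π / (2 * p) + π / 2) / 2 with ht1
  have ha : π / (2 * p) < π / 2 := by
    apply div_lt_div_of_pos_left hπ (by norm_num) (by linarith)
  have hb : 0 < π / (2 * p) := by positivity
  have ht1a : t1 < π / 2 := by linarith
  have ht1b : 0 < t1 := by linarith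
  have hpt : p * (π / (2 * p)) = π / 2 := by field_simp
  have hpt1 : π / 2 < p * t1 := by
    rw [← hpt]; apply mul_lt_mul_of_pos_left _ (by linarith); linarith
  have hpt2 : p * t1 < π := by nlinarith
  have hc1 : 0 < cos t1 := cos_pos_of_mem_Ioo ⟨by linarith, ht1a⟩
  have hc2 : cos (p * t1) < 0 := cos_neg_of_pi_div_two_lt_of_lt hpt1 (by linarith)
  set B := 1 / (- cos (p * t1)) with hB
  have hB0 : 0 < B := by rw [hB]; apply one_div_pos.2; linarith
  have hc1p : 0 < cos t1 ^ p := rpow_pos_of_pos hc1 p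
  refine ⟨(1 + B) / cos t1 ^ p, B, by positivity, hB0.le, fun z hz => ?_⟩
  have harg : |Complex.arg z| < π / 2 := (Complex.abs_arg_lt_pi_div_two_iff).2 (Or.inl hz)
  have hre : z.re = ‖z‖ * cos |Complex.arg z| := by
    rw [cos_abs]; exact (Complex.norm_mul_cos_arg z).symm
  have hcp : (z ^ (p : ℂ)).re = ‖z‖ ^ p * cos (p * |Complex.arg z|) := by
    rw [Complex.cpow_ofReal_re]
    congr 1
    rw [← cos_abs, abs_mul, abs_of_pos (show 0 < p by linarith), mul_comm]
  set t := |Complex.arg z| with ht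
  have ht0 : 0 ≤ t := abs_nonneg _
  have hct : 0 < cos t := cos_pos_of_mem_Ioo ⟨by linarith, harg⟩
  rw [hcp, hre, mul_rpow (norm_nonneg _) hct.le]
  have hz0 : 0 ≤ ‖z‖ ^ p := by positivity
  suffices h : 1 ≤ (1 + B) / cos t1 ^ p * cos t ^ p - B * cos (p * t) by
    calc ‖z‖ ^ p = ‖z‖ ^ p * 1 := by ring
      _ ≤ ‖z‖ ^ p * ((1 + B) / cos t1 ^ p * cos t ^ p - B * cos (p * t)) :=
        mul_le_mul_of_nonneg_left h hz0
      _ = _ := by ring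
  rcases le_total t t1 with h | h
  · have h1 : cos t1 ≤ cos t := cos_le_cos_of_nonneg_of_le_pi ht0 (by linarith) h
    have h2 : cos t1 ^ p ≤ cos t ^ p := rpow_le_rpow hc1.le h1 (by linarith)
    have h3 : 1 + B ≤ (1 + B) / cos t1 ^ p * cos t ^ p := by
      rw [div_mul_eq_mul_div, le_div_iff₀ hc1p]
      apply mul_le_mul_of_nonneg_left h2; linarith
    nlinarith [cos_le_one (p * t)]
  · have h1 : cos (p * t) ≤ cos (p * t1) := by
      apply cos_le_cos_of_nonneg_of_le_pi (by nlinarith) (by nlinarith) (by nlinarith)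
    have h2 : 1 ≤ - (B * cos (p * t)) := by
      have : 1 = - (B * cos (p * t1)) := by
        rw [hB]; field_simp; rw [div_self hc2.ne]
      nlinarith
    have h3 : 0 ≤ (1 + B) / cos t1 ^ p * cos t ^ p := by positivity
    linarith

/-- Herglotz kernel. -/
def hz (w : ℂ) : ℂ := (1 + w) / (1 - w)

lemma one_sub_ne {w : ℂ} (hw : ‖w‖ < 1) : 1 - w ≠ 0 := by
  intro h; rw [sub_eq_zero] at h; rw [← h] at hw; simp at hw

lemma one_sub_norm {w : ℂ} {r : ℝ} (hw : ‖w‖ ≤ r) : 1 - r ≤ ‖1 - w‖ := by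
  have := norm_sub_norm_le (1 : ℂ) w
  simp at this; linarith

lemma hz_bound {w : ℂ} {r : ℝ} (hr : r < 1) (hw : ‖w‖ ≤ r) : ‖hz w‖ ≤ 2 / (1 - r) := by
  unfold hz; rw [norm_div]
  have h1 := one_sub_norm hw
  have : ‖1 + w‖ ≤ 2 := (norm_add_le _ _).trans (by simp; linarith)
  have : 0 < 1 - r := by linarith
  gcongr

lemma hz_re {w : ℂ} {r : ℝ} (hr0 : 0 ≤ r) (hr : r < 1) (hw : ‖w‖ ≤ r) :
    (1 - r) / (1 + r) ≤ (hz w).re := by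
  have hw1 : ‖w‖ < 1 := by linarith
  have h0 := one_sub_ne hw1
  have h1 : (hz w).re = (1 - ‖w‖^2) / ‖1 - w‖^2 := by
    unfold hz
    rw [Complex.div_re, Complex.normSq_eq_norm_sq, ← add_div]
    congr 1
    have := Complex.normSq_eq_norm_sq w
    rw [Complex.normSq_apply] at this
    rw [← this]; simp; ring
  have h2 : ‖1 - w‖ ≤ 1 + ‖w‖ := by simpa using norm_sub_le (1 : ℂ) w
  have h3 : 0 < ‖1 - w‖ := norm_pos_iff.2 h0
  rw [h1, div_le_div_iff₀ (by linarith) (by positivity)]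
  have h4 : ‖1-w‖^2 ≤ (1 + ‖w‖)^2 := by gcongr
  have h5 := norm_nonneg w
  calc (1 - r) * ‖1 - w‖^2 ≤ (1-r) * (1 + ‖w‖)^2 := by
        apply mul_le_mul_of_nonneg_left h4; linarith
    _ ≤ (1 - ‖w‖^2) * (1 + r) := by
      have : 0 ≤ (1 + ‖w‖) * (r - ‖w‖) := mul_nonneg (by linarith) (by linarith)
      nlinarith

def FH (g : ℝ → ℝ) (z : ℂ) : ℂ := ∫ x', hz (z * ex (-x')) * (g x' : ℂ) ∂cI

lemma hz_meas : Measurable hz := by unfold hz; fun_prop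

lemma hz_int {g : ℝ → ℝ} (hg : Integrable g cI) {z : ℂ} (hz1 : ‖z‖ < 1) :
    Integrable (fun x' => hz (z * ex (-x')) * (g x' : ℂ)) cI := by
  apply (hg.ofReal (𝕜 := ℂ)).bdd_mul (c := 2 / (1 - ‖z‖))
  · have := hz_meas; apply Measurable.aestronglyMeasurable; fun_prop
  · filter_upwards with x
    apply hz_bound hz1
    simp [norm_ex]

lemma FH_diff {g : ℝ → ℝ} (hg : Integrable g cI) : DifferentiableOn ℂ (FH g) (Metric.ball 0 1) := by
  intro z0 hz0
  rw [mem_ball_zero_iff] at hz0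
  set R := (1 + ‖z0‖) / 2
  have hR : R < 1 := by simp only [R]; linarith
  have hs : Metric.ball (0:ℂ) R ∈ nhds z0 := by
    apply Metric.isOpen_ball.mem_nhds
    rw [mem_ball_zero_iff]; simp only [R]; linarith
  have hd := hasDerivAt_integral_of_dominated_loc_of_deriv_le (μ := cI) (𝕜 := ℂ) (s := Metric.ball 0 R)
    (x₀ := z0) (F := fun z x' => hz (z * ex (-x')) * (g x' : ℂ))
    (F' := fun z x' => (2 * ex (-x') / (1 - z * ex (-x'))^2) * (g x' : ℂ))
    (bound := fun x' => (2 / (1 - R)^2) * ‖g x'‖) hs ?_ (hz_int hg hz0) ?_ ?_ ?_ ?_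
  · exact hd.2.differentiableAt.differentiableWithinAt
  · filter_upwards [hs] with z hz'
    rw [mem_ball_zero_iff] at hz'
    exact (hz_int hg (hz'.trans hR)).aestronglyMeasurable
  · apply AEStronglyMeasurable.mul
    · apply Measurable.aestronglyMeasurable; fun_prop
    · exact (hg.ofReal (𝕜 := ℂ)).aestronglyMeasurable
  · filter_upwards with x z hz'
    rw [mem_ball_zero_iff] at hz'
    rw [norm_mul, norm_div, norm_pow, norm_mul, norm_ex]
    have h1 : 1 - R ≤ ‖1 - z * ex (-x)‖ := one_sub_norm (by simp [norm_ex, hz'.le])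
    have h2 : 0 < 1 - R := by linarith
    rw [Complex.norm_real]
    gcongr
    simp
  · exact hg.norm.const_mul _
  · filter_upwards with x z hz'
    rw [mem_ball_zero_iff] at hz'
    apply HasDerivAt.mul_const
    have h1 : 1 - z * ex (-x) ≠ 0 := one_sub_ne (by simp [norm_ex]; linarith)
    unfold hz
    have ha : HasDerivAt (fun z : ℂ => 1 + z * ex (-x)) (ex (-x)) z := by
      simpa using ((hasDerivAt_id z).mul_const (ex (-x))).const_add 1
    have hb : HasDerivAt (fun z : ℂ => 1 - z * ex (-x)) (-ex (-x)) z := by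
      simpa using ((hasDerivAt_id z).mul_const (ex (-x))).const_sub 1
    refine (ha.div hb h1).congr_deriv ?_
    congr 1
    ring

lemma hz_diff : DifferentiableOn ℂ hz (Metric.ball 0 1) := by
  unfold hz
  intro z hz'
  rw [mem_ball_zero_iff] at hz'
  apply DifferentiableAt.differentiableWithinAt
  apply DifferentiableAt.div (by fun_prop) (by fun_prop) (one_sub_ne hz')

lemma FH_re {g : ℝ → ℝ} (hg : Integrable g cI) {z : ℂ} (hz1 : ‖z‖ < 1) :
    (FH g z).re = ∫ x', (hz (z * ex (-x'))).re * g x' ∂cI := by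
  unfold FH
  have := integral_re (𝕜 := ℂ) (hz_int hg hz1)
  simp only [RCLike.re_to_complex] at this
  rw [← this]
  simp

lemma cI_univ : cI univ = ENNReal.ofReal (2 * π) := by
  unfold cI; rw [Measure.restrict_apply_univ, Real.volume_Ioc]; congr 1; ring

lemma hz_re_nonneg {w : ℂ} (hw : ‖w‖ < 1) : 0 ≤ (hz w).re :=
  le_trans (div_nonneg (by linarith) (by positivity)) (hz_re (norm_nonneg w) hw le_rfl)

lemma poisson_int {r : ℝ} (hr0 : 0 ≤ r) (hr : r < 1) (y : ℝ) :
    ∫⁻ x, ENNReal.ofReal (hz (r * ex x * ex (-y))).re ∂cI = ENNReal.ofReal (2 * π) := by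
  have hb : ∀ x, ‖(r : ℂ) * ex x * ex (-y)‖ ≤ r := fun x => by
    simp [norm_ex, abs_of_nonneg hr0]
  have hi : Integrable (fun x => hz (r * ex x * ex (-y))) cI := by
    apply Integrable.of_bound (C := 2 / (1 - r))
    · have := hz_meas; apply Measurable.aestronglyMeasurable; fun_prop
    · filter_upwards with x; exact hz_bound hr (hb x)
  rw [← ofReal_integral_eq_lintegral_ofReal]
  · congr 1
    have := integral_re (𝕜 := ℂ) hi
    simp only [RCLike.re_to_complex] at this
    rw [this]
    have h2 := meanval (fun z => hz (z * ex (-y))) ?_ r hr0 hr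
    · rw [h2]; simp [hz]
    · apply hz_diff.comp (by fun_prop)
      intro z hz'
      simpa [norm_ex] using hz'
  · exact hi.re
  · filter_upwards with x
    exact hz_re_nonneg ((hb x).trans_lt hr)

lemma hz_conj (w : ℂ) : (hz ((starRingEnd ℂ) w)).re = (hz w).re := by
  have : hz ((starRingEnd ℂ) w) = (starRingEnd ℂ) (hz w) := by simp [hz]
  rw [this, Complex.conj_re]

lemma poisson_int' {r : ℝ} (hr0 : 0 ≤ r) (hr : r < 1) (x : ℝ) :
    ∫⁻ y, ENNReal.ofReal (hz (r * ex x * ex (-y))).re ∂cI = ENNReal.ofReal (2 * π) := by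
  rw [← poisson_int hr0 hr x]
  apply lintegral_congr; intro y
  rw [← hz_conj]
  congr 3
  simp only [map_mul, conj_ex, neg_neg, Complex.conj_ofReal]
  ring

lemma poisson_Lp {p : ℝ} (hp : 1 < p) {r : ℝ} (hr0 : 0 ≤ r) (hr : r < 1) (g : ℝ → ℝ≥0∞)
    (hg : Measurable g) :
    ∫⁻ x, (∫⁻ y, ENNReal.ofReal (hz (r * ex x * ex (-y))).re * g y ∂cI) ^ p ∂cI ≤
      ENNReal.ofReal (2 * π) ^ p * ∫⁻ x, g x ^ p ∂cI := by
  refine schur_test (Real.HolderConjugate.conjExponent hp)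
    (fun x y => ENNReal.ofReal (hz (r * ex x * ex (-y))).re) ?_ (fun _ => 1) (by fun_prop) ?_ _ ?_ ?_ g hg
  · have := hz_meas
    have h2 : Measurable Complex.re := Complex.measurable_re
    show Measurable fun z : ℝ × ℝ => ENNReal.ofReal (hz (r * ex z.1 * ex (-z.2))).re
    fun_prop
  · simp
  · filter_upwards with x
    simp [poisson_int' hr0 hr]
  · filter_upwards with x
    simp [poisson_int hr0 hr]

lemma avg_Lp {p : ℝ} (hp : 1 < p) (g : ℝ → ℝ≥0∞) (hg : Measurable g) :
    ∫⁻ _, (∫⁻ y, g y ∂cI) ^ p ∂cI ≤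
      ENNReal.ofReal (2 * π) ^ p * ∫⁻ x, g x ^ p ∂cI := by
  have := schur_test (μ := cI) (Real.HolderConjugate.conjExponent hp)
    (fun x y => 1) (by fun_prop) (fun _ => 1) (by fun_prop) (by simp) (ENNReal.ofReal (2 * π)) (by simp [cI_univ])
    (by simp [cI_univ]) g hg
  simpa using this

lemma riesz_FH (p : ℝ) (hp1 : 1 < p) (hp2 : p ≤ 2) : ∃ C : ℝ≥0∞, C ≠ ⊤ ∧
    ∀ r : ℝ, 0 ≤ r → r < 1 → ∀ g : ℝ → ℝ, Measurable g → (∀ x, 0 ≤ g x) → Integrable g cI →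
    ∫⁻ x, ‖FH g (r * ex x)‖ₑ ^ p ∂cI ≤ C * ∫⁻ x, ‖g x‖ₑ ^ p ∂cI := by
  obtain ⟨A, B, hA, hB, hAB⟩ := riesz_pointwise p hp1 hp2
  refine ⟨ENNReal.ofReal A * ENNReal.ofReal (2 * π) ^ p, ?_, ?_⟩
  · exact ENNReal.mul_ne_top ENNReal.ofReal_ne_top
      (ENNReal.rpow_ne_top_of_nonneg (by linarith) ENNReal.ofReal_ne_top)
  intro r hr0 hr g hgm hg0 hgi
  have hb : ∀ x, ‖(r : ℂ) * ex x‖ ≤ r := fun x => by simp [norm_ex, abs_of_nonneg hr0]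
  have hp0 : 0 < p := by linarith
  have hre : ∀ x, ENNReal.ofReal (FH g (r * ex x)).re =
      ∫⁻ y, ENNReal.ofReal (hz (r * ex x * ex (-y))).re * ‖g y‖ₑ ∂cI := by
    intro x
    have hbx : ‖(r : ℂ) * ex x‖ < 1 := (hb x).trans_lt hr
    rw [FH_re hgi hbx, ofReal_integral_eq_lintegral_ofReal]
    · apply lintegral_congr; intro y
      rw [ENNReal.ofReal_mul, Real.enorm_eq_ofReal (hg0 y)]
      exact hz_re_nonneg (by simpa [norm_ex] using hbx)
    · simpa using (hz_int hgi hbx).re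
    · filter_upwards with y
      exact mul_nonneg (hz_re_nonneg (by simpa [norm_ex] using hbx)) (hg0 y)
  by_cases hzero : ∫ x, g x ∂cI = 0
  · have : g =ᵐ[cI] 0 := (integral_eq_zero_iff_of_nonneg hg0 hgi).1 hzero
    have h2 : ∀ z, FH g z = 0 := by
      intro z
      unfold FH
      apply integral_eq_zero_of_ae
      filter_upwards [this] with x hx; simp [hx]
    simp [h2, ENNReal.zero_rpow_of_pos hp0]
  · have hpos : 0 < ∫ x, g x ∂cI := lt_of_le_of_ne (integral_nonneg hg0) (Ne.symm hzero)
    have hrepos : ∀ z : ℂ, ‖z‖ < 1 → 0 < (FH g z).re := by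
      intro z hz1
      rw [FH_re hgi hz1]
      have h3 : ∫ x', (1 - ‖z‖)/(1+‖z‖) * g x' ∂cI ≤ ∫ x', (hz (z * ex (-x'))).re * g x' ∂cI := by
        apply integral_mono
        · exact hgi.const_mul _
        · simpa using (hz_int hgi hz1).re
        · intro y
          apply mul_le_mul_of_nonneg_right _ (hg0 y)
          exact hz_re (norm_nonneg z) hz1 (by simp [norm_ex])
      refine lt_of_lt_of_le ?_ h3
      rw [integral_const_mul]
      have : 0 < 1 - ‖z‖ := by linarith
      positivity
    have hcont : Continuous fun x => FH g (r * ex x) := by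
      rw [← continuousOn_univ]
      apply (FH_diff hgi).continuousOn.comp (by fun_prop)
      intro x _
      rw [mem_ball_zero_iff]; exact (hb x).trans_lt hr
    have hre_cont : Continuous fun x => (FH g (r * ex x)).re := Complex.continuous_re.comp hcont
    have hslit : ∀ z : ℂ, ‖z‖ < 1 → FH g z ∈ Complex.slitPlane := fun z hz1 => Or.inl (hrepos z hz1)
    have cint : ∀ {E : Type} [NormedAddCommGroup E] (f : ℝ → E), Continuous f → Integrable f cI := by
      intro E _ f hf
      unfold cI
      exact (hf.continuousOn.integrableOn_compact isCompact_Icc).mono_set Ioc_subset_Icc_self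
    have hi1 : Integrable (fun x => ‖FH g (r * ex x)‖ ^ p) cI := by
      apply cint; apply hcont.norm.rpow_const; intro x; right; linarith
    have hi2 : Integrable (fun x => (FH g (r * ex x)).re ^ p) cI := by
      apply cint; apply hre_cont.rpow_const; intro x; right; linarith
    have hi3 : Integrable (fun x => (FH g (r * ex x)) ^ (p : ℂ)) cI := by
      apply cint; apply hcont.cpow continuous_const
      intro x; apply hslit; exact (hb x).trans_lt hr
    have hmean : ∫ x, (FH g (r * ex x)) ^ (p : ℂ) ∂cI = 2 * π * (FH g 0) ^ (p : ℂ) := by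
      apply meanval (fun z => (FH g z) ^ (p : ℂ)) _ r hr0 hr
      intro z hz'
      apply DifferentiableWithinAt.cpow_const (FH_diff hgi z hz')
      apply hslit; simpa using hz'
    have hF0 : FH g 0 = ((∫ x, g x ∂cI : ℝ) : ℂ) := by
      unfold FH
      simp [hz]
      exact integral_ofReal
    have hmain : ∫ x, ‖FH g (r * ex x)‖ ^ p ∂cI ≤ A * ∫ x, (FH g (r * ex x)).re ^ p ∂cI := by
      have h1 : ∫ x, ‖FH g (r * ex x)‖ ^ p ∂cI ≤
          ∫ x, (A * (FH g (r * ex x)).re ^ p - B * ((FH g (r * ex x)) ^ (p : ℂ)).re) ∂cI := by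
        apply integral_mono hi1
        · exact (hi2.const_mul _).sub (hi3.re.const_mul _)
        · intro x
          exact hAB _ (hrepos _ ((hb x).trans_lt hr))
      have hi3r : Integrable (fun x => ((FH g (r * ex x)) ^ (p : ℂ)).re) cI := hi3.re
      rw [integral_sub (hi2.const_mul _) (hi3r.const_mul _), integral_const_mul,
        integral_const_mul] at h1
      have h4 := integral_re (𝕜 := ℂ) hi3
      simp only [RCLike.re_to_complex] at h4
      have h5 : 0 ≤ B * ∫ x, RCLike.re ((FH g (r * ex x)) ^ (p : ℂ)) ∂cI := by
        apply mul_nonneg hB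
        simp only [RCLike.re_to_complex]
        rw [h4, hmean, hF0, ← Complex.ofReal_cpow hpos.le]
        have : 0 ≤ (∫ x, g x ∂cI) ^ p := by positivity
        have h6 : (2 * (π:ℂ) * (((∫ x, g x ∂cI) ^ p : ℝ) : ℂ)).re = 2 * π * (∫ x, g x ∂cI) ^ p := by
          rw [← Complex.ofReal_re (2 * π * (∫ x, g x ∂cI) ^ p)]; push_cast; rfl
        rw [h6]; positivity
      simp only [RCLike.re_to_complex] at h5
      linarith
    calc ∫⁻ x, ‖FH g (r * ex x)‖ₑ ^ p ∂cI = ENNReal.ofReal (∫ x, ‖FH g (r * ex x)‖ ^ p ∂cI) := by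
          rw [ofReal_integral_eq_lintegral_ofReal hi1 (by filter_upwards with x; positivity)]
          apply lintegral_congr; intro x
          rw [← ENNReal.ofReal_rpow_of_nonneg (norm_nonneg _) hp0.le, ofReal_norm]
      _ ≤ ENNReal.ofReal (A * ∫ x, (FH g (r * ex x)).re ^ p ∂cI) := ENNReal.ofReal_le_ofReal hmain
      _ = ENNReal.ofReal A * ∫⁻ x, (∫⁻ y, ENNReal.ofReal (hz (r * ex x * ex (-y))).re * ‖g y‖ₑ ∂cI) ^ p ∂cI := by
          have h0 : ∀ x, 0 ≤ (FH g (r * ex x)).re := fun x => (hrepos _ ((hb x).trans_lt hr)).le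
          rw [ENNReal.ofReal_mul hA, ofReal_integral_eq_lintegral_ofReal hi2
            (by filter_upwards with x; exact rpow_nonneg (h0 x) p)]
          congr 1
          apply lintegral_congr; intro x
          rw [← ENNReal.ofReal_rpow_of_nonneg (h0 x) hp0.le, hre]
      _ ≤ _ := by
          rw [mul_assoc]
          exact mul_le_mul_right (poisson_Lp hp1 hr0 hr _ (by fun_prop)) _

def ck (r u : ℝ) : ℂ := (1 - r * ex u)⁻¹

def CR (r : ℝ) (g : ℝ → ℂ) (x : ℝ) : ℂ := ∫ y, ck r (x - y) * g y ∂cI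

@[fun_prop] lemma ck_meas (r : ℝ) : Measurable (ck r) := by unfold ck; fun_prop

lemma ck_bound {r : ℝ} (hr0 : 0 ≤ r) (hr : r < 1) (u : ℝ) : ‖ck r u‖ ≤ (1 - r)⁻¹ := by
  unfold ck
  rw [norm_inv]
  have h1 : 1 - r ≤ ‖1 - r * ex u‖ := one_sub_norm (by simp [norm_ex, abs_of_nonneg hr0])
  have : 0 < 1 - r := by linarith
  gcongr

lemma ck_conj (r u : ℝ) : (starRingEnd ℂ) (ck r u) = ck r (-u) := by
  simp [ck, conj_ex]

lemma ck_int {r : ℝ} (hr0 : 0 ≤ r) (hr : r < 1) {g : ℝ → ℂ} (hg : Integrable g cI) (x : ℝ) :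
    Integrable (fun y => ck r (x - y) * g y) cI := by
  apply hg.bdd_mul (c := (1 - r)⁻¹)
  · apply Measurable.aestronglyMeasurable; fun_prop
  · filter_upwards with y; exact ck_bound hr0 hr _

lemma CR_meas {r : ℝ} {g : ℝ → ℂ} (hg : Measurable g) : Measurable (CR r g) := by
  unfold CR
  apply StronglyMeasurable.measurable
  apply StronglyMeasurable.integral_prod_right (f := fun x y => ck r (x - y) * g y)
  apply Measurable.stronglyMeasurable
  show Measurable fun z : ℝ × ℝ => ck r (z.1 - z.2) * g z.2
  fun_prop

lemma int_of_Lp {μ : Measure ℝ} [IsFiniteMeasure μ] {p : ℝ} (hp : 1 < p) {g : ℝ → ℂ} (hg : Measurable g)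
    (h : ∫⁻ x, ‖g x‖ₑ ^ p ∂μ ≠ ⊤) : Integrable g μ := by
  have h1 : MemLp g (ENNReal.ofReal p) μ := by
    refine ⟨hg.aestronglyMeasurable, ?_⟩
    rw [eLpNorm_lt_top_iff_lintegral_rpow_enorm_lt_top (by simp; linarith) (by simp)]
    rw [ENNReal.toReal_ofReal (by linarith)]
    exact lt_top_iff_ne_top.2 h
  exact h1.integrable (by simpa using hp.le)

lemma rpow_add2 {p : ℝ} (hp : 1 ≤ p) (a b : ℝ≥0∞) : (a + b) ^ p ≤ 2 ^ p * (a ^ p + b ^ p) := by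
  refine (ENNReal.rpow_add_le_mul_rpow_add_rpow a b hp).trans ?_
  refine mul_le_mul_left ?_ _
  exact ENNReal.rpow_le_rpow_of_exponent_le (by norm_num) (by linarith)

lemma int_ofReal {μ : Measure ℝ} {g : ℝ → ℝ} (hg : Integrable g μ) :
    Integrable (fun x => ((g x : ℝ) : ℂ)) μ := hg.ofReal

lemma enorm_ofRealC (t : ℝ) : ‖(t : ℂ)‖ₑ = ‖t‖ₑ := by
  rw [← ofReal_norm, ← ofReal_norm, Complex.norm_real]

lemma CR_eq {r : ℝ} (hr0 : 0 ≤ r) (hr : r < 1) {g : ℝ → ℝ} (hg : Integrable g cI) (x : ℝ) :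
    CR r (fun y => (g y : ℂ)) x = (1/2) * (FH g (r * ex x) + ∫ y, (g y : ℂ) ∂cI) := by
  have hb : ‖(r : ℂ) * ex x‖ < 1 := by simpa [norm_ex, abs_of_nonneg hr0]
  unfold FH CR
  rw [← integral_add (hz_int hg hb) (int_ofReal hg), ← integral_const_mul]
  apply integral_congr_ae
  filter_upwards with y
  have h1 : 1 - r * ex x * ex (-y) ≠ 0 := one_sub_ne (by simpa [norm_ex] using hb)
  have h2 : ck r (x - y) = (1 - r * ex x * ex (-y))⁻¹ := by
    unfold ck; rw [sub_eq_add_neg x y, ex_add, mul_assoc]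
  rw [h2]; unfold hz
  field_simp
  ring

lemma riesz_real (p : ℝ) (hp1 : 1 < p) (hp2 : p ≤ 2) : ∃ C : ℝ≥0∞, C ≠ ⊤ ∧
    ∀ r : ℝ, 0 ≤ r → r < 1 → ∀ g : ℝ → ℝ, Measurable g → (∀ x, 0 ≤ g x) → Integrable g cI →
    ∫⁻ x, ‖CR r (fun y => (g y : ℂ)) x‖ₑ ^ p ∂cI ≤ C * ∫⁻ x, ‖g x‖ₑ ^ p ∂cI := by
  obtain ⟨C, hC, h⟩ := riesz_FH p hp1 hp2
  have h2p : (2 : ℝ≥0∞) ^ p ≠ ⊤ := ENNReal.rpow_ne_top_of_nonneg (by linarith) (by simp)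
  refine ⟨2 ^ p * (C + ENNReal.ofReal (2 * π) ^ p), ?_, ?_⟩
  · apply ENNReal.mul_ne_top h2p
    apply ENNReal.add_ne_top.2 ⟨hC, ENNReal.rpow_ne_top_of_nonneg (by linarith) ENNReal.ofReal_ne_top⟩
  intro r hr0 hr g hg hg0 hgi
  have hFm : Measurable fun x => FH g (r * ex x) := by
    have : Continuous fun x => FH g (r * ex x) := by
      rw [← continuousOn_univ]
      apply (FH_diff hgi).continuousOn.comp (by fun_prop)
      intro x _
      rw [mem_ball_zero_iff]; simpa [norm_ex, abs_of_nonneg hr0]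
    exact this.measurable
  calc _ ≤ ∫⁻ x, 2 ^ p * (‖FH g (r * ex x)‖ₑ ^ p + (∫⁻ y, ‖g y‖ₑ ∂cI) ^ p) ∂cI := by
        apply lintegral_mono; intro x
        simp only
        rw [CR_eq hr0 hr hgi]
        refine le_trans ?_ (rpow_add2 hp1.le _ _)
        apply ENNReal.rpow_le_rpow _ (by linarith)
        rw [enorm_mul]
        have h1 : ‖(1/2 : ℂ)‖ₑ ≤ 1 := by
          rw [← enorm_one (G := ℂ), enorm_le_iff_norm_le]; norm_num
        calc _ ≤ 1 * ‖FH g (r * ex x) + ∫ y, (g y : ℂ) ∂cI‖ₑ := mul_le_mul_left h1 _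
          _ ≤ ‖FH g (r * ex x)‖ₑ + ‖∫ y, (g y : ℂ) ∂cI‖ₑ := by rw [one_mul]; exact enorm_add_le _ _
          _ ≤ _ := by
            gcongr
            refine (enorm_integral_le_lintegral_enorm _).trans (le_of_eq ?_)
            simp only [enorm_ofRealC]
    _ = 2 ^ p * (∫⁻ x, ‖FH g (r * ex x)‖ₑ ^ p ∂cI + ∫⁻ _, (∫⁻ y, ‖g y‖ₑ ∂cI) ^ p ∂cI) := by
        rw [lintegral_const_mul _ (by fun_prop), lintegral_add_right _ (by fun_prop)]
    _ ≤ 2 ^ p * (C * ∫⁻ x, ‖g x‖ₑ ^ p ∂cI + ENNReal.ofReal (2 * π) ^ p * ∫⁻ x, ‖g x‖ₑ ^ p ∂cI) := by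
        gcongr
        · exact h r hr0 hr g hg hg0 hgi
        · exact avg_Lp hp1 _ (by fun_prop)
    _ = _ := by ring

lemma riesz_low (p : ℝ) (hp1 : 1 < p) (hp2 : p ≤ 2) : ∃ C : ℝ≥0∞, C ≠ ⊤ ∧ C ≠ 0 ∧
    ∀ r : ℝ, 0 ≤ r → r < 1 → ∀ g : ℝ → ℂ, Measurable g →
    ∫⁻ x, ‖CR r g x‖ₑ ^ p ∂cI ≤ C * ∫⁻ x, ‖g x‖ₑ ^ p ∂cI := by
  obtain ⟨C, hC, h⟩ := riesz_real p hp1 hp2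
  have h2p : (2 : ℝ≥0∞) ^ p ≠ ⊤ := ENNReal.rpow_ne_top_of_nonneg (by linarith) (by simp)
  refine ⟨2 ^ p * (2 ^ p * (4 * C)) + 1, ?_, ?_, ?_⟩
  · exact ENNReal.add_ne_top.2 ⟨ENNReal.mul_ne_top h2p (ENNReal.mul_ne_top h2p (ENNReal.mul_ne_top (by simp) hC)), by simp⟩
  · simp
  intro r hr0 hr g hg
  by_cases htop : ∫⁻ x, ‖g x‖ₑ ^ p ∂cI = ⊤
  · rw [htop, ENNReal.mul_top (by simp)]; exact le_top
  have hgi := int_of_Lp hp1 hg htop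
  have hp0 : 0 < p := by linarith
  -- the four parts
  have hpart : ∀ (φ : ℂ → ℝ), Measurable φ → (∀ z, 0 ≤ φ z) → (∀ z, φ z ≤ ‖z‖) →
      Integrable (fun x => φ (g x)) cI ∧ Measurable (fun x => CR r (fun y => ((φ (g y) : ℝ) : ℂ)) x) ∧
      ∫⁻ x, ‖CR r (fun y => ((φ (g y) : ℝ) : ℂ)) x‖ₑ ^ p ∂cI ≤ C * ∫⁻ x, ‖g x‖ₑ ^ p ∂cI := by
    intro φ hφm hφ0 hφ
    have hi : Integrable (fun x => φ (g x)) cI := by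
      apply Integrable.mono hgi (hφm.comp hg).aestronglyMeasurable
      filter_upwards with x
      rw [Function.comp_apply, Real.norm_of_nonneg (hφ0 _)]; exact hφ _
    refine ⟨hi, CR_meas (by fun_prop), ?_⟩
    refine (h r hr0 hr (fun x => φ (g x)) (hφm.comp hg) (fun x => hφ0 _) hi).trans ?_
    refine mul_le_mul_right (lintegral_mono fun x => ?_) _
    simp only
    apply ENNReal.rpow_le_rpow _ hp0.le
    rw [enorm_le_iff_norm_le, Real.norm_of_nonneg (hφ0 _)]; exact hφ _
  have hreM : Measurable Complex.re := Complex.measurable_re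
  have himM : Measurable Complex.im := Complex.measurable_im
  obtain ⟨i1, m1, b1⟩ := hpart (fun z => max z.re 0) (by fun_prop) (fun z => le_max_right _ _)
    (fun z => max_le ((le_abs_self _).trans (Complex.abs_re_le_norm z)) (norm_nonneg z))
  obtain ⟨i2, m2, b2⟩ := hpart (fun z => max (-z.re) 0) (by fun_prop) (fun z => le_max_right _ _)
    (fun z => max_le ((neg_le_abs _).trans (Complex.abs_re_le_norm z)) (norm_nonneg z))
  obtain ⟨i3, m3, b3⟩ := hpart (fun z => max z.im 0) (by fun_prop) (fun z => le_max_right _ _)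
    (fun z => max_le ((le_abs_self _).trans (Complex.abs_im_le_norm z)) (norm_nonneg z))
  obtain ⟨i4, m4, b4⟩ := hpart (fun z => max (-z.im) 0) (by fun_prop) (fun z => le_max_right _ _)
    (fun z => max_le ((neg_le_abs _).trans (Complex.abs_im_le_norm z)) (norm_nonneg z))
  set g1 := CR r (fun y => ((max (g y).re 0 : ℝ) : ℂ)) with hg1
  set g2 := CR r (fun y => ((max (-(g y).re) 0 : ℝ) : ℂ)) with hg2
  set g3 := CR r (fun y => ((max (g y).im 0 : ℝ) : ℂ)) with hg3
  set g4 := CR r (fun y => ((max (-(g y).im) 0 : ℝ) : ℂ)) with hg4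
  have hdec : ∀ x, CR r g x = (g1 x - g2 x) + Complex.I * (g3 x - g4 x) := by
    intro x
    have j1 := ck_int hr0 hr (int_ofReal i1) x
    have j2 := ck_int hr0 hr (int_ofReal i2) x
    have j3 := ck_int hr0 hr (int_ofReal i3) x
    have j4 := ck_int hr0 hr (int_ofReal i4) x
    simp only [hg1, hg2, hg3, hg4, CR]
    rw [← integral_sub j1 j2, ← integral_sub j3 j4, ← integral_const_mul]
    refine Eq.trans ?_ (integral_add (j1.sub j2) ((j3.sub j4).const_mul _))
    apply integral_congr_ae
    filter_upwards with y
    have hm : ∀ t : ℝ, max t 0 - max (-t) 0 = t := fun t => by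
      rcases le_total t 0 with h | h
      · rw [max_eq_right h, max_eq_left (by linarith)]; ring
      · rw [max_eq_left h, max_eq_right (by linarith)]; ring
    have e : g y = ((max (g y).re 0 - max (-(g y).re) 0 : ℝ) : ℂ)
        + Complex.I * ((max (g y).im 0 - max (-(g y).im) 0 : ℝ) : ℂ) := by
      rw [hm, hm, mul_comm]; exact (Complex.re_add_im _).symm
    conv_lhs => rw [e]
    push_cast
    ring
  calc _ ≤ ∫⁻ x, 2 ^ p * (2 ^ p * (‖g1 x‖ₑ ^ p + ‖g2 x‖ₑ ^ p) + 2 ^ p * (‖g3 x‖ₑ ^ p + ‖g4 x‖ₑ ^ p)) ∂cI := by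
        apply lintegral_mono; intro x
        simp only
        rw [hdec]
        calc _ ≤ (‖g1 x - g2 x‖ₑ + ‖g3 x - g4 x‖ₑ) ^ p := by
              apply ENNReal.rpow_le_rpow _ hp0.le
              refine (enorm_add_le _ _).trans ?_
              rw [enorm_mul, ← ofReal_norm Complex.I, Complex.norm_I, ENNReal.ofReal_one, one_mul]
          _ ≤ 2 ^ p * (‖g1 x - g2 x‖ₑ ^ p + ‖g3 x - g4 x‖ₑ ^ p) := rpow_add2 hp1.le _ _
          _ ≤ _ := by
              gcongr
              · exact (ENNReal.rpow_le_rpow (enorm_sub_le) hp0.le).trans (rpow_add2 hp1.le _ _)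
              · exact (ENNReal.rpow_le_rpow (enorm_sub_le) hp0.le).trans (rpow_add2 hp1.le _ _)
    _ = 2 ^ p * (2 ^ p * (∫⁻ x, ‖g1 x‖ₑ ^ p ∂cI + ∫⁻ x, ‖g2 x‖ₑ ^ p ∂cI)
          + 2 ^ p * (∫⁻ x, ‖g3 x‖ₑ ^ p ∂cI + ∫⁻ x, ‖g4 x‖ₑ ^ p ∂cI)) := by
        rw [lintegral_const_mul _ (by fun_prop), lintegral_add_right _ (by fun_prop),
          lintegral_const_mul _ (by fun_prop), lintegral_const_mul _ (by fun_prop),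
          lintegral_add_right _ (by fun_prop), lintegral_add_right _ (by fun_prop)]
    _ ≤ 2 ^ p * (2 ^ p * (C * ∫⁻ x, ‖g x‖ₑ ^ p ∂cI + C * ∫⁻ x, ‖g x‖ₑ ^ p ∂cI)
          + 2 ^ p * (C * ∫⁻ x, ‖g x‖ₑ ^ p ∂cI + C * ∫⁻ x, ‖g x‖ₑ ^ p ∂cI)) := by
        gcongr
    _ = 2 ^ p * (2 ^ p * (4 * C)) * ∫⁻ x, ‖g x‖ₑ ^ p ∂cI := by ring
    _ ≤ _ := by gcongr; exact le_self_add

lemma CR_bound {r : ℝ} (hr0 : 0 ≤ r) (hr : r < 1) (g : ℝ → ℂ) (x : ℝ) (hg : Integrable g cI) :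
    ‖CR r g x‖ ≤ (1 - r)⁻¹ * ∫ y, ‖g y‖ ∂cI := by
  unfold CR
  refine (norm_integral_le_integral_norm _).trans ?_
  rw [← integral_const_mul]
  apply integral_mono (ck_int hr0 hr hg x).norm (hg.norm.const_mul _)
  intro y
  simp only [norm_mul]
  exact mul_le_mul_of_nonneg_right (ck_bound hr0 hr _) (norm_nonneg _)

lemma riesz_high (p : ℝ) (hp : 2 < p) : ∃ C : ℝ≥0∞, C ≠ ⊤ ∧ C ≠ 0 ∧
    ∀ r : ℝ, 0 ≤ r → r < 1 → ∀ g : ℝ → ℂ, Measurable g →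
    ∫⁻ x, ‖CR r g x‖ₑ ^ p ∂cI ≤ C * ∫⁻ x, ‖g x‖ₑ ^ p ∂cI := by
  have hp1 : 1 < p := by linarith
  have hp0 : 0 < p := by linarith
  have hpq := Real.HolderConjugate.conjExponent hp1
  set q := Real.conjExponent p with hq
  have hq0 : 0 < q := hpq.symm.pos
  have hq1 : 1 < q := hpq.symm.lt
  have hqp : q * (p - 1) = p := by rw [hq, Real.conjExponent]; field_simp [show p - 1 ≠ 0 by linarith]
  have hq2 : q ≤ 2 := by nlinarith
  obtain ⟨C, hC, hC0, h⟩ := riesz_low q hq1 hq2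
  refine ⟨C ^ (p / q), ENNReal.rpow_ne_top_of_nonneg (by positivity) hC, by
    simp [ENNReal.rpow_eq_zero_iff, hC0, hC], ?_⟩
  intro r hr0 hr g hg
  by_cases htop : ∫⁻ x, ‖g x‖ₑ ^ p ∂cI = ⊤
  · rw [htop, ENNReal.mul_top (by simp [ENNReal.rpow_eq_zero_iff, hC0, hC])]; exact le_top
  have hgi := int_of_Lp hp1 hg htop
  set G := CR r g with hG
  have hGm : Measurable G := CR_meas hg
  set M := (1 - r)⁻¹ * ∫ y, ‖g y‖ ∂cI with hM
  have hGb : ∀ x, ‖G x‖ ≤ M := fun x => CR_bound hr0 hr g x hgi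
  have hM0 : 0 ≤ M := (norm_nonneg _).trans (hGb 0)
  set H : ℝ → ℂ := fun x => ((‖G x‖ ^ (p - 2) : ℝ) : ℂ) * G x with hH
  have hHm : Measurable H := by simp only [hH]; fun_prop
  have hHn : ∀ x, ‖H x‖ = ‖G x‖ ^ (p - 1) := by
    intro x
    simp only [hH, norm_mul, Complex.norm_real]
    rw [Real.norm_of_nonneg (by positivity)]
    by_cases h0 : ‖G x‖ = 0
    · rw [h0, mul_zero, Real.zero_rpow (by linarith)]
    · rw [show p - 1 = (p - 2) + 1 by ring, Real.rpow_add_one h0]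
  have hHi : Integrable H cI := by
    apply Integrable.of_bound hHm.aestronglyMeasurable (M ^ (p - 1))
    filter_upwards with x
    rw [hHn]; exact rpow_le_rpow (norm_nonneg _) (hGb x) (by linarith)
  have hGp : ∀ x, ((‖G x‖ ^ p : ℝ) : ℂ) = G x * (starRingEnd ℂ) (H x) := by
    intro x
    simp only [hH, map_mul, Complex.conj_ofReal]
    rw [mul_left_comm, Complex.mul_conj, Complex.normSq_eq_norm_sq]
    rw [← Complex.ofReal_mul]
    congr 1
    by_cases h0 : ‖G x‖ = 0
    · rw [h0, Real.zero_rpow (by linarith)]; simp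
    · rw [← Real.rpow_natCast, ← Real.rpow_add (lt_of_le_of_ne (norm_nonneg _) (Ne.symm h0))]
      norm_num
  have hswap : ∫ x, G x * (starRingEnd ℂ) (H x) ∂cI = ∫ y, g y * (starRingEnd ℂ) (CR r H y) ∂cI := by
    have h1 : ∀ x, G x * (starRingEnd ℂ) (H x) = ∫ y, (ck r (x - y) * g y) * (starRingEnd ℂ) (H x) ∂cI := by
      intro x; rw [integral_mul_const]; rfl
    have h2 : ∀ y, g y * (starRingEnd ℂ) (CR r H y) = ∫ x, (ck r (x - y) * g y) * (starRingEnd ℂ) (H x) ∂cI := by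
      intro y
      unfold CR
      rw [← integral_conj, ← integral_const_mul]
      apply integral_congr_ae
      filter_upwards with x
      simp only [map_mul, ck_conj, neg_sub]; ring
    simp_rw [h1, h2]
    apply integral_integral_swap
    have hb : Integrable (fun z : ℝ × ℝ => g z.2 * (starRingEnd ℂ) (H z.1)) (cI.prod cI) := by
      have hHc : Integrable (fun x => (starRingEnd ℂ) (H x)) cI := by
        apply hHi.mono (by fun_prop)
        filter_upwards with x; simp
      have := Integrable.mul_prod hHc hgi
      refine this.congr ?_
      filter_upwards with z; ring
    have := hb.bdd_mul (c := (1 - r)⁻¹) (f := fun z : ℝ × ℝ => ck r (z.1 - z.2)) (by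
      apply Measurable.aestronglyMeasurable; fun_prop) (by
      filter_upwards with z; exact ck_bound hr0 hr _)
    refine this.congr ?_
    filter_upwards with z
    simp only [Function.uncurry]; ring
  set I := ∫⁻ x, ‖G x‖ₑ ^ p ∂cI with hI
  have hIreal : I = ‖∫ x, G x * (starRingEnd ℂ) (H x) ∂cI‖ₑ := by
    have hi : Integrable (fun x => ‖G x‖ ^ p) cI := by
      apply Integrable.of_bound (Measurable.aestronglyMeasurable (by fun_prop)) (M ^ p)
      filter_upwards with x
      rw [Real.norm_of_nonneg (by positivity)]
      exact rpow_le_rpow (norm_nonneg _) (hGb x) (by linarith)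
    simp_rw [← hGp]
    rw [integral_complex_ofReal, enorm_ofRealC, Real.enorm_eq_ofReal (integral_nonneg fun x => by positivity),
      ofReal_integral_eq_lintegral_ofReal hi (by filter_upwards with x; positivity)]
    apply lintegral_congr; intro x
    rw [← ENNReal.ofReal_rpow_of_nonneg (norm_nonneg _) hp0.le, ofReal_norm]
  have hItop : I ≠ ⊤ := by rw [hIreal]; simp
  have hHI : ∫⁻ x, ‖H x‖ₑ ^ q ∂cI = I := by
    apply lintegral_congr; intro x
    rw [← ofReal_norm, hHn, ENNReal.ofReal_rpow_of_nonneg (by positivity) hq0.le, ← Real.rpow_mul (norm_nonneg _),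
      mul_comm, hqp, ← ENNReal.ofReal_rpow_of_nonneg (norm_nonneg _) hp0.le, ofReal_norm]
  have hle : I ≤ (∫⁻ x, ‖g x‖ₑ ^ p ∂cI) ^ (1/p) * (C * I) ^ (1/q) := by
    calc I = ‖∫ y, g y * (starRingEnd ℂ) (CR r H y) ∂cI‖ₑ := by rw [hIreal, hswap]
      _ ≤ ∫⁻ y, ‖g y * (starRingEnd ℂ) (CR r H y)‖ₑ ∂cI := enorm_integral_le_lintegral_enorm _
      _ = ∫⁻ y, ((fun y => ‖g y‖ₑ) * (fun y => ‖CR r H y‖ₑ)) y ∂cI := by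
          apply lintegral_congr; intro y
          rw [enorm_mul]
          simp only [Pi.mul_apply]
          congr 1
          rw [← ofReal_norm, ← ofReal_norm, RCLike.norm_conj]
      _ ≤ (∫⁻ x, ‖g x‖ₑ ^ p ∂cI) ^ (1/p) * (∫⁻ x, ‖CR r H x‖ₑ ^ q ∂cI) ^ (1/q) := by
          have hm : Measurable (CR r H) := CR_meas hHm
          exact ENNReal.lintegral_mul_le_Lp_mul_Lq cI hpq (by fun_prop) (by fun_prop)
      _ ≤ _ := by
          gcongr
          rw [← hHI]; exact h r hr0 hr H hHm
  by_cases hI0 : I = 0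
  · rw [hI0]; exact zero_le
  have hIq : I ^ (1/p) ≤ (∫⁻ x, ‖g x‖ₑ ^ p ∂cI) ^ (1/p) * C ^ (1/q) := by
    have hIq0 : I ^ (1/q) ≠ 0 := by simp [ENNReal.rpow_eq_zero_iff, hI0, hItop]
    have hIqt : I ^ (1/q) ≠ ⊤ := ENNReal.rpow_ne_top_of_nonneg (by positivity) hItop
    rw [ENNReal.mul_rpow_of_nonneg _ _ (by positivity), ← mul_assoc] at hle
    have : I = I ^ (1/p) * I ^ (1/q) := by
      rw [← ENNReal.rpow_add _ _ hI0 hItop, one_div, one_div, hpq.inv_add_inv_eq_one, ENNReal.rpow_one]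
    nth_rw 1 [this] at hle
    exact (ENNReal.mul_le_mul_iff_left hIq0 hIqt).1 hle
  calc I = (I ^ (1/p)) ^ p := by rw [← ENNReal.rpow_mul, one_div_mul_cancel hp0.ne', ENNReal.rpow_one]
    _ ≤ ((∫⁻ x, ‖g x‖ₑ ^ p ∂cI) ^ (1/p) * C ^ (1/q)) ^ p := ENNReal.rpow_le_rpow hIq hp0.le
    _ = _ := by
      rw [ENNReal.mul_rpow_of_nonneg _ _ hp0.le, ← ENNReal.rpow_mul, ← ENNReal.rpow_mul,
        one_div_mul_cancel hp0.ne', ENNReal.rpow_one, mul_comm]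
      congr 2; ring

theorem riesz (p : ℝ) (hp : 1 < p) : ∃ C : ℝ≥0∞, C ≠ ⊤ ∧
    ∀ r : ℝ, 0 ≤ r → r < 1 → ∀ g : ℝ → ℂ, Measurable g →
    ∫⁻ x, ‖CR r g x‖ₑ ^ p ∂cI ≤ C * ∫⁻ x, ‖g x‖ₑ ^ p ∂cI := by
  rcases le_or_gt p 2 with h | h
  · obtain ⟨C, hC, _, H⟩ := riesz_low p hp h
    exact ⟨C, hC, H⟩
  · obtain ⟨C, hC, _, H⟩ := riesz_high p h
    exact ⟨C, hC, H⟩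

lemma lint_shift (f : ℝ → ℝ≥0∞) (hf : Function.Periodic f (2 * π)) (c : ℝ) :
    ∫⁻ y, f (y + c) ∂cI = ∫⁻ y, f y ∂cI := by
  have hπ : 0 < 2 * π := by positivity
  have h1 : ∫⁻ y, f (y + c) ∂cI = ∫⁻ y in Ioc (-π + c) (-π + c + 2 * π), f y := by
    unfold cI
    rw [← lintegral_indicator measurableSet_Ioc, ← lintegral_indicator measurableSet_Ioc,
      ← lintegral_add_right_eq_self ((Ioc (-π + c) (-π + c + 2 * π)).indicator f) c]
    apply lintegral_congr; intro y
    simp only [indicator, mem_Ioc]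
    have : (-π < y ∧ y ≤ π) ↔ (-π + c < y + c ∧ y + c ≤ -π + c + 2 * π) := by
      constructor <;> rintro ⟨a, b⟩ <;> constructor <;> linarith
    simp only [this]
  have h2 : ∫⁻ y, f y ∂cI = ∫⁻ y in Ioc (-π) (-π + 2 * π), f y := by
    unfold cI; rw [show -π + 2 * π = π by ring]
  rw [h1, h2]
  apply (isAddFundamentalDomain_Ioc hπ _ volume).setLIntegral_eq (isAddFundamentalDomain_Ioc hπ _ volume)
  rintro ⟨g, hg⟩ x
  obtain ⟨k, rfl⟩ := AddSubgroup.mem_zmultiples_iff.1 hg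
  show f (k • (2 * π) + x) = f x
  rw [add_comm]
  exact hf.zsmul k x

lemma lint_sin (φ : ℝ → ℝ≥0∞) (hm : Measurable φ) (hφ : ∀ u v, 0 < u → u ≤ v → φ v ≤ φ u) :
    ∫⁻ y, φ |sin y| ∂cI ≤ ENNReal.ofReal (2 * π) * ∫⁻ v in Ioc 0 1, φ v := by
  have hπ := pi_pos
  set Φ : ℝ → ℝ≥0∞ := (Ioc 0 (π/2)).indicator (fun y => φ (2 / π * y)) with hΦ
  have hΦm : Measurable Φ := (hm.comp (by fun_prop)).indicator measurableSet_Ioc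
  have hΦi : ∫⁻ y, Φ y = ENNReal.ofReal (π / 2) * ∫⁻ v in Ioc 0 1, φ v := by
    have h1 : Φ = fun y => (Ioc (0:ℝ) 1).indicator φ (2 / π * y) := by
      funext y
      simp only [hΦ, indicator, mem_Ioc]
      have : (0 < y ∧ y ≤ π/2) ↔ (0 < 2 / π * y ∧ 2 / π * y ≤ 1) := by
        constructor
        · rintro ⟨a, b⟩
          refine ⟨by positivity, ?_⟩
          rw [div_mul_eq_mul_div, div_le_one hπ]; linarith
        · rintro ⟨a, b⟩
          rw [div_mul_eq_mul_div, div_le_one hπ] at b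
          refine ⟨?_, by linarith⟩
          by_contra hy
          push Not at hy
          have : 2 / π * y ≤ 0 := mul_nonpos_of_nonneg_of_nonpos (by positivity) hy
          linarith
      simp only [this]
    have hne : (2 / π) ≠ 0 := by positivity
    rw [h1, ← lintegral_map (f := (Ioc (0:ℝ) 1).indicator φ) (g := fun y => 2 / π * y)
      (hm.indicator measurableSet_Ioc) (by fun_prop),
      Real.map_volume_mul_left hne, lintegral_smul_measure, lintegral_indicator measurableSet_Ioc]
    congr 2
    rw [abs_of_pos (by positivity), inv_div]
  have hpt : ∀ᵐ y ∂cI, φ |sin y| ≤ Φ y + Φ (-y) + Φ (π - y) + Φ (π + y) := by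
    unfold cI
    have h0 : ∀ᵐ y ∂(volume.restrict (Ioc (-π) π)), y ≠ 0 := by
      apply ae_restrict_of_ae; exact Measure.ae_ne volume 0
    have h1 : ∀ᵐ y ∂(volume.restrict (Ioc (-π) π)), y ≠ π := by
      apply ae_restrict_of_ae; exact Measure.ae_ne volume π
    have key : ∀ w, 0 < w → w ≤ π/2 → φ (sin w) ≤ Φ w := by
      intro w hw hw2
      simp only [hΦ, indicator, mem_Ioc, hw, hw2, and_self, if_true]
      exact hφ _ _ (by positivity) (mul_le_sin hw.le hw2)
    filter_upwards [h0, h1, ae_restrict_mem measurableSet_Ioc] with y hy0 hy1 hy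
    rcases lt_or_gt_of_ne hy0 with hneg | hpos
    · have hs : |sin y| = sin (-y) := by
        rw [sin_neg, abs_of_nonpos (sin_nonpos_of_nonpos_of_neg_pi_le hneg.le hy.1.le)]
      rw [hs]
      rcases le_total (-y) (π/2) with h | h
      · refine (key (-y) (by linarith) h).trans ?_
        calc Φ (-y) ≤ Φ y + Φ (-y) := le_add_self
          _ ≤ _ := by rw [add_assoc]; exact le_self_add
      · rw [show sin (-y) = sin (π + y) by rw [add_comm, sin_add_pi, sin_neg]]
        refine (key (π + y) (by linarith [hy.1]) (by linarith)).trans ?_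
        exact le_add_self
    · have hs : |sin y| = sin y := abs_of_nonneg (sin_nonneg_of_nonneg_of_le_pi hpos.le hy.2)
      rw [hs]
      rcases le_total y (π/2) with h | h
      · refine (key y hpos h).trans ?_
        rw [add_assoc, add_assoc]; exact le_self_add
      · rw [← sin_pi_sub]
        refine (key (π - y) (by linarith [lt_of_le_of_ne hy.2 hy1]) (by linarith)).trans ?_
        rw [add_assoc]
        exact le_trans (le_self_add (b := Φ (π + y))) le_add_self
  calc _ ≤ ∫⁻ y, (Φ y + Φ (-y) + Φ (π - y) + Φ (π + y)) ∂cI := lintegral_mono_ae hpt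
    _ ≤ ∫⁻ y, (Φ y + Φ (-y) + Φ (π - y) + Φ (π + y)) := by
        unfold cI; exact setLIntegral_le_lintegral _ _
    _ = ENNReal.ofReal (2 * π) * ∫⁻ v in Ioc 0 1, φ v := by
        rw [lintegral_add_right _ (by fun_prop), lintegral_add_right _ (by fun_prop),
          lintegral_add_right _ (by fun_prop), lintegral_neg_eq_self, lintegral_sub_left_eq_self,
          lintegral_add_left_eq_self, hΦi, ← add_mul, ← add_mul, ← add_mul,
          ← ENNReal.ofReal_add (by positivity) (by positivity), ← ENNReal.ofReal_add (by positivity) (by positivity),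
          ← ENNReal.ofReal_add (by positivity) (by positivity)]
        congr 2; ring

lemma lint_cos_eq (φ : ℝ → ℝ≥0∞) :
    ∫⁻ y, φ |cos y| ∂cI = ∫⁻ y, φ |sin y| ∂cI := by
  have h := lint_shift (fun y => φ |sin y|) (fun y => by simp) (π/2)
  rw [← h]
  simp [sin_add_pi_div_two]

lemma lint_cos (φ : ℝ → ℝ≥0∞) (hm : Measurable φ) (hφ : ∀ u v, 0 < u → u ≤ v → φ v ≤ φ u) :
    ∫⁻ y, φ |cos y| ∂cI ≤ ENNReal.ofReal (2 * π) * ∫⁻ v in Ioc 0 1, φ v := by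
  rw [lint_cos_eq]; exact lint_sin φ hm hφ

lemma lint_L1 {R κ : ℝ} (hR : 0 < R) (hκ : κ < 1) :
    ∫⁻ v in Ioc 0 R, ENNReal.ofReal (v ^ (-κ)) = ENNReal.ofReal (R ^ (1 - κ) / (1 - κ)) := by
  have h1 : IntegrableOn (fun v : ℝ => v ^ (-κ)) (Ioc 0 R) := by
    have := intervalIntegral.intervalIntegrable_rpow' (a := 0) (b := R) (r := -κ) (by linarith)
    rwa [intervalIntegrable_iff_integrableOn_Ioc_of_le hR.le] at this
  rw [← ofReal_integral_eq_lintegral_ofReal h1]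
  · congr 1
    rw [← intervalIntegral.integral_of_le hR.le, integral_rpow (Or.inl (by linarith))]
    rw [show -κ + 1 = 1 - κ by ring, Real.zero_rpow (by linarith), sub_zero]
  · filter_upwards [ae_restrict_mem measurableSet_Ioc] with v hv
    have := hv.1; positivity

lemma lint_L2 {R κ : ℝ} (hR : 0 < R) (hκ : 1 < κ) :
    ∫⁻ v in Ioi R, ENNReal.ofReal (v ^ (-κ)) = ENNReal.ofReal (R ^ (1 - κ) / (κ - 1)) := by
  have h1 : IntegrableOn (fun v : ℝ => v ^ (-κ)) (Ioi R) := integrableOn_Ioi_rpow_of_lt (by linarith) hR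
  rw [← ofReal_integral_eq_lintegral_ofReal h1]
  · congr 1
    rw [integral_Ioi_rpow_of_lt (by linarith) hR, show -κ + 1 = 1 - κ by ring, neg_div, ← div_neg, neg_sub]
  · filter_upwards [ae_restrict_mem measurableSet_Ioi] with v hv
    have : 0 < v := hR.trans hv
    positivity

lemma lint_max {X κ : ℝ} (hX : 0 < X) (h0 : 0 < κ) (h1 : κ < 1) :
    ∫⁻ v in Ioc 0 1, ENNReal.ofReal (v ^ (-κ) / max X v) ≤
      ENNReal.ofReal ((1 / (1 - κ) + 1 / κ) * X ^ (-κ)) := by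
  have hm : Measurable fun v : ℝ => ENNReal.ofReal (v ^ (-κ) / max X v) := by fun_prop
  calc _ ≤ ∫⁻ v in Ioc 0 X ∪ Ioi X, ENNReal.ofReal (v ^ (-κ) / max X v) := by
        apply lintegral_mono_set
        intro v hv
        rcases le_or_gt v X with h | h
        · exact Or.inl ⟨hv.1, h⟩
        · exact Or.inr h
    _ ≤ (∫⁻ v in Ioc 0 X, ENNReal.ofReal (v ^ (-κ) / max X v)) + (∫⁻ v in Ioi X, ENNReal.ofReal (v ^ (-κ) / max X v)) :=
        lintegral_union_le _ _ _
    _ ≤ (∫⁻ v in Ioc 0 X, ENNReal.ofReal X⁻¹ * ENNReal.ofReal (v ^ (-κ))) + (∫⁻ v in Ioi X, ENNReal.ofReal (v ^ (-(κ+1)))) := by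
        gcongr ?_ + ?_
        · apply lintegral_mono_ae
          filter_upwards [ae_restrict_mem measurableSet_Ioc] with v hv
          rw [← ENNReal.ofReal_mul (by positivity), max_eq_left hv.2]
          apply le_of_eq; congr 1; ring
        · apply lintegral_mono_ae
          filter_upwards [ae_restrict_mem measurableSet_Ioi] with v hv
          have hv0 : 0 < v := hX.trans hv
          rw [max_eq_right (le_of_lt hv), neg_add, Real.rpow_add hv0, Real.rpow_neg_one]
          rfl
    _ = _ := by
        rw [lintegral_const_mul _ (by fun_prop), lint_L1 hX h1, lint_L2 hX (by linarith),
          ← ENNReal.ofReal_mul (by positivity), ← ENNReal.ofReal_add]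
        · congr 1
          have e1 : X ^ (1 - κ) = X * X ^ (-κ) := by
            rw [sub_eq_add_neg, Real.rpow_add hX, Real.rpow_one]
          rw [e1, show (1:ℝ) - (κ + 1) = -κ by ring, show κ + 1 - 1 = κ by ring]
          have : 1 - κ ≠ 0 := by linarith
          field_simp
        · have : 0 < 1 - κ := by linarith
          positivity
        · have : κ + 1 - 1 = κ := by ring
          rw [this]; positivity

lemma antitone_max {X κ : ℝ} (hX : 0 < X) (h0 : 0 < κ) (u v : ℝ) (hu : 0 < u) (huv : u ≤ v) :
    ENNReal.ofReal (v ^ (-κ) / max X v) ≤ ENNReal.ofReal (u ^ (-κ) / max X u) := by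
  apply ENNReal.ofReal_le_ofReal
  apply div_le_div₀ (by positivity) _ (by positivity) (max_le_max le_rfl huv)
  exact Real.rpow_le_rpow_of_nonpos hu huv (by linarith)

/-- key estimate -/
lemma lint_prod {κ l : ℝ} (h0 : 0 < κ) (h1 : κ < 1) (l0 : 0 < l) (l1 : l < 1) :
    ∃ C : ℝ, 0 ≤ C ∧ ∀ X Y : ℝ, 0 < X → 0 < Y → X ≤ 1 → Y ≤ 1 →
    ∫⁻ y, ENNReal.ofReal (|sin y| ^ (-κ) * |cos y| ^ (-l) / (max X |sin y| * max Y |cos y|)) ∂cI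
      ≤ ENNReal.ofReal (C * (X ^ (-κ) * Y ^ (-l))) := by
  have hκ1 : 0 < 1 - κ := by linarith
  have hl1 : 0 < 1 - l := by linarith
  set A := 2 * π * (1 / (1 - κ) + 1 / κ) with hA
  set B := 2 * π * (1 / (1 - l) + 1 / l) with hB
  have hA0 : 0 ≤ A := by positivity
  have hB0 : 0 ≤ B := by positivity
  refine ⟨4 * A + 4 * B, by positivity, fun X Y hX hY hX1 hY1 => ?_⟩
  have S1 : ∫⁻ y, ENNReal.ofReal (|sin y| ^ (-κ) / max X |sin y|) ∂cI ≤ ENNReal.ofReal (A * X ^ (-κ)) := by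
    refine (lint_sin (fun v => ENNReal.ofReal (v ^ (-κ) / max X v)) (by fun_prop) (antitone_max hX h0)).trans ?_
    rw [hA, mul_assoc (2 * π), ENNReal.ofReal_mul (p := 2 * π) (by positivity)]
    exact mul_le_mul_right (lint_max hX h0 h1) _
  have S2 : ∫⁻ y, ENNReal.ofReal (|cos y| ^ (-l) / max Y |cos y|) ∂cI ≤ ENNReal.ofReal (B * Y ^ (-l)) := by
    refine (lint_cos (fun v => ENNReal.ofReal (v ^ (-l) / max Y v)) (by fun_prop) (antitone_max hY l0)).trans ?_
    rw [hB, mul_assoc (2 * π), ENNReal.ofReal_mul (p := 2 * π) (by positivity)]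
    exact mul_le_mul_right (lint_max hY l0 l1) _
  have hbig : ∀ v k : ℝ, 1/2 ≤ v → 0 < k → k < 1 → v ^ (-k) ≤ 2 := by
    intro v k hv hk hk1
    calc v ^ (-k) ≤ (1/2 : ℝ) ^ (-k) := Real.rpow_le_rpow_of_nonpos (by norm_num) hv (by linarith)
      _ ≤ (1/2 : ℝ) ^ (-1 : ℝ) := Real.rpow_le_rpow_of_exponent_ge (by norm_num) (by norm_num) (by linarith)
      _ = 2 := by rw [Real.rpow_neg_one]; norm_num
  have hpt : ∀ y, ENNReal.ofReal (|sin y| ^ (-κ) * |cos y| ^ (-l) / (max X |sin y| * max Y |cos y|)) ≤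
      4 * ENNReal.ofReal (|sin y| ^ (-κ) / max X |sin y|) + 4 * ENNReal.ofReal (|cos y| ^ (-l) / max Y |cos y|) := by
    intro y
    have e4 : (4 : ℝ≥0∞) = ENNReal.ofReal 4 := by norm_num
    have hX' : 0 < max X |sin y| := lt_max_of_lt_left hX
    have hY' : 0 < max Y |cos y| := lt_max_of_lt_left hY
    rw [e4, ← ENNReal.ofReal_mul (by norm_num), ← ENNReal.ofReal_mul (by norm_num), ← ENNReal.ofReal_add (by positivity) (by positivity)]
    apply ENNReal.ofReal_le_ofReal
    have h2 : 1/2 ≤ |sin y| ∨ 1/2 ≤ |cos y| := by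
      by_contra hcon
      push Not at hcon
      have h3 := sin_sq_add_cos_sq y
      have h4 := sq_abs (sin y)
      have h5 := sq_abs (cos y)
      nlinarith [abs_nonneg (sin y), abs_nonneg (cos y)]
    have p1 : 0 ≤ |sin y| ^ (-κ) / max X |sin y| := by positivity
    have p2 : 0 ≤ |cos y| ^ (-l) / max Y |cos y| := by positivity
    rw [mul_div_mul_comm]
    rcases h2 with h2 | h2
    · have h6 : |sin y| ^ (-κ) / max X |sin y| ≤ 4 := by
        rw [div_le_iff₀ hX']
        have := hbig _ κ h2 h0 h1
        have := le_max_right X |sin y|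
        linarith
      nlinarith
    · have h6 : |cos y| ^ (-l) / max Y |cos y| ≤ 4 := by
        rw [div_le_iff₀ hY']
        have := hbig _ l h2 l0 l1
        have := le_max_right Y |cos y|
        linarith
      nlinarith
  calc _ ≤ ∫⁻ y, (4 * ENNReal.ofReal (|sin y| ^ (-κ) / max X |sin y|) + 4 * ENNReal.ofReal (|cos y| ^ (-l) / max Y |cos y|)) ∂cI :=
        lintegral_mono hpt
    _ ≤ 4 * ENNReal.ofReal (A * X ^ (-κ)) + 4 * ENNReal.ofReal (B * Y ^ (-l)) := by
        rw [lintegral_add_right _ (by fun_prop), lintegral_const_mul _ (by fun_prop), lintegral_const_mul _ (by fun_prop)]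
        gcongr
    _ ≤ _ := by
        have e4 : (4 : ℝ≥0∞) = ENNReal.ofReal 4 := by norm_num
        rw [e4, ← ENNReal.ofReal_mul (by norm_num), ← ENNReal.ofReal_mul (by norm_num), ← ENNReal.ofReal_add (by positivity) (by positivity)]
        apply ENNReal.ofReal_le_ofReal
        have x1 : 1 ≤ X ^ (-κ) := Real.one_le_rpow_of_pos_of_le_one_of_nonpos hX hX1 (by linarith)
        have y1 : 1 ≤ Y ^ (-l) := Real.one_le_rpow_of_pos_of_le_one_of_nonpos hY hY1 (by linarith)
        have a1 : X ^ (-κ) ≤ X ^ (-κ) * Y ^ (-l) := le_mul_of_one_le_right (by positivity) y1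
        have a2 : Y ^ (-l) ≤ X ^ (-κ) * Y ^ (-l) := le_mul_of_one_le_left (by positivity) x1
        have b1 := mul_le_mul_of_nonneg_left a1 hA0
        have b2 := mul_le_mul_of_nonneg_left a2 hB0
        linarith

def rho (s t x : ℝ) : ℝ := |sin x| ^ s * |cos x| ^ t

@[fun_prop] lemma rho_meas (s t : ℝ) : Measurable (rho s t) := by unfold rho; fun_prop

lemma ck_sin {r u : ℝ} : |sin u| * ‖ck r u‖ ≤ 1 := by
  unfold ck
  have h : |sin u| ≤ ‖1 - r * ex u‖ := by
    have h1 : (1 - r * ex u) = ex u * (ex (-u) - r) := by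
      rw [mul_sub, mul_comm (ex u) (ex (-u)), ex_neg_mul]; ring
    rw [h1, norm_mul, norm_ex, one_mul]
    refine le_trans (le_of_eq ?_) (Complex.abs_im_le_norm _)
    rw [ex_eq]
    simp [← Complex.ofReal_sin, ← Complex.ofReal_cos]
  rw [norm_inv]
  rcases eq_or_ne (‖1 - r * ex u‖) 0 with h0 | h0
  · rw [h0]; simp
  · rw [← div_eq_mul_inv]
    exact div_le_one_of_le₀ h (norm_nonneg _)

lemma abs_sin_le_add (x y : ℝ) : |sin x| ≤ |sin y| + |sin (x - y)| := by
  have : sin x = sin y * cos (x - y) + cos y * sin (x - y) := by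
    rw [← sin_add]; congr 1; ring
  rw [this]
  refine (abs_add_le _ _).trans ?_
  rw [abs_mul, abs_mul]
  have h1 := abs_cos_le_one (x - y)
  have h2 := abs_cos_le_one y
  have := mul_le_mul_of_nonneg_left h1 (abs_nonneg (sin y))
  have := mul_le_mul_of_nonneg_right h2 (abs_nonneg (sin (x - y)))
  linarith

lemma abs_cos_le_add (x y : ℝ) : |cos x| ≤ |cos y| + |sin (x - y)| := by
  have h := abs_sin_le_add (x + π/2) (y + π/2)
  rw [sin_add_pi_div_two, sin_add_pi_div_two, show x + π/2 - (y + π/2) = x - y by ring] at h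
  exact h

lemma abs_sin_sub_comm (x y : ℝ) : |sin (x - y)| = |sin (y - x)| := by
  rw [← neg_sub, sin_neg, abs_neg]

lemma abs_log_le {ξ : ℝ} (h : 1/2 ≤ ξ) : |log ξ| ≤ 2 * |ξ - 1| := by
  have h0 : 0 < ξ := by linarith
  rcases le_total 1 ξ with h1 | h1
  · rw [abs_of_nonneg (log_nonneg h1), abs_of_nonneg (by linarith)]
    linarith [log_le_sub_one_of_pos h0]
  · rw [abs_of_nonpos (log_nonpos h0.le h1), abs_of_nonpos (by linarith)]
    have h2 := log_le_sub_one_of_pos (inv_pos.2 h0)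
    rw [log_inv] at h2
    have : ξ⁻¹ - 1 ≤ 2 * (1 - ξ) := by
      rw [sub_le_iff_le_add, inv_le_iff_one_le_mul₀ h0]; nlinarith
    linarith

lemma exp_sub_one_bd (z : ℝ) : |exp z - 1| ≤ |z| * exp |z| := by
  rcases le_total 0 z with h | h
  · rw [abs_of_nonneg h, abs_of_nonneg (by linarith [add_one_le_exp z])]
    have h1 := add_one_le_exp (-z)
    have h2 : exp z * exp (-z) = 1 := by rw [← exp_add]; simp
    nlinarith [exp_pos z]
  · rw [abs_of_nonpos h, abs_of_nonpos (by linarith [exp_le_one_iff.2 h])]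
    have h1 := add_one_le_exp z
    have h2 : 1 ≤ exp (-z) := one_le_exp (by linarith)
    nlinarith

lemma ratio_bd {s t : ℝ} (hs : |s| ≤ 1) (ht : |t| ≤ 1) {ξ η : ℝ} (h1 : 1/2 ≤ ξ) (h1' : ξ ≤ 2) (h2 : 1/2 ≤ η) (h2' : η ≤ 2) :
    |ξ ^ s * η ^ t - 1| ≤ 2 * exp 4 * (|ξ - 1| + |η - 1|) := by
  have e : ξ ^ s * η ^ t = exp (s * log ξ + t * log η) := by
    rw [exp_add, rpow_def_of_pos (by linarith), rpow_def_of_pos (by linarith), mul_comm s, mul_comm t]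
  rw [e]
  refine (exp_sub_one_bd _).trans ?_
  have hz : |s * log ξ + t * log η| ≤ 2 * (|ξ - 1| + |η - 1|) := by
    refine (abs_add_le _ _).trans ?_
    rw [abs_mul, abs_mul]
    have a1 := abs_log_le h1
    have a2 := abs_log_le h2
    have := mul_le_mul_of_nonneg_right hs (abs_nonneg (log ξ))
    have := mul_le_mul_of_nonneg_right ht (abs_nonneg (log η))
    linarith
  have b1 : |ξ - 1| ≤ 1 := by rw [abs_le]; constructor <;> linarith
  have b2 : |η - 1| ≤ 1 := by rw [abs_le]; constructor <;> linarith
  have : exp |s * log ξ + t * log η| ≤ exp 4 := exp_le_exp.2 (by linarith)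
  calc _ ≤ (2 * (|ξ - 1| + |η - 1|)) * exp 4 := by gcongr
    _ = _ := by ring

set_option maxHeartbeats 800000 in
lemma ker_bd {s t : ℝ} (hs : |s| ≤ 1) (ht : |t| ≤ 1) {r x y : ℝ}
    (hx : sin x ≠ 0) (hx' : cos x ≠ 0) (hy : sin y ≠ 0) (hy' : cos y ≠ 0) :
    |rho s t x / rho s t y - 1| * ‖ck r (x - y)‖ ≤
      8 * exp 4 * ((1 + rho s t x / rho s t y) / (max |sin x| |sin y| * max |cos x| |cos y|)) := by
  have X0 : 0 < |sin x| := abs_pos.2 hx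
  have Y0 : 0 < |cos x| := abs_pos.2 hx'
  have X0' : 0 < |sin y| := abs_pos.2 hy
  have Y0' : 0 < |cos y| := abs_pos.2 hy'
  have k1 : |sin (x - y)| * ‖ck r (x - y)‖ ≤ 1 := ck_sin
  have hn := norm_nonneg (ck r (x - y))
  have d1 := abs_sin_le_add x y
  have d2 := abs_sin_le_add y x
  have d3 := abs_cos_le_add x y
  have d4 := abs_cos_le_add y x
  rw [abs_sin_sub_comm y x] at d2 d4
  have e : rho s t x / rho s t y = (|sin x| / |sin y|) ^ s * (|cos x| / |cos y|) ^ t := by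
    unfold rho
    rw [div_rpow X0.le X0'.le, div_rpow Y0.le Y0'.le]; ring
  have hρ : 0 < rho s t x / rho s t y := by rw [e]; positivity
  have u1 := abs_sin_le_one x
  have u2 := abs_sin_le_one y
  have u3 := abs_cos_le_one x
  have u4 := abs_cos_le_one y
  set D := |sin (x - y)|
  set N := ‖ck r (x - y)‖
  set R := rho s t x / rho s t y
  set X := |sin x|
  set X' := |sin y|
  set Y := |cos x|
  set Y' := |cos y|
  have hD : 0 ≤ D := abs_nonneg _
  have mX0 : 0 < max X X' := lt_max_of_lt_left X0
  have mY0 : 0 < max Y Y' := lt_max_of_lt_left Y0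
  have mX1 : max X X' ≤ 1 := max_le u1 u2
  have mY1 : max Y Y' ≤ 1 := max_le u3 u4
  have hE : 1 ≤ exp 4 := one_le_exp (by norm_num)
  rcases le_or_gt (max X X' * max Y Y' / 4) D with h | h
  · have h1 : |R - 1| ≤ 1 + R := by rw [abs_le]; constructor <;> linarith
    have h2 : max X X' * max Y Y' * N ≤ 4 := by nlinarith
    rw [← mul_div_assoc, le_div_iff₀ (by positivity)]
    calc |R - 1| * N * (max X X' * max Y Y') = |R - 1| * (max X X' * max Y Y' * N) := by ring
      _ ≤ (1 + R) * 4 := by gcongr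
      _ ≤ _ := by nlinarith
  · have q1 : D < max X X' / 4 := by nlinarith
    have q2 : D < max Y Y' / 4 := by nlinarith
    have a1 : 3/4 * max X X' ≤ X := by
      rcases max_choice X X' with hm | hm <;> rw [hm] at q1 ⊢ <;> linarith
    have a2 : 3/4 * max X X' ≤ X' := by
      rcases max_choice X X' with hm | hm <;> rw [hm] at q1 ⊢ <;> linarith
    have a3 : 3/4 * max Y Y' ≤ Y := by
      rcases max_choice Y Y' with hm | hm <;> rw [hm] at q2 ⊢ <;> linarith
    have a4 : 3/4 * max Y Y' ≤ Y' := by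
      rcases max_choice Y Y' with hm | hm <;> rw [hm] at q2 ⊢ <;> linarith
    have l1 := le_max_left X X'
    have l2 := le_max_right X X'
    have l3 := le_max_left Y Y'
    have l4 := le_max_right Y Y'
    have hb := ratio_bd hs ht (ξ := X / X') (η := Y / Y') (by rw [le_div_iff₀ X0']; linarith)
      (by rw [div_le_iff₀ X0']; linarith) (by rw [le_div_iff₀ Y0']; linarith) (by rw [div_le_iff₀ Y0']; linarith)
    rw [← e] at hb
    have c1 : |X / X' - 1| ≤ 2 * D / (max X X' * max Y Y') := by
      rw [div_sub_one X0'.ne', abs_div, abs_of_pos X0', div_le_div_iff₀ X0' (by positivity)]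
      have : |X - X'| ≤ D := by rw [abs_le]; constructor <;> linarith
      calc |X - X'| * (max X X' * max Y Y') ≤ D * (max X X' * 1) := by gcongr
        _ ≤ _ := by
          have w1 := mul_le_mul_of_nonneg_left a2 hD
          have w2 := mul_nonneg hD mX0.le
          linarith
    have c2 : |Y / Y' - 1| ≤ 2 * D / (max X X' * max Y Y') := by
      rw [div_sub_one Y0'.ne', abs_div, abs_of_pos Y0', div_le_div_iff₀ Y0' (by positivity)]
      have : |Y - Y'| ≤ D := by rw [abs_le]; constructor <;> linarith
      calc |Y - Y'| * (max X X' * max Y Y') ≤ D * (1 * max Y Y') := by gcongr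
        _ ≤ _ := by
          have w1 := mul_le_mul_of_nonneg_left a4 hD
          have w2 := mul_nonneg hD mY0.le
          linarith
    calc |R - 1| * N ≤ (2 * exp 4 * (2 * D / (max X X' * max Y Y') + 2 * D / (max X X' * max Y Y'))) * N := by
          gcongr; refine hb.trans ?_; gcongr
      _ = 8 * exp 4 * ((D * N) / (max X X' * max Y Y')) := by ring
      _ ≤ _ := by
          gcongr; linarith

lemma ae_sin_ne : ∀ᵐ x ∂cI, sin x ≠ 0 ∧ cos x ≠ 0 := by
  unfold cI
  apply ae_restrict_of_ae
  have h1 : {x : ℝ | ¬ (sin x ≠ 0 ∧ cos x ≠ 0)} ⊆ range (fun n : ℤ => (n : ℝ) * (π / 2)) := by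
    intro x hx
    simp only [mem_ofPred_eq, ne_eq, not_and_or, not_not] at hx
    have : sin (2 * x) = 0 := by rw [sin_two_mul]; rcases hx with h | h <;> simp [h]
    obtain ⟨n, hn⟩ := sin_eq_zero_iff.1 this
    exact ⟨n, by simp only; linarith⟩
  exact measure_mono_null h1 ((countable_range _).measure_zero volume)

def pker (s t x y : ℝ) : ℝ≥0∞ :=
  ENNReal.ofReal ((1 + rho s t x / rho s t y) / (max |sin x| |sin y| * max |cos x| |cos y|))

lemma pker_Lp {p q : ℝ} (hpq : p.HolderConjugate q) {s t : ℝ} (hs1 : -(1/p) < s) (hs2 : s < 1/q)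
    (ht1 : -(1/p) < t) (ht2 : t < 1/q) : ∃ C : ℝ≥0∞, C ≠ ⊤ ∧ ∀ f : ℝ → ℝ≥0∞, Measurable f →
    ∫⁻ x, (∫⁻ y, pker s t x y * f y ∂cI) ^ p ∂cI ≤ C * ∫⁻ x, f x ^ p ∂cI := by
  have hp0 := hpq.pos
  have hq0 := hpq.symm.pos
  have hpq1 : 1 / p + 1 / q = 1 := by simpa using hpq.inv_add_inv_eq_one
  have p1 : 0 < 1 / p := by positivity
  have q1 : 0 < 1 / q := by positivity
  obtain ⟨C1, hC1, H1⟩ := lint_prod (κ := 1/p) (l := 1/p) p1 (by linarith) p1 (by linarith)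
  obtain ⟨C2, hC2, H2⟩ := lint_prod (κ := 1/p+s) (l := 1/p+t) (by linarith) (by linarith) (by linarith) (by linarith)
  obtain ⟨C3, hC3, H3⟩ := lint_prod (κ := 1/q) (l := 1/q) q1 (by linarith) q1 (by linarith)
  obtain ⟨C4, hC4, H4⟩ := lint_prod (κ := 1/q-s) (l := 1/q-t) (by linarith) (by linarith) (by linarith) (by linarith)
  set C := ENNReal.ofReal (C1 + C2 + C3 + C4) with hC
  refine ⟨C ^ p, ENNReal.rpow_ne_top_of_nonneg hp0.le (by simp [hC]), fun f hf => ?_⟩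
  set v : ℝ → ℝ := fun x => |sin x| * |cos x| with hv
  have hvm : Measurable v := by fun_prop
  set h : ℝ → ℝ≥0∞ := fun x => ENNReal.ofReal (v x ^ (-(1/(p*q)))) with hh
  have hpow : ∀ x, 0 < v x → ∀ w, 0 < w → h x ^ w = ENNReal.ofReal (v x ^ (-(1/(p*q)) * w)) := by
    intro x hx w hw
    rw [hh]; simp only
    rw [ENNReal.ofReal_rpow_of_pos (by positivity), ← Real.rpow_mul hx.le]
  have vpos : ∀ x, sin x ≠ 0 ∧ cos x ≠ 0 → 0 < v x := fun x hx =>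
    mul_pos (abs_pos.2 hx.1) (abs_pos.2 hx.2)
  have eq1 : -(1/(p*q)) * q = -(1/p) := by field_simp
  have ep1 : -(1/(p*q)) * p = -(1/q) := by field_simp
  refine schur_test hpq (pker s t) (by unfold pker Function.uncurry; fun_prop) h (by fun_prop) ?_ C ?_ ?_ f hf
  · filter_upwards [ae_sin_ne] with x hx
    have := vpos x hx
    refine ⟨?_, by simp [hh]⟩
    simp only [hh, ne_eq, ENNReal.ofReal_eq_zero, not_le]; positivity
  · filter_upwards [ae_sin_ne] with x hx
    have X0 : 0 < |sin x| := abs_pos.2 hx.1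
    have Y0 : 0 < |cos x| := abs_pos.2 hx.2
    have hρx : 0 < rho s t x := by unfold rho; positivity
    rw [hpow x (vpos x hx) q hq0, eq1]
    have key : ∀ᵐ y ∂cI, pker s t x y * h y ^ q =
        ENNReal.ofReal (|sin y| ^ (-(1/p)) * |cos y| ^ (-(1/p)) / (max |sin x| |sin y| * max |cos x| |cos y|)) +
        ENNReal.ofReal (rho s t x) * ENNReal.ofReal (|sin y| ^ (-(1/p+s)) * |cos y| ^ (-(1/p+t)) / (max |sin x| |sin y| * max |cos x| |cos y|)) := by
      filter_upwards [ae_sin_ne] with y hy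
      have X0' : 0 < |sin y| := abs_pos.2 hy.1
      have Y0' : 0 < |cos y| := abs_pos.2 hy.2
      have mX0 : 0 < max |sin x| |sin y| := lt_max_of_lt_left X0
      have mY0 : 0 < max |cos x| |cos y| := lt_max_of_lt_left Y0
      have hρy : 0 < rho s t y := by unfold rho; positivity
      rw [hpow y (vpos y hy) q hq0, eq1, pker, ← ENNReal.ofReal_mul (by positivity), ← ENNReal.ofReal_mul (by positivity),
        ← ENNReal.ofReal_add (by positivity) (by positivity)]
      congr 1
      rw [hv]; simp only
      rw [Real.mul_rpow X0'.le Y0'.le, neg_add, neg_add, Real.rpow_add X0', Real.rpow_add Y0', Real.rpow_neg X0'.le s,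
        Real.rpow_neg Y0'.le t]
      have : rho s t x / rho s t y = rho s t x * (|sin y| ^ s)⁻¹ * (|cos y| ^ t)⁻¹ := by
        rw [rho, rho]; field_simp
      rw [this]; ring
    rw [lintegral_congr_ae key, lintegral_add_left (by fun_prop), lintegral_const_mul _ (by fun_prop)]
    have a1 := H1 _ _ X0 Y0 (abs_sin_le_one x) (abs_cos_le_one x)
    have a2 := H2 _ _ X0 Y0 (abs_sin_le_one x) (abs_cos_le_one x)
    refine (add_le_add a1 (mul_le_mul_right a2 _)).trans ?_
    rw [← ENNReal.ofReal_mul hρx.le, ← ENNReal.ofReal_add (by positivity) (by positivity), hC, ← ENNReal.ofReal_mul (by positivity)]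
    apply ENNReal.ofReal_le_ofReal
    have : rho s t x * (C2 * (|sin x| ^ (-(1 / p + s)) * |cos x| ^ (-(1 / p + t)))) = C2 * (v x ^ (-(1/p))) := by
      rw [hv]; simp only
      rw [Real.mul_rpow X0.le Y0.le, neg_add, neg_add, Real.rpow_add X0, Real.rpow_add Y0, Real.rpow_neg X0.le s,
        Real.rpow_neg Y0.le t, rho]
      field_simp
    rw [this, ← Real.mul_rpow X0.le Y0.le]
    have : 0 ≤ v x ^ (-(1/p)) := Real.rpow_nonneg (vpos x hx).le _
    change C1 * v x ^ (-(1/p)) + _ ≤ _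
    nlinarith [mul_nonneg hC3 this, mul_nonneg hC4 this]
  · filter_upwards [ae_sin_ne] with x hx
    have X0 : 0 < |sin x| := abs_pos.2 hx.1
    have Y0 : 0 < |cos x| := abs_pos.2 hx.2
    have hρx : 0 < rho s t x := by unfold rho; positivity
    rw [hpow x (vpos x hx) p hp0, ep1]
    have key : ∀ᵐ y ∂cI, pker s t y x * h y ^ p =
        ENNReal.ofReal (|sin y| ^ (-(1/q)) * |cos y| ^ (-(1/q)) / (max |sin x| |sin y| * max |cos x| |cos y|)) +
        ENNReal.ofReal (rho s t x)⁻¹ * ENNReal.ofReal (|sin y| ^ (-(1/q-s)) * |cos y| ^ (-(1/q-t)) / (max |sin x| |sin y| * max |cos x| |cos y|)) := by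
      filter_upwards [ae_sin_ne] with y hy
      have X0' : 0 < |sin y| := abs_pos.2 hy.1
      have Y0' : 0 < |cos y| := abs_pos.2 hy.2
      have mX0 : 0 < max |sin x| |sin y| := lt_max_of_lt_left X0
      have mY0 : 0 < max |cos x| |cos y| := lt_max_of_lt_left Y0
      have hρy : 0 < rho s t y := by unfold rho; positivity
      rw [hpow y (vpos y hy) p hp0, ep1, pker, max_comm |sin y|, max_comm |cos y|, ← ENNReal.ofReal_mul (by positivity), ← ENNReal.ofReal_mul (by positivity),
        ← ENNReal.ofReal_add (by positivity) (by positivity)]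
      congr 1
      rw [hv]; simp only
      rw [Real.mul_rpow X0'.le Y0'.le, neg_sub, neg_sub, sub_eq_add_neg, sub_eq_add_neg, Real.rpow_add X0', Real.rpow_add Y0']
      have : rho s t y / rho s t x = (rho s t x)⁻¹ * (|sin y| ^ s) * (|cos y| ^ t) := by
        rw [rho, rho]; field_simp
      rw [this]; ring
    rw [lintegral_congr_ae key, lintegral_add_left (by fun_prop), lintegral_const_mul _ (by fun_prop)]
    have a1 := H3 _ _ X0 Y0 (abs_sin_le_one x) (abs_cos_le_one x)
    have a2 := H4 _ _ X0 Y0 (abs_sin_le_one x) (abs_cos_le_one x)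
    refine (add_le_add a1 (mul_le_mul_right a2 _)).trans ?_
    rw [← ENNReal.ofReal_mul (by positivity), ← ENNReal.ofReal_add (by positivity) (by positivity), hC, ← ENNReal.ofReal_mul (by positivity)]
    apply ENNReal.ofReal_le_ofReal
    have : (rho s t x)⁻¹ * (C4 * (|sin x| ^ (-(1 / q - s)) * |cos x| ^ (-(1 / q - t)))) = C4 * (v x ^ (-(1/q))) := by
      rw [hv]; simp only
      rw [Real.mul_rpow X0.le Y0.le, neg_sub, neg_sub, sub_eq_add_neg, sub_eq_add_neg, Real.rpow_add X0, Real.rpow_add Y0, rho]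
      field_simp
    rw [this, ← Real.mul_rpow X0.le Y0.le]
    have : 0 ≤ v x ^ (-(1/q)) := Real.rpow_nonneg (vpos x hx).le _
    change C3 * v x ^ (-(1/q)) + _ ≤ _
    nlinarith [mul_nonneg hC1 this, mul_nonneg hC2 this]

theorem wriesz {p q : ℝ} (hpq : p.HolderConjugate q) {s t : ℝ} (hs1 : -(1/p) < s) (hs2 : s < 1/q)
    (ht1 : -(1/p) < t) (ht2 : t < 1/q) : ∃ C : ℝ≥0∞, C ≠ ⊤ ∧ ∀ r : ℝ, 0 ≤ r → r < 1 → ∀ g : ℝ → ℂ, Measurable g →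
    ∫⁻ x, ‖∫ y, ((rho s t x / rho s t y : ℝ) : ℂ) * ck r (x - y) * g y ∂cI‖ₑ ^ p ∂cI ≤ C * ∫⁻ x, ‖g x‖ₑ ^ p ∂cI := by
  have hp1 := hpq.lt
  have hp0 := hpq.pos
  have hq0 := hpq.symm.pos
  have hpq1 : 1 / p + 1 / q = 1 := by simpa using hpq.inv_add_inv_eq_one
  have p1 : 0 < 1 / p := by positivity
  have q1 : 0 < 1 / q := by positivity
  obtain ⟨C1, hC1, H1⟩ := riesz p hp1
  obtain ⟨C2, hC2, H2⟩ := pker_Lp hpq hs1 hs2 ht1 ht2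
  set E : ℝ≥0∞ := ENNReal.ofReal (8 * exp 4)
  have hEp : E ^ p ≠ ⊤ := ENNReal.rpow_ne_top_of_nonneg hp0.le ENNReal.ofReal_ne_top
  have h2p : (2 : ℝ≥0∞) ^ p ≠ ⊤ := ENNReal.rpow_ne_top_of_nonneg hp0.le (by simp)
  refine ⟨2 ^ p * (C1 + E ^ p * C2) + 1, by finiteness, fun r hr0 hr1 g hg => ?_⟩
  rcases eq_or_ne (∫⁻ x, ‖g x‖ₑ ^ p ∂cI) ⊤ with hT | hT
  · rw [hT, ENNReal.mul_top (by positivity)]; exact le_top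
  have hgi := int_of_Lp hp1 hg hT
  have hpt : ∀ᵐ x ∂cI, ‖∫ y, ((rho s t x / rho s t y : ℝ) : ℂ) * ck r (x - y) * g y ∂cI‖ₑ ≤
      ‖CR r g x‖ₑ + E * ∫⁻ y, pker s t x y * ‖g y‖ₑ ∂cI := by
    filter_upwards [ae_sin_ne] with x hx
    have hB := ck_int hr0 hr1 hgi x
    by_cases hA : Integrable (fun y => ((rho s t x / rho s t y : ℝ) : ℂ) * ck r (x - y) * g y) cI
    · have : ∫ y, ((rho s t x / rho s t y : ℝ) : ℂ) * ck r (x - y) * g y ∂cI = CR r g x +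
          ∫ y, (((rho s t x / rho s t y : ℝ) : ℂ) * ck r (x - y) * g y - ck r (x - y) * g y) ∂cI := by
        rw [integral_sub hA hB, CR]; ring
      rw [this]
      refine (enorm_add_le _ _).trans ?_
      gcongr
      refine (enorm_integral_le_lintegral_enorm _).trans ?_
      rw [← lintegral_const_mul _ (by unfold pker; fun_prop)]
      apply lintegral_mono_ae
      filter_upwards [ae_sin_ne] with y hy
      have : ((rho s t x / rho s t y : ℝ) : ℂ) * ck r (x - y) * g y - ck r (x - y) * g y =
        ((rho s t x / rho s t y - 1 : ℝ) : ℂ) * ck r (x - y) * g y := by push_cast; ring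
      rw [this, ← mul_assoc, enorm_mul]
      gcongr
      rw [pker, ← ENNReal.ofReal_mul (by positivity), ← ofReal_norm]
      apply ENNReal.ofReal_le_ofReal
      rw [norm_mul, Complex.norm_real, Real.norm_eq_abs]
      exact ker_bd (abs_le.2 ⟨by linarith, by linarith⟩) (abs_le.2 ⟨by linarith, by linarith⟩) hx.1 hx.2 hy.1 hy.2
    · rw [integral_undef hA]; simp
  calc _ ≤ ∫⁻ x, 2 ^ p * (‖CR r g x‖ₑ ^ p + E ^ p * (∫⁻ y, pker s t x y * ‖g y‖ₑ ∂cI) ^ p) ∂cI := by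
        apply lintegral_mono_ae
        filter_upwards [hpt] with x hx
        refine (ENNReal.rpow_le_rpow hx hp0.le).trans ?_
        refine (rpow_add2 hp1.le _ _).trans ?_
        rw [ENNReal.mul_rpow_of_nonneg _ _ hp0.le]
    _ ≤ 2 ^ p * (C1 * (∫⁻ x, ‖g x‖ₑ ^ p ∂cI) + E ^ p * (C2 * ∫⁻ x, ‖g x‖ₑ ^ p ∂cI)) := by
        have := CR_meas (r := r) hg
        rw [lintegral_const_mul' _ _ h2p, lintegral_add_left (by fun_prop), lintegral_const_mul' _ _ hEp]
        gcongr
        · exact H1 r hr0 hr1 g hg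
        · exact H2 _ (by fun_prop)
    _ = (2 ^ p * (C1 + E ^ p * C2)) * ∫⁻ x, ‖g x‖ₑ ^ p ∂cI := by ring
    _ ≤ _ := by gcongr; exact le_self_add

def tf (k : ℤ) (x : ℝ) : ℂ := ex (k * x)

lemma tf_mul (k l : ℤ) (x : ℝ) : tf k x * tf l x = tf (k + l) x := by
  unfold tf; rw [← ex_add]; congr 1; push_cast; ring

lemma tf_conj (k : ℤ) (x : ℝ) : (starRingEnd ℂ) (tf k x) = tf (-k) x := by
  unfold tf; rw [conj_ex]; congr 1; push_cast; ring

lemma tf_neg (k : ℤ) (x : ℝ) : tf k (-x) = tf (-k) x := by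
  unfold tf; congr 1; push_cast; ring

lemma tf_zero (x : ℝ) : tf 0 x = 1 := by simp [tf, ex_zero]

lemma tf_norm (k : ℤ) (x : ℝ) : ‖tf k x‖ = 1 := norm_ex _

@[fun_prop] lemma tf_cont (k : ℤ) : Continuous (tf k) := by unfold tf; fun_prop

lemma tf_per (k : ℤ) : Function.Periodic (tf k) (2 * π) := by
  intro x; unfold tf
  rw [mul_add]
  exact ex_periodic.int_mul k _

def SP (S : Set ℤ) : Submodule ℂ (ℝ → ℂ) := Submodule.span ℂ (tf '' S)

lemma tf_mem {S : Set ℤ} {k : ℤ} (h : k ∈ S) : tf k ∈ SP S := Submodule.subset_span ⟨k, h, rfl⟩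

lemma SP_mono {S T : Set ℤ} (h : S ⊆ T) : SP S ≤ SP T := Submodule.span_mono (image_mono h)

lemma SP_ind {S : Set ℤ} {P : (ℝ → ℂ) → Prop} (h1 : ∀ k ∈ S, P (tf k)) (h0 : P 0)
    (ha : ∀ f g, f ∈ SP S → g ∈ SP S → P f → P g → P (f + g)) (hs : ∀ (c : ℂ) f, f ∈ SP S → P f → P (c • f)) {f : ℝ → ℂ}
    (hf : f ∈ SP S) : P f := by
  refine Submodule.span_induction (p := fun f _ => P f) ?_ h0 (fun f g hf hg => ha f g hf hg) (fun c f hf => hs c f hf) hf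
  rintro _ ⟨k, hk, rfl⟩; exact h1 k hk

lemma SP_conj {S T : Set ℤ} (h : ∀ k ∈ S, -k ∈ T) {f : ℝ → ℂ} (hf : f ∈ SP S) :
    (fun x => (starRingEnd ℂ) (f x)) ∈ SP T := by
  refine SP_ind (P := fun f => (fun x => (starRingEnd ℂ) (f x)) ∈ SP T) ?_ ?_ ?_ ?_ hf
  · intro k hk
    simp only [tf_conj]; exact tf_mem (h k hk)
  · simp only [Pi.zero_apply, map_zero]; exact Submodule.zero_mem _
  · intro f g _ _ hf hg
    simp only [Pi.add_apply, map_add]; exact Submodule.add_mem _ hf hg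
  · intro c f _ hf
    simp only [Pi.smul_apply, smul_eq_mul, map_mul]; exact Submodule.smul_mem _ _ hf

lemma SP_tfmul {S T : Set ℤ} (m : ℤ) (h : ∀ k ∈ S, m + k ∈ T) {f : ℝ → ℂ} (hf : f ∈ SP S) :
    (fun x => tf m x * f x) ∈ SP T := by
  refine SP_ind (P := fun f => (fun x => tf m x * f x) ∈ SP T) ?_ ?_ ?_ ?_ hf
  · intro k hk
    simp only [tf_mul]; exact tf_mem (h k hk)
  · simp only [Pi.zero_apply, mul_zero]; exact Submodule.zero_mem _
  · intro f g _ _ hf hg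
    simp only [Pi.add_apply, mul_add]; exact Submodule.add_mem _ hf hg
  · intro c f _ hf
    simp only [Pi.smul_apply, smul_eq_mul, mul_left_comm _ c]; exact Submodule.smul_mem _ _ hf

lemma SP_mul {S T U : Set ℤ} (h : ∀ k ∈ S, ∀ l ∈ T, k + l ∈ U) {f g : ℝ → ℂ} (hf : f ∈ SP S) (hg : g ∈ SP T) :
    (fun x => f x * g x) ∈ SP U := by
  refine SP_ind (P := fun f => (fun x => f x * g x) ∈ SP U) ?_ ?_ ?_ ?_ hf
  · intro k hk; exact SP_tfmul k (h k hk) hg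
  · simp only [Pi.zero_apply, zero_mul]; exact Submodule.zero_mem _
  · intro f g _ _ hf hg
    simp only [Pi.add_apply, add_mul]; exact Submodule.add_mem _ hf hg
  · intro c f _ hf
    simp only [Pi.smul_apply, smul_eq_mul, mul_assoc]; exact Submodule.smul_mem _ _ hf

lemma SP_cont {S : Set ℤ} {f : ℝ → ℂ} (hf : f ∈ SP S) : Continuous f := by
  refine SP_ind (P := fun f => Continuous f) (fun k _ => tf_cont k) continuous_const ?_ ?_ hf
  · intro f g _ _ hf hg; exact hf.add hg
  · intro c f _ hf; exact hf.const_smul c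

lemma SP_per {S : Set ℤ} {f : ℝ → ℂ} (hf : f ∈ SP S) : Function.Periodic f (2 * π) := by
  refine SP_ind (P := fun f => Function.Periodic f (2 * π)) (fun k _ => tf_per k) (fun x => rfl) ?_ ?_ hf
  · intro f g _ _ hf hg; exact hf.add hg
  · intro c f _ hf; exact hf.smul c

lemma SP_bdd {S : Set ℤ} {f : ℝ → ℂ} (hf : f ∈ SP S) : ∃ C : ℝ, ∀ x, ‖f x‖ ≤ C := by
  refine SP_ind (P := fun f => ∃ C : ℝ, ∀ x, ‖f x‖ ≤ C) (fun k _ => ⟨1, fun x => (tf_norm k x).le⟩) ⟨0, by simp⟩ ?_ ?_ hf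
  · rintro f g _ _ ⟨C, hf⟩ ⟨D, hg⟩; exact ⟨C + D, fun x => (norm_add_le _ _).trans (add_le_add (hf x) (hg x))⟩
  · rintro c f _ ⟨C, hf⟩
    exact ⟨‖c‖ * C, fun x => by rw [Pi.smul_apply, norm_smul]; exact mul_le_mul_of_nonneg_left (hf x) (norm_nonneg _)⟩

lemma SP_int {S : Set ℤ} {f : ℝ → ℂ} (hf : f ∈ SP S) (μ : Measure ℝ) [IsFiniteMeasure μ] : Integrable f μ := by
  obtain ⟨C, hC⟩ := SP_bdd hf
  exact Integrable.of_bound (SP_cont hf).aestronglyMeasurable C (ae_of_all _ hC)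

structure GM (μ : Measure ℝ) : Prop where
  fin : IsFiniteMeasure μ
  even : ∀ k : ℤ, ∫ x, tf (-k) x ∂μ = ∫ x, tf k x ∂μ
  odd : ∀ k : ℤ, Odd k → ∫ x, tf k x ∂μ = 0
  ac : cI ≪ μ

lemma cI_tf (k : ℤ) (hk : k ≠ 0) : ∫ x, tf k x ∂cI = 0 := by
  unfold cI
  rw [← intervalIntegral.integral_of_le (by linarith [pi_pos])]
  have hc : (k * Complex.I : ℂ) ≠ 0 := by simp [hk]
  have h : ∀ x : ℝ, tf k x = Complex.exp (k * Complex.I * x) := by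
    intro x; unfold tf ex; congr 1; push_cast; ring
  simp_rw [h]
  rw [integral_exp_mul_complex hc]
  have := tf_per k (-π)
  rw [show -π + 2 * π = π by ring, h, h] at this
  rw [this]; simp

/-- a trigonometric polynomial vanishing a.e. vanishes -/
lemma SP_zero_ae {S : Set ℤ} {f : ℝ → ℂ} (hf : f ∈ SP S) (h : f =ᵐ[cI] 0) : f = 0 := by
  have h1 : EqOn f 0 (Ioc (-π) π) := by
    apply Measure.eqOn_Ioc_of_ae_eq (μ := volume) h (SP_cont hf).continuousOn continuousOn_const
  funext x
  obtain ⟨y, hy, hxy⟩ := (SP_per hf).exists_mem_Ioc (by positivity) x (-π)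
  rw [hxy]
  apply h1
  rw [show -π + 2 * π = π by ring] at hy; exact hy

lemma GM.zero {μ : Measure ℝ} (hμ : GM μ) {S : Set ℤ} {f : ℝ → ℂ} (hf : f ∈ SP S)
    (h : ∫ x, f x * (starRingEnd ℂ) (f x) ∂μ = 0) : f = 0 := by
  have := hμ.fin
  have hi : Integrable (fun x => f x * (starRingEnd ℂ) (f x)) μ :=
    SP_int (SP_mul (U := univ) (T := univ) (fun _ _ _ _ => mem_univ _) hf (SP_conj (fun _ _ => mem_univ _) hf)) μ
  have e : ∀ x, f x * (starRingEnd ℂ) (f x) = ((‖f x‖ ^ 2 : ℝ) : ℂ) := fun x => by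
    rw [Complex.mul_conj, Complex.normSq_eq_norm_sq]
  simp_rw [e] at h hi
  rw [integral_complex_ofReal] at h
  have h' : ∫ x, ‖f x‖ ^ 2 ∂μ = 0 := by exact_mod_cast h
  have hi' : Integrable (fun x => ‖f x‖ ^ 2) μ := by
    have := hi.re; simpa only [RCLike.re_to_complex, Complex.ofReal_re] using this
  rw [integral_eq_zero_iff_of_nonneg (fun x => by positivity) hi'] at h'
  apply SP_zero_ae hf
  filter_upwards [hμ.ac h'] with x hx
  have : ‖f x‖ ^ 2 = 0 := hx
  simpa using this

lemma GM.im {μ : Measure ℝ} (hμ : GM μ) (k : ℤ) : (∫ x, tf k x ∂μ).im = 0 := by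
  have h := hμ.even k
  have h2 : ∫ x, tf (-k) x ∂μ = (starRingEnd ℂ) (∫ x, tf k x ∂μ) := by
    rw [← integral_conj]; simp_rw [tf_conj]
  rw [h2] at h
  exact Complex.conj_eq_iff_im.1 h

lemma tf_indep {n : ℕ} {c : ℕ → ℝ} (h : ∀ x, ∑ j ∈ Finset.range (n+1), (c j : ℂ) * tf (2 * j - n) x = 0) :
    ∀ j, j ≤ n → c j = 0 := by
  intro j hj
  have h1 : ∫ x, (∑ i ∈ Finset.range (n+1), (c i : ℂ) * tf (2 * i - n) x) * tf (-(2 * j - n)) x ∂cI = 0 := by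
    simp_rw [h]; simp
  simp_rw [Finset.sum_mul, mul_assoc, tf_mul] at h1
  rw [integral_finsetSum _ (fun i _ => (SP_int (tf_mem (mem_univ _)) cI).const_mul _)] at h1
  rw [Finset.sum_eq_single j] at h1
  · rw [integral_const_mul] at h1
    simp only [add_neg_cancel, tf_zero, integral_const] at h1
    rw [measureReal_def, cI_univ] at h1
    simp only [smul_eq_mul, mul_eq_zero] at h1
    have : (2 * π) ≠ 0 := by positivity
    simpa [pi_ne_zero, ENNReal.toReal_ofReal (by positivity : (0:ℝ) ≤ 2 * π), pi_pos.le] using h1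
  · intro i _ hij
    rw [integral_const_mul, cI_tf _ (by omega), mul_zero]
  · intro h; simp at h; omega

lemma exists_g {μ : Measure ℝ} (hμ : GM μ) (n : ℕ) : ∃ c : ℕ → ℝ,
    (∀ j < n, ∫ x, (∑ i ∈ Finset.range (n+1), (c i : ℂ) * tf (2 * i - n) x) * tf (-(2 * j - n)) x ∂μ = 0) ∧
    ∫ x, (∑ i ∈ Finset.range (n+1), (c i : ℂ) * tf (2 * i - n) x) * (starRingEnd ℂ) (∑ i ∈ Finset.range (n+1), (c i : ℂ) * tf (2 * i - n) x) ∂μ = 1 := by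
  have := hμ.fin
  let A : Matrix (Fin n) (Fin (n+1)) ℝ := fun j i => (∫ x, tf (2 * i - 2 * j) x ∂μ).re
  have hk : LinearMap.ker (Matrix.mulVecLin A) ≠ ⊥ := LinearMap.ker_ne_bot_of_finrank_lt (by simp)
  obtain ⟨v, hv, hv0⟩ := (Submodule.ne_bot_iff _).1 hk
  set d : ℕ → ℝ := fun i => if h : i < n + 1 then v ⟨i, h⟩ else 0 with hd
  set F : ℝ → ℂ := fun x => ∑ i ∈ Finset.range (n+1), (d i : ℂ) * tf (2 * i - n) x with hF
  have hFm : F ∈ SP univ := by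
    have : F = ∑ i ∈ Finset.range (n+1), (d i : ℂ) • tf (2 * i - n) := by
      funext x; simp [hF]
    rw [this]
    exact Submodule.sum_mem _ fun i _ => Submodule.smul_mem _ _ (tf_mem (mem_univ _))
  have horth : ∀ j < n, ∫ x, F x * tf (-(2 * j - n)) x ∂μ = 0 := by
    intro j hj
    simp_rw [hF, Finset.sum_mul, mul_assoc, tf_mul]
    rw [integral_finsetSum _ (fun i _ => (SP_int (tf_mem (mem_univ _)) μ).const_mul _)]
    simp_rw [integral_const_mul]
    have e : ∀ i : ℕ, ∫ x, tf (2 * (i:ℤ) - n + -(2 * j - n)) x ∂μ = (((∫ x, tf (2 * i - 2 * j) x ∂μ).re : ℝ) : ℂ) := by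
      intro i
      rw [show (2 * (i:ℤ) - n + -(2 * j - n)) = 2 * i - 2 * j by ring]
      apply Complex.ext
      · simp
      · simp [hμ.im]
    simp_rw [e]
    have h1 := congr_fun (LinearMap.mem_ker.1 hv) ⟨j, hj⟩
    rw [Matrix.mulVecLin_apply, Matrix.mulVec, dotProduct] at h1
    simp only [A, Pi.zero_apply] at h1
    rw [Finset.sum_range]
    have h2 : ∀ i : Fin (n+1), d i = v i := fun i => by simp only [hd, i.isLt, dif_pos]
    simp_rw [h2]
    rw [← Complex.ofReal_zero, ← h1]
    push_cast
    apply Finset.sum_congr rfl; intro i _; ring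
  have hne : ∫ x, ‖F x‖ ^ 2 ∂μ ≠ 0 := by
    intro h0
    have : F = 0 := by
      apply hμ.zero hFm
      have e : ∀ x, F x * (starRingEnd ℂ) (F x) = ((‖F x‖ ^ 2 : ℝ) : ℂ) := fun x => by
        rw [Complex.mul_conj, Complex.normSq_eq_norm_sq]
      simp_rw [e]
      rw [integral_complex_ofReal, h0]; simp
    have h3 := tf_indep (c := d) (n := n) (fun x => congr_fun this x)
    apply hv0
    funext i
    have := h3 i (by omega)
    simp only [hd, i.isLt, dif_pos] at this
    exact this
  set N := ∫ x, ‖F x‖ ^ 2 ∂μ with hN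
  have hNpos : 0 < N := lt_of_le_of_ne (integral_nonneg fun x => by positivity) (Ne.symm hne)
  have e : ∀ x, ∑ i ∈ Finset.range (n+1), (((√N)⁻¹ * d i : ℝ) : ℂ) * tf (2 * i - n) x = (((√N)⁻¹ : ℝ) : ℂ) * F x := by
    intro x; simp only [hF, Finset.mul_sum]
    apply Finset.sum_congr rfl; intro i _; push_cast; ring
  refine ⟨fun i => (√N)⁻¹ * d i, fun j hj => ?_, ?_⟩
  · simp_rw [e, mul_assoc]
    rw [integral_const_mul, horth j hj, mul_zero]
  · simp_rw [e]
    have e2 : ∀ x, (((√N)⁻¹ : ℝ) : ℂ) * F x * (starRingEnd ℂ) ((((√N)⁻¹ : ℝ) : ℂ) * F x) = ((N⁻¹ * ‖F x‖ ^ 2 : ℝ) : ℂ) := fun x => by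
      rw [Complex.mul_conj, Complex.normSq_eq_norm_sq, norm_mul, mul_pow, Complex.norm_real, norm_inv, inv_pow,
        Real.norm_eq_abs, sq_abs, Real.sq_sqrt hNpos.le]
    simp_rw [e2]
    rw [integral_complex_ofReal, integral_const_mul, ← hN, inv_mul_cancel₀ hne]; simp

open Classical in
def gcoef (μ : Measure ℝ) (n : ℕ) : ℕ → ℝ := if h : GM μ then (exists_g h n).choose else 0

def gg (μ : Measure ℝ) (n : ℕ) (x : ℝ) : ℂ := ∑ i ∈ Finset.range (n+1), (gcoef μ n i : ℂ) * tf (2 * i - n) x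

def SG (n : ℕ) : Set ℤ := {k | ∃ j : ℕ, j < n ∧ k = 2 * j - (n - 1)}

lemma gg_neg (μ : Measure ℝ) (n : ℕ) (x : ℝ) : gg μ n (-x) = (starRingEnd ℂ) (gg μ n x) := by
  unfold gg
  rw [map_sum]
  apply Finset.sum_congr rfl; intro i _
  rw [map_mul, tf_conj, tf_neg, Complex.conj_ofReal]

lemma gg_mem (μ : Measure ℝ) (n : ℕ) : gg μ n ∈ SP (SG (n+1)) := by
  have : gg μ n = ∑ i ∈ Finset.range (n+1), (gcoef μ n i : ℂ) • tf (2 * i - n) := by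
    funext x; simp [gg]
  rw [this]
  exact Submodule.sum_mem _ fun i hi => Submodule.smul_mem _ _ (tf_mem ⟨i, Finset.mem_range.1 hi, by push_cast; ring⟩)

@[fun_prop] lemma gg_cont (μ : Measure ℝ) (n : ℕ) : Continuous (gg μ n) := SP_cont (gg_mem μ n)

lemma SG_neg {n : ℕ} {k : ℤ} (h : k ∈ SG n) : -k ∈ SG n := by
  obtain ⟨j, hj, rfl⟩ := h
  refine ⟨n - 1 - j, by omega, ?_⟩
  push_cast [show j ≤ n - 1 by omega, show 1 ≤ n by omega]; ring

def SL (n : ℕ) : Set ℤ := {k | ∃ j : ℕ, j < n ∧ k = 2 * j - n}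

lemma SP_conj_mem {n : ℕ} {f : ℝ → ℂ} (hf : f ∈ SP (SG n)) : (fun x => (starRingEnd ℂ) (f x)) ∈ SP (SG n) :=
  SP_conj (fun _ h => SG_neg h) hf

lemma SP_univ {S : Set ℤ} {f : ℝ → ℂ} (hf : f ∈ SP S) : f ∈ SP univ := SP_mono (subset_univ _) hf

lemma SP_mulu {S T : Set ℤ} {f g : ℝ → ℂ} (hf : f ∈ SP S) (hg : g ∈ SP T) : (fun x => f x * g x) ∈ SP univ :=
  SP_mul (fun _ _ _ _ => mem_univ _) hf hg

lemma SP_conju {S : Set ℤ} {f : ℝ → ℂ} (hf : f ∈ SP S) : (fun x => (starRingEnd ℂ) (f x)) ∈ SP univ :=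
  SP_conj (fun _ _ => mem_univ _) hf

lemma gg_orth {μ : Measure ℝ} (hμ : GM μ) {n : ℕ} {f : ℝ → ℂ} (hf : f ∈ SP (SL n)) : ∫ x, gg μ n x * (starRingEnd ℂ) (f x) ∂μ = 0 := by
  have := hμ.fin
  have h1 := (exists_g hμ n).choose_spec.1
  have e : (exists_g hμ n).choose = gcoef μ n := by simp [gcoef, hμ]
  rw [e] at h1
  refine SP_ind (P := fun f => ∫ x, gg μ n x * (starRingEnd ℂ) (f x) ∂μ = 0) ?_ ?_ ?_ ?_ hf
  · rintro k ⟨j, hj, rfl⟩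
    simp_rw [tf_conj]; exact h1 j hj
  · simp
  · intro f g hf hg h1 h2
    simp only [Pi.add_apply, map_add, mul_add]
    rw [integral_add (SP_int (SP_mulu (gg_mem μ n) (SP_conju hf)) μ) (SP_int (SP_mulu (gg_mem μ n) (SP_conju hg)) μ), h1, h2, add_zero]
  · intro c f hf h1
    simp only [Pi.smul_apply, smul_eq_mul, map_mul, mul_left_comm _ ((starRingEnd ℂ) c)]
    rw [integral_const_mul, h1, mul_zero]

lemma gg_orth' {μ : Measure ℝ} (hμ : GM μ) {n : ℕ} {f : ℝ → ℂ} (hf : f ∈ SP (SL n)) : ∫ x, (starRingEnd ℂ) (gg μ n x) * f x ∂μ = 0 := by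
  have h := congr_arg (starRingEnd ℂ) (gg_orth hμ hf)
  rw [← integral_conj, map_zero] at h
  simpa using h

lemma gg_norm {μ : Measure ℝ} (hμ : GM μ) (n : ℕ) : ∫ x, gg μ n x * (starRingEnd ℂ) (gg μ n x) ∂μ = 1 := by
  have h1 := (exists_g hμ n).choose_spec.2
  have e : (exists_g hμ n).choose = gcoef μ n := by simp [gcoef, hμ]
  rw [e] at h1
  exact h1

lemma gg_lead {μ : Measure ℝ} (hμ : GM μ) (n : ℕ) : gcoef μ n n ≠ 0 := by
  intro h0
  have : gg μ n ∈ SP (SL n) := by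
    have : gg μ n = ∑ i ∈ Finset.range n, (gcoef μ n i : ℂ) • tf (2 * i - n) := by
      funext x; simp [gg, Finset.sum_range_succ, h0]
    rw [this]
    exact Submodule.sum_mem _ fun i hi => Submodule.smul_mem _ _ (tf_mem ⟨i, Finset.mem_range.1 hi, rfl⟩)
  have h1 := gg_orth hμ this
  rw [gg_norm hμ] at h1
  exact one_ne_zero h1

lemma decomp {μ : Measure ℝ} (hμ : GM μ) {n : ℕ} {f : ℝ → ℂ} (hf : f ∈ SP (SG (n+1))) : ∃ h ∈ SP (SG n), ∃ c : ℂ,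
    ∀ x, f x = tf (-1) x * h x + c * gg μ n x := by
  refine SP_ind (P := fun f => ∃ h ∈ SP (SG n), ∃ c : ℂ,
    ∀ x, f x = tf (-1) x * h x + c * gg μ n x) ?_ ?_ ?_ ?_ hf
  · rintro k ⟨j, hj, rfl⟩
    rcases Nat.lt_succ_iff_lt_or_eq.1 hj with h | h
    · refine ⟨tf (2 * j - (n - 1)), tf_mem ⟨j, h, rfl⟩, 0, fun x => ?_⟩
      rw [tf_mul, zero_mul, add_zero]; congr 1; push_cast; ring
    · subst h
      have hl : (gcoef μ j j : ℂ) ≠ 0 := by exact_mod_cast gg_lead hμ j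
      refine ⟨∑ i ∈ Finset.range j, (-(gcoef μ j i : ℂ) / gcoef μ j j) • tf (2 * i - (j - 1)),
        Submodule.sum_mem _ fun i hi => Submodule.smul_mem _ _ (tf_mem ⟨i, Finset.mem_range.1 hi, rfl⟩),
        (gcoef μ j j : ℂ)⁻¹, fun x => ?_⟩
      rw [gg, Finset.sum_range_succ, mul_add, ← mul_assoc _ (gcoef μ j j : ℂ), inv_mul_cancel₀ hl, one_mul, Finset.sum_apply,
        Finset.mul_sum, Finset.mul_sum, ← add_assoc, ← Finset.sum_add_distrib, Finset.sum_eq_zero, zero_add]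
      · congr 1; push_cast; ring
      · intro i _
        rw [Pi.smul_apply, smul_eq_mul, mul_left_comm, tf_mul, show (-1 + (2 * (i:ℤ) - (j - 1))) = 2 * i - j by ring]
        ring
  · exact ⟨0, Submodule.zero_mem _, 0, fun x => by simp⟩
  · rintro f g - - ⟨h1, m1, c1, e1⟩ ⟨h2, m2, c2, e2⟩
    exact ⟨h1 + h2, Submodule.add_mem _ m1 m2, c1 + c2, fun x => by simp only [Pi.add_apply, e1, e2]; ring⟩
  · rintro c f - ⟨h1, m1, c1, e1⟩
    exact ⟨c • h1, Submodule.smul_mem _ _ m1, c * c1, fun x => by simp only [Pi.smul_apply, smul_eq_mul, e1]; ring⟩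

def kk (μ : Measure ℝ) : ℕ → ℝ → ℝ → ℂ
  | 0, _, _ => 0
  | n+1, x, y => tf (-1) x * tf 1 y * kk μ n x y + gg μ n x * (starRingEnd ℂ) (gg μ n y)

lemma kk_succ (μ : Measure ℝ) (n : ℕ) (x y : ℝ) :
  kk μ (n+1) x y = tf (-1) x * tf 1 y * kk μ n x y + gg μ n x * (starRingEnd ℂ) (gg μ n y) := rfl

lemma kk_mem (μ : Measure ℝ) (n : ℕ) (x : ℝ) : (fun y => kk μ n x y) ∈ SP (SG n) := by
  induction n with
  | zero => exact Submodule.zero_mem _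
  | succ n ih =>
    have : (fun y => kk μ (n+1) x y) = tf (-1) x • (fun y => tf 1 y * kk μ n x y) + gg μ n x • (fun y => (starRingEnd ℂ) (gg μ n y)) := by
      funext y; simp [kk_succ, mul_assoc]
    rw [this]
    refine Submodule.add_mem _ (Submodule.smul_mem _ _ (SP_tfmul 1 ?_ ih)) (Submodule.smul_mem _ _ (SP_conj_mem (gg_mem μ n)))
    rintro k ⟨j, hj, rfl⟩
    exact ⟨j + 1, by omega, by push_cast; ring⟩

lemma kk_herm (μ : Measure ℝ) (n : ℕ) (x y : ℝ) : kk μ n y x = (starRingEnd ℂ) (kk μ n x y) := by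
  induction n with
  | zero => simp [kk]
  | succ n ih =>
    rw [kk_succ, kk_succ, map_add, map_mul, map_mul, map_mul, tf_conj, tf_conj, ← ih, Complex.conj_conj]
    simp only [neg_neg]; ring

@[fun_prop] lemma kk_cont (μ : Measure ℝ) (n : ℕ) : Continuous (fun z : ℝ × ℝ => kk μ n z.1 z.2) := by
  induction n with
  | zero => simp only [kk]; fun_prop
  | succ n ih => simp only [kk_succ]; fun_prop

lemma kk_rep {μ : Measure ℝ} (hμ : GM μ) (n : ℕ) {f : ℝ → ℂ} (hf : f ∈ SP (SG n)) (x : ℝ) :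
    ∫ y, kk μ n x y * f y ∂μ = f x := by
  have := hμ.fin
  induction n generalizing f with
  | zero =>
    have : SG 0 = ∅ := by ext k; simp [SG]
    rw [this, SP, image_empty, Submodule.span_empty, Submodule.mem_bot] at hf
    simp [hf]
  | succ n ih =>
    obtain ⟨h, hh, c, e⟩ := decomp hμ hf
    have hL : (fun y => tf (-1) y * h y) ∈ SP (SL n) := by
      apply SP_tfmul (-1) _ hh
      rintro k ⟨j, hj, rfl⟩; exact ⟨j, hj, by ring⟩
    have hL2 : (fun y => tf (-1) y * (starRingEnd ℂ) (kk μ n x y)) ∈ SP (SL n) := by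
      apply SP_tfmul (-1) _ (SP_conj_mem (kk_mem μ n x))
      rintro k ⟨j, hj, rfl⟩; exact ⟨j, hj, by ring⟩
    have e1 : ∀ y, kk μ (n+1) x y * f y = tf (-1) x * (kk μ n x y * h y) + (tf (-1) x * c) * (gg μ n y * (starRingEnd ℂ) (tf (-1) y * (starRingEnd ℂ) (kk μ n x y)))
        + gg μ n x * ((starRingEnd ℂ) (gg μ n y) * (tf (-1) y * h y)) + (c * gg μ n x) * (gg μ n y * (starRingEnd ℂ) (gg μ n y)) := by
      intro y
      rw [kk_succ, e, map_mul, Complex.conj_conj, tf_conj, neg_neg]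
      have : tf 1 y * tf (-1) y = 1 := by rw [tf_mul]; simp [tf_zero]
      linear_combination (tf (-1) x * kk μ n x y * h y) * this
    simp_rw [e1]
    have i1 := (SP_int (SP_mulu (kk_mem μ n x) hh) μ).const_mul (tf (-1) x)
    have i2 := (SP_int (SP_mulu (gg_mem μ n) (SP_conju hL2)) μ).const_mul (tf (-1) x * c)
    have i3 := (SP_int (SP_mulu (SP_conju (gg_mem μ n)) hL) μ).const_mul (gg μ n x)
    have i4 := (SP_int (SP_mulu (gg_mem μ n) (SP_conju (gg_mem μ n))) μ).const_mul (c * gg μ n x)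
    rw [integral_add (by exact (i1.add i2).add i3) i4, integral_add (by exact i1.add i2) i3, integral_add i1 i2,
      integral_const_mul, integral_const_mul, integral_const_mul, integral_const_mul, ih hh,
      gg_orth hμ hL2, gg_orth' hμ hL, gg_norm hμ, e]
    ring

lemma kk_real {μ : Measure ℝ} (hμ : GM μ) (n : ℕ) (x y : ℝ) : (starRingEnd ℂ) (kk μ n x y) = kk μ n x y := by
  have := hμ.fin
  have h1 : ∀ f ∈ SP (SG n), ∫ y, (starRingEnd ℂ) (kk μ n x y) * f y ∂μ = f x := by
    intro f hf
    have h := congr_arg (starRingEnd ℂ) (kk_rep hμ n (SP_conj_mem hf) x)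
    rw [← integral_conj] at h
    simpa using h
  set D : ℝ → ℂ := fun y => kk μ n x y - (starRingEnd ℂ) (kk μ n x y) with hD
  have hDm : D ∈ SP (SG n) := Submodule.sub_mem _ (kk_mem μ n x) (SP_conj_mem (kk_mem μ n x))
  have h2 : D = 0 := by
    apply hμ.zero hDm
    have hc := SP_conj_mem hDm
    have : ∀ y, D y * (starRingEnd ℂ) (D y) = kk μ n x y * (starRingEnd ℂ) (D y) - (starRingEnd ℂ) (kk μ n x y) * (starRingEnd ℂ) (D y) := by
      intro y; rw [← sub_mul]
    simp_rw [this]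
    rw [integral_sub (SP_int (SP_mulu (kk_mem μ n x) hc) μ) (SP_int (SP_mulu (SP_conju (kk_mem μ n x)) hc) μ),
      kk_rep hμ n hc, h1 _ hc, sub_self]
  have := congr_fun h2 y
  simp only [hD, Pi.zero_apply, sub_eq_zero] at this
  exact this.symm

lemma tf_xy (x y : ℝ) : tf (-1) x * tf 1 y = ex (-(x - y)) := by
  unfold tf; rw [← ex_add]; congr 1; push_cast; ring

lemma kk_s1 (μ : Measure ℝ) (n : ℕ) (x y : ℝ) :
    kk μ (n+1) x y = ex (-(x - y)) * kk μ n x y + gg μ n x * (starRingEnd ℂ) (gg μ n y) := by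
  rw [kk_succ, tf_xy]

lemma kk_s2 {μ : Measure ℝ} (hμ : GM μ) (n : ℕ) (x y : ℝ) :
    kk μ (n+1) x y = ex (x - y) * kk μ n x y + (starRingEnd ℂ) (gg μ n x) * gg μ n y := by
  have h := congr_arg (starRingEnd ℂ) (kk_s1 μ n x y)
  rw [kk_real hμ, map_add, map_mul, kk_real hμ, conj_ex, neg_neg, map_mul, Complex.conj_conj] at h
  exact h

lemma norm_2sin (u : ℝ) : ‖ex u - ex (-u)‖ = 2 * |sin u| := by
  rw [ex_eq, ex_eq, cos_neg, sin_neg]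
  have : ((cos u : ℝ) : ℂ) + (sin u : ℝ) * Complex.I - ((cos u : ℝ) + ((-sin u : ℝ) : ℂ) * Complex.I) = ((2 * sin u : ℝ) : ℂ) * Complex.I := by
    push_cast; ring
  rw [this, norm_mul, Complex.norm_I, mul_one, Complex.norm_real, Real.norm_eq_abs, abs_mul]; simp

lemma kk_cd1 {μ : Measure ℝ} (hμ : GM μ) (n : ℕ) (x y : ℝ) :
    |sin (x - y)| * ‖kk μ n x y‖ ≤ ‖gg μ n x‖ * ‖gg μ n y‖ := by
  have h : (ex (x - y) - ex (-(x - y))) * kk μ n x y = gg μ n x * (starRingEnd ℂ) (gg μ n y) - (starRingEnd ℂ) (gg μ n x) * gg μ n y := by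
    linear_combination kk_s1 μ n x y - kk_s2 hμ n x y
  have h1 := congr_arg norm h
  rw [norm_mul, norm_2sin] at h1
  have h2 := norm_sub_le (gg μ n x * (starRingEnd ℂ) (gg μ n y)) ((starRingEnd ℂ) (gg μ n x) * gg μ n y)
  rw [← h1, norm_mul, norm_mul, RCLike.norm_conj, RCLike.norm_conj] at h2
  linarith

lemma kk_cd2 {μ : Measure ℝ} (hμ : GM μ) (n : ℕ) (x y : ℝ) :
    |sin (x - y)| * ‖kk μ (n+1) x y‖ ≤ ‖gg μ n x‖ * ‖gg μ n y‖ := by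
  have h : (ex (x - y) - ex (-(x - y))) * kk μ (n+1) x y = ex (x - y) * (gg μ n x * (starRingEnd ℂ) (gg μ n y)) - ex (-(x-y)) * ((starRingEnd ℂ) (gg μ n x) * gg μ n y) := by
    linear_combination ex (x - y) * kk_s1 μ n x y - ex (-(x - y)) * kk_s2 hμ n x y
  have h1 := congr_arg norm h
  rw [norm_mul, norm_2sin] at h1
  have h2 := norm_sub_le (ex (x - y) * (gg μ n x * (starRingEnd ℂ) (gg μ n y))) (ex (-(x - y)) * ((starRingEnd ℂ) (gg μ n x) * gg μ n y))
  rw [← h1, norm_mul, norm_mul, norm_mul, norm_mul, norm_ex, norm_ex, RCLike.norm_conj, RCLike.norm_conj] at h2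
  linarith

lemma kk_sum (μ : Measure ℝ) (n : ℕ) (x y : ℝ) : ‖kk μ n x y‖ ≤ ∑ j ∈ Finset.range n, ‖gg μ j x‖ * ‖gg μ j y‖ := by
  induction n with
  | zero => simp [kk]
  | succ n ih =>
    rw [kk_s1, Finset.sum_range_succ]
    refine (norm_add_le _ _).trans ?_
    rw [norm_mul, norm_ex, one_mul, norm_mul, RCLike.norm_conj]
    linarith

def KK (μ : Measure ℝ) (n : ℕ) (x y : ℝ) : ℂ := kk μ (n+1) x y + kk μ n x y

@[fun_prop] lemma KK_cont (μ : Measure ℝ) (n : ℕ) : Continuous (fun z : ℝ × ℝ => KK μ n z.1 z.2) := by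
  unfold KK; fun_prop

lemma KK_cd {μ : Measure ℝ} (hμ : GM μ) (n : ℕ) (x y : ℝ) :
    (1 - ex (x - y)) * KK μ n x y = (starRingEnd ℂ) (gg μ n x) * gg μ n y - ex (x - y) * (gg μ n x * (starRingEnd ℂ) (gg μ n y)) := by
  unfold KK
  have := ex_neg_mul (x - y)
  linear_combination (-ex (x-y)) * kk_s1 μ n x y + kk_s2 hμ n x y - kk μ n x y * this

lemma KK_real {μ : Measure ℝ} (hμ : GM μ) (n : ℕ) (x y : ℝ) : (starRingEnd ℂ) (KK μ n x y) = KK μ n x y := by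
  unfold KK; rw [map_add, kk_real hμ, kk_real hμ]

lemma KK_symm {μ : Measure ℝ} (hμ : GM μ) (n : ℕ) (x y : ℝ) : KK μ n y x = KK μ n x y := by
  unfold KK; rw [kk_herm, kk_real hμ, kk_herm μ n, kk_real hμ]

def STn (n : ℕ) : Set ℤ := {k | |k| ≤ (n : ℤ)}

lemma SG_STn (n : ℕ) : SG (n+1) ⊆ STn n := by
  rintro k ⟨j, hj, rfl⟩
  rw [STn, mem_ofPred_eq]
  rw [abs_le]; constructor <;> push_cast <;> omega

lemma SG_STp (n : ℕ) : SG n ⊆ STn n := by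
  rintro k ⟨j, hj, rfl⟩
  rw [STn, mem_ofPred_eq]
  rw [abs_le]; constructor <;> omega

lemma KK_mem (μ : Measure ℝ) (n : ℕ) (x : ℝ) : (fun y => KK μ n x y) ∈ SP (STn n) :=
  Submodule.add_mem _ (SP_mono (SG_STn n) (kk_mem μ (n+1) x)) (SP_mono (SG_STp n) (kk_mem μ n x))

lemma KK_rep {μ : Measure ℝ} (hμ : GM μ) (n : ℕ) {f : ℝ → ℂ} (hf : f ∈ SP (STn n)) (x : ℝ) :
    ∫ y, KK μ n x y * f y ∂μ = f x := by
  have := hμ.fin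
  have hodd : ∀ {S T : Set ℤ} {f g : ℝ → ℂ}, (∀ k ∈ S, ∀ l ∈ T, Odd (k + l)) → f ∈ SP S → g ∈ SP T → ∫ y, f y * g y ∂μ = 0 := by
    intro S T f g h hf hg
    have h1 := SP_mul (U := {k | Odd k}) h hf hg
    refine SP_ind (P := fun f => ∫ y, f y ∂μ = 0) (fun k hk => hμ.odd k hk) (by simp) ?_ ?_ h1
    · intro f g hf hg h1 h2
      simp only [Pi.add_apply]; rw [integral_add (SP_int hf μ) (SP_int hg μ), h1, h2, add_zero]
    · intro c f hf h1
      simp only [Pi.smul_apply]; rw [integral_smul, h1, smul_zero]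
  have hpar : ∀ k ∈ SG (n+1), ∀ l ∈ SG n, Odd (k + l) := by
    rintro k ⟨j, hj, rfl⟩ l ⟨i, hi, rfl⟩
    exact ⟨j + i - n, by push_cast; ring⟩
  refine SP_ind (P := fun f => ∫ y, KK μ n x y * f y ∂μ = f x) ?_ (by simp) ?_ ?_ hf
  · intro k hk
    have hsplit : k ∈ SG (n+1) ∨ k ∈ SG n := by
      have hk' := abs_le.1 (show |k| ≤ (n:ℤ) from hk)
      rcases Int.even_or_odd (k + n) with ⟨j, hj⟩ | ⟨j, hj⟩
      · left; exact ⟨j.toNat, by omega, by push_cast; omega⟩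
      · right; exact ⟨j.toNat, by omega, by omega⟩
    have e : ∀ y, KK μ n x y * tf k y = kk μ (n+1) x y * tf k y + kk μ n x y * tf k y := fun y => by
      unfold KK; ring
    simp_rw [e]
    have ik := tf_mem (mem_univ k)
    rw [integral_add (SP_int (SP_mulu (kk_mem μ (n+1) x) ik) μ) (SP_int (SP_mulu (kk_mem μ n x) ik) μ)]
    rcases hsplit with h | h
    · rw [kk_rep hμ _ (tf_mem h), hodd (fun a ha b hb => by rw [add_comm]; exact hpar b hb a ha) (kk_mem μ n x) (tf_mem h), add_zero]
    · rw [kk_rep hμ _ (tf_mem h), hodd hpar (kk_mem μ (n+1) x) (tf_mem h), zero_add]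
  · intro f g hf hg h1 h2
    simp only [Pi.add_apply, mul_add]
    rw [integral_add (SP_int (SP_mulu (KK_mem μ n x) hf) μ) (SP_int (SP_mulu (KK_mem μ n x) hg) μ), h1, h2]
  · intro c f hf h1
    simp only [Pi.smul_apply, smul_eq_mul, mul_left_comm _ c]
    rw [integral_const_mul, h1]

def mW (W : ℝ → ℝ) : Measure ℝ := cI.withDensity (fun x => ENNReal.ofReal (W x))

structure GW (W : ℝ → ℝ) : Prop where
  meas : Measurable W
  nonneg : ∀ x, 0 ≤ W x
  int : Integrable W cI
  even : ∀ x, W (-x) = W x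
  per : ∀ x, W (x + π) = W x
  pos : ∀ᵐ x ∂cI, 0 < W x

lemma cI_integral_neg {E : Type*} [NormedAddCommGroup E] [NormedSpace ℝ E] (f : ℝ → E) : ∫ x, f (-x) ∂cI = ∫ x, f x ∂cI := by
  unfold cI
  rw [← intervalIntegral.integral_of_le (by linarith [pi_pos]), ← intervalIntegral.integral_of_le (by linarith [pi_pos]),
    intervalIntegral.integral_comp_neg, neg_neg]

lemma cI_integral_shift {E : Type*} [NormedAddCommGroup E] [NormedSpace ℝ E] (f : ℝ → E) (hf : Function.Periodic f (2 * π)) (c : ℝ) :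
    ∫ x, f (x + c) ∂cI = ∫ x, f x ∂cI := by
  unfold cI
  rw [← intervalIntegral.integral_of_le (by linarith [pi_pos]), ← intervalIntegral.integral_of_le (by linarith [pi_pos]),
    intervalIntegral.integral_comp_add_right]
  have := hf.intervalIntegral_add_eq (-π + c) (-π)
  rw [show -π + c + 2 * π = π + c by ring, show -π + 2 * π = π by ring] at this
  exact this

lemma mW_integral {W : ℝ → ℝ} (hW : GW W) {E : Type*} [NormedAddCommGroup E] [NormedSpace ℝ E] (f : ℝ → E) :
    ∫ x, f x ∂(mW W) = ∫ x, W x • f x ∂cI := by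
  unfold mW
  rw [integral_withDensity_eq_integral_toReal_smul (by have := hW.meas; fun_prop) (by simp)]
  simp_rw [ENNReal.toReal_ofReal (hW.nonneg _)]

lemma mW_lintegral {W : ℝ → ℝ} (hW : GW W) {f : ℝ → ℝ≥0∞} (hf : Measurable f) :
    ∫⁻ x, f x ∂(mW W) = ∫⁻ x, ENNReal.ofReal (W x) * f x ∂cI := by
  unfold mW
  have := hW.meas
  rw [lintegral_withDensity_eq_lintegral_mul _ (by fun_prop) hf]; rfl

lemma GW.fin {W : ℝ → ℝ} (hW : GW W) : IsFiniteMeasure (mW W) := by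
  apply isFiniteMeasure_withDensity_ofReal
  exact hW.int.2

lemma GW.gm {W : ℝ → ℝ} (hW : GW W) : GM (mW W) where
  fin := hW.fin
  even := fun k => by
    rw [mW_integral hW, mW_integral hW, ← cI_integral_neg]
    simp_rw [hW.even, ← tf_neg, neg_neg]
  odd := fun k hk => by
    rw [mW_integral hW]
    have hp : ∀ x, tf k (x + π) = - tf k x := by
      intro x
      unfold tf
      obtain ⟨m, rfl⟩ := hk
      rw [mul_add, show (((2 * m + 1 : ℤ) : ℝ)) * π = π + m * (2 * π) by push_cast; ring, ← add_assoc]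
      rw [ex_periodic.int_mul m]
      rw [ex_add]; simp [ex]
    have h := cI_integral_shift (fun x => W x • tf k x) (fun x => by
      simp only
      rw [tf_per k x, show x + 2 * π = x + π + π by ring, hW.per, hW.per]) π
    simp_rw [hW.per, hp, smul_neg] at h
    rw [integral_neg] at h
    have : (2 : ℂ) * ∫ x, W x • tf k x ∂cI = 0 := by linear_combination -h
    simpa using this
  ac := by
    unfold mW
    have := hW.meas
    apply withDensity_absolutelyContinuous' (by fun_prop)
    filter_upwards [hW.pos] with x hx
    simpa using hx

lemma rho_nonneg (s t x : ℝ) : 0 ≤ rho s t x := by unfold rho; positivity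

lemma rho_pos {s t x : ℝ} (hx : sin x ≠ 0) (hx' : cos x ≠ 0) : 0 < rho s t x := by
  have := abs_pos.2 hx
  have := abs_pos.2 hx'
  unfold rho; positivity

lemma rho_GW {s t : ℝ} (hs : -1 < s) (ht : -1 < t) : GW (rho s t) where
  meas := rho_meas s t
  nonneg := rho_nonneg s t
  int := by
    set κ := max (-s) (1/2) with hκ
    set l := max (-t) (1/2) with hl
    obtain ⟨C, hC, H⟩ := lint_prod (κ := κ) (l := l) (lt_max_of_lt_right (by norm_num)) (max_lt (by linarith) (by norm_num))
      (lt_max_of_lt_right (by norm_num)) (max_lt (by linarith) (by norm_num))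
    refine ⟨(rho_meas s t).aestronglyMeasurable, ?_⟩
    have h1 := H 1 1 one_pos one_pos le_rfl le_rfl
    refine lt_of_le_of_lt ?_ (lt_of_le_of_lt h1 (by simp))
    apply lintegral_mono_ae
    filter_upwards [ae_sin_ne] with x hx
    have X0 := abs_pos.2 hx.1
    have Y0 := abs_pos.2 hx.2
    rw [max_eq_left (abs_sin_le_one x), max_eq_left (abs_cos_le_one x), ← ofReal_norm, Real.norm_of_nonneg (rho_nonneg _ _ _)]
    apply ENNReal.ofReal_le_ofReal
    rw [rho, mul_one, div_one]
    apply mul_le_mul _ _ (by positivity) (by positivity)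
    · exact rpow_le_rpow_of_exponent_ge X0 (abs_sin_le_one x) (by linarith [le_max_left (-s) (1/2)])
    · exact rpow_le_rpow_of_exponent_ge Y0 (abs_cos_le_one x) (by linarith [le_max_left (-t) (1/2)])
  even := fun x => by simp [rho]
  per := fun x => by simp [rho, sin_add_pi, cos_add_pi]
  pos := by filter_upwards [ae_sin_ne] with x hx using rho_pos hx.1 hx.2

lemma SG_iff {n : ℕ} {k : ℤ} : k ∈ SG n ↔ (-((n:ℤ)-1) ≤ k ∧ k ≤ n - 1 ∧ (k + n) % 2 = 1) := by
  constructor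
  · rintro ⟨j, hj, rfl⟩; omega
  · rintro ⟨h1, h2, h3⟩
    refine ⟨((k + (n - 1)) / 2).toNat, ?_, ?_⟩ <;> omega

lemma tf_deriv (k : ℤ) (x : ℝ) : HasDerivAt (tf k) (Complex.I * k * tf k x) x := by
  unfold tf ex
  have h : HasDerivAt (fun x : ℝ => (((k * x : ℝ)) : ℂ) * Complex.I) (k * Complex.I) x := by
    have := ((hasDerivAt_id x).const_mul (k:ℝ)).ofReal_comp.mul_const Complex.I
    simpa using this
  have := h.cexp
  convert this using 1
  ring

lemma SP_diff {S : Set ℤ} {f : ℝ → ℂ} (hf : f ∈ SP S) : Differentiable ℝ f := by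
  induction hf using Submodule.span_induction with
  | mem x h => obtain ⟨k, -, rfl⟩ := h; exact fun x => (tf_deriv k x).differentiableAt
  | zero => exact differentiable_const (0:ℂ)
  | add f g _ _ hf hg => exact hf.add hg
  | smul c f _ hf => exact hf.const_smul c

def DD (a b : ℝ) (f : ℝ → ℂ) (x : ℝ) : ℂ :=
  deriv f x + ((a * (cos x / sin x) : ℝ) : ℂ) * (f x - f (-x)) - ((b * (sin x / cos x) : ℝ) : ℂ) * (f x - f (π - x))

lemma DD_add (a b : ℝ) {f g : ℝ → ℂ} (hf : Differentiable ℝ f) (hg : Differentiable ℝ g) (x : ℝ) :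
    DD a b (f + g) x = DD a b f x + DD a b g x := by
  unfold DD; rw [deriv_add (hf x) (hg x)]; simp only [Pi.add_apply]; ring

lemma DD_smul (a b : ℝ) (c : ℂ) {f : ℝ → ℂ} (hf : Differentiable ℝ f) (x : ℝ) :
    DD a b (c • f) x = c * DD a b f x := by
  unfold DD; rw [deriv_const_smul c (hf x)]; simp only [Pi.smul_apply, smul_eq_mul]; ring

lemma tf_one (x : ℝ) : tf 1 x = cos x + sin x * Complex.I := by
  have := ex_eq x
  simpa [tf] using this

lemma tf_mone (x : ℝ) : tf (-1) x = cos x - sin x * Complex.I := by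
  have := ex_eq (-x)
  simp only [cos_neg, sin_neg] at this
  rw [show tf (-1) x = ex (-x) by simp [tf], this]; push_cast; ring

lemma tf_pi (k : ℤ) (x : ℝ) : tf k (π - x) = (-1 : ℂ) ^ k * tf (-k) x := by
  rw [show (-1:ℂ) ^ k = tf k π by
    unfold tf ex
    rw [show (((k * π : ℝ)) : ℂ) * Complex.I = k * ((π:ℂ) * Complex.I) by push_cast; ring, Complex.exp_int_mul, Complex.exp_pi_mul_I]]
  rw [← tf_neg]
  unfold tf
  rw [← ex_add]; congr 1; ring

lemma tf_key1 (k : ℤ) (s : ℂ) (x : ℝ) : tf (k+2+1) x + s * tf (-(k+2+1)) x = -(tf (k+1) x + s * tf (-(k+1)) x) + (tf (k+2) x + s * tf (-(k+2)) x) * (tf 1 x + tf (-1) x) := by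
  have h1 := tf_mul (k+2) 1 x
  have h2 := tf_mul (k+2) (-1) x
  have h3 := tf_mul (-(k+2)) 1 x
  have h4 := tf_mul (-(k+2)) (-1) x
  rw [show k + 2 + -1 = k + 1 by ring] at h2
  rw [show -(k + 2) + 1 = -(k + 1) by ring] at h3
  rw [show -(k + 2) + -1 = -(k + 2+1) by ring] at h4
  rw [← h1, ← h2, ← h3, ← h4]; ring

lemma tf_key2 (k : ℤ) (s : ℂ) (x : ℝ) : tf (k+2+1) x - s * tf (-(k+2+1)) x = (tf (k+1) x - s * tf (-(k+1)) x) + (tf (k+2) x + s * tf (-(k+2)) x) * (tf 1 x - tf (-1) x) := by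
  have h1 := tf_mul (k+2) 1 x
  have h2 := tf_mul (k+2) (-1) x
  have h3 := tf_mul (-(k+2)) 1 x
  have h4 := tf_mul (-(k+2)) (-1) x
  rw [show k + 2 + -1 = k + 1 by ring] at h2
  rw [show -(k + 2) + 1 = -(k + 1) by ring] at h3
  rw [show -(k + 2) + -1 = -(k + 2+1) by ring] at h4
  rw [← h1, ← h2, ← h3, ← h4]; ring

lemma cot_tf (k : ℕ) : ∃ q ∈ SP (SG k), ∀ x, sin x ≠ 0 →
    ((cos x / sin x : ℝ) : ℂ) * (tf (k+1) x - tf (-(k+1)) x) = Complex.I * (tf (k+1) x + tf (-(k+1)) x) + q x := by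
  induction k using Nat.twoStepInduction with
  | zero =>
    refine ⟨0, Submodule.zero_mem _, fun x hx => ?_⟩
    have hx' : (sin x : ℂ) ≠ 0 := by exact_mod_cast hx
    simp only [Nat.cast_zero, zero_add, tf_one, tf_mone, Pi.zero_apply]
    push_cast at hx' ⊢; field_simp; ring
  | one =>
    refine ⟨(2 * Complex.I) • tf 0, Submodule.smul_mem _ _ (tf_mem (by rw [SG_iff]; decide)), fun x hx => ?_⟩
    have hx' : (sin x : ℂ) ≠ 0 := by exact_mod_cast hx
    have e1 : tf (((1:ℕ):ℤ)+1) x = tf 1 x * tf 1 x := by rw [tf_mul]; rfl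
    have e2 : tf (-(((1:ℕ):ℤ)+1)) x = tf (-1) x * tf (-1) x := by rw [tf_mul]; rfl
    rw [e1, e2]
    simp only [tf_one, tf_mone, Pi.smul_apply, smul_eq_mul, tf_zero]
    have h1 : (sin x : ℂ)^2 + (cos x:ℂ)^2 = 1 := by exact_mod_cast sin_sq_add_cos_sq x
    push_cast at hx' h1 ⊢; field_simp
    linear_combination (2 * Complex.I * Complex.sin x * h1 - 4 * Complex.sin x ^3 * (Complex.I * Complex.I_sq) * 0 - 2 * Complex.I * Complex.sin x^3 * Complex.I_sq)
  | more k ih _ =>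
    obtain ⟨q, hq, h⟩ := ih
    refine ⟨q + (2 * Complex.I) • (tf (k+1) + tf (-(k+1))), Submodule.add_mem _ (SP_mono ?_ hq)
      (Submodule.smul_mem _ _ (Submodule.add_mem _ (tf_mem ?_) (tf_mem ?_))), fun x hx => ?_⟩
    · intro j hj; rw [SG_iff] at *; push_cast; omega
    · rw [SG_iff]; push_cast; omega
    · rw [SG_iff]; push_cast; omega
    have hx' : (sin x : ℂ) ≠ 0 := by exact_mod_cast hx
    have h := h x hx
    have key : tf (((k+2:ℕ):ℤ)+1) x - tf (-(((k+2:ℕ):ℤ)+1)) x = (tf (k+1) x - tf (-(k+1)) x) + (tf (k+2) x + tf (-(k+2)) x) * (tf 1 x - tf (-1) x) := by simpa using tf_key2 k 1 x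
    have key2 : tf (((k+2:ℕ):ℤ)+1) x + tf (-(((k+2:ℕ):ℤ)+1)) x = -(tf (k+1) x + tf (-(k+1)) x) + (tf (k+2) x + tf (-(k+2)) x) * (tf 1 x + tf (-1) x) := by simpa using tf_key1 k 1 x
    rw [key, mul_add, h, key2]
    have h1 : ((cos x / sin x : ℝ) : ℂ) * (tf 1 x - tf (-1) x) = Complex.I * (tf 1 x + tf (-1) x) := by
      simp only [tf_one, tf_mone]; push_cast at hx' ⊢; field_simp; ring
    simp only [Pi.add_apply, Pi.smul_apply, smul_eq_mul]
    linear_combination (tf (k+2) x + tf (-(k+2)) x) * h1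

lemma tan_tf (k : ℕ) : ∃ q ∈ SP (SG k), ∀ x, cos x ≠ 0 →
    ((sin x / cos x : ℝ) : ℂ) * (tf (k+1) x + (-1)^k * tf (-(k+1)) x) = -Complex.I * (tf (k+1) x - (-1)^k * tf (-(k+1)) x) + q x := by
  induction k using Nat.twoStepInduction with
  | zero =>
    refine ⟨0, Submodule.zero_mem _, fun x hx => ?_⟩
    have hx' : (cos x : ℂ) ≠ 0 := by exact_mod_cast hx
    simp only [Nat.cast_zero, zero_add, tf_one, tf_mone, Pi.zero_apply, pow_zero]
    push_cast at hx' ⊢; field_simp; ring_nf; simp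
  | one =>
    refine ⟨(2 * Complex.I) • tf 0, Submodule.smul_mem _ _ (tf_mem (by rw [SG_iff]; decide)), fun x hx => ?_⟩
    have hx' : (cos x : ℂ) ≠ 0 := by exact_mod_cast hx
    have e1 : tf (((1:ℕ):ℤ)+1) x = tf 1 x * tf 1 x := by rw [tf_mul]; rfl
    have e2 : tf (-(((1:ℕ):ℤ)+1)) x = tf (-1) x * tf (-1) x := by rw [tf_mul]; rfl
    rw [e1, e2]
    simp only [tf_one, tf_mone, Pi.smul_apply, smul_eq_mul, tf_zero]
    have h1 : (sin x : ℂ)^2 + (cos x:ℂ)^2 = 1 := by exact_mod_cast sin_sq_add_cos_sq x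
    push_cast at hx' h1 ⊢; field_simp
    linear_combination (2 * Complex.I * Complex.cos x * h1 + 2 * Complex.I * Complex.cos x * Complex.sin x ^2 * Complex.I_sq)
  | more k ih _ =>
    obtain ⟨q, hq, h⟩ := ih
    refine ⟨-q + (2 * Complex.I) • (tf (k+1) - (-1:ℂ)^k • tf (-(k+1))), Submodule.add_mem _ (Submodule.neg_mem _ (SP_mono ?_ hq))
      (Submodule.smul_mem _ _ (Submodule.sub_mem _ (tf_mem ?_) (Submodule.smul_mem _ _ (tf_mem ?_)))), fun x hx => ?_⟩
    · intro j hj; rw [SG_iff] at *; push_cast; omega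
    · rw [SG_iff]; push_cast; omega
    · rw [SG_iff]; push_cast; omega
    have hx' : (cos x : ℂ) ≠ 0 := by exact_mod_cast hx
    have h := h x hx
    have ek : (-1:ℂ)^(k+2) = (-1)^k := by ring
    rw [ek]
    have key : tf (((k+2:ℕ):ℤ)+1) x + (-1)^k * tf (-(((k+2:ℕ):ℤ)+1)) x = -(tf (k+1) x + (-1)^k * tf (-(k+1)) x) + (tf (k+2) x + (-1)^k * tf (-(k+2)) x) * (tf 1 x + tf (-1) x) := by exact_mod_cast tf_key1 k ((-1)^k) x
    have key2 : tf (((k+2:ℕ):ℤ)+1) x - (-1)^k * tf (-(((k+2:ℕ):ℤ)+1)) x = (tf (k+1) x - (-1)^k * tf (-(k+1)) x) + (tf (k+2) x + (-1)^k * tf (-(k+2)) x) * (tf 1 x - tf (-1) x) := by exact_mod_cast tf_key2 k ((-1)^k) x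
    rw [key, key2, mul_add, mul_neg, h]
    have h1 : ((sin x / cos x : ℝ) : ℂ) * (tf 1 x + tf (-1) x) = -Complex.I * (tf 1 x - tf (-1) x) := by
      simp only [tf_one, tf_mone]; push_cast at hx' ⊢; field_simp; ring_nf; simp
    simp only [Pi.add_apply, Pi.smul_apply, smul_eq_mul, Pi.neg_apply, Pi.sub_apply]
    linear_combination (tf (k+2) x + (-1)^k * tf (-(k+2)) x) * h1

lemma abs_rpow_deriv (c : ℝ) {s : ℝ} (hs : s ≠ 0) : HasDerivAt (fun s => |s| ^ c) (c * |s| ^ c / s) s := by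
  have h : HasDerivAt (fun s => Real.exp (Real.log s * c)) (Real.exp (Real.log s * c) * (s⁻¹ * c)) s :=
    ((Real.hasDerivAt_log hs).mul_const c).exp
  have e : ∀ t : ℝ, t ≠ 0 → |t| ^ c = Real.exp (Real.log t * c) := by
    intro t ht
    rw [Real.rpow_def_of_pos (abs_pos.2 ht), Real.log_abs]
  have := h.congr_of_eventuallyEq (f₁ := fun s => |s| ^ c) (by filter_upwards [eventually_ne_nhds hs] with t ht using e t ht)
  exact this.congr_deriv (by rw [e s hs]; field_simp)

lemma cont_abs_rpow_mul {c : ℝ} (hc : -1 < c) : Continuous (fun s : ℝ => |s| ^ c * s) := by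
  rw [continuous_iff_continuousAt]
  intro s
  by_cases hs : s = 0
  · subst hs
    unfold ContinuousAt
    simp only [mul_zero]
    rw [tendsto_zero_iff_norm_tendsto_zero]
    have e : (fun s : ℝ => ‖|s| ^ c * s‖) = fun s => |s| ^ (c + 1) := by
      funext s
      rw [norm_mul, Real.norm_eq_abs, Real.norm_eq_abs, abs_of_nonneg (Real.rpow_nonneg (abs_nonneg _) _)]
      by_cases hs : s = 0
      · subst hs; simp [Real.zero_rpow (by linarith : c + 1 ≠ 0)]
      · rw [Real.rpow_add_one (by positivity)]
    rw [e]
    have : Continuous (fun s : ℝ => |s| ^ (c+1)) := continuous_abs.rpow_const (fun _ => Or.inr (by linarith))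
    simpa [Real.zero_rpow (by linarith : c + 1 ≠ 0)] using this.tendsto 0
  · exact ((abs_rpow_deriv c hs).continuousAt).mul continuousAt_id

lemma zeros_countable : ({x : ℝ | ¬ (sin x ≠ 0 ∧ cos x ≠ 0)}).Countable := by
  have h1 : {x : ℝ | ¬ (sin x ≠ 0 ∧ cos x ≠ 0)} ⊆ range (fun n : ℤ => (n : ℝ) * (π / 2)) := by
    intro x hx
    rw [mem_ofPred_eq] at hx
    by_cases h : sin x = 0
    · obtain ⟨n, hn⟩ := Real.sin_eq_zero_iff.1 h
      exact ⟨2 * n, by push_cast; linarith⟩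
    · have : cos x = 0 := by tauto
      obtain ⟨n, hn⟩ := Real.cos_eq_zero_iff.1 this
      exact ⟨2 * n + 1, by rw [hn]; push_cast; ring⟩
  exact (countable_range _).mono h1

def ibpA (a b : ℝ) (m : ℤ) (x : ℝ) : ℝ :=
  2 * m * cos (2 * m * x) + (2 * a * (cos x / sin x) - 2 * b * (sin x / cos x)) * sin (2 * m * x)

lemma rho_ibp {a b : ℝ} (ha : -(1/2) < a) (hb : -(1/2) < b) (m : ℤ) :
    Integrable (fun x => rho (2*a) (2*b) x * ibpA a b m x) cI ∧
    ∫ x, rho (2*a) (2*b) x * ibpA a b m x ∂cI = 0 := by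
  set U : ℝ → ℝ := fun x => (Polynomial.Chebyshev.U ℝ (m-1)).eval (cos (2 * x)) with hU
  have hUc : Continuous U := by
    apply (Polynomial.continuous _).comp; fun_prop
  have hsin : ∀ x, sin (2 * m * x) = 2 * sin x * cos x * U x := by
    intro x
    have := Polynomial.Chebyshev.U_real_cos (2 * x) (m - 1)
    rw [hU]
    simp only
    rw [← sin_two_mul, mul_comm (sin (2*x)), this]; congr 1; push_cast; ring
  set B : ℝ → ℝ := fun x => 2 * m * cos (2 * m * x) + 4 * a * cos x ^ 2 * U x - 4 * b * sin x ^ 2 * U x with hB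
  have hBc : Continuous B := by fun_prop
  have hAB : ∀ x, sin x ≠ 0 → cos x ≠ 0 → ibpA a b m x = B x := by
    intro x h1 h2
    unfold ibpA
    rw [hsin]; simp only [hB]; field_simp; ring
  have hae : (fun x => rho (2*a) (2*b) x * ibpA a b m x) =ᵐ[cI] fun x => rho (2*a) (2*b) x * B x := by
    filter_upwards [ae_sin_ne] with x hx
    rw [hAB x hx.1 hx.2]
  have hG := rho_GW (s := 2*a) (t := 2*b) (by linarith) (by linarith)
  have hper : ∃ C, ∀ x, ‖B x‖ ≤ C := by
    obtain ⟨C, hC⟩ := isCompact_Icc.bddAbove_image (K := Icc (-1) 1) ((Polynomial.Chebyshev.U ℝ (m-1)).continuous.norm).continuousOn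
    refine ⟨|(2 * m : ℝ)| + |4 * a| * C + |4 * b| * C, fun x => ?_⟩
    have h1 : |U x| ≤ C := hC ⟨cos (2*x), ⟨neg_one_le_cos _, cos_le_one _⟩, rfl⟩
    simp only [hB]
    refine (norm_sub_le _ _).trans (add_le_add ((norm_add_le _ _).trans (add_le_add ?_ ?_)) ?_)
    · rw [norm_mul, Real.norm_eq_abs, Real.norm_eq_abs]
      exact mul_le_of_le_one_right (abs_nonneg _) (abs_cos_le_one _)
    · rw [norm_mul, norm_mul, Real.norm_eq_abs, Real.norm_eq_abs, Real.norm_eq_abs]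
      refine mul_le_mul (mul_le_of_le_one_right (abs_nonneg _) ?_) h1 (abs_nonneg _) (abs_nonneg _)
      rw [abs_of_nonneg (sq_nonneg _)]; exact cos_sq_le_one x
    · rw [norm_mul, norm_mul, Real.norm_eq_abs, Real.norm_eq_abs, Real.norm_eq_abs]
      refine mul_le_mul (mul_le_of_le_one_right (abs_nonneg _) ?_) h1 (abs_nonneg _) (abs_nonneg _)
      rw [abs_of_nonneg (sq_nonneg _)]; exact sin_sq_le_one x
  have hIntg : Integrable (fun x => rho (2*a) (2*b) x * B x) cI := by
    obtain ⟨C, hC⟩ := hper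
    exact hG.int.mul_bdd (c := C) hBc.aestronglyMeasurable (ae_of_all _ hC)
  refine ⟨hIntg.congr hae.symm, ?_⟩
  rw [integral_congr_ae hae]
  have := integral_eq_of_hasDerivAt_off_countable_of_le
    (fun x => (|sin x| ^ (2*a) * sin x) * ((|cos x| ^ (2*b) * cos x)) * (2 * U x))
    (fun x => rho (2*a) (2*b) x * B x) (a := -π) (b := π) (by linarith [pi_pos]) zeros_countable ?_ ?_ ?_
  · unfold cI
    rw [← intervalIntegral.integral_of_le (by linarith [pi_pos]), this]; simp
  · have h1 := (cont_abs_rpow_mul (c := 2*a) (by linarith)).comp continuous_sin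
    have h2 := (cont_abs_rpow_mul (c := 2*b) (by linarith)).comp continuous_cos
    exact ((h1.mul h2).mul (continuous_const.mul hUc)).continuousOn
  · intro x hx
    have hx : sin x ≠ 0 ∧ cos x ≠ 0 := by
      have := hx.2; rw [mem_ofPred_eq] at this; tauto
    have e : (fun x => (|sin x| ^ (2*a) * sin x) * ((|cos x| ^ (2*b) * cos x)) * (2 * U x))
        = fun x => |sin x| ^ (2*a) * |cos x| ^ (2*b) * sin (2 * m * x) := by
      funext y; rw [hsin]; ring
    rw [e]
    have d1 := (abs_rpow_deriv (2*a) hx.1).comp x (hasDerivAt_sin x)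
    have d2 := (abs_rpow_deriv (2*b) hx.2).comp x (hasDerivAt_cos x)
    have d3 : HasDerivAt (fun x : ℝ => sin (2 * m * x)) (cos (2 * m * x) * (2 * m)) x := by
      have := ((hasDerivAt_id x).const_mul (2 * m : ℝ)).sin
      simpa using this
    have := (d1.mul d2).mul d3
    refine this.congr_deriv ?_
    rw [← hAB x hx.1 hx.2]
    unfold ibpA rho
    have h1 := hx.1
    have h2 := hx.2
    simp only [Function.comp, Pi.mul_apply]
    field_simp; ring
  · rw [intervalIntegrable_iff_integrableOn_Ioc_of_le (by linarith [pi_pos])]; exact hIntg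

lemma tf_cs (k : ℤ) (x : ℝ) : tf k x = cos (k * x) + sin (k * x) * Complex.I := ex_eq _

lemma DD_tf (a b : ℝ) (k : ℤ) (x : ℝ) : DD a b (tf k) x = Complex.I * k * tf k x
    + ((a * (cos x / sin x) : ℝ) : ℂ) * (tf k x - tf (-k) x)
    - ((b * (sin x / cos x) : ℝ) : ℂ) * (tf k x - (-1)^k * tf (-k) x) := by
  unfold DD; rw [(tf_deriv k x).deriv, tf_neg, tf_pi]

lemma neg_one_zpow_conj (k : ℤ) : (starRingEnd ℂ) ((-1:ℂ)^k) = (-1)^k := by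
  rw [map_zpow₀]; simp

lemma neg_one_zpow_neg (k : ℤ) : ((-1:ℂ)^(-k)) = (-1)^k := by
  rw [zpow_neg, ← inv_zpow]; norm_num

lemma DD_tf_neg (a b : ℝ) (k : ℤ) (x : ℝ) : DD a b (tf (-k)) x = (starRingEnd ℂ) (DD a b (tf k) x) := by
  rw [DD_tf, DD_tf]
  simp only [map_sub, map_add, map_mul, tf_conj, Complex.conj_ofReal, neg_neg, neg_one_zpow_conj, neg_one_zpow_neg, Complex.conj_I]
  rw [show (starRingEnd ℂ) (k:ℂ) = k from by simp]; push_cast; ring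

lemma dd_tf (a b : ℝ) (k : ℕ) : ∃ q ∈ SP (SG k), ∀ x, sin x ≠ 0 → cos x ≠ 0 →
    DD a b (tf (k+1)) x = Complex.I * (k+1+a+b) * tf (k+1) x + Complex.I * (a - b * (-1)^k) * tf (-(k+1)) x + q x := by
  obtain ⟨q1, hq1, h1⟩ := cot_tf k
  obtain ⟨q2, hq2, h2⟩ := tan_tf k
  refine ⟨(a:ℂ) • q1 - (b:ℂ) • q2, Submodule.sub_mem _ (Submodule.smul_mem _ _ hq1) (Submodule.smul_mem _ _ hq2), fun x hs hc => ?_⟩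
  have h1 := h1 x hs
  have h2 := h2 x hc
  rw [DD_tf]
  have e : (-1:ℂ)^((k:ℤ)+1) = - (-1)^k := by rw [zpow_add_one₀ (by norm_num)]; simp
  rw [e]
  simp only [Pi.sub_apply, Pi.smul_apply, smul_eq_mul]
  push_cast at h1 h2 ⊢
  linear_combination (a:ℂ) * h1 - (b:ℂ) * h2

lemma dd_mem (a b : ℝ) (n : ℕ) {k : ℤ} (hk : k ∈ SG n) : ∃ q ∈ SP (SG n), ∀ x, sin x ≠ 0 → cos x ≠ 0 →
    DD a b (tf k) x = q x := by
  rw [SG_iff] at hk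
  have pos : ∀ m : ℕ, ((m:ℤ)+1) ∈ SG n → ∃ q ∈ SP (SG n), ∀ x, sin x ≠ 0 → cos x ≠ 0 → DD a b (tf (m+1)) x = q x := by
    intro m hm
    obtain ⟨q, hq, h⟩ := dd_tf a b m
    refine ⟨(Complex.I * (m+1+a+b)) • tf (m+1) + (Complex.I * (a - b * (-1)^m)) • tf (-(m+1)) + q, ?_, ?_⟩
    · refine Submodule.add_mem _ (Submodule.add_mem _ (Submodule.smul_mem _ _ (tf_mem hm)) (Submodule.smul_mem _ _ (tf_mem (SG_neg hm)))) (SP_mono ?_ hq)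
      intro j hj
      rw [SG_iff] at *; omega
    · intro x hs hc
      rw [h x hs hc]; rfl
  rcases lt_trichotomy k 0 with h | h | h
  · obtain ⟨m, hm⟩ : ∃ m : ℕ, k = -((m:ℤ)+1) := ⟨(-k-1).toNat, by omega⟩
    obtain ⟨q, hq, hh⟩ := pos m (by rw [SG_iff]; omega)
    refine ⟨fun x => (starRingEnd ℂ) (q x), SP_conj_mem hq, fun x hs hc => ?_⟩
    rw [hm, DD_tf_neg, hh x hs hc]
  · subst h
    exact ⟨0, Submodule.zero_mem _, fun x hs hc => by rw [DD_tf]; simp⟩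
  · obtain ⟨m, hm⟩ : ∃ m : ℕ, k = ((m:ℤ)+1) := ⟨(k-1).toNat, by omega⟩
    rw [hm]
    exact pos m (by rw [SG_iff]; omega)

lemma skew {a b : ℝ} (ha : -(1/2) < a) (hb : -(1/2) < b) {k l : ℤ} (hkl : (k - l) % 2 = 0)
    {qk ql : ℝ → ℂ} (hqk : qk ∈ SP univ) (hql : ql ∈ SP univ)
    (hk : ∀ x, sin x ≠ 0 → cos x ≠ 0 → DD a b (tf k) x = qk x)
    (hl : ∀ x, sin x ≠ 0 → cos x ≠ 0 → DD a b (tf l) x = ql x) :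
    ∫ x, qk x * (starRingEnd ℂ) (tf l x) ∂(mW (rho (2*a) (2*b))) = - ∫ x, tf k x * (starRingEnd ℂ) (ql x) ∂(mW (rho (2*a) (2*b))) := by
  have hG := rho_GW (s := 2*a) (t := 2*b) (by linarith) (by linarith)
  have := hG.fin
  have i1 : (fun x => qk x * (starRingEnd ℂ) (tf l x)) ∈ SP univ := SP_mulu hqk (SP_conju (tf_mem (mem_univ l)))
  have i2 : (fun x => tf k x * (starRingEnd ℂ) (ql x)) ∈ SP univ := SP_mulu (tf_mem (mem_univ k)) (SP_conju hql)
  rw [eq_neg_iff_add_eq_zero, ← integral_add (SP_int i1 _) (SP_int i2 _), mW_integral hG]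
  set T : ℝ → ℂ := fun x => qk x * (starRingEnd ℂ) (tf l x) + tf k x * (starRingEnd ℂ) (ql x) with hT
  have hTS : T ∈ SP univ := Submodule.add_mem _ i1 i2
  obtain ⟨m, hm⟩ : ∃ m, k - l = 2 * m := ⟨(k-l)/2, by omega⟩
  have hTi : Integrable (fun x => rho (2*a) (2*b) x • T x) cI := by
    obtain ⟨C, hC⟩ := SP_bdd hTS
    have h := hG.int.ofReal (𝕜 := ℂ) |>.mul_bdd (c := C) (SP_cont hTS).aestronglyMeasurable (ae_of_all _ hC)
    refine h.congr (ae_of_all _ fun x => ?_)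
    simp [Complex.real_smul]
  obtain ⟨hAi, hA⟩ := rho_ibp ha hb m
  set O : ℝ → ℂ := fun x => T x - Complex.I * (ibpA a b m x : ℂ) with hO
  have eT : ∀ x, rho (2*a) (2*b) x • T x = rho (2*a) (2*b) x • O x + Complex.I * ((rho (2*a) (2*b) x * ibpA a b m x : ℝ) : ℂ) := by
    intro x; simp only [hO, Complex.real_smul]; push_cast; ring
  have hAi' : Integrable (fun x => Complex.I * ((rho (2*a) (2*b) x * ibpA a b m x : ℝ) : ℂ)) cI := hAi.ofReal.const_mul _
  have hOi : Integrable (fun x => rho (2*a) (2*b) x • O x) cI := by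
    have := hTi.sub hAi'
    refine this.congr (ae_of_all _ fun x => ?_)
    simp only [Pi.sub_apply, eT]; ring
  have hTx : ∀ x, sin x ≠ 0 → cos x ≠ 0 → O x = ((-(2 * m) * sin (2 * m * x) + 2 * a * (cos x / sin x) * (cos (2 * m * x) - cos ((k + l) * x)) - 2 * b * (sin x / cos x) * (cos (2 * m * x) ) : ℝ) : ℂ) + ((2 * b * (sin x / cos x) * cos ((k + l) * x) : ℝ) : ℂ) * (-1)^k := by
    intro x hs hc
    have ekl : (-1:ℂ)^l = (-1)^k := by
      rw [show k = l + 2 * m by omega, zpow_add₀ (by norm_num), zpow_mul]; simp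
    simp only [hO, hT]
    rw [← hk x hs hc, ← hl x hs hc, DD_tf, DD_tf, ekl]
    simp only [map_sub, map_add, map_mul, tf_conj, Complex.conj_ofReal, neg_neg, neg_one_zpow_conj, Complex.conj_I]
    rw [show (starRingEnd ℂ) (l:ℂ) = l from by simp]
    have p1 := tf_mul k (-l) x
    have p2 := tf_mul (-k) (-l) x
    have p3 := tf_mul k l x
    rw [show k + -l = 2 * m by omega] at p1
    have e1 : tf (2*m) x = cos (2 * m * x) + sin (2 * m * x) * Complex.I := by rw [tf_cs]; push_cast; ring_nf
    have e2 : tf (-k + -l) x = cos ((k + l) * x) - sin ((k + l) * x) * Complex.I := by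
      rw [tf_cs]; push_cast
      rw [show ((-k + -l : ℂ)) * x = -((k+l)*x) by ring, Complex.cos_neg, Complex.sin_neg]; ring
    have e3 : tf (k + l) x = cos ((k + l) * x) + sin ((k + l) * x) * Complex.I := by rw [tf_cs]; push_cast; ring_nf
    rw [e1] at p1; rw [e2] at p2; rw [e3] at p3
    have hmc : (k:ℂ) - l = 2 * m := by exact_mod_cast hm
    unfold ibpA
    push_cast at p1 p2 p3 ⊢
    linear_combination (Complex.I * (k - l) + 2 * a * (Complex.cos x / Complex.sin x) - 2 * b * (Complex.sin x / Complex.cos x)) * p1 + (b * (Complex.sin x / Complex.cos x) * (-1)^k - a * (Complex.cos x / Complex.sin x)) * (p2 + p3) + Complex.I * (Complex.cos (2 * m * x) + Complex.sin (2 * m * x) * Complex.I) * hmc + 2 * m * Complex.sin (2 * m * x) * Complex.I_sq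
  have hodd : ∀ x, sin x ≠ 0 → cos x ≠ 0 → O (-x) = - O x := by
    intro x hs hc
    rw [hTx x hs hc, hTx (-x) (by simpa using hs) (by simpa using hc)]
    simp only [sin_neg, cos_neg, mul_neg]; push_cast; ring
  have hO0 : ∫ x, rho (2*a) (2*b) x • O x ∂cI = 0 := by
    have h1 : ∫ x, rho (2*a) (2*b) x • O x ∂cI = - ∫ x, rho (2*a) (2*b) x • O x ∂cI := by
      conv_lhs => rw [← cI_integral_neg]
      rw [← integral_neg]
      apply integral_congr_ae
      filter_upwards [ae_sin_ne] with x hx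
      rw [hodd x hx.1 hx.2, hG.even]; simp
    exact self_eq_neg.1 h1
  refine (integral_congr_ae (ae_of_all _ eT)).trans ?_
  rw [integral_add hOi hAi', hO0, integral_const_mul, integral_complex_ofReal, hA]; simp

lemma dd_SP {a b : ℝ} (ha : -(1/2) < a) (hb : -(1/2) < b) (n : ℕ) {f : ℝ → ℂ} (hf : f ∈ SP (SG n)) :
    ∃ q ∈ SP (SG n), (∀ x, sin x ≠ 0 → cos x ≠ 0 → DD a b f x = q x) ∧
      ∀ l : ℤ, (l + n) % 2 = 1 → ∀ ql ∈ SP univ, (∀ x, sin x ≠ 0 → cos x ≠ 0 → DD a b (tf l) x = ql x) →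
      ∫ x, q x * (starRingEnd ℂ) (tf l x) ∂(mW (rho (2*a) (2*b))) = - ∫ x, f x * (starRingEnd ℂ) (ql x) ∂(mW (rho (2*a) (2*b))) := by
  have hG := rho_GW (s := 2*a) (t := 2*b) (by linarith) (by linarith)
  have := hG.fin
  have hd : Differentiable ℝ f := SP_diff hf
  induction hf using Submodule.span_induction with
  | mem f h =>
    obtain ⟨k, hk, rfl⟩ := h
    obtain ⟨q, hq, h⟩ := dd_mem a b n hk
    rw [SG_iff] at hk
    exact ⟨q, hq, h, fun l hl ql hql hql' => skew ha hb (by omega) (SP_univ hq) hql h hql'⟩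
  | zero =>
    refine ⟨0, Submodule.zero_mem _, fun x _ _ => by simp [DD], fun l hl ql hql hql' => by simp⟩
  | add f g hf hg ihf ihg =>
    obtain ⟨q1, hq1, h1, h1'⟩ := ihf (SP_diff hf)
    obtain ⟨q2, hq2, h2, h2'⟩ := ihg (SP_diff hg)
    refine ⟨q1 + q2, Submodule.add_mem _ hq1 hq2, fun x hs hc => ?_, fun l hl ql hql hql' => ?_⟩
    · rw [DD_add a b (SP_diff hf) (SP_diff hg), h1 x hs hc, h2 x hs hc]; rfl
    · simp only [Pi.add_apply, add_mul]
      rw [integral_add (SP_int (SP_mulu hq1 (SP_conju (tf_mem (mem_univ l)))) _) (SP_int (SP_mulu hq2 (SP_conju (tf_mem (mem_univ l)))) _),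
        integral_add (SP_int (SP_mulu hf (SP_conju hql)) _) (SP_int (SP_mulu hg (SP_conju hql)) _), h1' l hl ql hql hql', h2' l hl ql hql hql']
      ring
  | smul c f hf ihf =>
    obtain ⟨q1, hq1, h1, h1'⟩ := ihf (SP_diff hf)
    refine ⟨c • q1, Submodule.smul_mem _ _ hq1, fun x hs hc => ?_, fun l hl ql hql hql' => ?_⟩
    · rw [DD_smul a b c (SP_diff hf), h1 x hs hc]; rfl
    · simp only [Pi.smul_apply, smul_eq_mul, mul_assoc]
      rw [integral_const_mul, integral_const_mul, h1' l hl ql hql hql']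
      ring

/-- first order system satisfied by the pure weight orthogonal functions -/
lemma gg_ode {a b : ℝ} (ha : -(1/2) < a) (hb : -(1/2) < b) (N : ℕ) (x : ℝ) (hs : sin x ≠ 0) (hc : cos x ≠ 0) :
    DD a b (gg (mW (rho (2*a) (2*b))) (N+1)) x = Complex.I * ((N+1+a+b) * gg (mW (rho (2*a) (2*b))) (N+1) x
      - (a - b * (-1)^N) * (starRingEnd ℂ) (gg (mW (rho (2*a) (2*b))) (N+1) x)) := by
  have hG := rho_GW (s := 2*a) (t := 2*b) (by linarith) (by linarith)
  have hgm := hG.gm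
  have := hG.fin
  set μ := mW (rho (2*a) (2*b)) with hμ
  set f := gg μ (N+1) with hfdef
  have hf : f ∈ SP (SG (N+2)) := gg_mem μ (N+1)
  have hfc := SP_conj_mem hf
  obtain ⟨q, hq, hDD, hsk⟩ := dd_SP ha hb (N+2) hf
  rw [← hμ] at hsk
  set R : ℝ → ℂ := q - Complex.I • (((N+1+a+b : ℂ)) • f - ((a:ℂ) - b * (-1)^N) • (fun x => (starRingEnd ℂ) (f x))) with hR
  have hRm : R ∈ SP (SG (N+2)) := Submodule.sub_mem _ hq (Submodule.smul_mem _ _ (Submodule.sub_mem _ (Submodule.smul_mem _ _ hf) (Submodule.smul_mem _ _ hfc)))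
  have SLm : ∀ l : ℤ, l ∈ SL (N+1) ↔ (-((N:ℤ)+1) ≤ l ∧ l < N+1 ∧ (l + N) % 2 = 1) := by
    intro l
    constructor
    · rintro ⟨j, hj, rfl⟩; push_cast; omega
    · rintro ⟨h1, h2, h3⟩
      refine ⟨((l + (N+1)) / 2).toNat, ?_, ?_⟩ <;> push_cast <;> omega
  have o1 : ∀ h ∈ SP (SL (N+1)), ∫ x, f x * (starRingEnd ℂ) (h x) ∂μ = 0 := fun h hh => gg_orth hgm hh
  have o2 : ∀ h ∈ SP (SL (N+1)), ∫ x, (starRingEnd ℂ) (f x) * h x ∂μ = 0 := fun h hh => gg_orth' hgm hh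
  have o2' : ∀ l : ℤ, -l ∈ SL (N+1) → ∫ x, (starRingEnd ℂ) (f x) * (starRingEnd ℂ) (tf l x) ∂μ = 0 := by
    intro l hl; simp_rw [tf_conj]; exact o2 _ (tf_mem hl)
  set γ := ∫ x, f x * (starRingEnd ℂ) (tf (N+1) x) ∂μ with hγ
  have hγ' : ∫ x, (starRingEnd ℂ) (f x) * (starRingEnd ℂ) (tf (-(N+1)) x) ∂μ = γ := by
    rw [hγ, mW_integral hG, mW_integral hG, ← cI_integral_neg]
    congr 1; funext x
    rw [hG.even, hfdef, gg_neg, tf_neg]; simp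
  have splitR : ∀ l : ℤ, ∫ x, R x * (starRingEnd ℂ) (tf l x) ∂μ = ∫ x, q x * (starRingEnd ℂ) (tf l x) ∂μ
      - (Complex.I * (N+1+a+b) * ∫ x, f x * (starRingEnd ℂ) (tf l x) ∂μ) + Complex.I * ((a:ℂ) - b * (-1)^N) * ∫ x, (starRingEnd ℂ) (f x) * (starRingEnd ℂ) (tf l x) ∂μ := by
    intro l
    have hl := SP_conju (tf_mem (mem_univ l))
    rw [← integral_const_mul, ← integral_const_mul]
    have j1 := SP_int (SP_mulu hq hl) μ
    have j2 := (SP_int (SP_mulu hf hl) μ).const_mul (Complex.I * (N+1+a+b))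
    have j3 := (SP_int (SP_mulu hfc hl) μ).const_mul (Complex.I * ((a:ℂ) - b * (-1)^N))
    rw [← integral_sub j1 j2, ← integral_add (by exact j1.sub j2) j3]
    congr 1; funext x; simp only [hR, Pi.sub_apply, Pi.smul_apply, smul_eq_mul]; ring
  obtain ⟨qn, hqn, hqn'⟩ := dd_tf a b N
  have hqnL : qn ∈ SP (SL (N+1)) := SP_mono (by intro l hl; rw [SG_iff] at hl; rw [SLm]; omega) hqn
  have hqnL' : (fun x => (starRingEnd ℂ) (qn x)) ∈ SP (SL (N+1)) := SP_mono (by intro l hl; rw [SG_iff] at hl; rw [SLm]; omega) (SP_conj_mem hqn)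
  have hR0 : ∀ l ∈ SG (N+2), ∫ x, R x * (starRingEnd ℂ) (tf l x) ∂μ = 0 := by
    intro l hl
    rw [SG_iff] at hl
    push_cast at hl
    rw [splitR]
    by_cases h1 : l = N+1
    · subst h1
      rw [hsk _ (by push_cast; omega) ((Complex.I * (N+1+a+b)) • tf (N+1) + (Complex.I * (a - b * (-1)^N)) • tf (-(N+1)) + qn)
        (Submodule.add_mem _ (Submodule.add_mem _ (Submodule.smul_mem _ _ (tf_mem (mem_univ _))) (Submodule.smul_mem _ _ (tf_mem (mem_univ _)))) (SP_univ hqn))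
        (fun x hs hc => by rw [hqn' x hs hc]; rfl), o2' _ (by rw [SLm]; omega), ← hγ]
      have : ∫ x, f x * (starRingEnd ℂ) (((Complex.I * (N+1+a+b)) • tf (N+1) + (Complex.I * (a - b * (-1)^N)) • tf (-(N+1)) + qn) x) ∂μ
          = -(Complex.I * (N+1+a+b)) * γ := by
        have j1 := (SP_int (SP_mulu hf (SP_conju (tf_mem (mem_univ ((N:ℤ)+1))))) μ).const_mul (-(Complex.I * (N+1+a+b)))
        have j2 := SP_int (SP_mulu hf (SP_conju (Submodule.add_mem _ (Submodule.smul_mem _ (Complex.I * (a - b * (-1)^N)) (tf_mem (show (-((N:ℤ)+1)) ∈ SL (N+1) by rw [SLm]; omega))) hqnL))) μ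
        rw [hγ, ← integral_const_mul, ← sub_eq_zero, ← sub_eq_zero]
        have o := o1 _ (Submodule.add_mem _ (Submodule.smul_mem _ (Complex.I * (a - b * (-1)^N)) (tf_mem (show (-((N:ℤ)+1)) ∈ SL (N+1) by rw [SLm]; omega))) hqnL)
        rw [sub_zero, sub_eq_zero, ← add_zero (∫ x, -(Complex.I * (N+1+a+b)) * _ ∂μ), ← o, ← integral_add j1 j2]
        congr 1; funext x
        simp only [Pi.add_apply, Pi.smul_apply, smul_eq_mul, map_add, map_mul, Complex.conj_I, Complex.conj_ofReal, map_natCast, map_one]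
        ring
      rw [this]; ring
    by_cases h2 : l = -(N+1)
    · subst h2
      rw [hsk _ (by push_cast; omega) (-(Complex.I * (N+1+a+b)) • tf (-(N+1)) + (-(Complex.I * (a - b * (-1)^N))) • tf ((N+1)) + fun x => (starRingEnd ℂ) (qn x))
        (Submodule.add_mem _ (Submodule.add_mem _ (Submodule.smul_mem _ _ (tf_mem (mem_univ _))) (Submodule.smul_mem _ _ (tf_mem (mem_univ _)))) (SP_conju hqn))
        (fun x hs hc => by
          rw [DD_tf_neg, hqn' x hs hc]
          simp only [Pi.add_apply, Pi.smul_apply, smul_eq_mul, map_add, map_mul, map_sub, map_neg, map_pow, Complex.conj_I, Complex.conj_ofReal, map_natCast, map_one, tf_conj, neg_neg]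
          ring), hγ', o1 _ (tf_mem (by rw [SLm]; omega))]
      have : ∫ x, f x * (starRingEnd ℂ) ((-(Complex.I * (N+1+a+b)) • tf (-(N+1)) + (-(Complex.I * (a - b * (-1)^N))) • tf ((N+1)) + fun x => (starRingEnd ℂ) (qn x)) x) ∂μ
          = (Complex.I * (a - b * (-1)^N)) * γ := by
        have j1 := (SP_int (SP_mulu hf (SP_conju (tf_mem (mem_univ ((N:ℤ)+1))))) μ).const_mul ((Complex.I * (a - b * (-1)^N)))
        have m2 := (Submodule.add_mem _ (Submodule.smul_mem _ (-(Complex.I * (N+1+a+b))) (tf_mem (show (-((N:ℤ)+1)) ∈ SL (N+1) by rw [SLm]; omega))) hqnL')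
        have j2 := SP_int (SP_mulu hf (SP_conju m2)) μ
        have o := o1 _ m2
        rw [hγ, ← integral_const_mul, ← add_zero (∫ x, (Complex.I * (a - b * (-1)^N)) * _ ∂μ), ← o, ← integral_add j1 j2]
        congr 1; funext x
        simp only [Pi.add_apply, Pi.smul_apply, smul_eq_mul, map_add, map_mul, map_sub, map_neg, map_pow, Complex.conj_I, Complex.conj_ofReal, map_natCast, map_one]
        ring
      rw [this]; ring
    · have hlN : l ∈ SG N := by rw [SG_iff]; omega
      obtain ⟨ql, hql, hql'⟩ := dd_mem a b N hlN
      rw [hsk l (by push_cast; omega) ql (SP_univ hql) hql', o1 ql (SP_mono (by intro l hl; rw [SG_iff] at hl; rw [SLm]; omega) hql),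
        o1 _ (tf_mem (by rw [SLm]; omega)), o2' _ (by rw [SLm]; omega)]
      simp
  have hRz : R = 0 := by
    apply hgm.zero hRm
    have : ∀ h ∈ SP (SG (N+2)), ∫ x, R x * (starRingEnd ℂ) (h x) ∂μ = 0 := by
      intro h hh
      induction hh using Submodule.span_induction with
      | mem h hh => obtain ⟨k, hk, rfl⟩ := hh; exact hR0 k hk
      | zero => simp
      | add f g hf hg ihf ihg =>
        simp only [Pi.add_apply, map_add, mul_add]
        rw [integral_add (SP_int (SP_mulu hRm (SP_conju hf)) _) (SP_int (SP_mulu hRm (SP_conju hg)) _), ihf, ihg, add_zero]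
      | smul c f hf ihf =>
        simp only [Pi.smul_apply, smul_eq_mul, map_mul]
        simp_rw [mul_left_comm]
        rw [integral_const_mul, ihf, mul_zero]
    exact this R hRm
  have hx := congrFun hRz x
  simp only [hR, Pi.sub_apply, Pi.smul_apply, smul_eq_mul, Pi.zero_apply] at hx
  rw [hDD x hs hc]
  linear_combination hx

lemma rpow_comp {s t κ c : ℝ} (hs : 0 < s) (hst : s ≤ t) (htk : t ≤ κ * s) : s ^ c ≤ κ ^ |c| * t ^ c := by
  have ht : 0 < t := lt_of_lt_of_le hs hst
  have hk : 1 ≤ κ := by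
    by_contra h
    push Not at h
    nlinarith
  rcases le_total 0 c with h | h
  · rw [abs_of_nonneg h]
    calc s ^ c ≤ t ^ c := Real.rpow_le_rpow hs.le hst h
      _ ≤ κ ^ c * t ^ c := le_mul_of_one_le_left (by positivity) (Real.one_le_rpow hk h)
  · rw [abs_of_nonpos h, Real.rpow_neg (by linarith), ← div_eq_inv_mul, le_div_iff₀ (by positivity), mul_comm, ← Real.mul_rpow (by linarith) hs.le]
    exact Real.rpow_le_rpow_of_nonpos ht htk h

lemma gron {G H G' H' : ℝ → ℝ} {x y : ℝ} (hxy : x ≤ y) (hG : ∀ z ∈ Icc x y, HasDerivAt G (G' z) z)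
    (hH : ∀ z ∈ Icc x y, HasDerivAt H (H' z) z) (h : ∀ z ∈ Icc x y, |G' z| ≤ H' z * G z) :
    G x ≤ G y * exp (H y - H x) ∧ G y ≤ G x * exp (H y - H x) := by
  have d1 : ∀ z ∈ Icc x y, HasDerivAt (fun z => G z * exp (H z)) (G' z * exp (H z) + G z * (exp (H z) * H' z)) z :=
    fun z hz => (hG z hz).mul (hH z hz).exp
  have d2 : ∀ z ∈ Icc x y, HasDerivAt (fun z => G z * exp (- H z)) (G' z * exp (- H z) + G z * (exp (- H z) * (-H' z))) z :=
    fun z hz => (hG z hz).mul (hH z hz).neg.exp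
  have m1 : MonotoneOn (fun z => G z * exp (H z)) (Icc x y) := by
    apply monotoneOn_of_deriv_nonneg (convex_Icc _ _) (fun z hz => (d1 z hz).continuousAt.continuousWithinAt)
    · intro z hz; exact (d1 z (interior_subset hz)).differentiableAt.differentiableWithinAt
    · intro z hz
      have hz := interior_subset hz
      rw [(d1 z hz).deriv]
      have := (abs_le.1 (h z hz)).1
      nlinarith [exp_pos (H z)]
  have m2 : AntitoneOn (fun z => G z * exp (- H z)) (Icc x y) := by
    apply antitoneOn_of_deriv_nonpos (convex_Icc _ _) (fun z hz => (d2 z hz).continuousAt.continuousWithinAt)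
    · intro z hz; exact (d2 z (interior_subset hz)).differentiableAt.differentiableWithinAt
    · intro z hz
      have hz := interior_subset hz
      rw [(d2 z hz).deriv]
      have := (abs_le.1 (h z hz)).2
      nlinarith [exp_pos (- H z)]
  have a1 := m1 ⟨le_refl _, hxy⟩ ⟨hxy, le_refl _⟩ hxy
  have a2 := m2 ⟨le_refl _, hxy⟩ ⟨hxy, le_refl _⟩ hxy
  simp only at a1 a2
  have e1 : exp (H y - H x) * exp (H x) = exp (H y) := by rw [← exp_add]; ring_nf
  have e2 : exp (H y - H x) * exp (- H y) = exp (- H x) := by rw [← exp_add]; ring_nf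
  constructor
  · rw [← mul_le_mul_iff_of_pos_right (exp_pos (H x)), mul_assoc, e1]; exact a1
  · rw [← mul_le_mul_iff_of_pos_right (exp_pos (- H y)), mul_assoc, e2]; exact a2

structure OSys (a B L n μ ν : ℝ) (r τ X Y : ℝ → ℝ) : Prop where
  hμ1 : n / 2 ≤ μ
  hμ2 : μ ≤ 2 * n
  hν1 : n / 2 ≤ ν
  hν2 : ν ≤ 2 * n
  hr : ∀ x ∈ Ioo 0 L, |r x| ≤ B
  ht : ∀ x ∈ Ioo 0 L, |τ x| ≤ B
  cX : ContinuousOn X (Icc 0 L)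
  cY : ContinuousOn Y (Icc 0 L)
  dX : ∀ x ∈ Ioo 0 L, HasDerivAt X (-(r x) * X x - μ * Y x) x
  dY : ∀ x ∈ Ioo 0 L, HasDerivAt Y (-(2 * a / x + τ x) * Y x + ν * X x) x
  zY : ∃ K, ∀ x ∈ Icc 0 L, |Y x| ≤ K * x

def FF (a μ ν : ℝ) (X Y : ℝ → ℝ) (x : ℝ) : ℝ := x ^ (2 * a) * (ν * X x ^ 2 + μ * Y x ^ 2)

lemma rpow2_deriv (a : ℝ) {x : ℝ} (hx : 0 < x) : HasDerivAt (fun x : ℝ => x ^ (2 * a)) (2 * a / x * x ^ (2*a)) x := by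
  have := Real.hasDerivAt_rpow_const (x := x) (p := 2 * a) (Or.inl hx.ne')
  refine this.congr_deriv ?_
  rw [Real.rpow_sub_one hx.ne']; field_simp

lemma FF_deriv {a B L n μ ν : ℝ} {r τ X Y : ℝ → ℝ} (h : OSys a B L n μ ν r τ X Y) {x : ℝ} (hx : x ∈ Ioo 0 L) :
    HasDerivAt (FF a μ ν X Y) (x ^ (2*a) * (2 * ν * (a / x - r x) * X x ^ 2 - 2 * μ * (a / x + τ x) * Y x ^ 2)) x := by
  have := (rpow2_deriv a hx.1).mul ((((h.dX x hx).pow 2).const_mul ν).add (((h.dY x hx).pow 2).const_mul μ))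
  refine this.congr_deriv ?_
  simp only [Pi.add_apply, Pi.pow_apply]
  have := hx.1.ne'
  field_simp; ring

def GF (a μ ν : ℝ) (X Y : ℝ → ℝ) (x : ℝ) : ℝ := FF a μ ν X Y x - 2 * a / x * (x ^ (2 * a) * (X x * Y x))

lemma GF_deriv {a B L n μ ν : ℝ} {r τ X Y : ℝ → ℝ} (h : OSys a B L n μ ν r τ X Y) {x : ℝ} (hx : x ∈ Ioo 0 L) :
    HasDerivAt (GF a μ ν X Y) (x ^ (2*a) * (- 2 * r x * ν * X x ^ 2 - 2 * μ * τ x * Y x ^ 2 + 2 * a / x ^ 2 * (X x * Y x) + 2 * a / x * (r x + τ x) * (X x * Y x))) x := by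
  have h0 := hx.1.ne'
  have d0 : HasDerivAt (fun x : ℝ => 2 * a / x) (-(2 * a) / x ^ 2) x := by
    have := (hasDerivAt_inv h0).const_mul (2 * a)
    refine (this.congr_deriv ?_)
    field_simp
  have := (FF_deriv h hx).sub (d0.mul ((rpow2_deriv a hx.1).mul ((h.dX x hx).mul (h.dY x hx))))
  refine this.congr_deriv ?_
  simp only [Pi.mul_apply]
  field_simp; ring

lemma xy_le {n μ ν X Y : ℝ} (hn : 0 < n) (h1 : n / 2 ≤ μ) (h2 : n / 2 ≤ ν) : n * |X * Y| ≤ ν * X ^ 2 + μ * Y ^ 2 := by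
  rw [abs_mul]
  nlinarith [sq_nonneg (|X| - |Y|), sq_abs X, sq_abs Y, sq_nonneg X, sq_nonneg Y]

/-- Step 1 -/
lemma far_bd {a B L : ℝ} (hB : 0 ≤ B) (hL : 0 < L) : ∃ C : ℝ, 0 < C ∧ ∀ {n μ ν : ℝ} {r τ X Y : ℝ → ℝ}, 1 ≤ n →
    OSys a B L n μ ν r τ X Y → ∀ x y : ℝ, (4 * |a| + 1) / n ≤ x → (4 * |a| + 1) / n ≤ y → x < L → y < L →
    FF a μ ν X Y x ≤ C * FF a μ ν X Y y := by
  set c0 := 6 * B + 4 * |a| with hc0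
  have hc0' : 0 ≤ c0 := by positivity
  refine ⟨3 * exp (c0 * (L + 1)), by positivity, ?_⟩
  intro n μ ν r τ X Y hn h x y hx hy hxL hyL
  have hn0 : 0 < n := by linarith
  have hA : 0 < (4 * |a| + 1) / n := by positivity
  -- comparison
  have key : ∀ z, (4 * |a| + 1) / n ≤ z → z < L → |2 * a / z * (z ^ (2*a) * (X z * Y z))| ≤ FF a μ ν X Y z / 2 ∧ 0 ≤ FF a μ ν X Y z := by
    intro z hz hzL
    have hz0 : 0 < z := by linarith
    rw [div_le_iff₀ hn0] at hz
    have h1 := xy_le (X := X z) (Y := Y z) hn0 h.hμ1 h.hν1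
    have hw : 0 < z ^ (2 * a) := by positivity
    have h3 : |2 * a / z * (z ^ (2*a) * (X z * Y z))| = z ^ (2*a) * (2 * |a| / z * |X z * Y z|) := by
      rw [abs_mul, abs_mul, abs_div, abs_mul, abs_of_pos hw, abs_of_pos hz0]; norm_num; ring
    have h4 : 2 * |a| / z * |X z * Y z| ≤ (ν * X z ^ 2 + μ * Y z ^ 2) / 2 := by
      rw [div_mul_eq_mul_div, div_le_iff₀ hz0]
      nlinarith [abs_nonneg (X z * Y z), abs_nonneg a]
    constructor
    · rw [h3]; unfold FF; nlinarith
    · unfold FF; have := h.hμ1; have := h.hν1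
      have : 0 ≤ ν * X z ^ 2 + μ * Y z ^ 2 := by nlinarith [abs_nonneg (X z * Y z)]
      positivity
  have kG : ∀ z, (4 * |a| + 1) / n ≤ z → z < L → FF a μ ν X Y z ≤ 2 * GF a μ ν X Y z ∧ GF a μ ν X Y z ≤ 3/2 * FF a μ ν X Y z := by
    intro z hz hzL
    have := abs_le.1 (key z hz hzL).1
    unfold GF; constructor <;> linarith [this.1, this.2]
  have hderiv : ∀ z, (4 * |a| + 1) / n ≤ z → z < L → |z ^ (2*a) * (- 2 * r z * ν * X z ^ 2 - 2 * μ * τ z * Y z ^ 2 + 2 * a / z ^ 2 * (X z * Y z) + 2 * a / z * (r z + τ z) * (X z * Y z))| ≤ (c0 * (1 + 1 / (n * z^2))) * GF a μ ν X Y z := by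
    intro z hz hzL
    have hz0 : 0 < z := by linarith
    have hzI : z ∈ Ioo 0 L := ⟨hz0, hzL⟩
    have hw : 0 < z ^ (2 * a) := by positivity
    have hr := h.hr z hzI
    have ht := h.ht z hzI
    have hF := (kG z hz hzL).1
    have hμ0 : 0 ≤ μ := by linarith [h.hμ1]
    have hν0 : 0 ≤ ν := by linarith [h.hν1]
    have h1 := xy_le (X := X z) (Y := Y z) hn0 h.hμ1 h.hν1
    rw [div_le_iff₀ hn0] at hz
    set E := ν * X z ^ 2 + μ * Y z ^ 2 with hE
    have hE0 : 0 ≤ E := by positivity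
    have t1 : |- 2 * r z * ν * X z ^ 2 - 2 * μ * τ z * Y z ^ 2| ≤ 2 * B * E := by
      have e1 : |- 2 * r z * ν * X z ^ 2| ≤ 2 * B * (ν * X z ^ 2) := by
        have hp : 0 ≤ ν * X z ^ 2 := by positivity
        rw [show - 2 * r z * ν * X z ^ 2 = (-2 * (ν * X z ^ 2)) * r z by ring, abs_mul, abs_of_nonpos (by linarith)]
        nlinarith [show 0 ≤ ν * X z ^ 2 by positivity]
      have e2 : |2 * μ * τ z * Y z ^ 2| ≤ 2 * B * (μ * Y z ^ 2) := by
        rw [show 2 * μ * τ z * Y z ^ 2 = (2 * (μ * Y z ^ 2)) * τ z by ring, abs_mul, abs_of_nonneg (by positivity)]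
        nlinarith [show 0 ≤ μ * Y z ^ 2 by positivity]
      exact (abs_sub _ _).trans (by linarith)
    have hxy : |X z * Y z| ≤ E / n := by rw [le_div_iff₀ hn0]; linarith
    have t2 : |2 * a / z ^ 2 * (X z * Y z)| ≤ 2 * |a| / (n * z^2) * E := by
      rw [abs_mul, abs_div, abs_mul, abs_of_pos (show (0:ℝ) < z^2 by positivity), abs_two]
      calc 2 * |a| / z^2 * |X z * Y z| ≤ 2 * |a| / z^2 * (E / n) := by gcongr
        _ = _ := by field_simp
    have t3 : |2 * a / z * (r z + τ z) * (X z * Y z)| ≤ B * E := by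
      rw [abs_mul, abs_mul, abs_div, abs_mul, abs_of_pos hz0, abs_two]
      calc 2 * |a| / z * |r z + τ z| * |X z * Y z| ≤ 2 * |a| / z * (2 * B) * (E / n) := by
            gcongr
            exact (abs_add_le _ _).trans (by linarith)
        _ = (4 * |a|) / (z * n) * (B * E) := by field_simp; ring
        _ ≤ 1 * (B * E) := by
            gcongr
            rw [div_le_one (by positivity)]; linarith
        _ = B * E := one_mul _
    rw [abs_mul, abs_of_pos hw]
    have hFE : FF a μ ν X Y z = z ^ (2*a) * E := rfl
    have tot : |- 2 * r z * ν * X z ^ 2 - 2 * μ * τ z * Y z ^ 2 + 2 * a / z ^ 2 * (X z * Y z) + 2 * a / z * (r z + τ z) * (X z * Y z)| ≤ (3 * B + 2 * |a| / (n * z^2)) * E :=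
      (abs_add_le _ _).trans ((add_le_add ((abs_add_le _ _).trans (add_le_add t1 t2)) t3).trans (by linarith))
    calc _ ≤ z ^ (2*a) * ((3 * B + 2 * |a| / (n * z^2)) * E) := by gcongr
      _ = (3 * B + 2 * |a| / (n * z^2)) * FF a μ ν X Y z := by rw [hFE]; ring
      _ ≤ (3 * B + 2 * |a| / (n * z^2)) * (2 * GF a μ ν X Y z) := by gcongr
      _ = (6 * B + 4 * |a| * (1 / (n * z ^ 2))) * GF a μ ν X Y z := by ring
      _ ≤ _ := by
        have hG0 : 0 ≤ GF a μ ν X Y z := by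
          have : 0 ≤ FF a μ ν X Y z := by rw [hFE]; positivity
          linarith
        apply mul_le_mul_of_nonneg_right _ hG0
        have : 0 ≤ 1 / (n * z^2) := by positivity
        rw [hc0]; nlinarith [abs_nonneg a]
  have hH : ∀ z, 0 < z → HasDerivAt (fun z => c0 * (z - 1 / (n * z))) (c0 * (1 + 1 / (n * z^2))) z := by
    intro z hz
    have := ((hasDerivAt_id z).sub ((hasDerivAt_inv hz.ne').const_mul (1/n))).const_mul c0
    have e : (fun z => c0 * (z - 1 / (n * z))) = fun y => c0 * ((id : ℝ → ℝ) - fun y => 1 / n * y⁻¹) y := by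
      funext y; simp only [Pi.sub_apply, id]; field_simp
    rw [e]
    refine this.congr_deriv ?_
    field_simp; ring
  have hHd : ∀ z w, (4 * |a| + 1) / n ≤ z → w < L → c0 * (w - 1 / (n * w)) - c0 * (z - 1 / (n * z)) ≤ c0 * (L + 1) ∨ w ≤ 0 := by
    intro z w hz hw
    by_cases hw0 : w ≤ 0
    · right; exact hw0
    left
    push Not at hw0
    rw [← mul_sub]
    apply mul_le_mul_of_nonneg_left _ hc0'
    have hz0 : 0 < z := by linarith
    have : 1 / (n * z) ≤ 1 := by
      rw [div_le_iff₀ hn0] at hz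
      rw [div_le_one (by positivity)]; nlinarith [abs_nonneg a]
    have : 0 ≤ 1 / (n * w) := by positivity
    linarith
  have fin : GF a μ ν X Y x ≤ GF a μ ν X Y y * exp (c0 * (L + 1)) := by
    have hG0 : 0 ≤ GF a μ ν X Y y := by linarith [(kG y hy hyL).1, (key y hy hyL).2]
    rcases le_total x y with hxy | hxy
    · have := (gron hxy (fun z hz => GF_deriv h ⟨by linarith [hz.1], by linarith [hz.2]⟩) (fun z hz => hH z (by linarith [hz.1]))
        (fun z hz => hderiv z (by linarith [hz.1]) (by linarith [hz.2]))).1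
      refine this.trans (mul_le_mul_of_nonneg_left (exp_le_exp.2 ?_) hG0)
      exact (hHd x y hx hyL).resolve_right (by linarith)
    · have := (gron hxy (fun z hz => GF_deriv h ⟨by linarith [hz.1], by linarith [hz.2]⟩) (fun z hz => hH z (by linarith [hz.1]))
        (fun z hz => hderiv z (by linarith [hz.1]) (by linarith [hz.2]))).2
      refine this.trans (mul_le_mul_of_nonneg_left (exp_le_exp.2 ?_) hG0)
      exact (hHd y x hy hxL).resolve_right (by linarith)
  calc FF a μ ν X Y x ≤ 2 * GF a μ ν X Y x := (kG x hx hxL).1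
    _ ≤ 2 * (GF a μ ν X Y y * exp (c0 * (L + 1))) := by gcongr
    _ ≤ 2 * ((3/2 * FF a μ ν X Y y) * exp (c0 * (L + 1))) := by gcongr; exact (kG y hy hyL).2
    _ = _ := by ring

lemma near_bd {a B L n μ ν : ℝ} {r τ X Y : ℝ → ℝ} (ha : -(1/2) < a) (hB : 0 ≤ B) (hn : 1 ≤ n)
    (h : OSys a B L n μ ν r τ X Y) {ε : ℝ} (hε : 0 < ε) (h1 : ε * (B + 1) ≤ 1 / 32) (h2 : ε * (B + 1) ≤ (2 * a + 1) / 32)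
    (hL : ε / n < L) : ∀ x ∈ Icc 0 (ε / n), X x ^ 2 + Y x ^ 2 ≤ 8 * X (ε / n) ^ 2 := by
  have hn0 : 0 < n := by linarith
  set δ := ε / n with hδ
  have hδ0 : 0 < δ := by positivity
  set d := 2 * a + 1 with hd
  have hd0 : 0 < d := by rw [hd]; linarith
  have hsub : Icc 0 δ ⊆ Icc 0 L := Icc_subset_Icc le_rfl hL.le
  have cX := h.cX.mono hsub
  have cY := h.cY.mono hsub
  have hI : ∀ x ∈ Ioo 0 δ, x ∈ Ioo 0 L := fun x hx => ⟨hx.1, hx.2.trans hL⟩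
  obtain ⟨x0, hx0, hm⟩ := isCompact_Icc.exists_isMaxOn ⟨0, ⟨le_rfl, hδ0.le⟩⟩ cX.abs
  obtain ⟨y0, hy0, hN⟩ := isCompact_Icc.exists_isMaxOn ⟨0, ⟨le_rfl, hδ0.le⟩⟩ cY.abs
  have hm : ∀ x ∈ Icc 0 δ, |X x| ≤ |X x0| := fun x hx => hm hx
  have hN : ∀ x ∈ Icc 0 δ, |Y x| ≤ |Y y0| := fun x hx => hN hx
  set m := |X x0| with hm0
  set N := |Y y0| with hN0
  have hm0' : 0 ≤ m := abs_nonneg _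
  have hN0' : 0 ≤ N := abs_nonneg _
  have hμ0 : 0 ≤ μ := by linarith [h.hμ1]
  have hν0 : 0 ≤ ν := by linarith [h.hν1]
  set Q := B * N + ν * m with hQ
  have hQ0 : 0 ≤ Q := by positivity
  -- the Y bound
  have cP : ContinuousOn (fun x : ℝ => x ^ (2*a) * Y x) (Icc 0 δ) := by
    intro x hx
    rcases eq_or_lt_of_le hx.1 with h0 | h0
    · subst h0
      obtain ⟨K, hK⟩ := h.zY
      have hY0 : Y 0 = 0 := by
        have := hK 0 ⟨le_rfl, by linarith⟩
        simpa using this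
      unfold ContinuousWithinAt
      simp only [hY0, mul_zero]
      have l1 : Tendsto (fun x : ℝ => K * x ^ d) (nhdsWithin 0 (Icc 0 δ)) (nhds 0) := by
        have : Continuous (fun x : ℝ => K * x ^ d) := continuous_const.mul (Real.continuous_rpow_const hd0.le)
        have := (this.tendsto 0).mono_left (nhdsWithin_le_nhds (s := Icc 0 δ))
        simpa [Real.zero_rpow hd0.ne'] using this
      apply squeeze_zero_norm' _ l1
      filter_upwards [self_mem_nhdsWithin] with x hx
      rcases eq_or_lt_of_le hx.1 with h0 | h0
      · subst h0; simp [hY0, Real.zero_rpow hd0.ne']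
      · rw [norm_mul, Real.norm_eq_abs, Real.norm_eq_abs, abs_of_pos (by positivity)]
        calc x ^ (2*a) * |Y x| ≤ x ^ (2*a) * (K * x) := by
              gcongr; exact hK x (hsub hx)
          _ = K * x ^ d := by rw [hd, Real.rpow_add_one h0.ne']; ring
    · exact ((Real.continuousAt_rpow_const x (2*a) (Or.inl h0.ne')).continuousWithinAt).mul (cY x hx)
  have dP : ∀ x ∈ Ioo 0 δ, HasDerivAt (fun x : ℝ => x ^ (2*a) * Y x) (x ^ (2*a) * (- τ x * Y x + ν * X x)) x := by
    intro x hx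
    refine ((rpow2_deriv a hx.1).mul (h.dY x (hI x hx))).congr_deriv ?_
    have := hx.1.ne'
    field_simp; ring
  have bP : ∀ x ∈ Ioo 0 δ, |x ^ (2*a) * (- τ x * Y x + ν * X x)| ≤ x ^ (2*a) * Q := by
    intro x hx
    have hx0 : 0 < x := hx.1
    rw [abs_mul, abs_of_pos (show 0 < x ^ (2*a) by positivity)]
    gcongr
    refine (abs_add_le _ _).trans ?_
    rw [abs_mul, abs_mul, abs_neg, abs_of_nonneg hν0]
    have := h.ht x (hI x hx)
    have := hN x ⟨hx.1.le, hx.2.le⟩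
    have := hm x ⟨hx.1.le, hx.2.le⟩
    rw [hQ]; gcongr
  have cQ : Continuous (fun x : ℝ => Q / d * x ^ d) := continuous_const.mul (Real.continuous_rpow_const hd0.le)
  have dQ : ∀ x ∈ Ioo 0 δ, HasDerivAt (fun x : ℝ => Q / d * x ^ d) (x ^ (2*a) * Q) x := by
    intro x hx
    have := (Real.hasDerivAt_rpow_const (x := x) (p := d) (Or.inl hx.1.ne')).const_mul (Q / d)
    refine this.congr_deriv ?_
    rw [show d - 1 = 2 * a by rw [hd]; ring]
    field_simp
  have mono : ∀ s : ℝ, (s = 1 ∨ s = -1) → MonotoneOn (fun x : ℝ => Q / d * x ^ d + s * (x ^ (2*a) * Y x)) (Icc 0 δ) := by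
    intro s hs
    apply monotoneOn_of_deriv_nonneg (convex_Icc _ _) (cQ.continuousOn.add (cP.const_mul s))
    · rw [interior_Icc]; intro x hx
      exact ((dQ x hx).add ((dP x hx).const_mul s)).differentiableAt.differentiableWithinAt
    · rw [interior_Icc]; intro x hx
      rw [HasDerivAt.deriv ((dQ x hx).add ((dP x hx).const_mul s))]
      have := abs_le.1 (bP x hx)
      rcases hs with rfl | rfl <;> linarith [this.1, this.2]
  have hY0 : Y 0 = 0 := by
    obtain ⟨K, hK⟩ := h.zY
    have := hK 0 ⟨le_rfl, by linarith⟩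
    simpa using this
  have hYb : ∀ x ∈ Icc 0 δ, |Y x| ≤ δ * Q / d := by
    intro x hx
    rcases eq_or_lt_of_le hx.1 with h0 | h0
    · subst h0; rw [hY0, abs_zero]; positivity
    · have m1 := mono 1 (Or.inl rfl) ⟨le_rfl, hδ0.le⟩ hx hx.1
      have m2 := mono (-1) (Or.inr rfl) ⟨le_rfl, hδ0.le⟩ hx hx.1
      simp only [hY0, Real.zero_rpow hd0.ne', mul_zero, add_zero] at m1 m2
      have hw : 0 < x ^ (2*a) := by positivity
      have e : x ^ d = x ^ (2*a) * x := by rw [hd, Real.rpow_add_one h0.ne']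
      rw [e] at m1 m2
      have m1' : 0 ≤ x ^ (2*a) * (Q / d * x + Y x) := by linarith
      have m2' : 0 ≤ x ^ (2*a) * (Q / d * x - Y x) := by linarith
      have m1'' := nonneg_of_mul_nonneg_right m1' hw
      have m2'' := nonneg_of_mul_nonneg_right m2' hw
      have : |Y x| ≤ Q / d * x := abs_le.2 ⟨by linarith, by linarith⟩
      refine this.trans ?_
      rw [mul_comm δ, mul_div_right_comm]
      gcongr; exact hx.2
  have hnδ : n * δ = ε := by rw [hδ]; field_simp
  have hδε : δ ≤ ε := by rw [hδ]; exact div_le_self hε.le hn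
  have hN8 : N ≤ m / 8 := by
    have h3 := hYb y0 hy0
    rw [le_div_iff₀ hd0] at h3
    have h4 : δ * Q ≤ ε * (B + 1) * N + 2 * (ε * (B + 1)) * m := by
      rw [hQ, mul_add]
      have i1 : δ * (B * N) ≤ ε * (B + 1) * N := by
        calc δ * (B * N) ≤ ε * ((B+1) * N) := by gcongr; linarith
          _ = _ := by ring
      have i2 : δ * (ν * m) ≤ 2 * (ε * (B + 1)) * m := by
        calc δ * (ν * m) ≤ δ * ((2 * n) * m) := by gcongr; exact h.hν2
          _ = 2 * (n * δ) * m := by ring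
          _ = 2 * (ε * 1) * m := by rw [hnδ, mul_one]
          _ ≤ _ := by gcongr; linarith
      linarith
    have h5 : N * d ≤ d / 32 * N + 2 * (d / 32) * m := by
      refine (h3.trans h4).trans ?_
      gcongr
    have h6 : N * d ≤ (N / 32 + m / 16) * d := by linarith
    have := le_of_mul_le_mul_right h6 hd0
    linarith
  have hX : ∀ x ∈ Icc 0 δ, |X x - X δ| ≤ m / 2 := by
    intro x hx
    have dX' : ∀ z ∈ interior (Icc 0 δ), deriv X z = -(r z) * X z - μ * Y z := by
      intro z hz; rw [interior_Icc] at hz; exact (h.dX z (hI z hz)).deriv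
    have hb : ∀ z ∈ interior (Icc 0 δ), |deriv X z| ≤ B * m + μ * N := by
      intro z hz
      rw [dX' z hz]
      rw [interior_Icc] at hz
      refine (abs_sub _ _).trans ?_
      rw [abs_mul, abs_mul, abs_neg, abs_of_nonneg hμ0]
      have := h.hr z (hI z hz)
      have := hN z ⟨hz.1.le, hz.2.le⟩
      have := hm z ⟨hz.1.le, hz.2.le⟩
      gcongr
    have hdiff : DifferentiableOn ℝ X (interior (Icc 0 δ)) := by
      intro z hz; rw [interior_Icc] at hz; exact (h.dX z (hI z hz)).differentiableAt.differentiableWithinAt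
    have u1 := Convex.image_sub_le_mul_sub_of_deriv_le (convex_Icc 0 δ) cX hdiff (fun z hz => (abs_le.1 (hb z hz)).2) x hx δ ⟨hδ0.le, le_rfl⟩ hx.2
    have u2 := Convex.mul_sub_le_image_sub_of_le_deriv (convex_Icc 0 δ) cX hdiff (fun z hz => (abs_le.1 (hb z hz)).1) x hx δ ⟨hδ0.le, le_rfl⟩ hx.2
    have hC0 : 0 ≤ B * m + μ * N := by positivity
    have h4 : (B * m + μ * N) * (δ - x) ≤ m / 2 := by
      calc (B * m + μ * N) * (δ - x) ≤ (B * m + (2 * n) * (m/8)) * δ := by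
            gcongr
            · exact sub_nonneg.2 hx.2
            · exact h.hμ2
            · linarith [hx.1]
        _ = δ * (B * m) + (n * δ) * (m / 4) := by ring
        _ ≤ ε * ((B + 1) * m) + ε * (m / 4) := by rw [hnδ]; gcongr; linarith
        _ = (ε * (B + 1)) * m + ε * 1 * (m/4) := by ring
        _ ≤ (1/32) * m + ε * (B + 1) * (m/4) := by gcongr; linarith
        _ ≤ (1/32) * m + (1/32) * (m/4) := by gcongr
        _ ≤ m / 2 := by linarith
    rw [abs_le]; constructor <;> linarith
  have hmX : m ≤ 2 * |X δ| := by
    have := hX x0 hx0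
    have h2 := abs_add_le (X x0 - X δ) (X δ)
    rw [sub_add_cancel] at h2
    linarith
  intro x hx
  have b1 := (hm x hx).trans hmX
  have b2 : |Y x| ≤ 2 * |X δ| / 8 := (hN x hx).trans (hN8.trans (by linarith))
  rw [← sq_abs (X x), ← sq_abs (Y x), ← sq_abs (X δ)]
  nlinarith [abs_nonneg (X x), abs_nonneg (Y x), abs_nonneg (X δ)]

set_option maxHeartbeats 1000000 in
lemma ode_bound {a B L l : ℝ} (ha : -(1/2) < a) (hB : 0 ≤ B) (hl : 0 < l) (hlL : l < L) :
    ∃ C n0 : ℝ, 0 < C ∧ 1 ≤ n0 ∧ ∀ {n μ ν : ℝ} {r τ X Y : ℝ → ℝ}, n0 ≤ n →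
    OSys a B L n μ ν r τ X Y → ∀ M y : ℝ, 0 ≤ M → y ∈ Ioo l L → X y ^ 2 + Y y ^ 2 ≤ M →
    ∀ x ∈ Ico 0 L, X x ^ 2 + Y x ^ 2 ≤ C * M * (x + 1 / n) ^ (-(2*a)) := by
  have hL : 0 < L := hl.trans hlL
  obtain ⟨C1, hC1, far⟩ := far_bd (a := a) hB hL
  set A := 4 * |a| + 1 with hA
  have hA0 : 0 < A := by positivity
  have hA1 : 1 ≤ A := by rw [hA]; linarith [abs_nonneg a]
  obtain ⟨ε, hε, e1, e2, e3⟩ : ∃ ε : ℝ, 0 < ε ∧ ε * (B + 1) ≤ 1 / 32 ∧ ε * (B + 1) ≤ (2 * a + 1) / 32 ∧ ε ≤ 1 := by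
    have hd0 : 0 < 2 * a + 1 := by linarith
    refine ⟨min (1/32) ((2*a+1)/32) / (B + 1), by positivity, ?_, ?_, ?_⟩
    · rw [div_mul_cancel₀ _ (by positivity)]; exact min_le_left _ _
    · rw [div_mul_cancel₀ _ (by positivity)]; exact min_le_right _ _
    · rw [div_le_one (by positivity)]; linarith [min_le_left (1/32:ℝ) ((2*a+1)/32)]
  set D := l ^ (2*a) + L ^ (2*a) with hD
  have hD0 : 0 < D := by positivity
  set E := exp (2 * |a| * (log A - log ε) + 2 * B * L) with hE
  have hlog : log ε ≤ log A := Real.log_le_log hε (by linarith)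
  have hE1 : 1 ≤ E := Real.one_le_exp (by
    have : 0 ≤ log A - log ε := by linarith
    positivity)
  set κ := 1 + 1 / ε with hκ
  have hκ0 : 0 < κ := by positivity
  set C2 := 4 * C1 * D * E with hC2
  have hC20 : 0 < C2 := by positivity
  refine ⟨8 * C2 * κ ^ |-(2*a)|, max 1 (A / l), by positivity, le_max_left _ _, ?_⟩
  intro n μ ν r τ X Y hn h M y hM hy hyM
  have hn1 : 1 ≤ n := (le_max_left _ _).trans hn
  have hn0 : 0 < n := by linarith
  have hAl : A / n ≤ l := by
    have := (le_max_right _ _).trans hn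
    rw [div_le_iff₀ hl] at this
    rw [div_le_iff₀ hn0]; linarith
  have hAn0 : 0 < A / n := by positivity
  have hμ0 : 0 ≤ μ := by linarith [h.hμ1]
  have hν0 : 0 ≤ ν := by linarith [h.hν1]
  have hy0 : 0 < y := hl.trans hy.1
  have hFy : FF a μ ν X Y y ≤ D * (2 * n * M) := by
    unfold FF
    have i1 : y ^ (2*a) ≤ D := by
      rcases le_total 0 a with h0 | h0
      · have : y ^ (2*a) ≤ L ^ (2*a) := Real.rpow_le_rpow hy0.le hy.2.le (by linarith)
        have : 0 < l ^ (2*a) := by positivity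
        rw [hD]; linarith
      · have : y ^ (2*a) ≤ l ^ (2*a) := Real.rpow_le_rpow_of_nonpos hl hy.1.le (by linarith)
        have : 0 < L ^ (2*a) := by positivity
        rw [hD]; linarith
    have i2 : ν * X y ^ 2 + μ * Y y ^ 2 ≤ 2 * n * M := by
      calc ν * X y ^ 2 + μ * Y y ^ 2 ≤ 2 * n * X y ^ 2 + 2 * n * Y y ^ 2 := by
            gcongr; exacts [h.hν2, h.hμ2]
        _ = 2 * n * (X y ^ 2 + Y y ^ 2) := by ring
        _ ≤ _ := by gcongr
    gcongr
  have hFF0 : ∀ x, 0 < x → 0 ≤ FF a μ ν X Y x := fun x hx => by unfold FF; positivity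
  have far1 : ∀ x, A / n ≤ x → x < L → FF a μ ν X Y x ≤ C1 * (D * (2 * n * M)) := by
    intro x hx hxL
    refine (far hn1 h x y hx (hAl.trans hy.1.le) hxL hy.2).trans ?_
    gcongr
  have all1 : ∀ x, ε / n ≤ x → x < L → FF a μ ν X Y x ≤ C1 * (D * (2 * n * M)) * E := by
    intro x hx hxL
    have hx0 : 0 < x := lt_of_lt_of_le (by positivity) hx
    rcases le_total (A / n) x with hAx | hAx
    · refine (far1 x hAx hxL).trans (le_mul_of_one_le_right (by positivity) hE1)
    · have hH : ∀ z, 0 < z → HasDerivAt (fun z : ℝ => 2 * |a| * log z + 2 * B * z) (2 * |a| * z⁻¹ + 2 * B * 1) z :=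
        fun z hz => ((Real.hasDerivAt_log hz.ne').const_mul _).add ((hasDerivAt_id z).const_mul _)
      have hd : ∀ z ∈ Icc x (A/n), |z ^ (2*a) * (2 * ν * (a / z - r z) * X z ^ 2 - 2 * μ * (a / z + τ z) * Y z ^ 2)| ≤ (2 * |a| * z⁻¹ + 2 * B * 1) * FF a μ ν X Y z := by
        intro z hz
        have hz0 : 0 < z := by linarith [hz.1]
        have hzI : z ∈ Ioo 0 L := ⟨hz0, by linarith [hz.2]⟩
        rw [abs_mul, abs_of_pos (show 0 < z ^ (2*a) by positivity)]
        unfold FF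
        have j1 : |a / z - r z| ≤ |a| * z⁻¹ + B := by
          refine (abs_sub _ _).trans ?_
          rw [abs_div, abs_of_pos hz0, div_eq_mul_inv]; linarith [h.hr z hzI]
        have j2 : |a / z + τ z| ≤ |a| * z⁻¹ + B := by
          refine (abs_add_le _ _).trans ?_
          rw [abs_div, abs_of_pos hz0, div_eq_mul_inv]; linarith [h.ht z hzI]
        have : |2 * ν * (a / z - r z) * X z ^ 2 - 2 * μ * (a / z + τ z) * Y z ^ 2| ≤ 2 * ν * (|a| * z⁻¹ + B) * X z ^ 2 + 2 * μ * (|a| * z⁻¹ + B) * Y z ^ 2 := by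
          refine (abs_sub _ _).trans ?_
          rw [abs_mul, abs_mul, abs_of_nonneg (show 0 ≤ 2 * ν by positivity), abs_mul, abs_mul (2 * μ), abs_of_nonneg (show 0 ≤ 2 * μ by positivity), abs_of_nonneg (sq_nonneg (X z)), abs_of_nonneg (sq_nonneg (Y z))]
          gcongr
        calc _ ≤ z ^ (2*a) * (2 * ν * (|a| * z⁻¹ + B) * X z ^ 2 + 2 * μ * (|a| * z⁻¹ + B) * Y z ^ 2) := by gcongr
          _ = _ := by ring
      have g := (gron hAx (fun z hz => FF_deriv h ⟨by linarith [hz.1], by linarith [hz.2]⟩) (fun z hz => hH z (by linarith [hz.1])) hd).1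
      refine g.trans ?_
      have hexp : exp (2 * |a| * log (A/n) + 2 * B * (A/n) - (2 * |a| * log x + 2 * B * x)) ≤ E := by
        rw [hE, Real.exp_le_exp]
        have l1 : log (A / n) - log x ≤ log A - log ε := by
          have := Real.log_le_log (by positivity) hx
          rw [Real.log_div hε.ne' hn0.ne'] at this
          rw [Real.log_div hA0.ne' hn0.ne']; linarith
        have l2 : 2 * B * (A / n) - 2 * B * x ≤ 2 * B * L := by
          have : A / n - x ≤ L := by linarith
          nlinarith
        nlinarith [abs_nonneg a]
      have := far1 (A/n) le_rfl (by linarith)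
      have := hFF0 (A/n) hAn0
      gcongr
  have all2 : ∀ x, ε / n ≤ x → x < L → X x ^ 2 + Y x ^ 2 ≤ C2 * M * x ^ (-(2*a)) := by
    intro x hx hxL
    have hx0 : 0 < x := lt_of_lt_of_le (by positivity) hx
    have hw : 0 < x ^ (2*a) := by positivity
    have h1 := all1 x hx hxL
    have h2 : n / 2 * (x ^ (2*a) * (X x ^ 2 + Y x ^ 2)) ≤ FF a μ ν X Y x := by
      unfold FF
      calc _ = x ^ (2*a) * (n / 2 * X x ^ 2 + n / 2 * Y x ^ 2) := by ring
        _ ≤ _ := by gcongr; exacts [h.hν1, h.hμ1]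
    rw [Real.rpow_neg hx0.le, ← div_eq_mul_inv, le_div_iff₀ hw]
    have h3 : n / 2 * (x ^ (2*a) * (X x ^ 2 + Y x ^ 2)) ≤ n / 2 * (C2 * M) := by
      refine (h2.trans h1).trans (le_of_eq ?_)
      rw [hC2]; ring
    have := le_of_mul_le_mul_left h3 (by positivity)
    linarith
  intro x hx
  have hδ : ε / n < L := by
    have : ε / n ≤ A / n := by gcongr; linarith
    linarith
  have hδ0 : 0 < ε / n := by positivity
  have hκδ : κ * (ε / n) = ε / n + 1 / n := by rw [hκ]; field_simp
  have h1n : 0 < 1 / n := by positivity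
  rcases le_total (ε / n) x with hxe | hxe
  · have hx0 : 0 < x := by linarith
    have hxk : x + 1 / n ≤ κ * x := by
      rw [hκ, add_mul, one_mul]
      have : 1 / n ≤ 1 / ε * x := by
        rw [div_le_iff₀ hn0] at hxe
        rw [div_mul_eq_mul_div, one_mul, div_le_div_iff₀ hn0 hε]; linarith
      linarith
    have hc := rpow_comp (c := -(2*a)) hx0 (show x ≤ x + 1 / n by linarith) hxk
    calc _ ≤ C2 * M * x ^ (-(2*a)) := all2 x hxe hx.2
      _ ≤ C2 * M * (κ ^ |-(2*a)| * (x + 1/n) ^ (-(2*a))) := by gcongr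
      _ ≤ 8 * (C2 * M * (κ ^ |-(2*a)| * (x + 1/n) ^ (-(2*a)))) := by
        have : 0 ≤ C2 * M * (κ ^ |-(2*a)| * (x + 1/n) ^ (-(2*a))) := by positivity
        linarith
      _ = _ := by ring
  · have hx0 : 0 ≤ x := hx.1
    have nb := near_bd ha hB hn1 h hε e1 e2 hδ x ⟨hx.1, hxe⟩
    have a2 := all2 (ε/n) le_rfl hδ
    have hc := rpow_comp (c := -(2*a)) hδ0 (show ε / n ≤ x + 1 / n by
      have : ε / n ≤ 1 / n := by gcongr
      linarith) (show x + 1/n ≤ κ * (ε / n) by rw [hκδ]; linarith)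
    calc _ ≤ 8 * X (ε/n) ^ 2 := nb
      _ ≤ 8 * (C2 * M * (ε/n) ^ (-(2*a))) := by
        have := sq_nonneg (Y (ε/n)); linarith
      _ ≤ 8 * (C2 * M * (κ ^ |-(2*a)| * (x + 1/n) ^ (-(2*a)))) := by gcongr
      _ = _ := by ring

lemma rpow_comp' {s t κ : ℝ} (c : ℝ) (hs : 0 < s) (ht : 0 < t) (h1 : s ≤ κ * t) (h2 : t ≤ κ * s) : s ^ c ≤ κ ^ |c| * t ^ c := by
  have hk : 0 < κ := by
    by_contra h
    push Not at h
    nlinarith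
  rcases le_total 0 c with h | h
  · rw [abs_of_nonneg h, ← Real.mul_rpow hk.le ht.le]
    exact Real.rpow_le_rpow hs.le h1 h
  · rw [abs_of_nonpos h, Real.rpow_neg hk.le, ← div_eq_inv_mul, le_div_iff₀ (by positivity), mul_comm, ← Real.mul_rpow hk.le hs.le]
    exact Real.rpow_le_rpow_of_nonpos ht h2 h

lemma SP_lip {S : Set ℤ} {f : ℝ → ℂ} (hf : f ∈ SP S) : ∃ K : ℝ, 0 ≤ K ∧ ∀ x y, ‖f x - f y‖ ≤ K * |x - y| := by
  unfold SP at hf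
  induction hf using Submodule.span_induction with
  | mem f hf =>
    obtain ⟨k, -, rfl⟩ := hf
    refine ⟨|(k:ℝ)|, abs_nonneg _, fun x y => ?_⟩
    have := Convex.norm_image_sub_le_of_norm_hasDerivWithin_le (f := tf k) (C := |(k:ℝ)|) (s := univ) (x := y) (y := x)
      (fun z _ => (tf_deriv k z).hasDerivWithinAt) (fun z _ => by
        rw [norm_mul, norm_mul, tf_norm, Complex.norm_I, one_mul, mul_one]
        simp) convex_univ (mem_univ _) (mem_univ _)
    simpa using this
  | zero => exact ⟨0, le_rfl, fun x y => by simp⟩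
  | add f g _ _ hf hg =>
    obtain ⟨K, hK, h1⟩ := hf
    obtain ⟨K', hK', h2⟩ := hg
    refine ⟨K + K', by positivity, fun x y => ?_⟩
    simp only [Pi.add_apply]
    rw [show f x + g x - (f y + g y) = (f x - f y) + (g x - g y) by ring]
    exact (norm_add_le _ _).trans (by linarith [h1 x y, h2 x y])
  | smul c f _ hf =>
    obtain ⟨K, hK, h1⟩ := hf
    refine ⟨‖c‖ * K, by positivity, fun x y => ?_⟩
    simp only [Pi.smul_apply, smul_eq_mul]
    rw [← mul_sub, norm_mul, mul_assoc]
    exact mul_le_mul_of_nonneg_left (h1 x y) (norm_nonneg _)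

lemma gg_pi (μ : Measure ℝ) (n : ℕ) (x : ℝ) : gg μ n (π - x) = (-1) ^ n * (starRingEnd ℂ) (gg μ n x) := by
  unfold gg
  rw [map_sum, Finset.mul_sum]
  refine Finset.sum_congr rfl fun i _ => ?_
  rw [map_mul, Complex.conj_ofReal, tf_conj, tf_pi]
  have : (-1:ℂ) ^ (2 * (i:ℤ) - n) = (-1)^n := by
    rw [zpow_sub₀ (by norm_num), zpow_mul]
    norm_num
    rcases neg_one_pow_eq_or ℂ n with h | h <;> rw [h] <;> norm_num
  rw [this]; ring

lemma gg_add_pi (μ : Measure ℝ) (n : ℕ) (x : ℝ) : gg μ n (x + π) = (-1) ^ n * gg μ n x := by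
  have := gg_pi μ n (-x)
  rw [gg_neg, Complex.conj_conj] at this
  rw [← this]; ring_nf

lemma sin_bds {x : ℝ} (hx : 0 ≤ x) (hx' : x ≤ π / 2) : x ≤ 2 * sin x ∧ sin x ≤ x := by
  refine ⟨?_, Real.sin_le hx⟩
  have := Real.mul_le_sin hx hx'
  have hpi := Real.pi_le_four
  have hp := Real.pi_pos
  have : x / 2 ≤ 2 / π * x := by
    rw [div_mul_eq_mul_div, div_le_div_iff₀ (by norm_num) hp]; nlinarith
  linarith

lemma cot_bd {x : ℝ} (hx : 0 < x) (hx' : x < π / 2) : |cos x / sin x - 1 / x| ≤ 2 := by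
  have hs := sin_bds hx.le hx'.le
  have hs0 : 0 < sin x := by linarith [hs.1]
  have h1 : 0 ≤ sin x - x * cos x := by
    have hc : 0 < cos x := Real.cos_pos_of_mem_Ioo ⟨by linarith, hx'⟩
    have := (Real.lt_tan hx hx').le
    rw [Real.tan_eq_sin_div_cos, le_div_iff₀ hc] at this; linarith
  have h2 := Real.one_sub_sq_div_two_le_cos (x := x)
  have e : cos x / sin x - 1 / x = - ((sin x - x * cos x) / (x * sin x)) := by field_simp; ring
  rw [e, abs_neg, abs_of_nonneg (by positivity), div_le_iff₀ (by positivity)]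
  have hx2 : x ≤ 2 := by linarith [Real.pi_le_four]
  nlinarith [mul_pos hx hx, mul_pos hx hs0]

lemma tan_bd {x : ℝ} (hx : 0 < x) (hx' : x ≤ 3 * π / 8) : |sin x / cos x| ≤ 8 := by
  have hp := Real.pi_pos
  have := (sin_bds (x := π/2 - x) (by linarith) (by linarith)).1
  rw [Real.sin_pi_div_two_sub] at this
  have hc : 1/8 ≤ cos x := by linarith [Real.pi_gt_three]
  rw [abs_div, abs_of_pos (by linarith : 0 < cos x), div_le_iff₀ (by linarith)]
  have := Real.abs_sin_le_one x
  linarith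

lemma mkOSys {a n μ ν r1 t1 B : ℝ} {X Y : ℝ → ℝ} (hμ1 : n / 2 ≤ μ) (hμ2 : μ ≤ 2 * n) (hν1 : n / 2 ≤ ν) (hν2 : ν ≤ 2 * n)
    (hr : |r1| ≤ B) (ht : |t1| ≤ B) (ha : |2 * a| ≤ B) (cX : Continuous X) (cY : Continuous Y)
    (dX : ∀ x ∈ Ioo 0 (π/2), HasDerivAt X (-(r1 * (sin x / cos x)) * X x - μ * Y x) x)
    (dY : ∀ x ∈ Ioo 0 (π/2), HasDerivAt Y (-(2 * a * (cos x / sin x) + t1 * (sin x / cos x)) * Y x + ν * X x) x)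
    (hY0 : Y 0 = 0) (lY : ∃ K, ∀ x y, |Y x - Y y| ≤ K * |x - y|) :
    OSys a (10 * B) (3 * π / 8) n μ ν (fun x => r1 * (sin x / cos x)) (fun x => 2 * a * (cos x / sin x - 1 / x) + t1 * (sin x / cos x)) X Y := by
  have hp := Real.pi_pos
  have hB : 0 ≤ B := (abs_nonneg _).trans hr
  have hI : ∀ x ∈ Ioo 0 (3 * π / 8), x ∈ Ioo 0 (π/2) := fun x hx => ⟨hx.1, by linarith [hx.2]⟩
  refine ⟨hμ1, hμ2, hν1, hν2, ?_, ?_, cX.continuousOn, cY.continuousOn, fun x hx => dX x (hI x hx), ?_, ?_⟩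
  · intro x hx
    have := tan_bd hx.1 hx.2.le
    rw [abs_mul]
    calc _ ≤ B * 8 := by gcongr
      _ ≤ _ := by linarith
  · intro x hx
    have h1 := tan_bd hx.1 hx.2.le
    have h2 := cot_bd (hI x hx).1 (hI x hx).2
    refine (abs_add_le _ _).trans ?_
    rw [abs_mul, abs_mul t1]
    calc _ ≤ B * 2 + B * 8 := by gcongr
      _ = _ := by ring
  · intro x hx
    refine (dY x (hI x hx)).congr_deriv ?_
    ring
  · obtain ⟨K, hK⟩ := lY
    refine ⟨K, fun x hx => ?_⟩
    have := hK x 0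
    simpa [hY0, abs_of_nonneg hx.1] using this

/-- ODE in real form -/
lemma gg_real_ode {a b : ℝ} (ha : -(1/2) < a) (hb : -(1/2) < b) (N : ℕ) {x : ℝ} (hs : sin x ≠ 0) (hc : cos x ≠ 0) :
    let f := gg (mW (rho (2*a) (2*b))) (N+1)
    (Even (N+1) → HasDerivAt (fun x => (f x).re) (- ((N+1:ℝ) + 2*a + 2*b) * (f x).im) x ∧
      HasDerivAt (fun x => (f x).im) (-(2 * a * (cos x / sin x) + (-(2*b)) * (sin x / cos x)) * (f x).im + (N+1:ℝ) * (f x).re) x) ∧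
    (Odd (N+1) → HasDerivAt (fun x => (f x).re) (-((-(2*b)) * (sin x / cos x)) * (f x).re - ((N+1:ℝ) + 2*a) * (f x).im) x ∧
      HasDerivAt (fun x => (f x).im) (-(2 * a * (cos x / sin x)) * (f x).im + ((N+1:ℝ) + 2*b) * (f x).re) x) := by
  intro f
  have ode := gg_ode ha hb N x hs hc
  have hd : DifferentiableAt ℝ f x := (SP_diff (gg_mem _ _)) x
  have hre : HasDerivAt (fun x => (f x).re) (deriv f x).re x :=
    (Complex.reCLM.hasFDerivAt.comp_hasDerivAt x hd.hasDerivAt)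
  have him : HasDerivAt (fun x => (f x).im) (deriv f x).im x :=
    (Complex.imCLM.hasFDerivAt.comp_hasDerivAt x hd.hasDerivAt)
  unfold DD at ode
  rw [gg_neg, gg_pi] at ode
  change deriv f x + _ * (f x - (starRingEnd ℂ) (f x)) - _ * (f x - (-1)^(N+1) * (starRingEnd ℂ) (f x)) = Complex.I * (_ * f x - _ * (starRingEnd ℂ) (f x)) at ode
  generalize cos x / sin x = c1 at ode ⊢
  generalize sin x / cos x = c2 at ode ⊢
  constructor
  · intro he
    have h1 : (-1:ℂ)^(N+1) = 1 := he.neg_one_pow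
    have h2 : (-1:ℂ)^N = -1 := by rw [pow_succ] at h1; linear_combination -h1
    rw [h1, h2] at ode
    have o1 := congrArg Complex.re ode
    have o2 := congrArg Complex.im ode
    simp at o1 o2
    constructor
    · refine hre.congr_deriv ?_
      linarith
    · refine him.congr_deriv ?_
      linarith
  · intro he
    have h1 : (-1:ℂ)^(N+1) = -1 := he.neg_one_pow
    have h2 : (-1:ℂ)^N = 1 := by rw [pow_succ] at h1; linear_combination -h1
    rw [h1, h2] at ode
    have o1 := congrArg Complex.re ode
    have o2 := congrArg Complex.im ode
    simp at o1 o2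
    constructor
    · refine hre.congr_deriv ?_
      linarith
    · refine him.congr_deriv ?_
      linarith

lemma gg_norm_real {W : ℝ → ℝ} (hW : GW W) (n : ℕ) : Integrable (fun x => W x * ‖gg (mW W) n x‖^2) cI ∧ ∫ x, W x * ‖gg (mW W) n x‖^2 ∂cI = 1 := by
  have h1 := gg_norm hW.gm n
  rw [mW_integral hW] at h1
  have e : ∀ x, W x • (gg (mW W) n x * (starRingEnd ℂ) (gg (mW W) n x)) = ((W x * ‖gg (mW W) n x‖^2 : ℝ) : ℂ) := by
    intro x
    rw [Complex.mul_conj, Complex.normSq_eq_norm_sq]; simp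
  simp_rw [e] at h1
  rw [integral_complex_ofReal] at h1
  have h2 : ∫ x, W x * ‖gg (mW W) n x‖^2 ∂cI = 1 := by exact_mod_cast h1
  refine ⟨?_, h2⟩
  by_contra hc
  rw [integral_undef hc] at h2
  norm_num at h2

lemma gg_avg {W : ℝ → ℝ} (hW : GW W) : ∃ M : ℝ, 0 < M ∧ ∀ n, ∃ y ∈ Ioo (π/8) (3*π/8), ‖gg (mW W) n y‖^2 ≤ M := by
  have hp := Real.pi_pos
  set J := Ioo (π/8) (3*π/8) with hJ
  have hJm : MeasurableSet J := measurableSet_Ioo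
  have hJc : cI J ≠ 0 := by
    unfold cI
    rw [Measure.restrict_apply hJm, inter_eq_left.2 (show J ⊆ Ioc (-π) π from fun x hx => ⟨by linarith [hx.1], by linarith [hx.2]⟩), hJ, Real.volume_Ioo]
    simp; linarith
  have hw : 0 < ∫ x in J, W x ∂cI := by
    rw [setIntegral_pos_iff_support_of_nonneg_ae (Eventually.of_forall hW.nonneg) hW.int.integrableOn]
    have : cI J = cI (Function.support W ∩ J) := by
      apply measure_congr
      filter_upwards [hW.pos] with x hx
      apply propext
      constructor
      · intro h; exact ⟨hx.ne', h⟩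
      · intro h; exact h.2
    rw [← this]; exact pos_iff_ne_zero.2 hJc
  refine ⟨2 / ∫ x in J, W x ∂cI, by positivity, fun n => ?_⟩
  by_contra! hcon
  obtain ⟨i1, i2⟩ := gg_norm_real hW n
  have h3 : ∫ x in J, W x * ‖gg (mW W) n x‖^2 ∂cI ≤ 1 := by
    rw [← i2]
    exact setIntegral_le_integral i1 (Eventually.of_forall fun x => mul_nonneg (hW.nonneg x) (by positivity))
  have h4 : ∫ x in J, W x * (2 / ∫ x in J, W x ∂cI) ∂cI ≤ ∫ x in J, W x * ‖gg (mW W) n x‖^2 ∂cI := by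
    apply setIntegral_mono_on (hW.int.integrableOn.mul_const _) i1.integrableOn hJm
    intro x hx
    exact mul_le_mul_of_nonneg_left (hcon x hx).le (hW.nonneg x)
  rw [integral_mul_const, mul_div_cancel₀ _ hw.ne'] at h4
  linarith

lemma gg_half {a b : ℝ} (ha : -(1/2) < a) (hb : -(1/2) < b) : ∃ C n0 : ℝ, 0 < C ∧ ∀ N : ℕ, n0 ≤ (N+1:ℝ) → ∀ x ∈ Icc 0 (π/4),
    ‖gg (mW (rho (2*a) (2*b))) (N+1) x‖^2 ≤ C * (x + 1/(N+1:ℝ)) ^ (-(2*a)) ∧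
    ‖gg (mW (rho (2*a) (2*b))) (N+1) (π/2 - x)‖^2 ≤ C * (x + 1/(N+1:ℝ)) ^ (-(2*b)) := by
  have hp := Real.pi_pos
  obtain ⟨M, hM, avg⟩ := gg_avg (rho_GW (s := 2*a) (t := 2*b) (by linarith) (by linarith))
  set B := 2 * |a| + 2 * |b| with hB
  have hB0 : 0 ≤ B := by positivity
  have ba : |2 * a| ≤ B := by rw [abs_mul, abs_two]; linarith [abs_nonneg b]
  have bb : |2 * b| ≤ B := by rw [abs_mul, abs_two]; linarith [abs_nonneg a]
  obtain ⟨C1, n1, hC1, hn1, o1⟩ := ode_bound (a := a) (B := 10 * B) (l := π/8) (L := 3 * π / 8) ha (by positivity) (by positivity) (by linarith)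
  obtain ⟨C2, n2, hC2, hn2, o2⟩ := ode_bound (a := b) (B := 10 * B) (l := π/8) (L := 3 * π / 8) hb (by positivity) (by positivity) (by linarith)
  refine ⟨(C1 + C2) * M, max (max n1 n2) (4 * B), by positivity, fun N hN => ?_⟩
  have hN1 : n1 ≤ (N+1:ℝ) := ((le_max_left _ _).trans (le_max_left _ _)).trans hN
  have hN2 : n2 ≤ (N+1:ℝ) := ((le_max_right _ _).trans (le_max_left _ _)).trans hN
  have hN3 : 4 * B ≤ (N+1:ℝ) := (le_max_right _ _).trans hN
  set f := gg (mW (rho (2*a) (2*b))) (N+1) with hf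
  set n : ℝ := (N+1:ℝ) with hn
  have hn0 : 0 < n := by rw [hn]; positivity
  obtain ⟨y, hy, hyM⟩ := avg (N+1)
  rw [← hf] at hyM
  have nsq : ∀ z : ℂ, ‖z‖^2 = z.re^2 + z.im^2 := fun z => by rw [← Complex.normSq_eq_norm_sq, Complex.normSq_apply]; ring
  have cf : Continuous f := gg_cont _ _
  have cX : Continuous (fun x => (f x).re) := Complex.continuous_re.comp cf
  have cY : Continuous (fun x => (f x).im) := Complex.continuous_im.comp cf
  obtain ⟨K, hK, lip⟩ := SP_lip (gg_mem (mW (rho (2*a) (2*b))) (N+1))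
  rw [← hf] at lip
  have lX : ∀ x y, |(f x).re - (f y).re| ≤ K * |x - y| := fun x y => by
    rw [← Complex.sub_re]; exact (Complex.abs_re_le_norm _).trans (lip x y)
  have lY : ∀ x y, |(f x).im - (f y).im| ≤ K * |x - y| := fun x y => by
    rw [← Complex.sub_im]; exact (Complex.abs_im_le_norm _).trans (lip x y)
  have hY0 : (f 0).im = 0 := by
    have := congrArg Complex.im (gg_neg (mW (rho (2*a) (2*b))) (N+1) 0)
    rw [neg_zero, ← hf, Complex.conj_im] at this; linarith
  have hpi2 := gg_pi (mW (rho (2*a) (2*b))) (N+1) (π/2)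
  rw [show π - π/2 = π/2 by ring, ← hf] at hpi2
  have hsc : ∀ x ∈ Ioo 0 (π/2), sin x ≠ 0 ∧ cos x ≠ 0 := fun x hx =>
    ⟨(Real.sin_pos_of_pos_of_lt_pi hx.1 (by linarith [hx.2])).ne', (Real.cos_pos_of_mem_Ioo ⟨by linarith [hx.1], hx.2⟩).ne'⟩
  have hrefl : ∀ x ∈ Ioo 0 (π/2), π/2 - x ∈ Ioo 0 (π/2) := fun x hx => ⟨by linarith [hx.2], by linarith [hx.1]⟩
  have bd : |2 * a| ≤ n / 4 ∧ |2 * b| ≤ n / 4 ∧ |2 * a + 2 * b| ≤ n / 4 := by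
    refine ⟨by linarith, by linarith, ?_⟩
    refine (abs_add_le _ _).trans ?_
    rw [abs_mul, abs_mul, abs_two]; linarith
  obtain ⟨bd1, bd2, bd3⟩ := bd
  rw [abs_le] at bd1 bd2 bd3
  have key : (∃ μ ν r1 t1, OSys a (10 * B) (3 * π / 8) n μ ν r1 t1 (fun x => (f x).re) (fun x => (f x).im)) ∧
      ∃ μ ν r1 t1 X Y, OSys b (10 * B) (3 * π / 8) n μ ν r1 t1 X Y ∧ ∀ x, X x ^ 2 + Y x ^ 2 = ‖f (π/2 - x)‖^2 := by
    have hrv : ∀ x : ℝ, HasDerivAt (fun x : ℝ => π/2 - x) (-1) x := fun x => by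
      simpa using (hasDerivAt_id x).const_sub (π/2)
    rcases Nat.even_or_odd (N+1) with he | he
    · have od : ∀ x ∈ Ioo 0 (π/2), _ := fun x hx => (gg_real_ode ha hb N (hsc x hx).1 (hsc x hx).2).1 he
      constructor
      · refine ⟨_, _, _, _, mkOSys (μ := n + 2*a+2*b) (ν := n) (r1 := 0) (t1 := -(2*b)) (by linarith) (by linarith) (by linarith) (by linarith)
          (by simpa using hB0) (by rw [abs_neg]; exact bb) ba cX cY (fun x hx => ?_) (fun x hx => (od x hx).2) hY0 ⟨K, lY⟩⟩
        refine (od x hx).1.congr_deriv ?_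
        ring
      · refine ⟨_, _, _, _, (fun x => (f (π/2 - x)).re), (fun x => -(f (π/2 - x)).im), mkOSys (μ := n + 2*a+2*b) (ν := n) (r1 := 0) (t1 := -(2*a)) (by linarith) (by linarith) (by linarith) (by linarith)
          (by simpa using hB0) (by rw [abs_neg]; exact ba) bb (cX.comp (by fun_prop)) ((cY.comp (by fun_prop)).neg) (fun x hx => ?_) (fun x hx => ?_) ?_ ⟨K, fun x y => ?_⟩, fun x => ?_⟩
        · have := (od _ (hrefl x hx)).1.comp x (hrv x)
          refine this.congr_deriv ?_
          ring
        · have := ((od _ (hrefl x hx)).2.comp x (hrv x)).neg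
          refine this.congr_deriv ?_
          rw [Real.sin_pi_div_two_sub, Real.cos_pi_div_two_sub]
          ring
        · rw [he.neg_one_pow] at hpi2
          have := congrArg Complex.im hpi2
          simp only [one_mul, Complex.conj_im] at this
          simp only [sub_zero]; linarith
        · have := lY (π/2 - y) (π/2 - x)
          rw [show π/2 - y - (π/2 - x) = x - y by ring] at this
          rw [show -(f (π/2 - x)).im - -(f (π/2 - y)).im = (f (π/2 - y)).im - (f (π/2 - x)).im by ring]
          exact this
        · rw [nsq]; ring
    · have od : ∀ x ∈ Ioo 0 (π/2), _ := fun x hx => (gg_real_ode ha hb N (hsc x hx).1 (hsc x hx).2).2 he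
      constructor
      · refine ⟨_, _, _, _, mkOSys (μ := n + 2*a) (ν := n+2*b) (r1 := -(2*b)) (t1 := 0) (by linarith) (by linarith) (by linarith) (by linarith)
          (by rw [abs_neg]; exact bb) (by simpa using hB0) ba cX cY (fun x hx => (od x hx).1) (fun x hx => ?_) hY0 ⟨K, lY⟩⟩
        refine (od x hx).2.congr_deriv ?_
        ring
      · refine ⟨_, _, _, _, (fun x => (f (π/2 - x)).im), (fun x => (f (π/2 - x)).re), mkOSys (μ := n + 2*b) (ν := n+2*a) (r1 := -(2*a)) (t1 := 0) (by linarith) (by linarith) (by linarith) (by linarith)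
          (by rw [abs_neg]; exact ba) (by simpa using hB0) bb (cY.comp (by fun_prop)) (cX.comp (by fun_prop)) (fun x hx => ?_) (fun x hx => ?_) ?_ ⟨K, fun x y => ?_⟩, fun x => ?_⟩
        · have := (od _ (hrefl x hx)).2.comp x (hrv x)
          refine this.congr_deriv ?_
          rw [Real.sin_pi_div_two_sub, Real.cos_pi_div_two_sub]
          ring
        · have := (od _ (hrefl x hx)).1.comp x (hrv x)
          refine this.congr_deriv ?_
          rw [Real.sin_pi_div_two_sub, Real.cos_pi_div_two_sub]
          ring
        · rw [he.neg_one_pow] at hpi2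
          have := congrArg Complex.re hpi2
          simp at this
          simp only [sub_zero]; linarith
        · have := lX (π/2 - x) (π/2 - y)
          rw [show π/2 - x - (π/2 - y) = -(x - y) by ring, abs_neg] at this
          exact this
        · rw [nsq]; ring
  obtain ⟨⟨μ, ν, r1, t1, s1⟩, μ', ν', r1', t1', X, Y, s2, hXY⟩ := key
  intro x hx
  have hxI : x ∈ Ico 0 (3*π/8) := ⟨hx.1, by linarith [hx.2]⟩
  have hx0 := hx.1
  constructor
  · have := o1 hN1 s1 M y hM.le hy (by rw [← nsq]; exact hyM) x hxI
    rw [← nsq] at this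
    refine this.trans ?_
    gcongr
    linarith
  · have := o2 hN2 s2 M (π/2 - y) hM.le ⟨by linarith [hy.2], by linarith [hy.1]⟩ (by rw [hXY, sub_sub_cancel]; exact hyM) x hxI
    rw [hXY] at this
    refine this.trans ?_
    gcongr
    linarith

def om (a b n x : ℝ) : ℝ := (|sin x| + 1/n) ^ (-a) * (|cos x| + 1/n) ^ (-b)

lemma om_nonneg {a b n : ℝ} (hn : 0 ≤ n) (x : ℝ) : 0 ≤ om a b n x := by unfold om; positivity

lemma om_sq {a b n : ℝ} (hn : 0 < n) (x : ℝ) : om a b n x ^ 2 = (|sin x| + 1/n) ^ (-(2*a)) * (|cos x| + 1/n) ^ (-(2*b)) := by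
  unfold om
  rw [mul_pow, ← Real.rpow_natCast, ← Real.rpow_natCast, ← Real.rpow_mul (by positivity), ← Real.rpow_mul (by positivity)]
  congr 2 <;> push_cast <;> ring

lemma red_pi {P : ℝ → Prop} (h1 : ∀ x, P x → P (-x)) (h2 : Function.Periodic P π) (h3 : ∀ x ∈ Icc 0 (π/2), P x) (x : ℝ) : P x := by
  have hp := Real.pi_pos
  obtain ⟨m, hm, -⟩ := existsUnique_add_zsmul_mem_Ico Real.pi_pos x 0
  have e : P (x + m • π) = P x := h2.zsmul m x
  rw [← e]
  simp only [zero_add] at hm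
  generalize x + m • π = z at hm
  rcases le_total z (π/2) with h | h
  · exact h3 z ⟨hm.1, h⟩
  · have := h3 (π - z) ⟨by linarith [hm.2], by linarith⟩
    have h4 := h1 _ this
    rw [neg_sub] at h4
    have := h2 (z - π)
    rw [sub_add_cancel] at this
    rw [this]; exact h4

lemma gg_small (μ : Measure ℝ) (a b : ℝ) (n : ℕ) (hn : 1 ≤ n) : ∃ C : ℝ, 0 ≤ C ∧ ∀ x, ‖gg μ n x‖ ≤ C * om a b n x := by
  obtain ⟨K, hK⟩ := SP_bdd (gg_mem μ n)
  have hK0 : 0 ≤ K := (norm_nonneg _).trans (hK 0)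
  have hn1 : (1:ℝ) ≤ n := by exact_mod_cast hn
  have hn0 : (0:ℝ) < n := by linarith
  refine ⟨K * ((2*n:ℝ) ^ |-a| * (2*n:ℝ) ^ |-b|), by positivity, fun x => (hK x).trans ?_⟩
  have key : ∀ s c : ℝ, |s| ≤ 1 → 1 ≤ (2*n:ℝ) ^ |c| * (|s| + 1/n) ^ c := by
    intro s c hs
    have h1 : 1 / (n:ℝ) ≤ 1 := by rw [div_le_one hn0]; exact hn1
    have := rpow_comp' (s := 1) (t := |s| + 1/n) (κ := 2 * n) c one_pos (by positivity) (by
      rw [mul_add, show 2 * (n:ℝ) * (1 / n) = 2 by field_simp]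
      have : 0 ≤ 2 * n * |s| := by positivity
      linarith) (by linarith)
    rwa [Real.one_rpow] at this
  have k1 := key (sin x) (-a) (Real.abs_sin_le_one x)
  have k2 := key (cos x) (-b) (Real.abs_cos_le_one x)
  have := mul_le_mul k1 k2 zero_le_one (by positivity)
  unfold om
  calc K = K * (1 * 1) := by ring
    _ ≤ K * (((2*n:ℝ) ^ |-a| * (|sin x| + 1/n) ^ (-a)) * ((2*n:ℝ) ^ |-b| * (|cos x| + 1/n) ^ (-b))) := by gcongr
    _ = _ := by ring

lemma fin_unif {P : ℕ → ℝ → Prop} (h : ∀ n, ∃ C : ℝ, 0 ≤ C ∧ P n C) (mono : ∀ n C C', C ≤ C' → P n C → P n C') (N : ℕ) :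
    ∃ C : ℝ, 0 ≤ C ∧ ∀ n < N, P n C := by
  choose C hC hP using h
  refine ⟨∑ i ∈ Finset.range N, C i, Finset.sum_nonneg fun i _ => hC i, fun n hn => mono n _ _ ?_ (hP n)⟩
  exact Finset.single_le_sum (f := C) (fun i _ => hC i) (Finset.mem_range.2 hn)

/-- from half-range estimates to all -/
lemma pure_bd {a b : ℝ} (ha : -(1/2) < a) (hb : -(1/2) < b) : ∃ C : ℝ, 0 ≤ C ∧ ∀ n : ℕ, 1 ≤ n → ∀ x,
    ‖gg (mW (rho (2*a) (2*b))) n x‖ ≤ C * om a b n x := by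
  have hp := Real.pi_pos
  obtain ⟨C, n0, hC, H⟩ := gg_half ha hb
  obtain ⟨C', hC', H'⟩ := fin_unif (P := fun n C => 1 ≤ n → ∀ x, ‖gg (mW (rho (2*a) (2*b))) n x‖ ≤ C * om a b n x)
    (fun n => by
      by_cases hn : 1 ≤ n
      · obtain ⟨C, h0, h⟩ := gg_small (mW (rho (2*a) (2*b))) a b n hn
        exact ⟨C, h0, fun _ => h⟩
      · exact ⟨0, le_rfl, fun h => absurd h hn⟩)
    (fun n C C' hCC h hn x => (h hn x).trans (mul_le_mul_of_nonneg_right hCC (om_nonneg (by positivity) x))) ⌈n0⌉₊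
  set D := C * (2 ^ |-(2*a)| * 2 ^ |-(2*b)|) with hD
  have hD0 : 0 ≤ D := by positivity
  refine ⟨C' + sqrt D, by positivity, fun n hn x => ?_⟩
  have hn1 : (1:ℝ) ≤ n := by exact_mod_cast hn
  have hn0 : (0:ℝ) < n := by linarith
  have ho := om_nonneg (a := a) (b := b) hn0.le x
  rcases lt_or_ge n ⌈n0⌉₊ with h | h
  · refine (H' n h hn x).trans ?_
    have := Real.sqrt_nonneg D
    gcongr; linarith
  · suffices hs : ∀ x, ‖gg (mW (rho (2*a) (2*b))) n x‖^2 ≤ D * om a b n x ^ 2 by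
      have h2 := hs x
      have h3 : ‖gg (mW (rho (2*a) (2*b))) n x‖ ≤ sqrt D * om a b n x := by
        apply abs_le_of_sq_le_sq' _ (by positivity) |>.2
        rw [mul_pow, Real.sq_sqrt hD0]; exact h2
      refine h3.trans ?_
      gcongr; linarith
    apply red_pi
    · intro x hx
      rw [gg_neg, RCLike.norm_conj]
      unfold om at hx ⊢
      rw [Real.sin_neg, Real.cos_neg, abs_neg]; exact hx
    · intro x
      simp only [gg_add_pi]
      unfold om
      simp [Real.sin_add_pi, Real.cos_add_pi, abs_neg]
    · intro x hx
      obtain ⟨N, rfl⟩ := Nat.exists_eq_succ_of_ne_zero (by omega : n ≠ 0)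
      have hN : n0 ≤ (N + 1 : ℝ) := by
        have := Nat.ceil_le.1 h; push_cast at this; exact this
      rw [om_sq (by positivity)]
      push_cast
      have h1n : 1 / (N + 1:ℝ) ≤ 1 := by rw [div_le_one (by positivity)]; linarith [Nat.cast_nonneg (α := ℝ) N]
      have h1p : 0 < 1 / (N + 1:ℝ) := by positivity
      have hs0 : 0 ≤ sin x := Real.sin_nonneg_of_nonneg_of_le_pi hx.1 (by linarith [hx.2])
      have hc0 : 0 ≤ cos x := Real.cos_nonneg_of_mem_Icc ⟨by linarith [hx.1], hx.2⟩
      have hs1 := Real.sin_le_one x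
      have hc1 := Real.cos_le_one x
      rw [abs_of_nonneg hs0, abs_of_nonneg hc0, hD]
      have piv := Real.pi_gt_three
      have hx0 := hx.1
      rcases le_total x (π/4) with hx4 | hx4
      · have h1 := (H N hN x ⟨hx.1, hx4⟩).1
        have sb := sin_bds hx.1 hx.2
        have cb := (sin_bds (x := π/2 - x) (by linarith) (by linarith)).1
        rw [Real.sin_pi_div_two_sub] at cb
        have r1 := rpow_comp' (s := x + 1/(N+1:ℝ)) (t := sin x + 1/(N+1:ℝ)) (κ := 2) (-(2*a)) (by positivity) (by positivity) (by linarith) (by linarith)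
        have cc : 1 ≤ 2 * (cos x + 1/(N+1:ℝ)) := by
          have := Real.cos_le_cos_of_nonneg_of_le_pi hx.1 (by linarith) hx4
          rw [Real.cos_pi_div_four] at this
          have h2 : 1 ≤ sqrt 2 := Real.one_le_sqrt.2 (by norm_num)
          linarith
        have r2 := rpow_comp' (s := 1) (t := cos x + 1/(N+1:ℝ)) (κ := 2) (-(2*b)) (by positivity) (by positivity) cc (by linarith)
        rw [Real.one_rpow] at r2
        calc _ ≤ C * (x + 1/(N+1:ℝ)) ^ (-(2*a)) * 1 := by rw [mul_one]; exact h1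
          _ ≤ C * (2 ^ |-(2*a)| * (sin x + 1/(N+1:ℝ)) ^ (-(2*a))) * (2 ^ |-(2*b)| * (cos x + 1/(N+1:ℝ)) ^ (-(2*b))) := by gcongr
          _ = _ := by ring
      · have h1 := (H N hN (π/2 - x) ⟨by linarith [hx.2], by linarith⟩).2
        rw [sub_sub_cancel] at h1
        have sb := sin_bds (x := π/2 - x) (by linarith [hx.2]) (by linarith)
        rw [Real.sin_pi_div_two_sub] at sb
        have hxx : 0 ≤ π/2 - x := by linarith [hx.2]
        have r1 := rpow_comp' (s := (π/2 - x) + 1/(N+1:ℝ)) (t := cos x + 1/(N+1:ℝ)) (κ := 2) (-(2*b)) (by positivity) (by positivity) (by linarith) (by linarith)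
        have cc : 1 ≤ 2 * (sin x + 1/(N+1:ℝ)) := by
          have := Real.cos_le_cos_of_nonneg_of_le_pi (x := π/2 - x) (y := π/4) (by linarith) (by linarith) (by linarith)
          rw [Real.cos_pi_div_four, Real.cos_pi_div_two_sub] at this
          have h2 : 1 ≤ sqrt 2 := Real.one_le_sqrt.2 (by norm_num)
          linarith
        have r2 := rpow_comp' (s := 1) (t := sin x + 1/(N+1:ℝ)) (κ := 2) (-(2*a)) (by positivity) (by positivity) cc (by linarith)
        rw [Real.one_rpow] at r2
        calc _ ≤ C * ((π/2 - x) + 1/(N+1:ℝ)) ^ (-(2*b)) * 1 := by rw [mul_one]; exact h1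
          _ ≤ C * (2 ^ |-(2*b)| * (cos x + 1/(N+1:ℝ)) ^ (-(2*b))) * (2 ^ |-(2*a)| * (sin x + 1/(N+1:ℝ)) ^ (-(2*a))) := by gcongr
          _ = _ := by ring

structure PF (P : ℝ → ℝ) (c0 c1 Λ : ℝ) : Prop where
  cont : Continuous P
  c0pos : 0 < c0
  lo : ∀ x, c0 ≤ P x
  hi : ∀ x, P x ≤ c1
  even : ∀ x, P (-x) = P x
  per : ∀ x, P (x + π) = P x
  Λ0 : 0 ≤ Λ
  lip : ∀ x y, |P x - P y| ≤ Λ * |sin (x - y)|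

def Wt (P : ℝ → ℝ) (a b x : ℝ) : ℝ := P x * rho (2*a) (2*b) x

lemma PF.pos {P : ℝ → ℝ} {c0 c1 Λ : ℝ} (h : PF P c0 c1 Λ) (x : ℝ) : 0 < P x := h.c0pos.trans_le (h.lo x)

lemma PF.c1pos {P : ℝ → ℝ} {c0 c1 Λ : ℝ} (h : PF P c0 c1 Λ) : 0 < c1 := (h.pos 0).trans_le (h.hi 0)

lemma PF.gw {P : ℝ → ℝ} {c0 c1 Λ : ℝ} (h : PF P c0 c1 Λ) {a b : ℝ} (ha : -(1/2) < a) (hb : -(1/2) < b) : GW (Wt P a b) := by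
  have h0 := rho_GW (s := 2*a) (t := 2*b) (by linarith) (by linarith)
  refine ⟨h.cont.measurable.mul h0.meas, fun x => mul_nonneg (h.pos x).le (h0.nonneg x), ?_, fun x => ?_, fun x => ?_, ?_⟩
  · apply h0.int.bdd_mul (c := c1) h.cont.aestronglyMeasurable
    exact ae_of_all _ fun x => by rw [Real.norm_of_nonneg (h.pos x).le]; exact h.hi x
  · unfold Wt; rw [h.even, h0.even]
  · unfold Wt; rw [h.per, h0.per]
  · filter_upwards [h0.pos] with x hx
    exact mul_pos (h.pos x) hx

lemma W_int {W : ℝ → ℝ} (hW : GW W) {h : ℝ → ℂ} (hc : Continuous h) {C : ℝ} (hb : ∀ x, ‖h x‖ ≤ C) : Integrable (fun x => W x • h x) cI := by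
  have := (hW.int.ofReal (𝕜 := ℂ)).mul_bdd (c := C) hc.aestronglyMeasurable (ae_of_all _ hb)
  refine this.congr (ae_of_all _ fun x => ?_)
  simp

lemma W_intSP {W : ℝ → ℝ} (hW : GW W) {S : Set ℤ} {h : ℝ → ℂ} (hh : h ∈ SP S) : Integrable (fun x => W x • h x) cI := by
  obtain ⟨C, hC⟩ := SP_bdd hh
  exact W_int hW (SP_cont hh) hC

lemma korous {P : ℝ → ℝ} {c0 c1 Λ : ℝ} (h : PF P c0 c1 Λ) {a b : ℝ} (ha : -(1/2) < a) (hb : -(1/2) < b) (n : ℕ) (x : ℝ) :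
    ‖gg (mW (Wt P a b)) n x‖ ≤ (Λ * (1 + 1/c0) / 2 + (c1 + 1) / 2) / c0 * ‖gg (mW (rho (2*a) (2*b))) n x‖ := by
  have h0 := rho_GW (s := 2*a) (t := 2*b) (by linarith) (by linarith)
  have hW := h.gw ha hb
  set W0 := rho (2*a) (2*b) with hW0
  set W := Wt P a b with hWd
  have hWe : ∀ x, W x = P x * W0 x := fun x => rfl
  set f := gg (mW W0) n with hf
  set g := gg (mW W) n with hg
  obtain ⟨if1, if2⟩ := gg_norm_real h0 n
  obtain ⟨ig1, ig2⟩ := gg_norm_real hW n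
  rw [← hf] at if1 if2
  rw [← hg] at ig1 ig2
  have cf : Continuous f := gg_cont _ _
  have cg : Continuous g := gg_cont _ _
  have hc0 := h.c0pos
  -- integral of |f||g|W0
  have pt1 : ∀ y, W0 y * (‖f y‖ * ‖g y‖) ≤ (W0 y * ‖f y‖^2 + (1/c0) * (W y * ‖g y‖^2)) / 2 := by
    intro y
    have e1 : W0 y * ‖g y‖^2 ≤ (1/c0) * (W y * ‖g y‖^2) := by
      rw [hWe, one_div, ← div_eq_inv_mul, le_div_iff₀ hc0]
      have := mul_le_mul_of_nonneg_right (h.lo y) (mul_nonneg (h0.nonneg y) (sq_nonneg ‖g y‖))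
      linarith
    have e2 : ‖f y‖ * ‖g y‖ ≤ (‖f y‖^2 + ‖g y‖^2) / 2 := by nlinarith [sq_nonneg (‖f y‖ - ‖g y‖)]
    have := mul_le_mul_of_nonneg_left e2 (h0.nonneg y)
    linarith
  have i2 : Integrable (fun y => (W0 y * ‖f y‖^2 + (1/c0) * (W y * ‖g y‖^2)) / 2) cI := (if1.add (ig1.const_mul _)).div_const 2
  have i1 : Integrable (fun y => W0 y * (‖f y‖ * ‖g y‖)) cI := by
    refine i2.mono' (by have := h0.meas; exact (by fun_prop : Measurable fun y => W0 y * (‖f y‖ * ‖g y‖)).aestronglyMeasurable) (ae_of_all _ fun y => ?_)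
    rw [Real.norm_of_nonneg (mul_nonneg (h0.nonneg y) (by positivity))]; exact pt1 y
  have b1 : ∫ y, W0 y * (‖f y‖ * ‖g y‖) ∂cI ≤ (1 + 1/c0)/2 := by
    refine (integral_mono i1 i2 pt1).trans (le_of_eq ?_)
    rw [integral_div, integral_add if1 (ig1.const_mul _), integral_const_mul, if2, ig2, mul_one]
  have pt2 : ∀ y, W y * (‖f y‖ * ‖g y‖) ≤ (c1 * (W0 y * ‖f y‖^2) + W y * ‖g y‖^2) / 2 := by
    intro y
    have e1 : W y * ‖f y‖^2 ≤ c1 * (W0 y * ‖f y‖^2) := by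
      rw [hWe, mul_assoc]
      exact mul_le_mul_of_nonneg_right (h.hi y) (mul_nonneg (h0.nonneg y) (sq_nonneg ‖f y‖))
    have e2 : ‖f y‖ * ‖g y‖ ≤ (‖f y‖^2 + ‖g y‖^2) / 2 := by nlinarith [sq_nonneg (‖f y‖ - ‖g y‖)]
    have := mul_le_mul_of_nonneg_left e2 (hW.nonneg y)
    linarith
  have i4 : Integrable (fun y => (c1 * (W0 y * ‖f y‖^2) + W y * ‖g y‖^2) / 2) cI := ((if1.const_mul _).add ig1).div_const 2
  have i3 : Integrable (fun y => W y * (‖f y‖ * ‖g y‖)) cI := by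
    refine i4.mono' (by have := hW.meas; exact (by fun_prop : Measurable fun y => W y * (‖f y‖ * ‖g y‖)).aestronglyMeasurable) (ae_of_all _ fun y => ?_)
    rw [Real.norm_of_nonneg (mul_nonneg (hW.nonneg y) (by positivity))]; exact pt2 y
  have b2 : ∫ y, W y * (‖f y‖ * ‖g y‖) ∂cI ≤ (c1 + 1)/2 := by
    refine (integral_mono i3 i4 pt2).trans (le_of_eq ?_)
    rw [integral_div, integral_add (if1.const_mul _) ig1, integral_const_mul, if2, ig2, mul_one]
  -- representation
  have rep := kk_rep h0.gm (n+1) (gg_mem (mW W) n) x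
  rw [mW_integral h0, ← hg] at rep
  have mkg : (fun y => kk (mW W0) (n+1) x y * g y) ∈ SP univ := SP_mulu (kk_mem _ _ _) (gg_mem _ _)
  have iB := W_intSP hW mkg
  have iT := (W_intSP h0 mkg).const_mul (P x : ℂ)
  have hsplit : (P x : ℂ) * g x = (∫ y, (W0 y • (((P x - P y : ℝ) : ℂ) * (kk (mW W0) (n+1) x y * g y))) ∂cI) + ∫ y, W y • (kk (mW W0) (n+1) x y * g y) ∂cI := by
    rw [← rep, ← integral_const_mul, ← sub_eq_iff_eq_add, ← integral_sub iT iB]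
    refine integral_congr_ae (ae_of_all _ fun y => ?_)
    simp only [hWe, Complex.real_smul]; push_cast; ring
  have hB : ∫ y, W y • (kk (mW W0) (n+1) x y * g y) ∂cI = f x * ∫ y, W y • ((starRingEnd ℂ) (f y) * g y) ∂cI := by
    have m1 : (fun y => tf (-1) y * (starRingEnd ℂ) (kk (mW W0) n x y)) ∈ SP (SL n) := by
      refine SP_tfmul (-1) ?_ (SP_conj_mem (kk_mem (mW W0) n x))
      rintro k ⟨j, hj, rfl⟩
      exact ⟨j, hj, by ring⟩
    have o1 := gg_orth hW.gm m1
    rw [mW_integral hW, ← hg] at o1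
    have e : ∀ y, W y • (kk (mW W0) (n+1) x y * g y) = tf (-1) x * (W y • (g y * (starRingEnd ℂ) (tf (-1) y * (starRingEnd ℂ) (kk (mW W0) n x y)))) + f x * (W y • ((starRingEnd ℂ) (f y) * g y)) := by
      intro y
      rw [kk_succ, map_mul, Complex.conj_conj, tf_conj, neg_neg, ← hf]
      simp only [Complex.real_smul]; ring
    simp_rw [e]
    rw [integral_add, integral_const_mul, integral_const_mul, o1, mul_zero, zero_add]
    · exact (W_intSP hW (SP_mulu (gg_mem (mW W) n) (SP_conju m1))).const_mul _
    · exact (W_intSP hW (SP_mulu (SP_conju (gg_mem (mW W0) n)) (gg_mem (mW W) n))).const_mul _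
  have n1 : ‖∫ y, (W0 y • (((P x - P y : ℝ) : ℂ) * (kk (mW W0) (n+1) x y * g y))) ∂cI‖ ≤ Λ * ‖f x‖ * ((1 + 1/c0)/2) := by
    refine (norm_integral_le_of_norm_le (i1.const_mul (Λ * ‖f x‖)) (ae_of_all _ fun y => ?_)).trans ?_
    · rw [norm_smul, norm_mul, norm_mul, Real.norm_of_nonneg (h0.nonneg y), Complex.norm_real, Real.norm_eq_abs]
      have l := h.lip x y
      have cd := kk_cd2 h0.gm n x y
      have hk : |P x - P y| * ‖kk (mW W0) (n+1) x y‖ ≤ Λ * (‖f x‖ * ‖f y‖) := by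
        calc _ ≤ (Λ * |sin (x - y)|) * ‖kk (mW W0) (n+1) x y‖ := by gcongr
          _ = Λ * (|sin (x - y)| * ‖kk (mW W0) (n+1) x y‖) := by ring
          _ ≤ _ := mul_le_mul_of_nonneg_left cd h.Λ0
      have := h0.nonneg y
      calc _ = W0 y * ((|P x - P y| * ‖kk (mW W0) (n+1) x y‖) * ‖g y‖) := by ring
        _ ≤ W0 y * ((Λ * (‖f x‖ * ‖f y‖)) * ‖g y‖) := by gcongr
        _ = _ := by ring
    · rw [integral_const_mul]
      exact mul_le_mul_of_nonneg_left b1 (mul_nonneg h.Λ0 (norm_nonneg _))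
  have n2 : ‖∫ y, W y • ((starRingEnd ℂ) (f y) * g y) ∂cI‖ ≤ (c1 + 1)/2 := by
    refine (norm_integral_le_of_norm_le i3 (ae_of_all _ fun y => ?_)).trans b2
    rw [norm_smul, norm_mul, RCLike.norm_conj, Real.norm_of_nonneg (hW.nonneg y)]
  have fin : P x * ‖g x‖ ≤ Λ * ‖f x‖ * ((1 + 1/c0)/2) + ‖f x‖ * ((c1 + 1)/2) := by
    have := congrArg norm hsplit
    rw [norm_mul, Complex.norm_real, Real.norm_of_nonneg (h.pos x).le] at this
    rw [this, hB]
    refine (norm_add_le _ _).trans (add_le_add n1 ?_)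
    rw [norm_mul]; gcongr
  rw [div_mul_eq_mul_div, le_div_iff₀ hc0]
  have := mul_le_mul_of_nonneg_right (h.lo x) (norm_nonneg (g x))
  linarith

lemma gg_bd {P : ℝ → ℝ} {c0 c1 Λ : ℝ} (h : PF P c0 c1 Λ) {a b : ℝ} (ha : -(1/2) < a) (hb : -(1/2) < b) : ∃ C : ℝ, 0 ≤ C ∧ ∀ n : ℕ, 1 ≤ n → ∀ x,
    ‖gg (mW (Wt P a b)) n x‖ ≤ C * om a b n x := by
  obtain ⟨C, hC, H⟩ := pure_bd ha hb
  have h1 := h.c0pos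
  have h2 := h.c1pos
  have h3 := h.Λ0
  refine ⟨(Λ * (1 + 1/c0) / 2 + (c1 + 1) / 2) / c0 * C, by positivity, fun n hn x => ?_⟩
  refine (korous h ha hb n x).trans ?_
  rw [mul_assoc]
  gcongr
  exact H n hn x

lemma near1 {μ : Measure ℝ} [SFinite μ] {p q : ℝ} (hpq : p.HolderConjugate q) {k : ℝ → ℝ → ℝ≥0∞}
    (hk : Measurable (Function.uncurry k)) {N : Set ℝ} (hN : MeasurableSet N) {A : ℝ≥0∞}
    (hA : ∀ x ∈ N, ∫⁻ y, k x y ^ q ∂μ ≤ A) {f : ℝ → ℝ≥0∞} (hf : Measurable f) :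
    ∫⁻ x in N, (∫⁻ y, k x y * f y ∂μ) ^ p ∂μ ≤ A ^ (p / q) * μ N * ∫⁻ y, f y ^ p ∂μ := by
  have hp0 := hpq.pos
  have hq0 := hpq.symm.pos
  have h : ∀ x ∈ N, (∫⁻ y, k x y * f y ∂μ) ^ p ≤ A ^ (p / q) * ∫⁻ y, f y ^ p ∂μ := by
    intro x hx
    have hkx : Measurable (k x) := hk.of_uncurry_left
    have h1 := ENNReal.lintegral_mul_le_Lp_mul_Lq μ hpq.symm hkx.aemeasurable hf.aemeasurable
    calc _ ≤ ((∫⁻ y, k x y ^ q ∂μ) ^ (1 / q) * (∫⁻ y, f y ^ p ∂μ) ^ (1 / p)) ^ p :=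
          ENNReal.rpow_le_rpow h1 hp0.le
      _ = (∫⁻ y, k x y ^ q ∂μ) ^ (p / q) * ∫⁻ y, f y ^ p ∂μ := by
          rw [ENNReal.mul_rpow_of_nonneg _ _ hp0.le, ← ENNReal.rpow_mul, ← ENNReal.rpow_mul,
            one_div_mul_cancel hp0.ne', ENNReal.rpow_one, one_div_mul_eq_div]
      _ ≤ _ := by
          gcongr
          exact hA x hx
  calc _ ≤ ∫⁻ x in N, A ^ (p / q) * ∫⁻ y, f y ^ p ∂μ ∂μ := setLIntegral_mono' hN h
    _ = _ := by
      rw [lintegral_const, Measure.restrict_apply_univ]; ring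

lemma near2 {μ : Measure ℝ} [SFinite μ] {p q : ℝ} (hpq : p.HolderConjugate q) {k : ℝ → ℝ → ℝ≥0∞}
    (hk : Measurable (Function.uncurry k)) (hs : ∀ x y, k x y = k y x) {N : Set ℝ} (hN : MeasurableSet N) {B : ℝ≥0∞}
    (hB : ∀ x ∈ N, ∫⁻ y, k x y ^ p ∂μ ≤ B) {f : ℝ → ℝ≥0∞} (hf : Measurable f) :
    ∫⁻ x, (∫⁻ y in N, k x y * f y ∂μ) ^ p ∂μ ≤ μ N ^ (p / q) * B * ∫⁻ y, f y ^ p ∂μ := by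
  have hp0 := hpq.pos
  have hq0 := hpq.symm.pos
  have h : ∀ x, (∫⁻ y in N, k x y * f y ∂μ) ^ p ≤ μ N ^ (p / q) * ∫⁻ y in N, (k x y * f y) ^ p ∂μ := by
    intro x
    have hkx : Measurable (k x) := hk.of_uncurry_left
    have h1 := ENNReal.lintegral_mul_le_Lp_mul_Lq (μ.restrict N) hpq.symm
      (f := fun _ => 1) (g := fun y => k x y * f y) aemeasurable_const (hkx.mul hf).aemeasurable
    simp only [Pi.mul_apply, one_mul, ENNReal.one_rpow, lintegral_const, Measure.restrict_apply_univ] at h1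
    calc _ ≤ _ := ENNReal.rpow_le_rpow h1 hp0.le
      _ = _ := by
          rw [ENNReal.mul_rpow_of_nonneg _ _ hp0.le, ← ENNReal.rpow_mul, ← ENNReal.rpow_mul,
            one_div_mul_cancel hp0.ne', ENNReal.rpow_one, one_div_mul_eq_div]
  have hm : Measurable (fun z : ℝ × ℝ => (k z.1 z.2 * f z.2) ^ p) := by
    have : Measurable (fun z : ℝ × ℝ => k z.1 z.2) := hk
    fun_prop
  calc _ ≤ ∫⁻ x, μ N ^ (p / q) * ∫⁻ y in N, (k x y * f y) ^ p ∂μ ∂μ := lintegral_mono h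
    _ = μ N ^ (p / q) * ∫⁻ x, ∫⁻ y in N, (k x y * f y) ^ p ∂μ ∂μ := by
        rw [lintegral_const_mul]
        exact hm.lintegral_prod_right'
    _ = μ N ^ (p / q) * ∫⁻ y in N, ∫⁻ x, (k x y * f y) ^ p ∂μ ∂μ := by
        rw [lintegral_lintegral_swap]
        exact hm.aemeasurable
    _ ≤ μ N ^ (p / q) * ∫⁻ y in N, B * f y ^ p ∂μ := by
        refine mul_le_mul_right (setLIntegral_mono' hN fun y hy => ?_) _
        simp_rw [ENNReal.mul_rpow_of_nonneg _ _ hp0.le]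
        have : Measurable fun x => k x y ^ p := by
          have : Measurable fun x => k x y := hk.of_uncurry_right
          fun_prop
        rw [lintegral_mul_const _ this]
        gcongr
        simp_rw [hs _ y]
        exact hB y hy
    _ ≤ μ N ^ (p / q) * ∫⁻ y, B * f y ^ p ∂μ := by
        gcongr; exact Measure.restrict_le_self
    _ = _ := by
        rw [lintegral_const_mul _ (by fun_prop)]; ring

lemma wt_bds {P : ℝ → ℝ} {c0 c1 Λ : ℝ} (h : PF P c0 c1 Λ) (e : ℝ) (x : ℝ) : P x ^ e ≤ c0 ^ e + c1 ^ e := by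
  have h0 := h.c0pos
  have h1 := h.c1pos
  have hx := h.pos x
  have a0 : 0 < c0 ^ e := by positivity
  have a1 : 0 < c1 ^ e := by positivity
  rcases le_total 0 e with he | he
  · have := Real.rpow_le_rpow hx.le (h.hi x) he; linarith
  · have := Real.rpow_le_rpow_of_nonpos h0 (h.lo x) he; linarith

/-- pointwise bound of the first factor -/
lemma far_A {P : ℝ → ℝ} {c0 c1 Λ : ℝ} (h : PF P c0 c1 Λ) {a b p : ℝ} (hp : 0 < p) {D : ℝ} (hD : 0 ≤ D) {x A : ℝ}
    (hA0 : 0 ≤ A) (hx : sin x ≠ 0) (hx' : cos x ≠ 0) (hA : A ^ 2 * Wt P a b x ≤ D) :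
    (A / rho (2*a*(1/p-1/2)) (2*b*(1/p-1/2)) x) ^ p * Wt P a b x ≤ D ^ (p/2) * (c0 ^ (1 - p/2) + c1 ^ (1-p/2)) := by
  have hP := h.pos x
  have hR : 0 < rho (2*a) (2*b) x := rho_pos hx hx'
  have hs : rho (2*a*(1/p-1/2)) (2*b*(1/p-1/2)) x = rho (2*a) (2*b) x ^ (1/p-1/2) := by
    unfold rho
    rw [Real.mul_rpow (by positivity) (by positivity), ← Real.rpow_mul (abs_nonneg _), ← Real.rpow_mul (abs_nonneg _)]
  rw [hs]
  have hW : Wt P a b x = P x * rho (2*a) (2*b) x := rfl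
  rw [hW] at hA ⊢
  generalize rho (2*a) (2*b) x = R at *
  have h1 : (A ^ 2 * (P x * R)) ^ (p/2) ≤ D ^ (p/2) := Real.rpow_le_rpow (by positivity) hA (by positivity)
  have h2 := wt_bds h (1 - p/2) x
  calc (A / R ^ (1/p-1/2)) ^ p * (P x * R) = (A ^ 2 * (P x * R)) ^ (p/2) * P x ^ (1 - p/2) := by
        rw [Real.div_rpow hA0 (by positivity), Real.mul_rpow (by positivity) (by positivity),
          Real.mul_rpow (by positivity) (by positivity), ← Real.rpow_mul hR.le]
        rw [← Real.rpow_natCast A 2, ← Real.rpow_mul hA0]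
        rw [show (2:ℕ) * (p/2) = p by push_cast; ring, show (1/p-1/2)*p = 1 - p/2 by field_simp,
          Real.rpow_sub hP, Real.rpow_sub hR, Real.rpow_one, Real.rpow_one]
        have : 0 < P x ^ (p/2) := by positivity
        have : 0 < R ^ (p/2) := by positivity
        field_simp
    _ ≤ _ := by gcongr

lemma far_B {P : ℝ → ℝ} {c0 c1 Λ : ℝ} (h : PF P c0 c1 Λ) {a b p : ℝ} (hp : 0 < p) {D : ℝ} (hD : 0 ≤ D) {x A : ℝ}
    (hA0 : 0 ≤ A) (hx : sin x ≠ 0) (hx' : cos x ≠ 0) (hA : A ^ 2 * Wt P a b x ≤ D) :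
    (A * Wt P a b x * rho (2*a*(1/p-1/2)) (2*b*(1/p-1/2)) x) ^ p ≤ D ^ (p/2) * (c0 ^ (p/2-1) + c1 ^ (p/2-1)) * Wt P a b x := by
  have hP := h.pos x
  have hR : 0 < rho (2*a) (2*b) x := rho_pos hx hx'
  have hs : rho (2*a*(1/p-1/2)) (2*b*(1/p-1/2)) x = rho (2*a) (2*b) x ^ (1/p-1/2) := by
    unfold rho
    rw [Real.mul_rpow (by positivity) (by positivity), ← Real.rpow_mul (abs_nonneg _), ← Real.rpow_mul (abs_nonneg _)]
  rw [hs]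
  have hW : Wt P a b x = P x * rho (2*a) (2*b) x := rfl
  rw [hW] at hA ⊢
  generalize rho (2*a) (2*b) x = R at *
  have h1 : (A ^ 2 * (P x * R)) ^ (p/2) ≤ D ^ (p/2) := Real.rpow_le_rpow (by positivity) hA (by positivity)
  have h2 := wt_bds h (p/2-1) x
  calc (A * (P x * R) * R ^ (1/p-1/2)) ^ p = (A ^ 2 * (P x * R)) ^ (p/2) * P x ^ (p/2-1) * (P x * R) := by
        rw [Real.mul_rpow (by positivity) (by positivity), Real.mul_rpow hA0 (by positivity), Real.mul_rpow (by positivity) (by positivity),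
          Real.mul_rpow (by positivity) (by positivity),
          Real.mul_rpow (by positivity) (by positivity), ← Real.rpow_mul hR.le]
        rw [← Real.rpow_natCast A 2, ← Real.rpow_mul hA0]
        rw [show (2:ℕ) * (p/2) = p by push_cast; ring, show (1/p-1/2)*p = 1 - p/2 by field_simp,
          Real.rpow_sub hP, Real.rpow_sub hR, Real.rpow_one, Real.rpow_one]
        have e1 : P x ^ p = P x ^ (p/2) * P x ^ (p/2) := by rw [← Real.rpow_add hP]; congr 1; ring
        have e2 : R ^ p = R ^ (p/2) * R ^ (p/2) := by rw [← Real.rpow_add hR]; congr 1; ring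
        rw [e1, e2]
        have : 0 < P x ^ (p/2) := by positivity
        have : 0 < R ^ (p/2) := by positivity
        field_simp
    _ ≤ _ := by gcongr

/-- the basic far estimate -/
lemma far_basic {P : ℝ → ℝ} {c0 c1 Λ : ℝ} (h : PF P c0 c1 Λ) {a b p q : ℝ} (hpq : p.HolderConjugate q)
    (ha : -(1/2) < a) (hb : -(1/2) < b)
    (ha1 : a * (p - 2) < 1) (ha2 : a * (2 - p) < p - 1) (hb1 : b * (p - 2) < 1) (hb2 : b * (2 - p) < p - 1)
    (D : ℝ) (hD : 0 ≤ D) :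
    ∃ C : ℝ≥0∞, C ≠ ⊤ ∧ ∀ r : ℝ, 0 ≤ r → r < 1 → ∀ A B : ℝ → ℂ, Measurable A → Measurable B →
      (∀ x, ‖A x‖ ^ 2 * Wt P a b x ≤ D) → (∀ x, ‖B x‖ ^ 2 * Wt P a b x ≤ D) → ∀ f : ℝ → ℂ, Measurable f →
      ∫⁻ x, ‖∫ y, A x * ck r (x - y) * B y * f y ∂(mW (Wt P a b))‖ₑ ^ p ∂(mW (Wt P a b)) ≤
        C * ∫⁻ x, ‖f x‖ₑ ^ p ∂(mW (Wt P a b)) := by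
  have hp0 := hpq.pos
  have hq0 := hpq.symm.pos
  have hpq1 : 1 / q = 1 - 1 / p := by have : p⁻¹ + q⁻¹ = 1 := by simpa using hpq.inv_add_inv_eq_one
                                      simp only [one_div]; linarith
  have hW := h.gw ha hb
  have key : ∀ c : ℝ, c * (p - 2) < 1 → c * (2 - p) < p - 1 → -(1/p) < 2*c*(1/p-1/2) ∧ 2*c*(1/p-1/2) < 1/q := by
    intro c hc1 hc2
    rw [hpq1]
    constructor
    · rw [← sub_pos]
      have : 2*c*(1/p-1/2) - -(1/p) = (1 - c * (p-2)) / p := by field_simp; ring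
      rw [this]; apply div_pos _ hp0; linarith
    · rw [← sub_pos]
      have : 1 - 1/p - 2*c*(1/p-1/2) = (p - 1 - c * (2-p)) / p := by field_simp
      rw [this]; apply div_pos _ hp0; linarith
  obtain ⟨C, hC, H⟩ := wriesz hpq (key a ha1 ha2).1 (key a ha1 ha2).2 (key b hb1 hb2).1 (key b hb1 hb2).2
  set s := 2*a*(1/p-1/2) with hs
  set t := 2*b*(1/p-1/2) with ht
  set E1 := ENNReal.ofReal (D ^ (p/2) * (c0 ^ (1 - p/2) + c1 ^ (1-p/2))) with hE1
  set E2 := ENNReal.ofReal (D ^ (p/2) * (c0 ^ (p/2-1) + c1 ^ (p/2-1))) with hE2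
  refine ⟨E1 * (C * E2), ENNReal.mul_ne_top (by simp [hE1]) (ENNReal.mul_ne_top hC (by simp [hE2])), ?_⟩
  intro r hr0 hr A B hA hB hAD hBD f hf
  have hWm := hW.meas
  set W := Wt P a b with hWd
  set G : ℝ → ℂ := fun y => B y * f y * (W y * rho s t y : ℝ) with hG
  have hGm : Measurable G := by have := rho_meas s t; fun_prop
  set T : ℝ → ℂ := fun x => ∫ y, ((rho s t x / rho s t y : ℝ) : ℂ) * ck r (x - y) * G y ∂cI with hT
  have hTm : Measurable T := by
    apply StronglyMeasurable.measurable
    apply StronglyMeasurable.integral_prod_right (f := fun x y => ((rho s t x / rho s t y : ℝ) : ℂ) * ck r (x - y) * G y)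
    apply Measurable.stronglyMeasurable
    show Measurable fun z : ℝ × ℝ => ((rho s t z.1 / rho s t z.2 : ℝ) : ℂ) * ck r (z.1 - z.2) * G z.2
    have := rho_meas s t
    fun_prop
  have h1 : ∀ x, sin x ≠ 0 → cos x ≠ 0 → ∫ y, A x * ck r (x - y) * B y * f y ∂(mW W) = A x * ((1 / rho s t x : ℝ) : ℂ) * T x := by
    intro x hx hx'
    have hrx : rho s t x ≠ 0 := (rho_pos hx hx').ne'
    rw [mW_integral hW, hT, ← integral_const_mul]
    apply integral_congr_ae
    filter_upwards [ae_sin_ne] with y hy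
    have hry : rho s t y ≠ 0 := (rho_pos hy.1 hy.2).ne'
    simp only [hG, Complex.real_smul]
    push_cast
    have e1 : (rho s t x : ℂ) ≠ 0 := by exact_mod_cast hrx
    have e2 : (rho s t y : ℂ) ≠ 0 := by exact_mod_cast hry
    field_simp
  have hm0 : Measurable fun x => ‖∫ y, A x * ck r (x - y) * B y * f y ∂(mW W)‖ₑ ^ p := by
    have hfin := hW.fin
    have : Measurable fun x => ∫ y, A x * ck r (x - y) * B y * f y ∂(mW W) := by
      apply StronglyMeasurable.measurable
      apply StronglyMeasurable.integral_prod_right (f := fun x y => A x * ck r (x - y) * B y * f y)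
      apply Measurable.stronglyMeasurable
      show Measurable fun z : ℝ × ℝ => A z.1 * ck r (z.1 - z.2) * B z.2 * f z.2
      fun_prop
    fun_prop
  have conv : ∀ (z : ℂ) (w : ℝ), 0 ≤ w → ENNReal.ofReal w * ‖z‖ₑ ^ p = ENNReal.ofReal (‖z‖ ^ p * w) := by
    intro z w hw
    rw [mul_comm, ENNReal.ofReal_mul (by positivity), ← ofReal_norm, ENNReal.ofReal_rpow_of_nonneg (norm_nonneg _) hp0.le]
  calc _ = ∫⁻ x, ENNReal.ofReal (W x) * ‖∫ y, A x * ck r (x - y) * B y * f y ∂(mW W)‖ₑ ^ p ∂cI := mW_lintegral hW hm0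
    _ ≤ ∫⁻ x, E1 * ‖T x‖ₑ ^ p ∂cI := by
        apply lintegral_mono_ae
        filter_upwards [ae_sin_ne] with x hx
        rw [h1 x hx.1 hx.2, enorm_mul, ENNReal.mul_rpow_of_nonneg _ _ hp0.le, ← mul_assoc]
        refine mul_le_mul_left ?_ _
        rw [conv _ _ (hW.nonneg x)]
        apply ENNReal.ofReal_le_ofReal
        have := far_A h hp0 hD (norm_nonneg (A x)) hx.1 hx.2 (hAD x)
        refine le_trans (le_of_eq ?_) this
        congr 2
        rw [norm_mul, Complex.norm_real, Real.norm_of_nonneg (by have := rho_nonneg s t x; positivity)]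
        rw [mul_one_div]
    _ = E1 * ∫⁻ x, ‖T x‖ₑ ^ p ∂cI := lintegral_const_mul _ (by fun_prop)
    _ ≤ E1 * (C * ∫⁻ x, ‖G x‖ₑ ^ p ∂cI) := mul_le_mul_right (H r hr0 hr G hGm) _
    _ ≤ E1 * (C * ∫⁻ x, E2 * (ENNReal.ofReal (W x) * ‖f x‖ₑ ^ p) ∂cI) := by
        refine mul_le_mul_right (mul_le_mul_right ?_ _) _
        apply lintegral_mono_ae
        filter_upwards [ae_sin_ne] with x hx
        have e : G x = (B x * (W x * rho s t x : ℝ)) * f x := by simp only [hG]; ring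
        rw [e, enorm_mul, ENNReal.mul_rpow_of_nonneg _ _ hp0.le, ← mul_assoc]
        refine mul_le_mul_left ?_ _
        have := far_B h hp0 hD (norm_nonneg (B x)) hx.1 hx.2 (hBD x)
        rw [hE2, ← ENNReal.ofReal_mul (by have := h.c0pos; have := h.c1pos; positivity), ← ofReal_norm, ENNReal.ofReal_rpow_of_nonneg (norm_nonneg _) hp0.le]
        apply ENNReal.ofReal_le_ofReal
        refine le_trans (le_of_eq ?_) this
        congr 1
        rw [norm_mul, Complex.norm_real, Real.norm_of_nonneg (mul_nonneg (hW.nonneg x) (rho_nonneg s t x)), mul_assoc]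
    _ = _ := by
        rw [lintegral_const_mul _ (by fun_prop), mW_lintegral hW (by fun_prop)]; ring

lemma ck_reg (r u : ℝ) (hr0 : 0 ≤ r) (hr : r < 1) : ‖(1 - ex u) * ck r u‖ ≤ 2 := by
  unfold ck
  have h1 : 1 - r ≤ ‖1 - r * ex u‖ := one_sub_norm (by simp [norm_ex, abs_of_nonneg hr0])
  have h2 : 0 < ‖1 - r * ex u‖ := by linarith
  rw [norm_mul, norm_inv, ← div_eq_mul_inv, div_le_iff₀ h2]
  have h3 : 1 - ex u = (1 - r * ex u) - (1 - r : ℝ) * ex u := by push_cast; ring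
  rw [h3]
  refine (norm_sub_le _ _).trans ?_
  rw [norm_mul, norm_ex, Complex.norm_real, Real.norm_of_nonneg (by linarith)]
  linarith

lemma ck_lim (u : ℝ) (hu : ex u ≠ 1) : Tendsto (fun m : ℕ => (1 - ex u) * ck (1 - 1/((m:ℝ)+1)) u) atTop (nhds 1) := by
  have h0 : Tendsto (fun m : ℕ => (1 - 1/((m:ℝ)+1))) atTop (nhds 1) := by
    simpa using (tendsto_one_div_add_atTop_nhds_zero_nat (𝕜 := ℝ)).const_sub 1
  have hc : ContinuousAt (fun r : ℝ => (1 - ex u) * (1 - (r:ℂ) * ex u)⁻¹) 1 := by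
    apply ContinuousAt.mul continuousAt_const
    apply ContinuousAt.inv₀ (by fun_prop)
    simp only [Complex.ofReal_one, one_mul]
    exact sub_ne_zero.2 hu.symm
  have := hc.tendsto.comp h0
  simp only [Complex.ofReal_one, one_mul] at this
  rw [mul_inv_cancel₀ (sub_ne_zero.2 hu.symm)] at this
  exact this

lemma ex_one_ae (x : ℝ) : ∀ᵐ y ∂cI, ex (x - y) ≠ 1 := by
  unfold cI
  apply ae_restrict_of_ae
  have h1 : {y : ℝ | ¬ (ex (x - y) ≠ 1)} ⊆ range (fun n : ℤ => x - (n : ℝ) * (2 * π)) := by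
    intro y hy
    simp only [mem_ofPred_eq, ne_eq, not_not] at hy
    have : Complex.exp ((x - y : ℝ) * Complex.I) = 1 := hy
    rw [Complex.exp_eq_one_iff] at this
    obtain ⟨n, hn⟩ := this
    refine ⟨n, ?_⟩
    have h2 : ((x - y : ℝ) : ℂ) = ((n * (2 * π) : ℝ) : ℂ) := by
      have := mul_right_cancel₀ Complex.I_ne_zero (hn.trans (by push_cast; ring : _ = ((n * (2 * π) : ℝ) : ℂ) * Complex.I))
      exact this
    have h3 : x - y = n * (2 * π) := by exact_mod_cast h2
    simp only
    linarith
  exact measure_mono_null h1 ((countable_range _).measure_zero _)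

lemma mW_ac (W : ℝ → ℝ) : mW W ≪ cI := withDensity_absolutelyContinuous _ _

theorem far_thm {P : ℝ → ℝ} {c0 c1 Λ : ℝ} (h : PF P c0 c1 Λ) {a b p q : ℝ} (hpq : p.HolderConjugate q)
    (ha : -(1/2) < a) (hb : -(1/2) < b)
    (ha1 : a * (p - 2) < 1) (ha2 : a * (2 - p) < p - 1) (hb1 : b * (p - 2) < 1) (hb2 : b * (2 - p) < p - 1)
    (D : ℝ) (hD : 0 ≤ D) :
    ∃ C : ℝ≥0∞, C ≠ ⊤ ∧ ∀ (n : ℕ) (N : Set ℝ), MeasurableSet N →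
      (∀ x ∈ N, ‖gg (mW (Wt P a b)) n x‖ ^ 2 * Wt P a b x ≤ D) → ∀ f : ℝ → ℂ, Measurable f →
      ∫⁻ x, ‖f x‖ₑ ^ p ∂(mW (Wt P a b)) ≠ ⊤ →
      ∫⁻ x in N, ‖∫ y in N, KK (mW (Wt P a b)) n x y * f y ∂(mW (Wt P a b))‖ₑ ^ p ∂(mW (Wt P a b)) ≤
        C * ∫⁻ x, ‖f x‖ₑ ^ p ∂(mW (Wt P a b)) := by
  have hp1 := hpq.lt
  have hp0 := hpq.pos
  have hW := h.gw ha hb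
  have hfin := hW.fin
  obtain ⟨C, hC, H⟩ := far_basic h hpq ha hb ha1 ha2 hb1 hb2 D hD
  set W := Wt P a b with hWd
  set μ := mW W with hμ
  have h2p : (2 : ℝ≥0∞) ^ p ≠ ⊤ := ENNReal.rpow_ne_top_of_nonneg (by linarith) (by simp)
  refine ⟨2 ^ p * (C + C), ENNReal.mul_ne_top h2p (by simp [hC]), ?_⟩
  intro n N hN hg f hf hfp
  have hfi : Integrable f μ := int_of_Lp hp1 hf hfp
  set g := gg μ n with hgd
  have hgc : Continuous g := gg_cont μ n
  set A1 : ℝ → ℂ := N.indicator fun x => (starRingEnd ℂ) (g x)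
  set B1 : ℝ → ℂ := N.indicator g
  set A2 : ℝ → ℂ := N.indicator fun x => g x * ex x
  set B2 : ℝ → ℂ := N.indicator fun y => ex (-y) * (starRingEnd ℂ) (g y)
  have mA1 : Measurable A1 := Measurable.indicator (by fun_prop) hN
  have mB1 : Measurable B1 := Measurable.indicator (by fun_prop) hN
  have mA2 : Measurable A2 := Measurable.indicator (by fun_prop) hN
  have mB2 : Measurable B2 := Measurable.indicator (by fun_prop) hN
  have bd : ∀ F : ℝ → ℂ, (∀ x, ‖F x‖ = ‖g x‖) → ∀ x, ‖N.indicator F x‖ ^ 2 * W x ≤ D := by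
    intro F hF x
    by_cases hx : x ∈ N
    · rw [indicator_of_mem hx, hF]; exact hg x hx
    · rw [indicator_of_notMem hx]; simpa using hD
  have bA1 := bd (fun x => (starRingEnd ℂ) (g x)) (fun x => RCLike.norm_conj _)
  have bB1 := bd g (fun x => rfl)
  have bA2 := bd (fun x => g x * ex x) (fun x => by rw [norm_mul, norm_ex, mul_one])
  have bB2 := bd (fun y => ex (-y) * (starRingEnd ℂ) (g y)) (fun x => by rw [norm_mul, norm_ex, one_mul, RCLike.norm_conj])
  have bdd : ∀ F : ℝ → ℂ, Continuous F → (∀ x, ‖F x‖ = ‖g x‖) → ∃ c : ℝ, ∀ x, ‖N.indicator F x‖ ≤ c := by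
    intro F hF hF'
    obtain ⟨c, hc⟩ := SP_bdd (gg_mem μ n)
    refine ⟨c, fun x => (norm_indicator_le_norm_self _ _).trans ?_⟩
    rw [hF']; exact hc x
  obtain ⟨d1, hd1⟩ := bdd g hgc (fun x => rfl)
  obtain ⟨d2, hd2⟩ := bdd (fun y => ex (-y) * (starRingEnd ℂ) (g y)) (by fun_prop) (fun x => by rw [norm_mul, norm_ex, one_mul, RCLike.norm_conj])
  let J : ℝ → ℝ → ℂ := fun r x => ∫ y, A1 x * ck r (x - y) * B1 y * f y ∂μ - ∫ y, A2 x * ck r (x - y) * B2 y * f y ∂μ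
  have Jint : ∀ r, 0 ≤ r → r < 1 → ∀ x (A : ℝ → ℂ) (B : ℝ → ℂ), Measurable B → (∃ c, ∀ y, ‖B y‖ ≤ c) →
      Integrable (fun y => A x * ck r (x - y) * B y * f y) μ := by
    intro r hr0 hr x A B hB ⟨c, hc⟩
    apply hfi.bdd_mul (c := ‖A x‖ * (1 - r)⁻¹ * c) (Measurable.aestronglyMeasurable (by fun_prop))
    refine ae_of_all _ fun y => ?_
    rw [norm_mul, norm_mul]
    have := ck_bound hr0 hr (x - y)
    have := hc y
    have : 0 < 1 - r := by linarith
    gcongr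
  have Jm : ∀ r, 0 ≤ r → r < 1 → ∀ (A B : ℝ → ℂ), Measurable A → Measurable B →
     Measurable (fun x => ∫ y, A x * ck r (x - y) * B y * f y ∂μ) := by
    intro r _ _ A B hA hB
    apply StronglyMeasurable.measurable
    apply StronglyMeasurable.integral_prod_right (f := fun x y => A x * ck r (x - y) * B y * f y)
    apply Measurable.stronglyMeasurable
    show Measurable fun z : ℝ × ℝ => A z.1 * ck r (z.1 - z.2) * B z.2 * f z.2
    fun_prop
  have Jbd : ∀ r, 0 ≤ r → r < 1 → ∫⁻ x, ‖J r x‖ₑ ^ p ∂μ ≤ 2 ^ p * (C + C) * ∫⁻ x, ‖f x‖ₑ ^ p ∂μ := by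
    intro r hr0 hr
    have m1 := Jm r hr0 hr A1 B1 mA1 mB1
    have m2 := Jm r hr0 hr A2 B2 mA2 mB2
    calc _ ≤ ∫⁻ x, 2 ^ p * (‖∫ y, A1 x * ck r (x - y) * B1 y * f y ∂μ‖ₑ ^ p + ‖∫ y, A2 x * ck r (x - y) * B2 y * f y ∂μ‖ₑ ^ p) ∂μ := by
          apply lintegral_mono
          intro x
          refine le_trans (ENNReal.rpow_le_rpow enorm_sub_le hp0.le) (rpow_add2 hp1.le _ _)
      _ = 2 ^ p * ((∫⁻ x, ‖∫ y, A1 x * ck r (x - y) * B1 y * f y ∂μ‖ₑ ^ p ∂μ) + (∫⁻ x, ‖∫ y, A2 x * ck r (x - y) * B2 y * f y ∂μ‖ₑ ^ p ∂μ)) := by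
          rw [lintegral_const_mul _ (by fun_prop), lintegral_add_left (by fun_prop)]
      _ ≤ 2 ^ p * ((C * ∫⁻ x, ‖f x‖ₑ ^ p ∂μ) + (C * ∫⁻ x, ‖f x‖ₑ ^ p ∂μ)) := by
          refine mul_le_mul_right (add_le_add ?_ ?_) _
          · exact H r hr0 hr A1 B1 mA1 mB1 bA1 bB1 f hf
          · exact H r hr0 hr A2 B2 mA2 mB2 bA2 bB2 f hf
      _ = _ := by ring
  have hgm := hW.gm
  have Jeq : ∀ r, 0 ≤ r → r < 1 → ∀ x ∈ N, J r x = ∫ y in N, (1 - ex (x - y)) * ck r (x - y) * KK μ n x y * f y ∂μ := by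
    intro r hr0 hr x hx
    show _ - _ = _
    rw [← integral_sub (Jint r hr0 hr x A1 B1 mB1 ⟨d1, hd1⟩) (Jint r hr0 hr x A2 B2 mB2 ⟨d2, hd2⟩), ← integral_indicator hN]
    congr 1
    ext y
    by_cases hy : y ∈ N
    · simp only [A1, A2, B1, B2, indicator_of_mem hx, indicator_of_mem hy]
      have e := KK_cd hgm n x y
      have e2 : ex (x - y) = ex x * ex (-y) := by rw [← ex_add]; rfl
      have e3 : (1 - ex (x - y)) * ck r (x - y) * KK μ n x y * f y = ((1 - ex (x - y)) * KK μ n x y) * (ck r (x - y) * f y) := by ring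
      rw [e3, e, e2]; ring
    · simp only [B1, B2, indicator_of_notMem hy]; simp
  have Jlim : ∀ x ∈ N, Tendsto (fun m : ℕ => J (1 - 1/((m:ℝ)+1)) x) atTop (nhds (∫ y in N, KK μ n x y * f y ∂μ)) := by
    intro x hx
    have hr0 : ∀ m : ℕ, 0 ≤ 1 - 1/((m:ℝ)+1) := fun m => by
      rw [sub_nonneg, div_le_one (by positivity)]; linarith [(Nat.cast_nonneg m : (0:ℝ) ≤ m)]
    have hr1 : ∀ m : ℕ, 1 - 1/((m:ℝ)+1) < 1 := fun m => by
      have : 0 < 1/((m:ℝ)+1) := by positivity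
      linarith
    simp_rw [fun m : ℕ => Jeq _ (hr0 m) (hr1 m) x hx]
    obtain ⟨c, hc⟩ := SP_bdd (KK_mem μ n x)
    have kc : Continuous fun y => KK μ n x y := SP_cont (KK_mem μ n x)
    apply tendsto_integral_of_dominated_convergence (fun y => 2 * c * ‖f y‖)
    · intro m
      exact Measurable.aestronglyMeasurable (by fun_prop)
    · exact (hfi.restrict.norm.const_mul _)
    · intro m
      refine ae_of_all _ fun y => ?_
      rw [norm_mul, norm_mul]
      have h1 := ck_reg _ (x - y) (hr0 m) (hr1 m)
      have h2 := hc y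
      gcongr
    · have : ∀ᵐ y ∂(μ.restrict N), ex (x - y) ≠ 1 := ae_restrict_of_ae ((mW_ac W) (ex_one_ae x))
      filter_upwards [this] with y hy
      have := (ck_lim (x - y) hy).mul_const (KK μ n x y * f y)
      simpa [mul_assoc] using this
  calc _ = ∫⁻ x in N, liminf (fun m : ℕ => ‖J (1 - 1/((m:ℝ)+1)) x‖ₑ ^ p) atTop ∂μ := by
        apply setLIntegral_congr_fun hN
        intro x hx
        have := ((ENNReal.continuous_rpow_const (y := p)).tendsto _).comp ((Jlim x hx).enorm)
        exact this.liminf_eq.symm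
    _ ≤ liminf (fun m : ℕ => ∫⁻ x in N, ‖J (1 - 1/((m:ℝ)+1)) x‖ₑ ^ p ∂μ) atTop := by
        apply lintegral_liminf_le'
        intro m
        have hr0 : 0 ≤ 1 - 1/((m:ℝ)+1) := by
          rw [sub_nonneg, div_le_one (by positivity)]; linarith [(Nat.cast_nonneg m : (0:ℝ) ≤ m)]
        have hr1 : 1 - 1/((m:ℝ)+1) < 1 := by
          have : 0 < 1/((m:ℝ)+1) := by positivity
          linarith
        have m1 := Jm _ hr0 hr1 A1 B1 mA1 mB1
        have m2 := Jm _ hr0 hr1 A2 B2 mA2 mB2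
        have : Measurable fun x => J (1 - 1/((m:ℝ)+1)) x := m1.sub m2
        exact Measurable.aemeasurable (by fun_prop)
    _ ≤ _ := by
        refine liminf_le_of_le (by isBoundedDefault) ?_
        intro c hc
        obtain ⟨m, hm⟩ := hc.exists
        refine hm.trans (le_trans (lintegral_mono' Measure.restrict_le_self le_rfl) (Jbd _ ?_ ?_))
        · rw [sub_nonneg, div_le_one (by positivity)]; linarith [(Nat.cast_nonneg m : (0:ℝ) ≤ m)]
        · have : 0 < 1/((m:ℝ)+1) := by positivity
          linarith

structure SK (σ κ : ℝ → ℝ) : Prop where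
  ms : Measurable σ
  mka : Measurable κ
  s0 : ∀ x, 0 ≤ σ x
  k0 : ∀ x, 0 ≤ κ x
  s1 : ∀ x, σ x ≤ 1
  k1 : ∀ x, κ x ≤ 1
  sk : ∀ x, 1 ≤ σ x + κ x
  lip : ∀ x y, σ y ≤ σ x + |sin (x - y)|
  pos : ∀ᵐ x ∂cI, 0 < σ x ∧ 0 < κ x
  ls : ∀ φ : ℝ → ℝ≥0∞, Measurable φ → (∀ u v, 0 < u → u ≤ v → φ v ≤ φ u) →
    ∫⁻ y, φ (σ y) ∂cI ≤ ENNReal.ofReal (2 * π) * ∫⁻ v in Ioc 0 1, φ v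
  lk : ∀ φ : ℝ → ℝ≥0∞, Measurable φ → (∀ u v, 0 < u → u ≤ v → φ v ≤ φ u) →
    ∫⁻ y, φ (κ y) ∂cI ≤ ENNReal.ofReal (2 * π) * ∫⁻ v in Ioc 0 1, φ v

lemma sc_ge (x : ℝ) : 1 ≤ |sin x| + |cos x| := by
  have h := sin_sq_add_cos_sq x
  have h1 := abs_sin_le_one x
  have h2 := abs_cos_le_one x
  rw [← sq_abs (sin x), ← sq_abs (cos x)] at h
  nlinarith [abs_nonneg (sin x), abs_nonneg (cos x)]

lemma SK1 : SK (fun x => |sin x|) (fun x => |cos x|) where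
  ms := by fun_prop
  mka := by fun_prop
  s0 := fun x => abs_nonneg _
  k0 := fun x => abs_nonneg _
  s1 := abs_sin_le_one
  k1 := abs_cos_le_one
  sk := sc_ge
  lip := fun x y => by rw [abs_sin_sub_comm]; exact abs_sin_le_add y x
  pos := by filter_upwards [ae_sin_ne] with x hx; exact ⟨abs_pos.2 hx.1, abs_pos.2 hx.2⟩
  ls := lint_sin
  lk := lint_cos

lemma SK2 : SK (fun x => |cos x|) (fun x => |sin x|) where
  ms := by fun_prop
  mka := by fun_prop
  s0 := fun x => abs_nonneg _
  k0 := fun x => abs_nonneg _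
  s1 := abs_cos_le_one
  k1 := abs_sin_le_one
  sk := fun x => by rw [add_comm]; exact sc_ge x
  lip := fun x y => by rw [abs_sin_sub_comm]; exact abs_cos_le_add y x
  pos := by filter_upwards [ae_sin_ne] with x hx; exact ⟨abs_pos.2 hx.2, abs_pos.2 hx.1⟩
  ls := lint_cos
  lk := lint_sin

lemma sum_pow {s : ℝ} (hs0 : 0 < s) (hs1 : s ≤ 1) (n : ℕ) :
    ∑ j ∈ Finset.range n, ((j:ℝ)+1) ^ (s - 1) ≤ (n:ℝ) ^ s / s := by
  induction n with
  | zero => simp [Real.zero_rpow hs0.ne']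
  | succ n ih =>
    rw [Finset.sum_range_succ]
    have hn : (0:ℝ) < (n:ℝ) + 1 := by positivity
    have h1 := rpow_one_add_le_one_add_mul_self (s := -(1/((n:ℝ)+1))) (p := s)
      (by rw [neg_le_neg_iff, div_le_one hn]; linarith [(Nat.cast_nonneg n : (0:ℝ) ≤ n)]) hs0.le hs1
    have h2 : (1 + -(1/((n:ℝ)+1))) = n / (n+1) := by field_simp; ring
    rw [h2, Real.div_rpow (by positivity) hn.le] at h1
    have h3 : 0 < ((n:ℝ)+1) ^ s := by positivity
    have h4 : (n:ℝ) ^ s ≤ ((n:ℝ)+1) ^ s - s * ((n:ℝ)+1) ^ (s - 1) := by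
      rw [div_le_iff₀ h3] at h1
      rw [Real.rpow_sub hn, Real.rpow_one]
      refine h1.trans (le_of_eq ?_)
      field_simp
      ring
    push_cast
    calc _ ≤ (n:ℝ) ^ s / s + ((n:ℝ)+1) ^ (s - 1) := by linarith
      _ ≤ (((n:ℝ)+1) ^ s - s * ((n:ℝ)+1) ^ (s - 1)) / s + ((n:ℝ)+1) ^ (s - 1) := by gcongr
      _ = _ := by field_simp; ring

/-- the kernel bound for `x` close to the singular point -/
lemma near_ker {σ κ : ℝ → ℝ} (hS : SK σ κ) {μ : Measure ℝ} (hμ : GM μ) {a b C : ℝ} (ha : -(1/2) < a) (ha0 : a < 0) (hb : 0 ≤ b) (hC : 0 ≤ C)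
    (hg : ∀ n : ℕ, 1 ≤ n → ∀ x, ‖gg μ n x‖ ≤ C * ((σ x + 1/n) ^ (-a) * (κ x + 1/n) ^ (-b))) :
    ∃ C' : ℝ, 0 ≤ C' ∧ ∀ n : ℕ, 1 ≤ n → ∀ x, σ x < 1/n → ∀ y,
      ‖KK μ n x y‖ ≤ C' * ((1/n:ℝ) ^ (-a) * (σ y + 1/n) ^ (-a-1) * (κ y + 1/n) ^ (-b)) := by
  obtain ⟨c00, hc00⟩ := SP_bdd (gg_mem μ 0)
  have hc0 : 0 ≤ c00 := (norm_nonneg _).trans (hc00 0)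
  have s0 : 0 < 1 + 2 * a := by linarith
  have hkey : ∀ j n : ℕ, 1 ≤ j → j ≤ n → ∀ x, σ x ≤ 2/n → ‖gg μ j x‖ ≤ 3 * C * 3 ^ b * (1/j:ℝ) ^ (-a) := by
    intro j n hj hjn x hx
    have hj0 : (0:ℝ) < j := by positivity
    have hn0 : (0:ℝ) < n := by have := hj.trans hjn; positivity
    have hjn' : (j:ℝ) ≤ n := by exact_mod_cast hjn
    refine (hg j hj x).trans ?_
    have h1 : (σ x + 1/j) ^ (-a) ≤ 3 * (1/j:ℝ) ^ (-a) := by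
      have e : σ x + 1/j ≤ 3 * (1/j) := by
        have : (2:ℝ)/n ≤ 2/j := by gcongr
        have e2 : (3:ℝ) * (1/j) = 2/j + 1/j := by ring
        rw [e2]; linarith
      refine (Real.rpow_le_rpow (by have := hS.s0 x; positivity) e (by linarith)).trans ?_
      rw [Real.mul_rpow (by norm_num) (by positivity)]
      gcongr
      calc (3:ℝ) ^ (-a) ≤ 3 ^ (1:ℝ) := Real.rpow_le_rpow_of_exponent_le (by norm_num) (by linarith)
        _ = 3 := by simp
    have h2 : 1/3 ≤ κ x + 1/j := by
      rcases le_or_gt j 3 with h | h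
      · have h' : (j:ℝ) ≤ 3 := by exact_mod_cast h
        have : (1:ℝ)/3 ≤ 1/j := by gcongr
        linarith [hS.k0 x]
      · have h' : (4:ℝ) ≤ n := by exact_mod_cast (by omega : 4 ≤ n)
        have : (2:ℝ)/n ≤ 2/4 := by gcongr
        have : (0:ℝ) < 1/j := by positivity
        linarith [hS.sk x]
    have h3 : (κ x + 1/j) ^ (-b) ≤ 3 ^ b := by
      refine (Real.rpow_le_rpow_of_nonpos (by norm_num) h2 (by linarith)).trans (le_of_eq ?_)
      rw [one_div, Real.inv_rpow (by norm_num), Real.rpow_neg (by norm_num), inv_inv]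
    calc _ ≤ C * ((3 * (1/j:ℝ) ^ (-a)) * 3 ^ b) := by
          have := hS.s0 x; have := hS.k0 x
          gcongr
      _ = _ := by ring
  set M := 3 * C * 3 ^ b with hM
  have hM0 : 0 ≤ M := by positivity
  refine ⟨2 * (c00 ^ 2 + M ^ 2 / (1 + 2*a)) * 3 * 2 ^ b + 6 * M * C, by positivity, ?_⟩
  intro n hn x hx y
  have hn0 : (0:ℝ) < n := by positivity
  have hn1 : (1:ℝ) ≤ n := by exact_mod_cast hn
  set τ : ℝ := 1/n with hτ
  have hτ0 : 0 < τ := by positivity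
  have hτ1 : τ ≤ 1 := by rw [hτ, div_le_one hn0]; exact hn1
  have hsy := hS.s0 y
  have hky := hS.k0 y
  have hx2 : σ x ≤ 2/n := by rw [show (2:ℝ)/n = 2 * τ by rw [hτ]; ring]; linarith
  have pos1 : 0 ≤ τ ^ (-a) * (σ y + τ) ^ (-a-1) * (κ y + τ) ^ (-b) := by positivity
  rcases le_or_gt (σ y) (2 * τ) with hy | hy
  · have hy2 : σ y ≤ 2/n := by rw [show (2:ℝ)/n = 2 * τ by rw [hτ]; ring]; linarith
    have hsum : ∑ j ∈ Finset.range (n+1), ‖gg μ j x‖ * ‖gg μ j y‖ ≤ (c00 ^ 2 + M ^ 2 / (1 + 2*a)) * (n:ℝ) ^ (1 + 2*a) := by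
      rw [Finset.sum_range_succ']
      have h0 : ‖gg μ 0 x‖ * ‖gg μ 0 y‖ ≤ c00 ^ 2 := by
        rw [sq]; gcongr
        · exact hc00 x
        · exact hc00 y
      have h1 : ∑ j ∈ Finset.range n, ‖gg μ (j+1) x‖ * ‖gg μ (j+1) y‖ ≤ ∑ j ∈ Finset.range n, M ^ 2 * ((j:ℝ)+1) ^ (1 + 2 * a - 1) := by
        apply Finset.sum_le_sum
        intro j hj
        have hj' := Finset.mem_range.1 hj
        calc _ ≤ (M * (1/((j+1:ℕ):ℝ)) ^ (-a)) * (M * (1/((j+1:ℕ):ℝ)) ^ (-a)) := by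
              gcongr
              · exact hkey (j+1) n (by omega) (by omega) x hx2
              · exact hkey (j+1) n (by omega) (by omega) y hy2
          _ = _ := by
              have : (0:ℝ) < (j:ℝ)+1 := by positivity
              push_cast
              rw [one_div, Real.inv_rpow this.le, ← Real.rpow_neg this.le, neg_neg,
                show 1 + 2 * a - 1 = a + a by ring, Real.rpow_add this]
              ring
      have h2 := sum_pow s0 (by linarith) n
      have h3 : 1 ≤ (n:ℝ) ^ (1 + 2*a) := Real.one_le_rpow hn1 s0.le
      calc _ ≤ (M ^ 2 * ((n:ℝ) ^ (1 + 2*a) / (1 + 2*a))) + c00 ^ 2 * (n:ℝ) ^ (1 + 2*a) := by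
            apply add_le_add
            · refine h1.trans ?_
              rw [← Finset.mul_sum]; gcongr
            · refine h0.trans ?_
              exact le_mul_of_one_le_right (by positivity) h3
        _ = _ := by ring
    have hk : ‖KK μ n x y‖ ≤ 2 * ((c00 ^ 2 + M ^ 2 / (1 + 2*a)) * (n:ℝ) ^ (1 + 2*a)) := by
      unfold KK
      refine (norm_add_le _ _).trans ?_
      have k1 := kk_sum μ (n+1) x y
      have k2 := kk_sum μ n x y
      rw [Finset.sum_range_succ] at k1 hsum
      have : 0 ≤ ‖gg μ n x‖ * ‖gg μ n y‖ := by positivity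
      linarith
    have hlow : (n:ℝ) ^ (1 + 2*a) ≤ 3 * 2 ^ b * (τ ^ (-a) * (σ y + τ) ^ (-a-1) * (κ y + τ) ^ (-b)) := by
      have e1 : (3*τ) ^ (-a-1) ≤ (σ y + τ) ^ (-a-1) := Real.rpow_le_rpow_of_nonpos (by positivity) (by linarith) (by linarith)
      have e2 : (2:ℝ) ^ (-b) ≤ (κ y + τ) ^ (-b) := Real.rpow_le_rpow_of_nonpos (by positivity) (by linarith [hS.k1 y]) (by linarith)
      have e3 : (3:ℝ) ^ (-1:ℝ) ≤ 3 ^ (-a-1) := Real.rpow_le_rpow_of_exponent_le (by norm_num) (by linarith)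
      rw [Real.rpow_neg_one] at e3
      have e4 : (n:ℝ) ^ (1 + 2*a) = τ ^ (-a) * τ ^ (-a-1) := by
        rw [← Real.rpow_add hτ0, hτ, one_div, Real.inv_rpow hn0.le, ← Real.rpow_neg hn0.le]; congr 1; ring
      have e5 : (2:ℝ) ^ b * 2 ^ (-b) = 1 := by rw [← Real.rpow_add (by norm_num)]; simp
      calc (n:ℝ) ^ (1 + 2*a) = 3 * 2 ^ b * (τ ^ (-a) * (3⁻¹ * τ ^ (-a-1)) * 2 ^ (-b)) := by
            rw [e4]
            linear_combination (-(τ ^ (-a) * τ ^ (-a-1))) * e5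
        _ ≤ 3 * 2 ^ b * (τ ^ (-a) * (3 ^ (-a-1) * τ ^ (-a-1)) * 2 ^ (-b)) := by gcongr
        _ ≤ _ := by
            rw [← Real.mul_rpow (by norm_num) hτ0.le]
            gcongr
    calc _ ≤ _ := hk
      _ ≤ 2 * ((c00 ^ 2 + M ^ 2 / (1 + 2*a)) * (3 * 2 ^ b * (τ ^ (-a) * (σ y + τ) ^ (-a-1) * (κ y + τ) ^ (-b)))) := by gcongr
      _ = (2 * (c00 ^ 2 + M ^ 2 / (1 + 2*a)) * 3 * 2 ^ b) * (τ ^ (-a) * (σ y + τ) ^ (-a-1) * (κ y + τ) ^ (-b)) := by ring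
      _ ≤ _ := by
          refine mul_le_mul_of_nonneg_right ?_ pos1
          have : 0 ≤ 6 * M * C := by positivity
          linarith
  · have hsin : (σ y + τ) / 3 ≤ |sin (x - y)| := by linarith [hS.lip x y]
    have h1 := kk_cd1 hμ n x y
    have h2 := kk_cd2 hμ n x y
    have h3 : |sin (x - y)| * ‖KK μ n x y‖ ≤ 2 * (‖gg μ n x‖ * ‖gg μ n y‖) := by
      unfold KK
      calc _ ≤ |sin (x - y)| * (‖kk μ (n+1) x y‖ + ‖kk μ n x y‖) := by gcongr; exact norm_add_le _ _
        _ ≤ _ := by linarith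
    have h4 := hkey n n hn le_rfl x hx2
    have h5 := hg n hn y
    have hpos : 0 < (σ y + τ) / 3 := by positivity
    have h6 : (σ y + τ) / 3 * ‖KK μ n x y‖ ≤ 2 * ((M * τ ^ (-a)) * (C * ((σ y + τ) ^ (-a) * (κ y + τ) ^ (-b)))) := by
      calc _ ≤ |sin (x - y)| * ‖KK μ n x y‖ := by gcongr
        _ ≤ _ := h3
        _ ≤ _ := by gcongr
    calc ‖KK μ n x y‖ ≤ 2 * ((M * τ ^ (-a)) * (C * ((σ y + τ) ^ (-a) * (κ y + τ) ^ (-b)))) / ((σ y + τ) / 3) := by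
          rw [le_div_iff₀ hpos]; linarith
      _ = 6 * M * C * (τ ^ (-a) * (σ y + τ) ^ (-a-1) * (κ y + τ) ^ (-b)) := by
          rw [Real.rpow_sub_one (by positivity)]
          field_simp; ring
      _ ≤ _ := by
          refine mul_le_mul_of_nonneg_right ?_ pos1
          have : 0 ≤ 2 * (c00 ^ 2 + M ^ 2 / (1 + 2*a)) * 3 * 2 ^ b := by positivity
          linarith

lemma near_int {σ κ : ℝ → ℝ} (hS : SK σ κ) {a b q : ℝ} (ha : -(1/2) < a) (ha0 : a < 0) (hb : 0 ≤ b) (hq : 1 < q)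
    (hbq : b * (q - 2) < 1) : ∃ C : ℝ, 0 ≤ C ∧ ∀ τ : ℝ, 0 < τ → τ ≤ 1 →
    ∫⁻ y, ENNReal.ofReal ((τ ^ (-a) * (σ y + τ) ^ (-a-1) * (κ y + τ) ^ (-b)) ^ q * (σ y ^ (2*a) * κ y ^ (2*b))) ∂cI
      ≤ ENNReal.ofReal (C * τ ^ (-((1 + 2*a) * (q - 1)))) := by
  set l := max 0 (b * (q - 2)) with hl
  have hl0 : 0 ≤ l := le_max_left _ _
  have hl1 : l < 1 := max_lt (by norm_num) hbq
  have s0 : 0 < 1 + 2 * a := by linarith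
  have ea : 0 < (a + 1) * q - 2 * a - 1 := by nlinarith
  set E := 1 + 2 * a - (a + 1) * q with hE
  set D0 := (1/2:ℝ) ^ (-((a+1)*q)) * (1/2:ℝ) ^ (2*a) with hD0
  set D1 := 1/(1+2*a) + 1/((a + 1) * q - 2 * a - 1) with hD1
  have hl1' : 0 < 1 - l := by linarith
  have hD00 : 0 ≤ D0 := by positivity
  have hD10 : 0 ≤ D1 := by positivity
  have hπ := pi_pos
  refine ⟨D0 * (2 * π * (1 / (1 - l))) + (1/2:ℝ)^(-l) * (2 * π * D1), by positivity, ?_⟩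
  intro τ hτ0 hτ1
  set φ1 : ℝ → ℝ := fun d => (d + τ) ^ (-((a+1)*q)) * d ^ (2*a) with hφ1
  set φ2 : ℝ → ℝ := fun k => k ^ (-l) with hφ2
  have an1 : ∀ u v : ℝ, 0 < u → u ≤ v → φ1 v ≤ φ1 u := by
    intro u v hu huv
    simp only [hφ1]
    have h1 : (v + τ) ^ (-((a+1)*q)) ≤ (u + τ) ^ (-((a+1)*q)) :=
      Real.rpow_le_rpow_of_nonpos (by positivity) (by linarith) (by nlinarith)
    have h2 : v ^ (2*a) ≤ u ^ (2*a) := Real.rpow_le_rpow_of_nonpos hu huv (by linarith)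
    have : 0 < v := by linarith
    gcongr
  have an2 : ∀ u v : ℝ, 0 < u → u ≤ v → φ2 v ≤ φ2 u := by
    intro u v hu huv
    exact Real.rpow_le_rpow_of_nonpos hu huv (by linarith)
  have m1 : Measurable φ1 := by fun_prop
  have m2 : Measurable φ2 := by fun_prop
  have hms := hS.ms
  have hmk := hS.mka
  have pw : ∀ y, 0 < σ y → 0 < κ y →
      (τ ^ (-a) * (σ y + τ) ^ (-a-1) * (κ y + τ) ^ (-b)) ^ q * (σ y ^ (2*a) * κ y ^ (2*b)) ≤
        τ ^ (-a*q) * (D0 * φ2 (κ y) + (1/2:ℝ)^(-l) * φ1 (σ y)) := by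
    intro y hs hk
    have e1 : (τ ^ (-a) * (σ y + τ) ^ (-a-1) * (κ y + τ) ^ (-b)) ^ q * (σ y ^ (2*a) * κ y ^ (2*b))
      = τ ^ (-a*q) * (φ1 (σ y) * ((κ y + τ) ^ (-b*q) * κ y ^ (2*b))) := by
      rw [Real.mul_rpow (by positivity) (by positivity), Real.mul_rpow (by positivity) (by positivity),
        ← Real.rpow_mul (by positivity), ← Real.rpow_mul (by positivity), ← Real.rpow_mul (by positivity)]
      simp only [hφ1]
      rw [show (-a-1)*q = -((a+1)*q) by ring]
      ring
    have e2 : (κ y + τ) ^ (-b*q) * κ y ^ (2*b) ≤ φ2 (κ y) := by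
      calc _ ≤ κ y ^ (-b*q) * κ y ^ (2*b) := by
            refine mul_le_mul_of_nonneg_right ?_ (by positivity)
            exact Real.rpow_le_rpow_of_nonpos hk (by linarith) (by nlinarith)
        _ = κ y ^ (-(b*(q-2))) := by rw [← Real.rpow_add hk]; congr 1; ring
        _ ≤ _ := Real.rpow_le_rpow_of_exponent_ge hk (hS.k1 y) (by linarith [le_max_right 0 (b * (q - 2))])
    rw [e1]
    refine mul_le_mul_of_nonneg_left ?_ (by positivity)
    have p1 : 0 ≤ φ1 (σ y) := by simp only [hφ1]; positivity
    have p2 : 0 ≤ φ2 (κ y) := by simp only [hφ2]; positivity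
    refine (mul_le_mul_of_nonneg_left e2 p1).trans ?_
    rcases le_total (1/2) (σ y) with h | h
    · have h1 : φ1 (σ y) ≤ D0 := by
        refine (an1 _ _ (by norm_num) h).trans ?_
        simp only [hφ1, hD0]
        refine mul_le_mul_of_nonneg_right ?_ (by positivity)
        exact Real.rpow_le_rpow_of_nonpos (by norm_num) (by linarith) (by nlinarith)
      have : φ1 (σ y) * φ2 (κ y) ≤ D0 * φ2 (κ y) := by gcongr
      have : 0 ≤ (1/2:ℝ)^(-l) * φ1 (σ y) := by positivity
      linarith
    · have h1 : φ2 (κ y) ≤ (1/2:ℝ)^(-l) := an2 _ _ (by norm_num) (by linarith [hS.sk y])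
      have : φ1 (σ y) * φ2 (κ y) ≤ φ1 (σ y) * (1/2:ℝ)^(-l) := by gcongr
      have : 0 ≤ D0 * φ2 (κ y) := by positivity
      linarith
  have i2 : ∫⁻ y, ENNReal.ofReal (φ2 (κ y)) ∂cI ≤ ENNReal.ofReal (2 * π * (1 / (1 - l))) := by
    refine (hS.lk (fun k => ENNReal.ofReal (φ2 k)) (by fun_prop) (fun u v hu huv => ENNReal.ofReal_le_ofReal (an2 u v hu huv))).trans ?_
    simp only [hφ2]
    rw [lint_L1 one_pos hl1, ← ENNReal.ofReal_mul (by positivity)]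
    simp
  have i1 : ∫⁻ y, ENNReal.ofReal (φ1 (σ y)) ∂cI ≤ ENNReal.ofReal (2 * π * D1 * τ ^ E) := by
    refine (hS.ls (fun k => ENNReal.ofReal (φ1 k)) (by fun_prop) (fun u v hu huv => ENNReal.ofReal_le_ofReal (an1 u v hu huv))).trans ?_
    rw [show 2 * π * D1 * τ ^ E = 2 * π * (D1 * τ ^ E) by ring, ENNReal.ofReal_mul (p := 2 * π) (by positivity)]
    refine mul_le_mul_right (b := ∫⁻ v in Ioc 0 1, ENNReal.ofReal (φ1 v)) ?_ _
    calc _ ≤ ∫⁻ v in Ioc 0 τ ∪ Ioi τ, ENNReal.ofReal (φ1 v) := by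
          apply lintegral_mono_set
          intro v hv
          rcases le_or_gt v τ with h | h
          · exact Or.inl ⟨hv.1, h⟩
          · exact Or.inr h
      _ ≤ (∫⁻ v in Ioc 0 τ, ENNReal.ofReal (φ1 v)) + (∫⁻ v in Ioi τ, ENNReal.ofReal (φ1 v)) := lintegral_union_le _ _ _
      _ ≤ (∫⁻ v in Ioc 0 τ, ENNReal.ofReal (τ ^ (-((a+1)*q))) * ENNReal.ofReal (v ^ (-(-(2*a)))))
          + (∫⁻ v in Ioi τ, ENNReal.ofReal (v ^ (-((a+1)*q-2*a)))) := by
          apply add_le_add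
          · apply setLIntegral_mono' measurableSet_Ioc
            intro v hv
            rw [← ENNReal.ofReal_mul (by positivity), neg_neg]
            apply ENNReal.ofReal_le_ofReal
            simp only [hφ1]
            have := hv.1
            refine mul_le_mul_of_nonneg_right ?_ (by positivity)
            exact Real.rpow_le_rpow_of_nonpos hτ0 (by linarith) (by nlinarith)
          · apply setLIntegral_mono' measurableSet_Ioi
            intro v hv
            have hv' : τ < v := hv
            have hv0 : 0 < v := by linarith
            apply ENNReal.ofReal_le_ofReal
            rw [show -((a+1)*q-2*a) = -((a+1)*q) + 2*a by ring, Real.rpow_add hv0]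
            refine mul_le_mul_of_nonneg_right ?_ (by positivity)
            exact Real.rpow_le_rpow_of_nonpos hv0 (by linarith) (by nlinarith)
      _ = ENNReal.ofReal (D1 * τ ^ E) := by
          rw [lintegral_const_mul _ (by fun_prop), lint_L1 hτ0 (by linarith), lint_L2 hτ0 (by linarith),
            ← ENNReal.ofReal_mul (by positivity), ← ENNReal.ofReal_add _ _]
          · congr 1
            rw [mul_div_assoc', ← Real.rpow_add hτ0, hD1, hE]
            rw [show -((a+1)*q) + (1 - -(2*a)) = 1 + 2*a - (a+1)*q by ring, show 1 - ((a+1)*q-2*a) = 1 + 2*a - (a+1)*q by ring]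
            ring_nf
          · rw [show 1 - -(2*a) = 1 + 2*a by ring]; positivity
          · rw [show (a + 1) * q - 2 * a - 1 = (a + 1) * q - 2 * a - 1 by rfl]; positivity
  calc _ ≤ ∫⁻ y, ENNReal.ofReal (τ ^ (-a*q)) * (ENNReal.ofReal D0 * ENNReal.ofReal (φ2 (κ y)) + ENNReal.ofReal ((1/2:ℝ)^(-l)) * ENNReal.ofReal (φ1 (σ y))) ∂cI := by
        apply lintegral_mono_ae
        filter_upwards [hS.pos] with y hy
        refine (ENNReal.ofReal_le_ofReal (pw y hy.1 hy.2)).trans (le_of_eq ?_)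
        have p1 : 0 ≤ φ1 (σ y) := by have := hy.1; simp only [hφ1]; positivity
        have p2 : 0 ≤ φ2 (κ y) := by have := hy.2; simp only [hφ2]; positivity
        rw [ENNReal.ofReal_mul (by positivity), ENNReal.ofReal_add (by positivity) (by positivity), ENNReal.ofReal_mul hD00, ENNReal.ofReal_mul (p := (1/2:ℝ)^(-l)) (by positivity)]
    _ = ENNReal.ofReal (τ ^ (-a*q)) * (ENNReal.ofReal D0 * (∫⁻ y, ENNReal.ofReal (φ2 (κ y)) ∂cI) + ENNReal.ofReal ((1/2:ℝ)^(-l)) * (∫⁻ y, ENNReal.ofReal (φ1 (σ y)) ∂cI)) := by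
        rw [lintegral_const_mul _ (by fun_prop), lintegral_add_left (by fun_prop), lintegral_const_mul _ (by fun_prop), lintegral_const_mul _ (by fun_prop)]
    _ ≤ ENNReal.ofReal (τ ^ (-a*q)) * (ENNReal.ofReal D0 * ENNReal.ofReal (2 * π * (1 / (1 - l))) + ENNReal.ofReal ((1/2:ℝ)^(-l)) * ENNReal.ofReal (2 * π * D1 * τ ^ E)) := by
        gcongr
    _ = ENNReal.ofReal (τ ^ (-a*q) * (D0 * (2 * π * (1 / (1 - l))) + (1/2:ℝ)^(-l) * (2 * π * D1 * τ ^ E))) := by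
        rw [ENNReal.ofReal_mul (p := τ ^ (-a*q)) (by positivity), ENNReal.ofReal_add (by positivity) (by positivity), ENNReal.ofReal_mul hD00, ENNReal.ofReal_mul (p := (1/2:ℝ)^(-l)) (by positivity)]
    _ ≤ _ := by
        apply ENNReal.ofReal_le_ofReal
        have e1 : 1 ≤ τ ^ E := Real.one_le_rpow_of_pos_of_le_one_of_nonpos hτ0 hτ1 (by linarith)
        have e2 : τ ^ (-((1 + 2*a) * (q - 1))) = τ ^ (-a*q) * τ ^ E := by
          rw [← Real.rpow_add hτ0]; congr 1; rw [hE]; ring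
        rw [e2]
        have e3 : D0 * (2 * π * (1 / (1 - l))) ≤ D0 * (2 * π * (1 / (1 - l))) * τ ^ E := le_mul_of_one_le_right (by positivity) e1
        calc _ ≤ τ ^ (-a*q) * (D0 * (2 * π * (1 / (1 - l))) * τ ^ E + (1/2:ℝ)^(-l) * (2 * π * D1 * τ ^ E)) := by gcongr
          _ = _ := by ring

lemma near_meas {σ κ : ℝ → ℝ} (hS : SK σ κ) {a b : ℝ} (ha : -(1/2) < a) (ha0 : a < 0) (hb : 0 ≤ b) {τ : ℝ} (hτ0 : 0 < τ) :
    ∫⁻ y in {y | σ y < τ}, ENNReal.ofReal (σ y ^ (2*a) * κ y ^ (2*b)) ∂cI ≤ ENNReal.ofReal (2 * π / (1 + 2*a) * τ ^ (1 + 2*a)) := by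
  have hms := hS.ms
  have s0 : 0 < 1 + 2 * a := by linarith
  set φ : ℝ → ℝ≥0∞ := (Iio τ).indicator fun d => ENNReal.ofReal (d ^ (-(-(2*a)))) with hφ
  have hm : Measurable φ := Measurable.indicator (by fun_prop) measurableSet_Iio
  have hmN : MeasurableSet {y | σ y < τ} := measurableSet_lt hms measurable_const
  calc _ ≤ ∫⁻ y in {y | σ y < τ}, ENNReal.ofReal (σ y ^ (-(-(2*a)))) ∂cI := by
        apply lintegral_mono
        intro y
        apply ENNReal.ofReal_le_ofReal
        rw [neg_neg]
        have := hS.s0 y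
        exact mul_le_of_le_one_right (by positivity) (Real.rpow_le_one (hS.k0 y) (hS.k1 y) (by linarith))
    _ = ∫⁻ y, φ (σ y) ∂cI := by
        rw [← lintegral_indicator hmN]; rfl
    _ ≤ ENNReal.ofReal (2 * π) * ∫⁻ v in Ioc 0 1, φ v := by
        apply hS.ls φ hm
        intro u v hu huv
        simp only [hφ]
        by_cases hv : v < τ
        · rw [indicator_of_mem (show v ∈ Iio τ from hv), indicator_of_mem (show u ∈ Iio τ from huv.trans_lt hv), neg_neg]
          exact ENNReal.ofReal_le_ofReal (Real.rpow_le_rpow_of_nonpos hu huv (by linarith))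
        · rw [indicator_of_notMem (show v ∉ Iio τ from hv)]; simp
    _ ≤ ENNReal.ofReal (2 * π) * ∫⁻ v in Ioc 0 τ, ENNReal.ofReal (v ^ (-(-(2*a)))) := by
        refine mul_le_mul_right ?_ _
        rw [← lintegral_indicator measurableSet_Ioc, ← lintegral_indicator measurableSet_Ioc]
        apply lintegral_mono
        intro v
        by_cases h : v ∈ Ioc (0:ℝ) 1
        · rw [indicator_of_mem h]
          by_cases h2 : v < τ
          · rw [hφ, indicator_of_mem (show v ∈ Iio τ from h2), indicator_of_mem (show v ∈ Ioc 0 τ from ⟨h.1, h2.le⟩)]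
          · rw [hφ, indicator_of_notMem (show v ∉ Iio τ from h2)]; simp
        · rw [indicator_of_notMem h]; simp
    _ = _ := by
        rw [lint_L1 hτ0 (by linarith), ← ENNReal.ofReal_mul (by positivity)]
        congr 1
        rw [show 1 - -(2*a) = 1 + 2*a by ring]; ring

lemma fac1 {b k τ : ℝ} (hb : 0 ≤ b) (hk : 0 ≤ k) (hτ : 0 < τ) : ((k + τ) ^ (-b)) ^ 2 * k ^ (2*b) ≤ 1 := by
  have h : 0 < k + τ := by linarith
  rw [← Real.rpow_natCast, ← Real.rpow_mul h.le]
  have e : k ^ (2*b) ≤ (k + τ) ^ (2*b) := Real.rpow_le_rpow hk (by linarith) (by linarith)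
  calc _ ≤ (k + τ) ^ (-b * (2:ℕ)) * (k + τ) ^ (2*b) := by gcongr
    _ = 1 := by rw [← Real.rpow_add h]; push_cast; rw [show -b * 2 + 2 * b = 0 by ring, Real.rpow_zero]

lemma fac2 {a s τ : ℝ} (ha : -(1/2) < a) (ha0 : a < 0) (hτ : 0 < τ) (hs : τ ≤ s) : ((s + τ) ^ (-a)) ^ 2 * s ^ (2*a) ≤ 2 := by
  have h : 0 < s + τ := by linarith
  have h0 : 0 < s := by linarith
  rw [← Real.rpow_natCast, ← Real.rpow_mul h.le]
  have e : (s + τ) ^ (-a * (2:ℕ)) ≤ (2 * s) ^ (-a * (2:ℕ)) := Real.rpow_le_rpow h.le (by linarith) (by push_cast; linarith)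
  calc _ ≤ (2 * s) ^ (-a * (2:ℕ)) * s ^ (2*a) := by gcongr
    _ = 2 ^ (-a * (2:ℕ)) := by
      rw [Real.mul_rpow (by norm_num) h0.le, mul_assoc, ← Real.rpow_add h0]
      push_cast; rw [show -a * 2 + 2 * a = 0 by ring, Real.rpow_zero, mul_one]
    _ ≤ 2 ^ (1:ℝ) := Real.rpow_le_rpow_of_exponent_le (by norm_num) (by push_cast; linarith)
    _ = 2 := by simp

lemma comb {μ : Measure ℝ} [IsFiniteMeasure μ] {p : ℝ} (hp : 1 < p) {k : ℝ → ℝ → ℂ} (hk : Continuous fun z : ℝ × ℝ => k z.1 z.2)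
    (hkb : ∀ x, ∃ c, ∀ y, ‖k x y‖ ≤ c)
    {N : Set ℝ} (hN : MeasurableSet N) {f : ℝ → ℂ} (hf : Measurable f) (hfi : Integrable f μ) {F C1 C2 C3 : ℝ≥0∞}
    (h1 : ∫⁻ x in N, (∫⁻ y, ‖k x y‖ₑ * ‖f y‖ₑ ∂μ) ^ p ∂μ ≤ C1 * F)
    (h2 : ∫⁻ x, (∫⁻ y in N, ‖k x y‖ₑ * ‖f y‖ₑ ∂μ) ^ p ∂μ ≤ C2 * F)
    (h3 : ∫⁻ x in Nᶜ, ‖∫ y in Nᶜ, k x y * f y ∂μ‖ₑ ^ p ∂μ ≤ C3 * F) :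
    ∫⁻ x, ‖∫ y, k x y * f y ∂μ‖ₑ ^ p ∂μ ≤ (C1 + 2 ^ p * (C2 + C3)) * F := by
  have hp0 : 0 < p := by linarith
  have hkm := hk.measurable
  have hIntg : ∀ x, Integrable (fun y => k x y * f y) μ := by
    intro x
    obtain ⟨c, hc⟩ := hkb x
    have : Continuous fun y => k x y := hk.comp (by fun_prop : Continuous fun y => (x, y))
    exact hfi.bdd_mul (c := c) this.aestronglyMeasurable (ae_of_all _ hc)
  have hle : ∀ x (S : Set ℝ), ‖∫ y in S, k x y * f y ∂μ‖ₑ ≤ ∫⁻ y in S, ‖k x y‖ₑ * ‖f y‖ₑ ∂μ := by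
    intro x S
    refine (enorm_integral_le_lintegral_enorm _).trans (le_of_eq ?_)
    simp_rw [enorm_mul]
  have hm : Measurable fun z : ℝ × ℝ => ‖k z.1 z.2‖ₑ * ‖f z.2‖ₑ := by fun_prop
  have hmN : Measurable fun x => (∫⁻ y in N, ‖k x y‖ₑ * ‖f y‖ₑ ∂μ) ^ p :=
    (Measurable.lintegral_prod_right' (ν := μ.restrict N) hm).pow_const p
  calc _ = (∫⁻ x in N, ‖∫ y, k x y * f y ∂μ‖ₑ ^ p ∂μ) + (∫⁻ x in Nᶜ, ‖∫ y, k x y * f y ∂μ‖ₑ ^ p ∂μ) :=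
        (lintegral_add_compl _ hN).symm
    _ ≤ C1 * F + (∫⁻ x in Nᶜ, 2 ^ p * ((∫⁻ y in N, ‖k x y‖ₑ * ‖f y‖ₑ ∂μ) ^ p + ‖∫ y in Nᶜ, k x y * f y ∂μ‖ₑ ^ p) ∂μ) := by
        apply add_le_add
        · refine le_trans (lintegral_mono fun x => ENNReal.rpow_le_rpow ?_ hp0.le) h1
          have := hle x univ
          simpa using this
        · apply lintegral_mono
          intro x
          refine le_trans (ENNReal.rpow_le_rpow ?_ hp0.le) (rpow_add2 hp.le _ _)
          rw [← integral_add_compl hN (hIntg x)]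
          exact (enorm_add_le _ _).trans (add_le_add (hle x N) le_rfl)
    _ = C1 * F + 2 ^ p * ((∫⁻ x in Nᶜ, (∫⁻ y in N, ‖k x y‖ₑ * ‖f y‖ₑ ∂μ) ^ p ∂μ) + (∫⁻ x in Nᶜ, ‖∫ y in Nᶜ, k x y * f y ∂μ‖ₑ ^ p ∂μ)) := by
        rw [lintegral_const_mul' _ _ (ENNReal.rpow_ne_top_of_nonneg hp0.le (by simp)), lintegral_add_left hmN]
    _ ≤ C1 * F + 2 ^ p * (C2 * F + C3 * F) := by
        gcongr
        exact le_trans (lintegral_mono' Measure.restrict_le_self le_rfl) h2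
    _ = _ := by ring

/-- trivial bound for a fixed kernel -/
lemma fixed_n {μ : Measure ℝ} [IsFiniteMeasure μ] {p q : ℝ} (hpq : p.HolderConjugate q) {k : ℝ → ℝ → ℂ}
    (hk : Continuous fun z : ℝ × ℝ => k z.1 z.2) {c : ℝ} (hc : ∀ x y, ‖k x y‖ ≤ c) :
    ∃ C : ℝ≥0∞, C ≠ ⊤ ∧ ∀ f : ℝ → ℂ, Measurable f → ∫⁻ x, ‖∫ y, k x y * f y ∂μ‖ₑ ^ p ∂μ ≤ C * ∫⁻ x, ‖f x‖ₑ ^ p ∂μ := by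
  have hp0 := hpq.pos
  have hq0 := hpq.symm.pos
  refine ⟨(ENNReal.ofReal c ^ q * μ univ) ^ (p / q) * μ univ, ?_, ?_⟩
  · apply ENNReal.mul_ne_top _ (measure_ne_top _ _)
    apply ENNReal.rpow_ne_top_of_nonneg (by positivity)
    exact ENNReal.mul_ne_top (ENNReal.rpow_ne_top_of_nonneg hq0.le (by simp)) (measure_ne_top _ _)
  · intro f hf
    have hkm := hk.measurable
    have h := near1 (μ := μ) hpq (k := fun x y => ‖k x y‖ₑ) (by unfold Function.uncurry; fun_prop) MeasurableSet.univ
      (A := ENNReal.ofReal c ^ q * μ univ) (by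
        intro x _
        rw [← lintegral_const]
        apply lintegral_mono
        intro y
        apply ENNReal.rpow_le_rpow _ hq0.le
        rw [← ofReal_norm]
        exact ENNReal.ofReal_le_ofReal (hc x y)) (f := fun y => ‖f y‖ₑ) (by fun_prop)
    rw [Measure.restrict_univ] at h
    refine le_trans (lintegral_mono fun x => ENNReal.rpow_le_rpow ?_ hp0.le) h
    refine (enorm_integral_le_lintegral_enorm _).trans (le_of_eq ?_)
    simp_rw [enorm_mul]

/-- the one-sided near estimates -/
lemma near_both {σ κ : ℝ → ℝ} (hS : SK σ κ) {W : ℝ → ℝ} (hW : GW W) {a b C c1 : ℝ} (ha : -(1/2) < a) (ha0 : a < 0) (hb : 0 ≤ b) (hC : 0 ≤ C)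
    (hc1 : 0 ≤ c1) (hWb : ∀ x, W x ≤ c1 * (σ x ^ (2*a) * κ x ^ (2*b)))
    (hg : ∀ n : ℕ, 1 ≤ n → ∀ x, ‖gg (mW W) n x‖ ≤ C * ((σ x + 1/n) ^ (-a) * (κ x + 1/n) ^ (-b)))
    {p q : ℝ} (hpq : p.HolderConjugate q) (hbp : b * (p - 2) < 1) (hbq : b * (q - 2) < 1) :
    ∃ C1 C2 : ℝ≥0∞, C1 ≠ ⊤ ∧ C2 ≠ ⊤ ∧ ∀ n : ℕ, 1 ≤ n → ∀ f : ℝ → ℝ≥0∞, Measurable f →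
      (∫⁻ x in {x | σ x < 1/n}, (∫⁻ y, ‖KK (mW W) n x y‖ₑ * f y ∂(mW W)) ^ p ∂(mW W) ≤ C1 * ∫⁻ x, f x ^ p ∂(mW W)) ∧
      (∫⁻ x, (∫⁻ y in {x | σ x < 1/n}, ‖KK (mW W) n x y‖ₑ * f y ∂(mW W)) ^ p ∂(mW W) ≤ C2 * ∫⁻ x, f x ^ p ∂(mW W)) := by
  have hp0 := hpq.pos
  have hq0 := hpq.symm.pos
  have hp1 := hpq.lt
  have hq1 := hpq.symm.lt
  have s0 : 0 < 1 + 2 * a := by linarith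
  have hfin := hW.fin
  have hms := hS.ms
  have hmk := hS.mka
  have hWm := hW.meas
  obtain ⟨D, hD, HD⟩ := near_ker hS hW.gm ha ha0 hb hC hg
  have gen : ∀ r : ℝ, 1 < r → b * (r - 2) < 1 → ∃ E : ℝ, 0 ≤ E ∧ ∀ n : ℕ, 1 ≤ n → ∀ x, σ x < 1/n →
      ∫⁻ y, ‖KK (mW W) n x y‖ₑ ^ r ∂(mW W) ≤ ENNReal.ofReal (E * (1/n:ℝ) ^ (-((1 + 2*a) * (r - 1)))) := by
    intro r hr hbr
    obtain ⟨E, hE, HE⟩ := near_int hS ha ha0 hb hr hbr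
    refine ⟨D ^ r * c1 * E, by positivity, fun n hn x hx => ?_⟩
    have hn0 : (0:ℝ) < n := by positivity
    have hn1 : (1:ℝ) ≤ n := by exact_mod_cast hn
    have hτ0 : (0:ℝ) < 1/n := by positivity
    have hτ1 : (1:ℝ)/n ≤ 1 := by rw [div_le_one hn0]; exact hn1
    have kc : Continuous fun y => KK (mW W) n x y := SP_cont (KK_mem _ n x)
    rw [mW_lintegral hW (by fun_prop)]
    calc _ ≤ ∫⁻ y, ENNReal.ofReal (D ^ r * c1) * ENNReal.ofReal (((1/n:ℝ) ^ (-a) * (σ y + 1/n) ^ (-a-1) * (κ y + 1/n) ^ (-b)) ^ r * (σ y ^ (2*a) * κ y ^ (2*b))) ∂cI := by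
          apply lintegral_mono
          intro y
          simp only [Pi.mul_apply, Function.comp_apply]
          rw [← ofReal_norm, ENNReal.ofReal_rpow_of_nonneg (norm_nonneg _) (by linarith), ← ENNReal.ofReal_mul (hW.nonneg y),
            ← ENNReal.ofReal_mul (by positivity)]
          apply ENNReal.ofReal_le_ofReal
          have e1 := HD n hn x hx y
          have e2 := hWb y
          have := hS.s0 y
          have := hS.k0 y
          have := hW.nonneg y
          calc _ ≤ (c1 * (σ y ^ (2*a) * κ y ^ (2*b))) * (D * ((1/n:ℝ) ^ (-a) * (σ y + 1/n) ^ (-a-1) * (κ y + 1/n) ^ (-b))) ^ r := by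
                gcongr
            _ = _ := by
                rw [Real.mul_rpow hD (by positivity)]; ring
      _ = ENNReal.ofReal (D ^ r * c1) * ∫⁻ y, ENNReal.ofReal (((1/n:ℝ) ^ (-a) * (σ y + 1/n) ^ (-a-1) * (κ y + 1/n) ^ (-b)) ^ r * (σ y ^ (2*a) * κ y ^ (2*b))) ∂cI :=
          lintegral_const_mul _ (by fun_prop)
      _ ≤ ENNReal.ofReal (D ^ r * c1) * ENNReal.ofReal (E * (1/n:ℝ) ^ (-((1 + 2*a) * (r - 1)))) := mul_le_mul_right (HE _ hτ0 hτ1) _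
      _ = _ := by rw [← ENNReal.ofReal_mul (by positivity), mul_assoc (D ^ r * c1)]
  obtain ⟨Ep, hEp, HEp⟩ := gen p hp1 hbp
  obtain ⟨Eq, hEq, HEq⟩ := gen q hq1 hbq
  set M := c1 * (2 * π / (1 + 2*a)) with hM
  have hM0 : 0 ≤ M := by have := pi_pos; positivity
  have hmeas : ∀ n : ℕ, 1 ≤ n → mW W {x | σ x < 1/n} ≤ ENNReal.ofReal (M * (1/n:ℝ) ^ (1 + 2*a)) := by
    intro n hn
    have hn0 : (0:ℝ) < n := by positivity
    have hτ0 : (0:ℝ) < 1/n := by positivity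
    have hmN : MeasurableSet {x | σ x < 1/n} := measurableSet_lt hms measurable_const
    unfold mW
    rw [withDensity_apply _ hmN]
    calc _ ≤ ∫⁻ y in {y | σ y < 1/n}, ENNReal.ofReal c1 * ENNReal.ofReal (σ y ^ (2*a) * κ y ^ (2*b)) ∂cI := by
          apply lintegral_mono
          intro y
          beta_reduce
          rw [← ENNReal.ofReal_mul hc1]
          exact ENNReal.ofReal_le_ofReal (hWb y)
      _ ≤ _ := by
          rw [lintegral_const_mul _ (by fun_prop), hM, mul_assoc, ENNReal.ofReal_mul hc1]
          exact mul_le_mul_right (near_meas hS ha ha0 hb hτ0) _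
  have hpq2 : p / q = p - 1 := by have := hpq.mul_eq_add; field_simp; linarith
  refine ⟨ENNReal.ofReal (Eq ^ (p/q) * M), ENNReal.ofReal (M ^ (p/q) * Ep), by simp, by simp, fun n hn f hf => ?_⟩
  have hn0 : (0:ℝ) < n := by positivity
  have hτ0 : (0:ℝ) < 1/n := by positivity
  have hmN : MeasurableSet {x | σ x < 1/n} := measurableSet_lt hms measurable_const
  have hkm := (KK_cont (mW W) n).measurable
  constructor
  · refine (near1 (μ := mW W) hpq (k := fun x y => ‖KK (mW W) n x y‖ₑ) (by unfold Function.uncurry; fun_prop) hmN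
      (fun x hx => HEq n hn x hx) hf).trans ?_
    refine mul_le_mul_left ?_ _
    refine (mul_le_mul_right (hmeas n hn) _).trans (le_of_eq ?_)
    rw [ENNReal.ofReal_rpow_of_nonneg (by positivity) (by positivity), ← ENNReal.ofReal_mul (by positivity)]
    congr 1
    rw [Real.mul_rpow hEq (by positivity), ← Real.rpow_mul hτ0.le]
    have e : (1/n:ℝ) ^ (-((1 + 2*a) * (q - 1)) * (p/q)) * (1/n:ℝ) ^ (1 + 2*a) = 1 := by
      rw [← Real.rpow_add hτ0]
      have : (q - 1) * (p/q) = 1 := by have := hpq.mul_eq_add; field_simp; linarith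
      rw [show -((1 + 2*a) * (q - 1)) * (p/q) + (1 + 2*a) = (1 + 2*a) * (1 - (q - 1) * (p/q)) by ring, this]
      simp
    linear_combination (Eq ^ (p/q) * M) * e
  · refine (near2 (μ := mW W) hpq (k := fun x y => ‖KK (mW W) n x y‖ₑ) (by unfold Function.uncurry; fun_prop)
      (fun x y => by simp only [KK_symm hW.gm]) hmN (fun x hx => HEp n hn x hx) hf).trans ?_
    refine mul_le_mul_left ?_ _
    refine (mul_le_mul_left (ENNReal.rpow_le_rpow (hmeas n hn) (by positivity)) _).trans (le_of_eq ?_)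
    rw [ENNReal.ofReal_rpow_of_nonneg (by positivity) (by positivity), ← ENNReal.ofReal_mul (by positivity)]
    congr 1
    rw [Real.mul_rpow hM0 (by positivity), ← Real.rpow_mul hτ0.le]
    have e : (1/n:ℝ) ^ ((1 + 2*a) * (p/q)) * (1/n:ℝ) ^ (-((1 + 2*a) * (p - 1))) = 1 := by
      rw [← Real.rpow_add hτ0, hpq2]
      simp
    linear_combination (M ^ (p/q) * Ep) * e

lemma kk_bdd (μ : Measure ℝ) (n : ℕ) : ∃ c : ℝ, ∀ x y, ‖kk μ n x y‖ ≤ c := by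
  choose C hC using fun j => SP_bdd (gg_mem μ j)
  refine ⟨∑ j ∈ Finset.range n, C j * C j, fun x y => (kk_sum μ n x y).trans (Finset.sum_le_sum fun j _ => ?_)⟩
  exact mul_le_mul (hC j x) (hC j y) (norm_nonneg _) ((norm_nonneg _).trans (hC j x))

lemma KK_bdd (μ : Measure ℝ) (n : ℕ) : ∃ c : ℝ, ∀ x y, ‖KK μ n x y‖ ≤ c := by
  obtain ⟨c, hc⟩ := kk_bdd μ (n+1)
  obtain ⟨d, hd⟩ := kk_bdd μ n
  exact ⟨c + d, fun x y => (norm_add_le _ _).trans (add_le_add (hc x y) (hd x y))⟩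

lemma q_cond {b p q : ℝ} (hpq : p.HolderConjugate q) (hb2 : b * (2 - p) < p - 1) : b * (q - 2) < 1 := by
  have hp := hpq.lt
  have h := hpq.mul_eq_add
  have hq : q * (p - 1) = p := by linarith
  have : b * (q - 2) * (p - 1) < 1 * (p - 1) := by
    have e : b * (q - 2) * (p - 1) = b * (2 - p) := by linear_combination b * hq
    rw [e]; linarith
  exact lt_of_mul_lt_mul_right this (by linarith)

/-- one variable theorem, one bad exponent -/
lemma oneD_neg {P : ℝ → ℝ} {c0 c1 Λ : ℝ} (h : PF P c0 c1 Λ) {a b p q : ℝ} (hpq : p.HolderConjugate q)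
    (ha : -(1/2) < a) (hb : -(1/2) < b)
    (ha1 : a * (p - 2) < 1) (ha2 : a * (2 - p) < p - 1) (hb1 : b * (p - 2) < 1) (hb2 : b * (2 - p) < p - 1)
    {σ κ : ℝ → ℝ} (hS : SK σ κ) {s t : ℝ} (hs : -(1/2) < s) (hs0 : s < 0) (ht : 0 ≤ t)
    (ht1 : t * (p - 2) < 1) (ht2 : t * (2 - p) < p - 1)
    (hrho : ∀ x, rho (2*a) (2*b) x = σ x ^ (2*s) * κ x ^ (2*t))
    (hom : ∀ n x : ℝ, om a b n x = (σ x + 1/n) ^ (-s) * (κ x + 1/n) ^ (-t)) :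
    ∃ C : ℝ≥0∞, C ≠ ⊤ ∧ ∀ n : ℕ, 1 ≤ n → ∀ f : ℝ → ℂ, Measurable f → ∫⁻ x, ‖f x‖ₑ ^ p ∂(mW (Wt P a b)) ≠ ⊤ →
      ∫⁻ x, ‖∫ y, KK (mW (Wt P a b)) n x y * f y ∂(mW (Wt P a b))‖ₑ ^ p ∂(mW (Wt P a b)) ≤
        C * ∫⁻ x, ‖f x‖ₑ ^ p ∂(mW (Wt P a b)) := by
  have hW := h.gw ha hb
  have hfin := hW.fin
  have hc1 := h.c1pos
  obtain ⟨C, hC, H⟩ := gg_bd h ha hb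
  obtain ⟨C1, C2, hC1, hC2, HN⟩ := near_both hS hW hs hs0 ht hC hc1.le
    (fun x => by
      unfold Wt; rw [hrho]
      have := hS.s0 x; have := hS.k0 x
      gcongr; exact h.hi x) (fun n hn x => by rw [← hom]; exact H n hn x) hpq ht1 (q_cond hpq ht2)
  obtain ⟨C3, hC3, HF⟩ := far_thm h hpq ha hb ha1 ha2 hb1 hb2 (C^2 * c1 * 2) (by positivity)
  refine ⟨C1 + 2 ^ p * (C2 + C3), ?_, fun n hn f hf hft => ?_⟩
  · have : (2:ℝ≥0∞) ^ p ≠ ⊤ := ENNReal.rpow_ne_top_of_nonneg hpq.pos.le (by simp)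
    exact ENNReal.add_ne_top.2 ⟨hC1, ENNReal.mul_ne_top this (ENNReal.add_ne_top.2 ⟨hC2, hC3⟩)⟩
  have hn0 : (0:ℝ) < n := by positivity
  have hτ0 : (0:ℝ) < 1/n := by positivity
  have hmN : MeasurableSet {x | σ x < 1/n} := measurableSet_lt hS.ms measurable_const
  obtain ⟨k1, k2⟩ := HN n hn (fun y => ‖f y‖ₑ) (by fun_prop)
  obtain ⟨c, hc⟩ := KK_bdd (mW (Wt P a b)) n
  refine comb hpq.lt (KK_cont _ n) (fun x => ⟨c, hc x⟩) hmN hf (int_of_Lp hpq.lt hf hft) k1 k2 ?_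
  refine HF n _ hmN.compl (fun x hx => ?_) f hf hft
  have hx' : (1:ℝ)/n ≤ σ x := by simpa using hx
  have e := H n hn x
  rw [hom] at e
  have s0 := hS.s0 x
  have k0 := hS.k0 x
  have e1 := fac2 hs hs0 hτ0 hx'
  have e2 := fac1 ht k0 hτ0
  have hw : Wt P a b x = P x * (σ x ^ (2*s) * κ x ^ (2*t)) := by unfold Wt; rw [hrho]
  rw [hw]
  have hP := h.pos x
  calc _ ≤ (C * ((σ x + 1/n) ^ (-s) * (κ x + 1/n) ^ (-t))) ^ 2 * (c1 * (σ x ^ (2*s) * κ x ^ (2*t))) := by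
        gcongr; exact h.hi x
    _ = C^2 * c1 * ((((σ x + 1/n) ^ (-s)) ^ 2 * σ x ^ (2*s)) * (((κ x + 1/n) ^ (-t)) ^ 2 * κ x ^ (2*t))) := by ring
    _ ≤ C^2 * c1 * (2 * 1) := by gcongr
    _ = _ := by ring

lemma oneD_pos {P : ℝ → ℝ} {c0 c1 Λ : ℝ} (h : PF P c0 c1 Λ) {a b p q : ℝ} (hpq : p.HolderConjugate q)
    (ha : -(1/2) < a) (hb : -(1/2) < b)
    (ha1 : a * (p - 2) < 1) (ha2 : a * (2 - p) < p - 1) (hb1 : b * (p - 2) < 1) (hb2 : b * (2 - p) < p - 1)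
    (ha0 : 0 ≤ a) (hb0 : 0 ≤ b) :
    ∃ C : ℝ≥0∞, C ≠ ⊤ ∧ ∀ n : ℕ, 1 ≤ n → ∀ f : ℝ → ℂ, Measurable f → ∫⁻ x, ‖f x‖ₑ ^ p ∂(mW (Wt P a b)) ≠ ⊤ →
      ∫⁻ x, ‖∫ y, KK (mW (Wt P a b)) n x y * f y ∂(mW (Wt P a b))‖ₑ ^ p ∂(mW (Wt P a b)) ≤
        C * ∫⁻ x, ‖f x‖ₑ ^ p ∂(mW (Wt P a b)) := by
  have hc1 := h.c1pos
  obtain ⟨C, hC, H⟩ := gg_bd h ha hb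
  obtain ⟨C3, hC3, HF⟩ := far_thm h hpq ha hb ha1 ha2 hb1 hb2 (C^2 * c1) (by positivity)
  refine ⟨C3, hC3, fun n hn f hf hft => ?_⟩
  have hn0 : (0:ℝ) < n := by positivity
  have hτ0 : (0:ℝ) < 1/n := by positivity
  have := HF n univ MeasurableSet.univ (fun x _ => ?_) f hf hft
  · simpa using this
  have e := H n hn x
  unfold om at e
  have e1 := fac1 ha0 (abs_nonneg (sin x)) hτ0
  have e2 := fac1 hb0 (abs_nonneg (cos x)) hτ0
  have hP := h.pos x
  have hw : Wt P a b x = P x * (|sin x| ^ (2*a) * |cos x| ^ (2*b)) := rfl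
  rw [hw]
  calc _ ≤ (C * ((|sin x| + 1/n) ^ (-a) * (|cos x| + 1/n) ^ (-b))) ^ 2 * (c1 * (|sin x| ^ (2*a) * |cos x| ^ (2*b))) := by
        gcongr; exact h.hi x
    _ = C^2 * c1 * ((((|sin x| + 1/n) ^ (-a)) ^ 2 * |sin x| ^ (2*a)) * (((|cos x| + 1/n) ^ (-b)) ^ 2 * |cos x| ^ (2*b))) := by ring
    _ ≤ C^2 * c1 * (1 * 1) := by gcongr
    _ = _ := by ring

theorem thm1D {P : ℝ → ℝ} {c0 c1 Λ : ℝ} (h : PF P c0 c1 Λ) {a b p q : ℝ} (hpq : p.HolderConjugate q)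
    (ha : -(1/2) < a) (hb : -(1/2) < b)
    (ha1 : a * (p - 2) < 1) (ha2 : a * (2 - p) < p - 1) (hb1 : b * (p - 2) < 1) (hb2 : b * (2 - p) < p - 1)
    (hab : 0 ≤ a ∨ 0 ≤ b) :
    ∃ C : ℝ≥0∞, C ≠ ⊤ ∧ ∀ n : ℕ, ∀ f : ℝ → ℂ, Measurable f →
      ∫⁻ x, ‖∫ y, KK (mW (Wt P a b)) n x y * f y ∂(mW (Wt P a b))‖ₑ ^ p ∂(mW (Wt P a b)) ≤
        C * ∫⁻ x, ‖f x‖ₑ ^ p ∂(mW (Wt P a b)) := by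
  have hfin := (h.gw ha hb).fin
  have key : ∃ C : ℝ≥0∞, C ≠ ⊤ ∧ ∀ n : ℕ, 1 ≤ n → ∀ f : ℝ → ℂ, Measurable f → ∫⁻ x, ‖f x‖ₑ ^ p ∂(mW (Wt P a b)) ≠ ⊤ →
      ∫⁻ x, ‖∫ y, KK (mW (Wt P a b)) n x y * f y ∂(mW (Wt P a b))‖ₑ ^ p ∂(mW (Wt P a b)) ≤
        C * ∫⁻ x, ‖f x‖ₑ ^ p ∂(mW (Wt P a b)) := by
    rcases lt_or_ge a 0 with h0 | h0
    · have hb0 : 0 ≤ b := by rcases hab with h | h <;> linarith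
      exact oneD_neg h hpq ha hb ha1 ha2 hb1 hb2 SK1 ha h0 hb0 hb1 hb2 (fun x => rfl) (fun n x => rfl)
    · rcases lt_or_ge b 0 with h1 | h1
      · exact oneD_neg h hpq ha hb ha1 ha2 hb1 hb2 SK2 hb h1 h0 ha1 ha2 (fun x => mul_comm _ _) (fun n x => mul_comm _ _)
      · exact oneD_pos h hpq ha hb ha1 ha2 hb1 hb2 h0 h1
  obtain ⟨C, hC, H⟩ := key
  obtain ⟨c, hc⟩ := KK_bdd (mW (Wt P a b)) 0
  obtain ⟨C', hC', H'⟩ := fixed_n (μ := mW (Wt P a b)) hpq (KK_cont _ 0) hc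
  refine ⟨C + C' + 1, by simp [hC, hC'], fun n f hf => ?_⟩
  by_cases hft : ∫⁻ x, ‖f x‖ₑ ^ p ∂(mW (Wt P a b)) = ⊤
  · rw [hft, ENNReal.mul_top (by simp)]; exact le_top
  rcases Nat.eq_zero_or_pos n with rfl | hn
  · refine (H' f hf).trans (mul_le_mul_left ?_ _)
    rw [add_assoc, add_comm C, add_assoc]; exact le_self_add
  · refine (H n hn f hf hft).trans (mul_le_mul_left ?_ _)
    rw [add_assoc]; exact le_self_add

lemma lint_period (f : ℝ → ℝ≥0∞) (hf : Function.Periodic f (2 * π)) (t : ℝ) :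
    ∫⁻ y in Ioc t (t + 2 * π), f y = ∫⁻ y, f y ∂cI := by
  have hπ : 0 < 2 * π := by positivity
  have h2 : ∫⁻ y, f y ∂cI = ∫⁻ y in Ioc (-π) (-π + 2 * π), f y := by
    unfold cI; rw [show -π + 2 * π = π by ring]
  rw [h2]
  apply (isAddFundamentalDomain_Ioc hπ _ volume).setLIntegral_eq (isAddFundamentalDomain_Ioc hπ _ volume)
  rintro ⟨g, hg⟩ x
  obtain ⟨k, rfl⟩ := AddSubgroup.mem_zmultiples_iff.1 hg
  show f (k • (2 * π) + x) = f x
  rw [add_comm]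
  exact hf.zsmul k x

lemma lint_double (f : ℝ → ℝ≥0∞) (hf : Function.Periodic f (2 * π)) :
    ∫⁻ y, f (2 * y) ∂cI = ∫⁻ y, f y ∂cI := by
  have hπ := pi_pos
  have h := lintegral_image_eq_lintegral_abs_deriv_mul (s := Ioc (-π) π) measurableSet_Ioc
    (f := fun y => 2 * y) (f' := fun _ => 2)
    (fun x _ => by simpa using ((hasDerivAt_id x).const_mul 2).hasDerivWithinAt)
    (fun x _ y _ h => by simpa using h) f
  have him : (fun y : ℝ => 2 * y) '' Ioc (-π) π = Ioc (-2 * π) (-2 * π + 2 * π) ∪ Ioc 0 (0 + 2 * π) := by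
    rw [Set.image_mul_left_Ioc two_pos, show -2 * π + 2 * π = 0 by ring, zero_add,
      Ioc_union_Ioc_eq_Ioc (by linarith) (by linarith)]
    congr 1; ring
  rw [him, lintegral_union measurableSet_Ioc, lint_period f hf, lint_period f hf, lintegral_const_mul' _ _ (by simp)] at h
  · have e : ENNReal.ofReal |(2:ℝ)| = 2 := by simp
    rw [e, ← two_mul] at h
    exact ((ENNReal.mul_right_inj (by simp) (by simp)).1 h).symm
  · rw [Set.disjoint_iff]; rintro x ⟨h1, h2⟩; simp only [mem_Ioc] at h1 h2; simp only [mem_empty_iff_false]; linarith [h1.2, h2.1]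

lemma lint_even (f : ℝ → ℝ≥0∞) (hf : ∀ x, f (-x) = f x) :
    ∫⁻ y, f y ∂cI = 2 * ∫⁻ y in Ioo 0 π, f y := by
  have hπ := pi_pos
  have h := lintegral_image_eq_lintegral_abs_deriv_mul (s := Ioo 0 π) measurableSet_Ioo
    (f := fun y => -y) (f' := fun _ => -1)
    (fun x _ => (hasDerivAt_neg x).hasDerivWithinAt)
    (fun x _ y _ h => by simpa using h) f
  simp only [hf, abs_neg, abs_one, ENNReal.ofReal_one, one_mul, Set.image_neg_eq_neg, Set.neg_Ioo, neg_zero] at h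
  unfold cI
  rw [← Ioc_union_Ioc_eq_Ioc (b := 0) (by linarith) hπ.le, lintegral_union measurableSet_Ioc,
    setLIntegral_congr Ioo_ae_eq_Ioc.symm, setLIntegral_congr (Ioo_ae_eq_Ioc (a := 0) (b := π)).symm, h, two_mul]
  rw [Set.disjoint_iff]; rintro x ⟨h1, h2⟩; simp only [mem_Ioc] at h1 h2; simp only [mem_empty_iff_false]; linarith [h1.2, h2.1]

lemma lint_neg (f : ℝ → ℝ≥0∞) : ∫⁻ y, f (-y) ∂cI = ∫⁻ y, f y ∂cI := by
  have hπ := pi_pos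
  have h := lintegral_image_eq_lintegral_abs_deriv_mul (s := Ioo (-π) π) measurableSet_Ioo
    (f := fun y => -y) (f' := fun _ => -1)
    (fun x _ => (hasDerivAt_neg x).hasDerivWithinAt)
    (fun x _ y _ h => by simpa using h) f
  simp only [abs_neg, abs_one, ENNReal.ofReal_one, one_mul, Set.image_neg_eq_neg, Set.neg_Ioo, neg_neg] at h
  unfold cI
  rw [setLIntegral_congr Ioo_ae_eq_Ioc.symm, setLIntegral_congr Ioo_ae_eq_Ioc.symm, h]

lemma lint_cosv (g : ℝ → ℝ≥0∞) :
    ∫⁻ v in Ioo (-1) 1, g v = ∫⁻ y in Ioo 0 π, ENNReal.ofReal (sin y) * g (cos y) := by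
  have hπ := pi_pos
  have h := lintegral_image_eq_lintegral_abs_deriv_mul (s := Ioo 0 π) measurableSet_Ioo
    (f := cos) (f' := fun y => -sin y)
    (fun x _ => (hasDerivAt_cos x).hasDerivWithinAt)
    (injOn_cos.mono Ioo_subset_Icc_self) g
  have him : cos '' Ioo 0 π = Ioo (-1) 1 := by
    ext v; constructor
    · rintro ⟨y, hy, rfl⟩
      constructor
      · rw [← cos_pi]; exact strictAntiOn_cos (Ioo_subset_Icc_self hy) (by simp [hπ.le]) hy.2
      · rw [← cos_zero]; exact strictAntiOn_cos (by simp [hπ.le]) (Ioo_subset_Icc_self hy) hy.1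
    · intro hv
      refine ⟨arccos v, ⟨?_, ?_⟩, cos_arccos hv.1.le hv.2.le⟩
      · exact arccos_pos.2 hv.2
      · have := arccos_le_pi v
        refine lt_of_le_of_ne this fun h => ?_
        rw [arccos_eq_pi] at h; linarith [hv.1]
  rw [him] at h
  rw [h]
  apply setLIntegral_congr_fun measurableSet_Ioo
  intro y hy
  simp only [abs_neg, abs_of_nonneg (sin_nonneg_of_mem_Icc (Ioo_subset_Icc_self hy))]

def TT (z : ℝ × ℝ) : ℝ × ℝ := (cos (z.1 + z.2), cos (z.1 - z.2))

@[fun_prop] lemma TT_cont : Continuous TT := by unfold TT; fun_prop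

/-- the change of variables, trigonometric form -/
lemma cov_trig {W : ℝ → ℝ} (hW : GW W) {G : ℝ × ℝ → ℝ≥0∞} (hG : Measurable G) :
    ∫⁻ z, G (TT z) ∂((mW W).prod (mW W)) =
      4 * ∫⁻ θ in Ioo 0 π, ∫⁻ φ in Ioo 0 π, ENNReal.ofReal (W ((θ + φ)/2) * W ((θ - φ)/2)) * G (cos θ, cos φ) := by
  have hWm := hW.meas
  have hTm := TT_cont.measurable
  set h : ℝ → ℝ → ℝ≥0∞ := fun θ φ => ENNReal.ofReal (W ((θ + φ)/2) * W ((θ - φ)/2)) * G (cos θ, cos φ) with hh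
  have hhm : Measurable fun z : ℝ × ℝ => h z.1 z.2 := by simp only [hh]; fun_prop
  have hneg : ∀ x, W (-x) = W x := hW.even
  have p1 : ∀ φ, Function.Periodic (fun θ => h θ φ) (2 * π) := by
    intro φ θ
    simp only [hh, cos_add_two_pi]
    rw [show (θ + 2 * π + φ)/2 = (θ + φ)/2 + π by ring, show (θ + 2 * π - φ)/2 = (θ - φ)/2 + π by ring, hW.per, hW.per]
  have p2 : ∀ θ, Function.Periodic (fun φ => h θ φ) (2 * π) := by
    intro θ φ
    simp only [hh, cos_add_two_pi]
    rw [show (θ + (φ + 2 * π))/2 = (θ + φ)/2 + π by ring, hW.per, ← hW.per ((θ - (φ + 2 * π))/2), show (θ - (φ + 2 * π))/2 + π = (θ - φ)/2 by ring]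
  have e1 : ∀ θ φ, h (-θ) φ = h θ φ := by
    intro θ φ
    simp only [hh, cos_neg]
    rw [show (-θ + φ)/2 = -((θ - φ)/2) by ring, show (-θ - φ)/2 = -((θ + φ)/2) by ring, hneg, hneg, mul_comm (W ((θ - φ)/2))]
  have e2 : ∀ θ φ, h θ (-φ) = h θ φ := by
    intro θ φ
    simp only [hh, cos_neg]
    rw [show (θ + -φ)/2 = (θ - φ)/2 by ring, show (θ - -φ)/2 = (θ + φ)/2 by ring, mul_comm (W ((θ - φ)/2))]
  have : IsFiniteMeasure cI := inferInstance
  have s1 : ∫⁻ z, G (TT z) ∂((mW W).prod (mW W)) = ∫⁻ z, h (z.1 + z.2) (z.1 - z.2) ∂(cI.prod cI) := by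
    unfold mW
    rw [prod_withDensity (by fun_prop) (by fun_prop), lintegral_withDensity_eq_lintegral_mul _ (by fun_prop) (by fun_prop)]
    apply lintegral_congr
    intro z
    simp only [Pi.mul_apply, hh, TT]
    rw [← ENNReal.ofReal_mul (hW.nonneg _)]
    congr 3
    · congr 1; ring
    · congr 1; ring
  rw [s1, lintegral_prod_symm _ (by fun_prop)]
  have s2 : ∀ y, ∫⁻ x, h (x + y) (x - y) ∂cI = ∫⁻ θ, h θ (θ - 2 * y) ∂cI := by
    intro y
    rw [← lint_shift (fun θ => h θ (θ - 2 * y)) _ y]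
    · apply lintegral_congr; intro x; congr 1; ring
    · intro θ
      simp only
      rw [show θ + 2 * π - 2 * y = θ - 2 * y + 2 * π by ring]
      exact (p1 _ θ).trans (p2 θ _)
  simp only [s2]
  rw [lintegral_lintegral_swap (by unfold Function.uncurry; fun_prop)]
  have s3 : ∀ θ, ∫⁻ y, h θ (θ - 2 * y) ∂cI = ∫⁻ φ, h θ φ ∂cI := by
    intro θ
    rw [lint_double (fun y => h θ (θ - y)), ← lint_neg]
    · have := lint_shift (fun φ => h θ φ) (p2 θ) θ
      rw [← this]; apply lintegral_congr; intro x; congr 1; ring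
    · intro y; simp only
      refine (p2 θ (θ - (y + 2 * π))).symm.trans ?_
      simp only; congr 1; ring
  simp only [s3]
  rw [lint_even _ (fun θ => by simp only [e1])]
  simp only [fun θ => lint_even (fun φ => h θ φ) (e2 θ)]
  rw [lintegral_const_mul' _ _ (by simp), ← mul_assoc]
  norm_num [hh]

lemma cov_lint {W : ℝ → ℝ} (hW : GW W) {G : ℝ × ℝ → ℝ≥0∞} (hG : Measurable G) {V : ℝ × ℝ → ℝ}
    (hV : AEMeasurable V (volume.restrict sqDom)) (hVW : ∀ θ ∈ Ioo 0 π, ∀ φ ∈ Ioo 0 π,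
      sin θ * (sin φ * V (cos θ, cos φ)) = W ((θ + φ)/2) * W ((θ - φ)/2)) :
    ∫⁻ z, G (TT z) ∂((mW W).prod (mW W)) = 4 * ∫⁻ q in sqDom, ENNReal.ofReal (V q) * G q := by
  rw [cov_trig hW hG]
  congr 1
  have hs : (volume : Measure (ℝ × ℝ)).restrict sqDom = (volume.restrict (Ioo (-1:ℝ) 1)).prod (volume.restrict (Ioo (-1:ℝ) 1)) := by
    unfold sqDom
    rw [Measure.volume_eq_prod, ← Measure.prod_restrict]
    rw [restrict_Ioo_eq_restrict_Icc]
  rw [hs] at hV ⊢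
  rw [lintegral_prod _ (by fun_prop), lint_cosv]
  apply setLIntegral_congr_fun measurableSet_Ioo
  intro θ hθ
  simp only
  rw [lint_cosv, ← lintegral_const_mul' _ _ (by simp)]
  apply setLIntegral_congr_fun measurableSet_Ioo
  intro φ hφ
  simp only
  rw [← hVW θ hθ φ hφ, ENNReal.ofReal_mul (sin_nonneg_of_mem_Icc (Ioo_subset_Icc_self hθ)),
    ENNReal.ofReal_mul (sin_nonneg_of_mem_Icc (Ioo_subset_Icc_self hφ))]
  ring

/-- The weighted measure on the square. -/
def nuV (V : ℝ × ℝ → ℝ) : Measure (ℝ × ℝ) := (volume.restrict sqDom).withDensity (fun q => ENNReal.ofReal (V q))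

/-- Link between the square weight and the one variable weight. -/
structure VW (W : ℝ → ℝ) (V : ℝ × ℝ → ℝ) : Prop where
  gw : GW W
  am : AEMeasurable V (volume.restrict sqDom)
  nn : ∀ q ∈ sqDom, 0 ≤ V q
  id : ∀ θ ∈ Ioo 0 π, ∀ φ ∈ Ioo 0 π, sin θ * (sin φ * V (cos θ, cos φ)) = W ((θ + φ)/2) * W ((θ - φ)/2)

lemma sqDom_meas : MeasurableSet sqDom := measurableSet_Icc.prod measurableSet_Icc

lemma TT_mem (z : ℝ × ℝ) : TT z ∈ sqDom := ⟨⟨neg_one_le_cos _, cos_le_one _⟩, ⟨neg_one_le_cos _, cos_le_one _⟩⟩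

lemma VW.lint {W : ℝ → ℝ} {V : ℝ × ℝ → ℝ} (h : VW W V) {G : ℝ × ℝ → ℝ≥0∞} (hG : Measurable G) :
    ∫⁻ z, G (TT z) ∂((mW W).prod (mW W)) = 4 * ∫⁻ q, G q ∂(nuV V) := by
  have := h.am
  rw [cov_lint h.gw hG h.am h.id]
  unfold nuV
  rw [lintegral_withDensity_eq_lintegral_mul₀ (by fun_prop) (by fun_prop)]; rfl

lemma VW.map {W : ℝ → ℝ} {V : ℝ × ℝ → ℝ} (h : VW W V) :
    Measure.map TT ((mW W).prod (mW W)) = (4:ℝ≥0∞) • nuV V := by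
  ext s hs
  have hT := TT_cont.measurable
  have := h.lint (G := s.indicator 1) (measurable_one.indicator hs)
  rw [Measure.smul_apply, ← lintegral_indicator_one hs, ← lintegral_indicator_one hs, lintegral_map (measurable_one.indicator hs) hT]
  exact this

lemma VW.fin {W : ℝ → ℝ} {V : ℝ × ℝ → ℝ} (h : VW W V) : IsFiniteMeasure (nuV V) := by
  have := h.gw.fin
  constructor
  have e := congr_arg (fun m => m univ) h.map
  simp only [Measure.smul_apply, smul_eq_mul] at e
  have l : (4:ℝ≥0∞) * nuV V univ < ⊤ := by rw [← e]; exact measure_lt_top _ _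
  exact ENNReal.lt_top_of_mul_ne_top_right l.ne (by norm_num)

lemma VW.int {W : ℝ → ℝ} {V : ℝ × ℝ → ℝ} (h : VW W V) {g : ℝ × ℝ → ℝ} (hg : Measurable g) :
    ∫ z, g (TT z) ∂((mW W).prod (mW W)) = 4 * ∫ q, g q ∂(nuV V) := by
  have hT := TT_cont.measurable
  rw [← integral_map hT.aemeasurable hg.aestronglyMeasurable, h.map, integral_smul_measure]
  simp

lemma VW.intble {W : ℝ → ℝ} {V : ℝ × ℝ → ℝ} (h : VW W V) {g : ℝ × ℝ → ℝ} (hg : Measurable g) :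
    Integrable (fun z => g (TT z)) ((mW W).prod (mW W)) ↔ Integrable g (nuV V) := by
  have hT := TT_cont.measurable
  have := integrable_map_measure (μ := (mW W).prod (mW W)) (f := TT) hg.aestronglyMeasurable hT.aemeasurable
  rw [h.map, integrable_smul_measure (by simp) (by simp)] at this
  exact this.symm

lemma nu_integral {W : ℝ → ℝ} {V : ℝ × ℝ → ℝ} (h : VW W V) (g : ℝ × ℝ → ℝ) :
    ∫ q, g q ∂(nuV V) = ∫ q in sqDom, g q * V q := by
  have := h.am
  unfold nuV
  rw [integral_withDensity_eq_integral_toReal_smul₀ (by fun_prop) (by simp)]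
  apply setIntegral_congr_fun sqDom_meas
  intro q hq
  simp only [ENNReal.toReal_ofReal (h.nn q hq), smul_eq_mul]
  ring

lemma nu_lp {W : ℝ → ℝ} {V : ℝ × ℝ → ℝ} (h : VW W V) {e : ℝ} (he : 0 < e) {g : ℝ × ℝ → ℝ} (hg : Measurable g) :
    ∫⁻ q in sqDom, ENNReal.ofReal (|g q| ^ e * V q) = ∫⁻ q, ‖g q‖ₑ ^ e ∂(nuV V) := by
  have := h.am
  unfold nuV
  rw [lintegral_withDensity_eq_lintegral_mul₀ (by fun_prop) (by fun_prop)]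
  apply lintegral_congr
  intro q
  simp only [Pi.mul_apply]
  rw [ENNReal.ofReal_mul (by positivity), mul_comm, ← ENNReal.ofReal_rpow_of_nonneg (abs_nonneg _) he.le, ← Real.norm_eq_abs, ofReal_norm]

lemma mW_shift {W : ℝ → ℝ} (hW : GW W) {E : Type*} [NormedAddCommGroup E] [NormedSpace ℝ E] {g : ℝ → E}
    (hg : Function.Periodic g (2 * π)) : ∫ x, g (x + π) ∂(mW W) = ∫ x, g x ∂(mW W) := by
  rw [mW_integral hW, mW_integral hW, ← cI_integral_shift (fun x => W x • g x) _ π]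
  · simp only [hW.per]
  · intro x
    simp only
    rw [hg x, show x + 2 * π = x + π + π by ring, hW.per, hW.per]

lemma mW_neg {W : ℝ → ℝ} (hW : GW W) {E : Type*} [NormedAddCommGroup E] [NormedSpace ℝ E] (g : ℝ → E) :
    ∫ x, g (-x) ∂(mW W) = ∫ x, g x ∂(mW W) := by
  rw [mW_integral hW, mW_integral hW, ← cI_integral_neg (fun x => W x • g x)]
  simp only [hW.even]

lemma mW2_shift {W : ℝ → ℝ} (hW : GW W) {g : ℝ × ℝ → ℝ} (h1 : ∀ x y, g (x + 2 * π, y) = g (x, y)) (h2 : ∀ x y, g (x, y + 2 * π) = g (x, y))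
    (hi : Integrable g ((mW W).prod (mW W))) (hi2 : Integrable (fun z : ℝ × ℝ => g (z.1 + π, z.2 + π)) ((mW W).prod (mW W))) :
    ∫ z, g (z.1 + π, z.2 + π) ∂((mW W).prod (mW W)) = ∫ z, g z ∂((mW W).prod (mW W)) := by
  have := hW.fin
  rw [integral_prod _ hi, integral_prod _ hi2]
  simp only
  simp only [fun x => mW_shift hW (g := fun y => g (x + π, y)) (fun y => h2 _ _)]
  exact mW_shift hW (g := fun x => ∫ y, g (x, y) ∂(mW W)) (fun x => by simp only [h1])

lemma mW2_neg {W : ℝ → ℝ} (hW : GW W) {g : ℝ × ℝ → ℝ}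
    (hi : Integrable g ((mW W).prod (mW W))) (hi2 : Integrable (fun z : ℝ × ℝ => g (-z.1, -z.2)) ((mW W).prod (mW W))) :
    ∫ z, g (-z.1, -z.2) ∂((mW W).prod (mW W)) = ∫ z, g z ∂((mW W).prod (mW W)) := by
  have := hW.fin
  rw [integral_prod _ hi, integral_prod _ hi2]
  simp only
  simp only [fun x => mW_neg hW (fun y => g (-x, y))]
  exact mW_neg hW (fun x => ∫ y, g (x, y) ∂(mW W))

lemma evalP_cont (Q : MvPolynomial (Fin 2) ℝ) : Continuous (evalP Q) := by
  have : Continuous fun q : ℝ × ℝ => MvPolynomial.eval ![q.1, q.2] Q := by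
    refine (MvPolynomial.continuous_eval Q).comp ?_
    refine continuous_pi fun i => ?_
    fin_cases i
    · exact continuous_fst
    · exact continuous_snd
  exact this

lemma sqDom_compact : IsCompact sqDom := isCompact_Icc.prod isCompact_Icc

lemma evalP_bdd (Q : MvPolynomial (Fin 2) ℝ) : ∃ c, ∀ q ∈ sqDom, ‖evalP Q q‖ ≤ c :=
  sqDom_compact.exists_bound_of_continuousOn (evalP_cont Q).continuousOn

lemma polyX_deg (q : Polynomial ℝ) : (polyX q).totalDegree ≤ q.natDegree := by
  unfold polyX
  rw [Polynomial.aeval_eq_sum_range]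
  refine (MvPolynomial.totalDegree_finsetSum _ _).trans (Finset.sup_le fun i hi => ?_)
  refine (MvPolynomial.totalDegree_smul_le _ _).trans ?_
  rw [MvPolynomial.totalDegree_X_pow]
  simpa [Nat.lt_succ_iff] using hi

lemma polyY_deg (q : Polynomial ℝ) : (polyY q).totalDegree ≤ q.natDegree := by
  unfold polyY
  rw [Polynomial.aeval_eq_sum_range]
  refine (MvPolynomial.totalDegree_finsetSum _ _).trans (Finset.sup_le fun i hi => ?_)
  refine (MvPolynomial.totalDegree_smul_le _ _).trans ?_
  rw [MvPolynomial.totalDegree_X_pow]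
  simpa [Nat.lt_succ_iff] using hi

lemma polyX_eval (q : Polynomial ℝ) (z : ℝ × ℝ) : evalP (polyX q) z = q.eval z.1 := by
  unfold polyX evalP
  rw [Polynomial.aeval_def, Polynomial.hom_eval₂, Polynomial.eval, MvPolynomial.eval_X]
  congr 1
  ext; simp

lemma polyY_eval (q : Polynomial ℝ) (z : ℝ × ℝ) : evalP (polyY q) z = q.eval z.2 := by
  unfold polyY evalP
  rw [Polynomial.aeval_def, Polynomial.hom_eval₂, Polynomial.eval, MvPolynomial.eval_X]
  congr 1
  ext; simp

lemma tf_tf (k l : ℤ) (x y : ℝ) : tf k x * tf l y = Complex.ofReal (cos (k * x + l * y)) + Complex.ofReal (sin (k * x + l * y)) * Complex.I := by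
  unfold tf
  rw [← ex_add, ex_eq]

lemma re_ctf (c : ℂ) (k l : ℤ) (x y : ℝ) : (c * (tf k x * tf l y)).re = c.re * cos (k * x + l * y) - c.im * sin (k * x + l * y) := by
  rw [tf_tf]
  generalize cos (k * x + l * y) = s
  generalize sin (k * x + l * y) = t
  simp only [Complex.mul_re, Complex.add_re, Complex.ofReal_re, Complex.ofReal_im, Complex.add_im, Complex.mul_im, Complex.I_re, Complex.I_im]; ring

/-- the lifted projection of a bi-trigonometric function is a polynomial of degree at most `n` -/
def Lf (μ : Measure ℝ) (n : ℕ) (g : ℝ × ℝ → ℂ) : Prop := ∀ c : ℂ, ∃ Q : MvPolynomial (Fin 2) ℝ, Q.totalDegree ≤ n ∧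
  ∀ f : ℝ × ℝ → ℝ, Integrable (fun z => f (TT z)) (μ.prod μ) →
    ∫ z, f (TT z) * (c * g z).re ∂(μ.prod μ) = ∫ z, f (TT z) * evalP Q (TT z) ∂(μ.prod μ)

lemma int_evalP {m : Measure (ℝ × ℝ)} {f : ℝ × ℝ → ℝ} (hf : Integrable (fun z => f (TT z)) m) (Q : MvPolynomial (Fin 2) ℝ) :
    Integrable (fun z => f (TT z) * evalP Q (TT z)) m := by
  obtain ⟨c, hc⟩ := evalP_bdd Q
  exact hf.mul_bdd (c := c) (((evalP_cont Q).comp TT_cont).aestronglyMeasurable) (ae_of_all _ fun z => hc _ (TT_mem z))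

lemma int_re {m : Measure (ℝ × ℝ)} {f : ℝ × ℝ → ℝ} (hf : Integrable (fun z => f (TT z)) m) {S T : Set ℤ} {u v : ℝ → ℂ}
    (hu : u ∈ SP S) (hv : v ∈ SP T) (c : ℂ) :
    Integrable (fun z => f (TT z) * (c * (u z.1 * v z.2)).re) m := by
  obtain ⟨A, hA⟩ := SP_bdd hu
  obtain ⟨B, hB⟩ := SP_bdd hv
  have cu := SP_cont hu
  have cv := SP_cont hv
  refine hf.mul_bdd (c := ‖c‖ * (A * B)) (by
    have : Continuous fun z : ℝ × ℝ => (c * (u z.1 * v z.2)).re := by fun_prop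
    exact this.aestronglyMeasurable) (ae_of_all _ fun z => ?_)
  refine (Complex.abs_re_le_norm _).trans ?_
  rw [norm_mul, norm_mul]
  have := (norm_nonneg _).trans (hA z.1)
  gcongr
  · exact hA _
  · exact hB _

lemma Lf_base {W : ℝ → ℝ} (hW : GW W) {n : ℕ} {k l : ℤ} (hk : |k| ≤ (n:ℤ)) (hl : |l| ≤ (n:ℤ)) :
    Lf (mW W) n (fun z => tf k z.1 * tf l z.2) := by
  intro c
  have hfin := hW.fin
  set m := (mW W).prod (mW W) with hm
  have bc : ∀ f : ℝ × ℝ → ℝ, Integrable (fun z => f (TT z)) m → ∀ k l : ℤ, Integrable (fun z => f (TT z) * cos (k * z.1 + l * z.2)) m := by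
    intro f hf k l
    exact hf.mul_bdd (c := 1) (by have : Continuous fun z : ℝ × ℝ => cos (k * z.1 + l * z.2) := by fun_prop
                                  exact this.aestronglyMeasurable) (ae_of_all _ fun z => abs_cos_le_one _)
  have bs : ∀ f : ℝ × ℝ → ℝ, Integrable (fun z => f (TT z)) m → ∀ k l : ℤ, Integrable (fun z => f (TT z) * sin (k * z.1 + l * z.2)) m := by
    intro f hf k l
    exact hf.mul_bdd (c := 1) (by have : Continuous fun z : ℝ × ℝ => sin (k * z.1 + l * z.2) := by fun_prop
                                  exact this.aestronglyMeasurable) (ae_of_all _ fun z => abs_sin_le_one _)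
  have hTn : ∀ z : ℝ × ℝ, TT (-z.1, -z.2) = TT z := by
    intro z; unfold TT; simp only
    rw [show -z.1 + -z.2 = -(z.1 + z.2) by ring, show -z.1 - -z.2 = -(z.1 - z.2) by ring, cos_neg, cos_neg]
  have hTs : ∀ z : ℝ × ℝ, TT (z.1 + π, z.2 + π) = TT z := by
    intro z; unfold TT; simp only
    rw [show z.1 + π + (z.2 + π) = z.1 + z.2 + 2 * π by ring, show z.1 + π - (z.2 + π) = z.1 - z.2 by ring, cos_add_two_pi]
  have hTw : ∀ z : ℝ × ℝ, TT z.swap = TT z := by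
    intro z; unfold TT; simp only [Prod.fst_swap, Prod.snd_swap]
    rw [show z.2 - z.1 = -(z.1 - z.2) by ring, cos_neg, add_comm]
  have hT1 : ∀ x y, TT (x + 2 * π, y) = TT (x, y) := by
    intro x y; unfold TT; simp only
    rw [show x + 2 * π + y = x + y + 2 * π by ring, show x + 2 * π - y = x - y + 2 * π by ring, cos_add_two_pi, cos_add_two_pi]
  have hT2 : ∀ x y, TT (x, y + 2 * π) = TT (x, y) := by
    intro x y; unfold TT; simp only
    rw [show x + (y + 2 * π) = x + y + 2 * π by ring, show x - (y + 2 * π) = x - y - 2 * π by ring, cos_add_two_pi, cos_sub_two_pi]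
  have hsin : ∀ f : ℝ × ℝ → ℝ, Integrable (fun z => f (TT z)) m → ∫ z, f (TT z) * sin (k * z.1 + l * z.2) ∂m = 0 := by
    intro f hf
    have e : ∀ z : ℝ × ℝ, f (TT (-z.1, -z.2)) * sin (k * (-z.1) + l * (-z.2)) = -(f (TT z) * sin (k * z.1 + l * z.2)) := by
      intro z; rw [hTn, show (k:ℝ) * (-z.1) + l * (-z.2) = -(k * z.1 + l * z.2) by ring, sin_neg]; ring
    have := mW2_neg hW (g := fun z => f (TT z) * sin (k * z.1 + l * z.2)) (bs f hf k l) (by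
      simp only [e]; exact (bs f hf k l).neg)
    simp only [e] at this
    rw [integral_neg] at this
    linarith
  have hre : ∀ f : ℝ × ℝ → ℝ, Integrable (fun z => f (TT z)) m →
      ∫ z, f (TT z) * (c * (tf k z.1 * tf l z.2)).re ∂m = c.re * ∫ z, f (TT z) * cos (k * z.1 + l * z.2) ∂m := by
    intro f hf
    have e : ∀ z : ℝ × ℝ, f (TT z) * (c * (tf k z.1 * tf l z.2)).re = c.re * (f (TT z) * cos (k * z.1 + l * z.2)) - c.im * (f (TT z) * sin (k * z.1 + l * z.2)) := by
      intro z; rw [re_ctf]; ring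
    simp only [e]
    rw [integral_sub ((bc f hf k l).const_mul _) ((bs f hf k l).const_mul _), integral_const_mul, integral_const_mul, hsin f hf]
    ring
  rcases Int.even_or_odd (k + l) with he | ho
  · obtain ⟨j, hj⟩ := he
    have hkj : k - l = 2 * (k - j) := by linarith
    set i := k - j with hi
    have kj : k = j + i := by linarith
    have lj : l = j - i := by linarith
    refine ⟨MvPolynomial.C c.re * (polyX (Polynomial.Chebyshev.T ℝ j) * polyY (Polynomial.Chebyshev.T ℝ i)), ?_, ?_⟩
    · refine (MvPolynomial.totalDegree_mul _ _).trans ?_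
      rw [MvPolynomial.totalDegree_C, zero_add]
      refine (MvPolynomial.totalDegree_mul _ _).trans ((add_le_add (polyX_deg _) (polyY_deg _)).trans ?_)
      rw [Polynomial.Chebyshev.natDegree_T, Polynomial.Chebyshev.natDegree_T]
      rw [abs_le] at hk hl
      omega
    · intro f hf
      rw [hre f hf]
      have hsw : ∫ z, f (TT z) * cos (k * z.1 + l * z.2) ∂m = ∫ z, f (TT z) * cos (l * z.1 + k * z.2) ∂m := by
        rw [← integral_prod_swap]
        simp only [hTw, Prod.fst_swap, Prod.snd_swap]
        apply integral_congr_ae; filter_upwards with z; rw [add_comm (k * z.2 : ℝ)]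
      have e : ∀ z : ℝ × ℝ, f (TT z) * evalP (MvPolynomial.C c.re * (polyX (Polynomial.Chebyshev.T ℝ j) * polyY (Polynomial.Chebyshev.T ℝ i))) (TT z)
          = c.re / 2 * (f (TT z) * cos (k * z.1 + l * z.2)) + c.re / 2 * (f (TT z) * cos (l * z.1 + k * z.2)) := by
        intro z
        have e1 : evalP (MvPolynomial.C c.re * (polyX (Polynomial.Chebyshev.T ℝ j) * polyY (Polynomial.Chebyshev.T ℝ i))) (TT z)
            = c.re * (evalP (polyX (Polynomial.Chebyshev.T ℝ j)) (TT z) * evalP (polyY (Polynomial.Chebyshev.T ℝ i)) (TT z)) := by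
          unfold evalP; simp
        rw [e1, polyX_eval, polyY_eval]
        rw [show (TT z).1 = cos (z.1 + z.2) from rfl, show (TT z).2 = cos (z.1 - z.2) from rfl, Polynomial.Chebyshev.T_real_cos, Polynomial.Chebyshev.T_real_cos]
        have a1 : (k:ℝ) * z.1 + l * z.2 = j * (z.1 + z.2) + i * (z.1 - z.2) := by rw [kj, lj]; push_cast; ring
        have a2 : (l:ℝ) * z.1 + k * z.2 = j * (z.1 + z.2) - i * (z.1 - z.2) := by rw [kj, lj]; push_cast; ring
        rw [a1, a2, cos_add (j * (z.1 + z.2)) (i * (z.1 - z.2)), cos_sub (j * (z.1 + z.2)) (i * (z.1 - z.2))]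
        generalize f (TT z) = F
        generalize cos ((j:ℝ) * (z.1 + z.2)) = A
        generalize cos ((i:ℝ) * (z.1 - z.2)) = B
        ring
      simp only [e]
      rw [integral_add ((bc f hf k l).const_mul _) ((bc f hf l k).const_mul _), integral_const_mul, integral_const_mul, ← hsw]
      ring
  · refine ⟨0, by simp, fun f hf => ?_⟩
    rw [hre f hf]
    have e : ∀ z : ℝ × ℝ, f (TT (z.1 + π, z.2 + π)) * cos (k * (z.1 + π) + l * (z.2 + π)) = -(f (TT z) * cos (k * z.1 + l * z.2)) := by
      intro z
      obtain ⟨j, hj⟩ := ho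
      have : ((k:ℝ) + l) = 2 * j + 1 := by exact_mod_cast hj
      rw [hTs, show (k:ℝ) * (z.1 + π) + l * (z.2 + π) = k * z.1 + l * z.2 + (k + l) * π by ring, this,
        show k * z.1 + l * z.2 + (2 * j + 1) * π = k * z.1 + l * z.2 + π + j * (2 * π) by ring, cos_add_int_mul_two_pi, cos_add_pi]
      ring
    have := mW2_shift hW (g := fun z => f (TT z) * cos (k * z.1 + l * z.2)) (by
        intro x y; simp only [hT1]
        rw [show (k:ℝ) * (x + 2 * π) + l * y = k * x + l * y + k * (2 * π) by ring, cos_add_int_mul_two_pi]) (by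
        intro x y; simp only [hT2]
        rw [show (k:ℝ) * x + l * (y + 2 * π) = k * x + l * y + l * (2 * π) by ring, cos_add_int_mul_two_pi]) (bc f hf k l) (by
        simp only [e]; exact (bc f hf k l).neg)
    simp only [e] at this
    rw [integral_neg] at this
    have h0 : ∫ z, f (TT z) * cos (k * z.1 + l * z.2) ∂m = 0 := by linarith
    rw [h0]
    simp [evalP]

lemma Lf_add {μ : Measure ℝ} {n : ℕ} {S : Set ℤ} {u u' v v' : ℝ → ℂ}
    (hu : u ∈ SP S) (hv : v ∈ SP S) (hu' : u' ∈ SP S) (hv' : v' ∈ SP S)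
    (h1 : Lf μ n (fun z => u z.1 * v z.2)) (h2 : Lf μ n (fun z => u' z.1 * v' z.2)) : Lf μ n (fun z => u z.1 * v z.2 + u' z.1 * v' z.2) := by
  intro c
  obtain ⟨Q1, d1, H1⟩ := h1 c
  obtain ⟨Q2, d2, H2⟩ := h2 c
  refine ⟨Q1 + Q2, (MvPolynomial.totalDegree_add _ _).trans (max_le d1 d2), fun f hf => ?_⟩
  have e : ∀ z, evalP (Q1 + Q2) z = evalP Q1 z + evalP Q2 z := by intro z; unfold evalP; simp
  simp only [e, mul_add, Complex.add_re]
  rw [integral_add (int_evalP hf Q1) (int_evalP hf Q2), ← H1 f hf, ← H2 f hf, ← integral_add (int_re hf hu hv c) (int_re hf hu' hv' c)]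

lemma Lf_SP {W : ℝ → ℝ} (hW : GW W) {n : ℕ} {u v : ℝ → ℂ} (hu : u ∈ SP (STn n)) (hv : v ∈ SP (STn n)) :
    Lf (mW W) n (fun z => u z.1 * v z.2) := by
  have Lz : Lf (mW W) n (fun _ => 0) := fun c => ⟨0, by simp, fun f hf => by simp [evalP]⟩
  have Ls : ∀ (a : ℂ) (g : ℝ × ℝ → ℂ), Lf (mW W) n g → Lf (mW W) n (fun z => a * g z) := by
    intro a g hg c
    obtain ⟨Q, d, H⟩ := hg (c * a)
    exact ⟨Q, d, fun f hf => by simp only [← mul_assoc]; exact H f hf⟩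
  have h1 : ∀ k ∈ STn n, Lf (mW W) n (fun z => tf k z.1 * v z.2) := by
    intro k hk
    refine SP_ind (P := fun v => Lf (mW W) n (fun z => tf k z.1 * v z.2)) (fun l hl => Lf_base hW hk hl) (by simpa using Lz) ?_ ?_ hv
    · intro f g hf hg h1 h2
      simp only [Pi.add_apply, mul_add]
      exact Lf_add (tf_mem hk) hf (tf_mem hk) hg h1 h2
    · intro a f hf h
      simp only [Pi.smul_apply, smul_eq_mul, mul_left_comm _ a]
      exact Ls a _ h
  refine SP_ind (P := fun u => Lf (mW W) n (fun z => u z.1 * v z.2)) h1 (by simpa using Lz) ?_ ?_ hu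
  · intro f g hf hg h1 h2
    simp only [Pi.add_apply, add_mul]
    exact Lf_add hf hv hg hv h1 h2
  · intro a f hf h
    simp only [Pi.smul_apply, smul_eq_mul, mul_assoc]
    exact Ls a _ h

/-- Bi-trigonometric polynomials of degree at most `n` in each variable. -/
def SP2 (n : ℕ) : Submodule ℂ (ℝ × ℝ → ℂ) :=
  Submodule.span ℂ {g | ∃ k ∈ STn n, ∃ l ∈ STn n, g = fun z => tf k z.1 * tf l z.2}

lemma SP2_base {n : ℕ} {k l : ℤ} (hk : |k| ≤ (n:ℤ)) (hl : |l| ≤ (n:ℤ)) : (fun z : ℝ × ℝ => tf k z.1 * tf l z.2) ∈ SP2 n :=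
  Submodule.subset_span ⟨k, hk, l, hl, rfl⟩

lemma SP2_mono {m n : ℕ} (h : m ≤ n) : SP2 m ≤ SP2 n := by
  have hh : (m:ℤ) ≤ n := by exact_mod_cast h
  refine Submodule.span_mono ?_
  rintro g ⟨k, hk, l, hl, rfl⟩
  exact ⟨k, le_trans hk hh, l, le_trans hl hh, rfl⟩

lemma cosp_tf (x y : ℝ) : ((cos (x + y) : ℝ) : ℂ) = (1/2) * (tf 1 x * tf 1 y) + (1/2) * (tf (-1) x * tf (-1) y) := by
  rw [tf_tf, tf_tf, show ((1:ℤ):ℝ) * x + (1:ℤ) * y = x + y by push_cast; ring,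
    show ((-1:ℤ):ℝ) * x + (-1:ℤ) * y = -(x + y) by push_cast; ring, cos_neg, sin_neg]
  push_cast; ring

lemma cosm_tf (x y : ℝ) : ((cos (x - y) : ℝ) : ℂ) = (1/2) * (tf 1 x * tf (-1) y) + (1/2) * (tf (-1) x * tf 1 y) := by
  rw [tf_tf, tf_tf, show ((1:ℤ):ℝ) * x + (-1:ℤ) * y = x - y by push_cast; ring,
    show ((-1:ℤ):ℝ) * x + (1:ℤ) * y = -(x - y) by push_cast; ring, cos_neg, sin_neg]
  push_cast; ring

lemma SP2_mul {n : ℕ} {a b : ℤ} (ha : |a| ≤ 1) (hb : |b| ≤ 1) {g : ℝ × ℝ → ℂ} (hg : g ∈ SP2 n) :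
    (fun z : ℝ × ℝ => (tf a z.1 * tf b z.2) * g z) ∈ SP2 (n+1) := by
  unfold SP2 at hg
  induction hg using Submodule.span_induction with
  | mem g h =>
    obtain ⟨k, hk, l, hl, rfl⟩ := h
    have : (fun z : ℝ × ℝ => (tf a z.1 * tf b z.2) * (tf k z.1 * tf l z.2)) = fun z => tf (a + k) z.1 * tf (b + l) z.2 := by
      funext z; rw [← tf_mul, ← tf_mul]; ring
    rw [this]
    have hk' : |k| ≤ (n:ℤ) := hk
    have hl' : |l| ≤ (n:ℤ) := hl
    refine SP2_base ?_ ?_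
    · refine (abs_add_le _ _).trans ?_; push_cast; linarith
    · refine (abs_add_le _ _).trans ?_; push_cast; linarith
  | zero =>
    have := (SP2 (n+1)).zero_mem
    convert this using 1
    funext z; simp
  | add f g _ _ h1 h2 =>
    have := (SP2 (n+1)).add_mem h1 h2
    convert this using 1
    funext z; simp only [Pi.add_apply]; ring
  | smul c f _ h =>
    have := (SP2 (n+1)).smul_mem c h
    convert this using 1
    funext z; simp only [Pi.smul_apply, smul_eq_mul]; ring

lemma SP2_T1 {n : ℕ} {g : ℝ × ℝ → ℂ} (hg : g ∈ SP2 n) : (fun z : ℝ × ℝ => (((TT z).1 : ℝ) : ℂ) * g z) ∈ SP2 (n+1) := by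
  have h1 := SP2_mul (a := 1) (b := 1) (by simp) (by simp) hg
  have h2 := SP2_mul (a := -1) (b := -1) (by simp) (by simp) hg
  have := (SP2 (n+1)).add_mem ((SP2 (n+1)).smul_mem (1/2) h1) ((SP2 (n+1)).smul_mem (1/2) h2)
  convert this using 1
  funext z; simp only [Pi.add_apply, Pi.smul_apply, smul_eq_mul]
  rw [show (TT z).1 = cos (z.1 + z.2) from rfl, cosp_tf]; ring

lemma SP2_T2 {n : ℕ} {g : ℝ × ℝ → ℂ} (hg : g ∈ SP2 n) : (fun z : ℝ × ℝ => (((TT z).2 : ℝ) : ℂ) * g z) ∈ SP2 (n+1) := by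
  have h1 := SP2_mul (a := 1) (b := -1) (by simp) (by simp) hg
  have h2 := SP2_mul (a := -1) (b := 1) (by simp) (by simp) hg
  have := (SP2 (n+1)).add_mem ((SP2 (n+1)).smul_mem (1/2) h1) ((SP2 (n+1)).smul_mem (1/2) h2)
  convert this using 1
  funext z; simp only [Pi.add_apply, Pi.smul_apply, smul_eq_mul]
  rw [show (TT z).2 = cos (z.1 - z.2) from rfl, cosm_tf]; ring

lemma SP2_mon (a b : ℕ) : (fun z : ℝ × ℝ => (((TT z).1 : ℝ) : ℂ)^a * (((TT z).2 : ℝ) : ℂ)^b) ∈ SP2 (a + b) := by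
  induction a with
  | zero =>
    induction b with
    | zero =>
      have := SP2_base (n := 0) (k := 0) (l := 0) (by simp) (by simp)
      convert this using 1
      funext z; simp [tf, ex]
    | succ b ih =>
      have := SP2_T2 ih
      rw [show 0 + (b + 1) = 0 + b + 1 by ring]
      convert this using 1
      funext z; ring
  | succ a ih =>
    have := SP2_T1 ih
    rw [show a + 1 + b = a + b + 1 by ring]
    convert this using 1
    funext z; ring

lemma SP2_poly {n : ℕ} {P : MvPolynomial (Fin 2) ℝ} (hP : P.totalDegree ≤ n) : (fun z : ℝ × ℝ => ((evalP P (TT z) : ℝ) : ℂ)) ∈ SP2 n := by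
  have : (fun z : ℝ × ℝ => ((evalP P (TT z) : ℝ) : ℂ)) = ∑ d ∈ P.support, ((P.coeff d : ℝ) : ℂ) •
      (fun z : ℝ × ℝ => (((TT z).1 : ℝ) : ℂ)^(d 0) * (((TT z).2 : ℝ) : ℂ)^(d 1)) := by
    funext z
    unfold evalP
    rw [MvPolynomial.eval_eq']
    simp only [Fin.prod_univ_two, Finset.sum_apply, Pi.smul_apply, smul_eq_mul]
    push_cast
    rfl
  rw [this]
  refine Submodule.sum_mem _ fun d hd => Submodule.smul_mem _ _ (SP2_mono ?_ (SP2_mon _ _))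
  have := MvPolynomial.le_totalDegree hd
  rw [Finsupp.sum_fintype _ _ (by simp)] at this
  simp only [Fin.sum_univ_two] at this
  omega

lemma SP2_cb {n : ℕ} {g : ℝ × ℝ → ℂ} (hg : g ∈ SP2 n) : Continuous g ∧ ∃ c, ∀ z, ‖g z‖ ≤ c := by
  unfold SP2 at hg
  induction hg using Submodule.span_induction with
  | mem g h =>
    obtain ⟨k, hk, l, hl, rfl⟩ := h
    have c1 := SP_cont (tf_mem hk)
    have c2 := SP_cont (tf_mem hl)
    refine ⟨by fun_prop, 1, fun z => ?_⟩
    simp only [tf, norm_mul, norm_ex]; norm_num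
  | zero => exact ⟨continuous_const, 0, by simp⟩
  | add f g _ _ h1 h2 =>
    obtain ⟨a1, c, hc⟩ := h1
    obtain ⟨a2, d, hd⟩ := h2
    exact ⟨a1.add a2, c + d, fun z => (norm_add_le _ _).trans (add_le_add (hc z) (hd z))⟩
  | smul c f _ h =>
    obtain ⟨a1, d, hd⟩ := h
    refine ⟨a1.const_smul c, ‖c‖ * d, fun z => ?_⟩
    simp only [Pi.smul_apply, norm_smul]
    gcongr; exact hd z

lemma SP2_kint {W : ℝ → ℝ} (hW : GW W) {n : ℕ} {g : ℝ × ℝ → ℂ} (hg : g ∈ SP2 n) (x y : ℝ) :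
    Integrable (fun z : ℝ × ℝ => (KK (mW W) n x z.1 * KK (mW W) n y z.2) * g z) ((mW W).prod (mW W)) := by
  have hfin := hW.fin
  obtain ⟨h1, c, hc⟩ := SP2_cb hg
  obtain ⟨d, hd⟩ := KK_bdd (mW W) n
  have k1 : Continuous fun y => KK (mW W) n x y := SP_cont (KK_mem _ n x)
  have k2 : Continuous fun x => KK (mW W) n y x := SP_cont (KK_mem _ n y)
  refine Integrable.of_bound (C := d * d * c) (by
    have : Continuous (fun z : ℝ × ℝ => (KK (mW W) n x z.1 * KK (mW W) n y z.2) * g z) := by fun_prop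
    exact this.aestronglyMeasurable) (ae_of_all _ fun z => ?_)
  rw [norm_mul, norm_mul]
  have := (norm_nonneg _).trans (hd x z.1)
  gcongr
  · exact hd _ _
  · exact hd _ _
  · exact hc _

lemma SP2_rep {W : ℝ → ℝ} (hW : GW W) {n : ℕ} {g : ℝ × ℝ → ℂ} (hg : g ∈ SP2 n) (x y : ℝ) :
    ∫ z : ℝ × ℝ, (KK (mW W) n x z.1 * KK (mW W) n y z.2) * g z ∂((mW W).prod (mW W)) = g (x, y) := by
  have hfin := hW.fin
  have key := fun (g : ℝ × ℝ → ℂ) (hg : g ∈ SP2 n) => SP2_kint hW hg x y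
  unfold SP2 at hg
  induction hg using Submodule.span_induction with
  | mem g h =>
    obtain ⟨k, hk, l, hl, rfl⟩ := h
    have e : ∀ z : ℝ × ℝ, (KK (mW W) n x z.1 * KK (mW W) n y z.2) * (tf k z.1 * tf l z.2) = (KK (mW W) n x z.1 * tf k z.1) * (KK (mW W) n y z.2 * tf l z.2) := by
      intro z; ring
    simp only [e]
    rw [integral_prod_mul (fun a => KK (mW W) n x a * tf k a) (fun a => KK (mW W) n y a * tf l a), KK_rep hW.gm n (tf_mem hk), KK_rep hW.gm n (tf_mem hl)]
  | zero => simp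
  | add f g hf hg h1 h2 =>
    simp only [Pi.add_apply, mul_add]
    rw [integral_add (key f hf) (key g hg), h1, h2]
  | smul c f _ h =>
    simp only [Pi.smul_apply, smul_eq_mul, mul_left_comm _ c]
    rw [integral_const_mul, h]

lemma kern {W : ℝ → ℝ} {V : ℝ × ℝ → ℝ} (h : VW W V) {n : ℕ} {R : MvPolynomial (Fin 2) ℝ} (hR : R.totalDegree ≤ n) (z : ℝ × ℝ)
    (hrep : ∀ P : MvPolynomial (Fin 2) ℝ, P.totalDegree ≤ n → (∫ y in sqDom, evalP R y * evalP P y * V y) = evalP P (TT z))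
    {f : ℝ × ℝ → ℝ} (hf : Measurable f) (hfi : Integrable f (nuV V)) :
    ∫ q, f q * evalP R q ∂(nuV V) = ∫ w, f (TT w) * (KK (mW W) n z.1 w.1 * KK (mW W) n z.2 w.2).re ∂((mW W).prod (mW W)) := by
  have hfin := h.gw.fin
  have hfin2 := h.fin
  obtain ⟨Q, dQ, hQ⟩ := Lf_SP h.gw (KK_mem (mW W) n z.1) (KK_mem (mW W) n z.2) 1
  simp only [one_mul] at hQ
  have mP : ∀ P, Measurable (evalP P) := fun P => (evalP_cont P).measurable
  have iP : ∀ P, Integrable (evalP P) (nuV V) := by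
    intro P
    rw [← h.intble (mP P)]
    simpa using int_evalP (f := fun _ => 1) (m := (mW W).prod (mW W)) (integrable_const 1) P
  have e1 : ∀ P : MvPolynomial (Fin 2) ℝ, P.totalDegree ≤ n → ∫ q, evalP P q * evalP R q ∂(nuV V) = evalP P (TT z) := by
    intro P hP
    rw [nu_integral h, ← hrep P hP]
    apply integral_congr_ae; filter_upwards with q; ring
  have e2 : ∀ P : MvPolynomial (Fin 2) ℝ, P.totalDegree ≤ n → 4 * ∫ q, evalP P q * evalP Q q ∂(nuV V) = evalP P (TT z) := by
    intro P hP
    rw [← h.int (g := fun q => evalP P q * evalP Q q) ((mP P).mul (mP Q)), ← hQ _ ((h.intble (mP P)).2 (iP P))]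
    have hs := SP2_poly hP
    have hr := SP2_rep h.gw hs z.1 z.2
    have := integral_re (𝕜 := ℂ) (SP2_kint h.gw hs z.1 z.2)
    rw [hr] at this
    simp only [RCLike.re_eq_complex_re, Complex.re_mul_ofReal, Complex.ofReal_re] at this
    rw [← this]
    apply integral_congr_ae; filter_upwards with q; ring
  have iPQ : ∀ P Q, Integrable (fun q => evalP P q * evalP Q q) (nuV V) := by
    intro P Q
    rw [← h.intble (g := fun q => evalP P q * evalP Q q) ((mP P).mul (mP Q))]
    exact int_evalP ((h.intble (mP P)).2 (iP P)) Q
  set D := R - MvPolynomial.C 4 * Q with hD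
  have eD : ∀ q, evalP D q = evalP R q - 4 * evalP Q q := by intro q; simp [hD, evalP]
  have dD : D.totalDegree ≤ n := by
    refine (MvPolynomial.totalDegree_sub _ _).trans (max_le hR ((MvPolynomial.totalDegree_mul _ _).trans ?_))
    rw [MvPolynomial.totalDegree_C]; omega
  have z0 : ∫ q, evalP D q * evalP D q ∂(nuV V) = 0 := by
    have e : ∀ q, evalP D q * evalP D q = evalP D q * evalP R q - 4 * (evalP D q * evalP Q q) := by
      intro q; rw [eD]; ring
    simp only [e]
    rw [integral_sub (iPQ D R) ((iPQ D Q).const_mul 4), integral_const_mul, e1 D dD, e2 D dD, sub_self]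
  rw [integral_eq_zero_iff_of_nonneg (fun q => mul_self_nonneg _) (iPQ D D)] at z0
  have fQ : Integrable (fun w => f (TT w)) ((mW W).prod (mW W)) := (h.intble hf).2 hfi
  rw [hQ f fQ, h.int (g := fun q => f q * evalP Q q) (hf.mul (mP Q)), ← integral_const_mul]
  apply integral_congr_ae
  filter_upwards [z0] with q hq
  have : evalP D q = 0 := mul_self_eq_zero.1 hq
  rw [eD] at this
  rw [sub_eq_zero.1 this]; ring

lemma two_step {μ : Measure ℝ} [IsFiniteMeasure μ] {k : ℝ → ℝ → ℂ} (kc : Continuous fun z : ℝ × ℝ => k z.1 z.2)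
    {d : ℝ} (kb : ∀ x y, ‖k x y‖ ≤ d) {p : ℝ} {C : ℝ≥0∞}
    (H : ∀ f : ℝ → ℂ, Measurable f → ∫⁻ x, ‖∫ y, k x y * f y ∂μ‖ₑ ^ p ∂μ ≤ C * ∫⁻ x, ‖f x‖ₑ ^ p ∂μ)
    {F : ℝ × ℝ → ℂ} (hF : Measurable F) (hi : Integrable F (μ.prod μ)) :
    ∫⁻ z, ‖∫ w, (k z.1 w.1 * k z.2 w.2) * F w ∂(μ.prod μ)‖ₑ ^ p ∂(μ.prod μ) ≤ C * (C * ∫⁻ z, ‖F z‖ₑ ^ p ∂(μ.prod μ)) := by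
  have km := kc.measurable
  have k2 : ∀ {α : Type} [MeasurableSpace α] {u v : α → ℝ}, Measurable u → Measurable v → Measurable fun t => k (u t) (v t) :=
    fun hu hv => km.comp (hu.prodMk hv)
  have Gm : Measurable fun z : ℝ × ℝ => ∫ x', k z.1 x' * F (x', z.2) ∂μ := by
    have : Measurable fun t : (ℝ × ℝ) × ℝ => k t.1.1 t.2 * F (t.2, t.1.2) :=
      (k2 (by fun_prop) (by fun_prop)).mul (hF.comp (by fun_prop))
    exact this.stronglyMeasurable.integral_prod_right.measurable
  have Sm : Measurable fun z : ℝ × ℝ => ∫ w, (k z.1 w.1 * k z.2 w.2) * F w ∂(μ.prod μ) := by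
    have : Measurable fun t : (ℝ × ℝ) × (ℝ × ℝ) => (k t.1.1 t.2.1 * k t.1.2 t.2.2) * F t.2 :=
      ((k2 (by fun_prop) (by fun_prop)).mul (k2 (by fun_prop) (by fun_prop))).mul (hF.comp (by fun_prop))
    exact this.stronglyMeasurable.integral_prod_right.measurable
  have e : ∀ x y, ∫ w, (k x w.1 * k y w.2) * F w ∂(μ.prod μ) = ∫ y', k y y' * ∫ x', k x x' * F (x', y') ∂μ ∂μ := by
    intro x y
    have ib : Integrable (fun w : ℝ × ℝ => (k x w.1 * k y w.2) * F w) (μ.prod μ) := by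
      refine hi.bdd_mul (c := d * d) ((k2 measurable_const measurable_fst).mul (k2 measurable_const measurable_snd)).aestronglyMeasurable (ae_of_all _ fun w => ?_)
      rw [norm_mul]
      have := (norm_nonneg _).trans (kb x w.1)
      exact mul_le_mul (kb _ _) (kb _ _) (norm_nonneg _) this
    rw [integral_prod_symm _ ib]
    apply integral_congr_ae; filter_upwards with y'
    rw [← integral_const_mul]
    apply integral_congr_ae; filter_upwards with x'
    ring
  rw [lintegral_prod _ (Sm.enorm.pow_const p).aemeasurable]
  calc _ ≤ ∫⁻ x, C * ∫⁻ y', ‖∫ x', k x x' * F (x', y') ∂μ‖ₑ ^ p ∂μ ∂μ := by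
        apply lintegral_mono; intro x
        simp only [e]
        exact H (fun y' => ∫ x', k x x' * F (x', y') ∂μ) (Gm.comp (by fun_prop : Measurable fun y : ℝ => (x, y)))
    _ = C * ∫⁻ y', ∫⁻ x, ‖∫ x', k x x' * F (x', y') ∂μ‖ₑ ^ p ∂μ ∂μ := by
        rw [lintegral_const_mul _ ((Gm.enorm.pow_const p).lintegral_prod_right'), lintegral_lintegral_swap (Gm.enorm.pow_const p).aemeasurable]
    _ ≤ C * ∫⁻ y', C * ∫⁻ x, ‖F (x, y')‖ₑ ^ p ∂μ ∂μ := by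
        gcongr with y'
        exact H (fun x' => F (x', y')) (hF.comp (by fun_prop))
    _ = _ := by
        rw [lintegral_const_mul _ ((hF.enorm.pow_const p).lintegral_prod_left'), lintegral_prod_symm _ (hF.enorm.pow_const p).aemeasurable]

lemma IsRK_meas {D : Set (ℝ × ℝ)} {V : ℝ × ℝ → ℝ} {n : ℕ} {K : ℝ × ℝ → ℝ × ℝ → ℝ} (hK : IsRK D V n K) :
    Measurable fun t : (ℝ × ℝ) × (ℝ × ℝ) => K t.1 t.2 := by
  obtain ⟨⟨KP, h⟩, -⟩ := hK
  simp only [h]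
  have : Continuous fun t : (ℝ × ℝ) × (ℝ × ℝ) => MvPolynomial.eval ![t.1.1, t.1.2, t.2.1, t.2.2] KP := by
    refine (MvPolynomial.continuous_eval KP).comp (continuous_pi fun i => ?_)
    fin_cases i <;> simp <;> fun_prop
  exact this.measurable

lemma boundV {W : ℝ → ℝ} {V : ℝ × ℝ → ℝ} (h : VW W V) {p : ℝ} (hp : 1 < p) {C : ℝ≥0∞} {n : ℕ}
    (H : ∀ f : ℝ → ℂ, Measurable f → ∫⁻ x, ‖∫ y, KK (mW W) n x y * f y ∂(mW W)‖ₑ ^ p ∂(mW W) ≤ C * ∫⁻ x, ‖f x‖ₑ ^ p ∂(mW W))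
    {K : ℝ × ℝ → ℝ × ℝ → ℝ} (hK : IsRK sqDom V n K) {f : ℝ × ℝ → ℝ} (hf : Measurable f) (hfin : ∫⁻ q, ‖f q‖ₑ ^ p ∂(nuV V) ≠ ⊤) :
    ∫⁻ x, ‖∫ y, f y * K x y ∂(nuV V)‖ₑ ^ p ∂(nuV V) ≤ C * C * ∫⁻ q, ‖f q‖ₑ ^ p ∂(nuV V) := by
  have f1 := h.gw.fin
  have f2 := h.fin
  have hT := TT_cont.measurable
  have Km := IsRK_meas hK
  have hfi : Integrable f (nuV V) := by
    have h1 : MemLp f (ENNReal.ofReal p) (nuV V) := by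
      refine ⟨hf.aestronglyMeasurable, ?_⟩
      rw [eLpNorm_lt_top_iff_lintegral_rpow_enorm_lt_top (by simp; linarith) (by simp)]
      rw [ENNReal.toReal_ofReal (by linarith)]
      exact hfin.lt_top
    exact h1.integrable (by rw [← ENNReal.ofReal_one]; exact ENNReal.ofReal_le_ofReal hp.le)
  have hfiT := (h.intble hf).2 hfi
  have Sm : Measurable fun x : ℝ × ℝ => ∫ y, f y * K x y ∂(nuV V) := by
    have : Measurable fun t : (ℝ × ℝ) × (ℝ × ℝ) => f t.2 * K t.1 t.2 := (hf.comp measurable_snd).mul Km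
    exact this.stronglyMeasurable.integral_prod_right.measurable
  have e : ∀ z, ‖∫ y, f y * K (TT z) y ∂(nuV V)‖ₑ = ‖∫ w, (KK (mW W) n z.1 w.1 * KK (mW W) n z.2 w.2) * ((f (TT w) : ℝ) : ℂ) ∂((mW W).prod (mW W))‖ₑ := by
    intro z
    obtain ⟨R, dR, hR⟩ := hK.2.1 (TT z) (TT_mem z)
    have hrep := fun P hP => hK.2.2 P hP (TT z) (TT_mem z)
    simp only [hR] at hrep ⊢
    rw [kern h dR z hrep hf hfi]
    have e3 : ∀ w : ℝ × ℝ, (KK (mW W) n z.1 w.1 * KK (mW W) n z.2 w.2) * ((f (TT w) : ℝ) : ℂ) = ((f (TT w) * (KK (mW W) n z.1 w.1 * KK (mW W) n z.2 w.2).re : ℝ) : ℂ) := by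
      intro w
      have : (starRingEnd ℂ) (KK (mW W) n z.1 w.1 * KK (mW W) n z.2 w.2) = KK (mW W) n z.1 w.1 * KK (mW W) n z.2 w.2 := by
        rw [map_mul, KK_real h.gw.gm, KK_real h.gw.gm]
      rw [Complex.conj_eq_iff_re] at this
      rw [Complex.ofReal_mul, this, mul_comm]
    simp only [e3]
    rw [integral_complex_ofReal]
    rw [← ofReal_norm, ← ofReal_norm, Complex.norm_real]
  have L1 := h.lint (G := fun x => ‖∫ y, f y * K x y ∂(nuV V)‖ₑ ^ p) (Sm.enorm.pow_const p)
  have L2 := h.lint (G := fun x => ‖f x‖ₑ ^ p) (hf.enorm.pow_const p)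
  obtain ⟨d, hd⟩ := KK_bdd (mW W) n
  have T := two_step (KK_cont (mW W) n) hd H (F := fun w => ((f (TT w) : ℝ) : ℂ)) (Complex.measurable_ofReal.comp (hf.comp hT)) hfiT.ofReal
  have e4 : ∀ w : ℝ × ℝ, ‖((f (TT w) : ℝ) : ℂ)‖ₑ = ‖f (TT w)‖ₑ := by
    intro w; rw [← ofReal_norm, ← ofReal_norm, Complex.norm_real]
  simp only [e4, ← e] at T
  rw [L1, L2] at T
  have T' : 4 * ∫⁻ x, ‖∫ y, f y * K x y ∂(nuV V)‖ₑ ^ p ∂(nuV V) ≤ 4 * (C * C * ∫⁻ q, ‖f q‖ₑ ^ p ∂(nuV V)) := by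
    refine T.trans (le_of_eq ?_); ring
  exact (ENNReal.mul_le_mul_iff_right (by norm_num) (by norm_num)).1 T'

lemma c1_lip {ψ : ℝ → ℝ} (h : ContDiffOn ℝ 1 ψ (Icc (-1:ℝ) 1)) :
    ∃ L : ℝ, 0 ≤ L ∧ ∀ x ∈ Icc (-1:ℝ) 1, ∀ y ∈ Icc (-1:ℝ) 1, |ψ x - ψ y| ≤ L * |x - y| := by
  have hu : UniqueDiffOn ℝ (Icc (-1:ℝ) 1) := uniqueDiffOn_Icc (by norm_num)
  have hd : DifferentiableOn ℝ ψ (Icc (-1:ℝ) 1) := h.differentiableOn (by norm_num)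
  have hc : ContinuousOn (derivWithin ψ (Icc (-1:ℝ) 1)) (Icc (-1:ℝ) 1) := h.continuousOn_derivWithin hu (by norm_num)
  obtain ⟨L, hL⟩ := isCompact_Icc.exists_bound_of_continuousOn hc
  refine ⟨L, (norm_nonneg _).trans (hL 0 (by constructor <;> norm_num)), fun x hx y hy => ?_⟩
  exact (convex_Icc (-1:ℝ) 1).norm_image_sub_le_of_norm_derivWithin_le hd hL hy hx

lemma mk_PF {ψ : ℝ → ℝ} (h0 : ∀ x ∈ Icc (-1:ℝ) 1, 0 < ψ x) (h : ContDiffOn ℝ 1 ψ (Icc (-1:ℝ) 1)) {c : ℝ} (hc : 0 < c) :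
    ∃ c0 c1 Λ, PF (fun x => c * ψ (cos (2 * x))) c0 c1 Λ := by
  obtain ⟨L, hL0, hL⟩ := c1_lip h
  have hm : ∀ x : ℝ, cos (2 * x) ∈ Icc (-1:ℝ) 1 := fun x => ⟨neg_one_le_cos _, cos_le_one _⟩
  have ne : (Icc (-1:ℝ) 1).Nonempty := ⟨0, by constructor <;> norm_num⟩
  obtain ⟨t, ht, hmin⟩ := isCompact_Icc.exists_isMinOn ne h.continuousOn
  obtain ⟨s, hs, hmax⟩ := isCompact_Icc.exists_isMaxOn ne h.continuousOn
  refine ⟨c * ψ t, c * ψ s, c * (L * 2), ?_, mul_pos hc (h0 t ht), ?_, ?_, ?_, ?_, by positivity, ?_⟩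
  · exact continuous_const.mul (h.continuousOn.comp_continuous (by fun_prop) hm)
  · intro x; exact mul_le_mul_of_nonneg_left (hmin (hm x)) hc.le
  · intro x; exact mul_le_mul_of_nonneg_left (hmax (hm x)) hc.le
  · intro x; simp only [mul_neg, cos_neg]
  · intro x; simp only [mul_add, cos_add_two_pi]
  · intro x y
    rw [← mul_sub, abs_mul, abs_of_pos hc, mul_assoc]
    refine mul_le_mul_of_nonneg_left ((hL _ (hm x) _ (hm y)).trans ?_) hc.le
    rw [mul_assoc]
    refine mul_le_mul_of_nonneg_left ?_ hL0
    rw [cos_sub_cos, show (2 * x + 2 * y) / 2 = x + y by ring, show (2 * x - 2 * y) / 2 = x - y by ring, abs_mul, abs_mul]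
    have := abs_sin_le_one (x + y)
    rw [show |(-2:ℝ)| = 2 by norm_num]
    nlinarith [abs_nonneg (sin (x - y)), abs_nonneg (sin (x + y))]

lemma sq_rp {s : ℝ} (hs : 0 < s) : (s^2) ^ (-(1/2) : ℝ) = s⁻¹ := by
  rw [← rpow_natCast, ← rpow_mul hs.le]
  norm_num
  exact rpow_neg_one s

lemma mk_VW {ψ : ℝ → ℝ} (hψ0 : ∀ x ∈ Icc (-1:ℝ) 1, 0 < ψ x)
    {Ψ : ℝ × ℝ → ℝ}
    (hΨ : ∀ θ φ : ℝ, θ ∈ Icc (0:ℝ) π → φ ∈ Icc (0:ℝ) π →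
      Ψ (Real.cos θ, Real.cos φ) = ψ (Real.cos (θ - φ)) * ψ (Real.cos (θ + φ)))
    {α β : ℝ} {CW : ℝ × ℝ → ℝ}
    (hCW : ∀ q : ℝ × ℝ, CW q
      = Ψ q * |q.1 - q.2| ^ (2*α+1) * |q.1 + q.2| ^ (2*β+1)
        * (1 - q.1^2) ^ (-(1/2) : ℝ) * (1 - q.2^2) ^ (-(1/2) : ℝ))
    (hg : GW (Wt (fun x => (2:ℝ) ^ (α + 1/2 + (β + 1/2)) * ψ (cos (2 * x))) (α + 1/2) (β + 1/2))) :
    VW (Wt (fun x => (2:ℝ) ^ (α + 1/2 + (β + 1/2)) * ψ (cos (2 * x))) (α + 1/2) (β + 1/2)) CW := by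
  set W := Wt (fun x => (2:ℝ) ^ (α + 1/2 + (β + 1/2)) * ψ (cos (2 * x))) (α + 1/2) (β + 1/2) with hW
  have hid : ∀ θ ∈ Ioo 0 π, ∀ φ ∈ Ioo 0 π, sin θ * (sin φ * CW (cos θ, cos φ)) = W ((θ + φ)/2) * W ((θ - φ)/2) := by
    intro θ hθ φ hφ
    have s1 := sin_pos_of_mem_Ioo hθ
    have s2 := sin_pos_of_mem_Ioo hφ
    rw [hCW]
    simp only
    rw [hΨ θ φ ⟨hθ.1.le, hθ.2.le⟩ ⟨hφ.1.le, hφ.2.le⟩, ← sin_sq, ← sin_sq, sq_rp s1, sq_rp s2, hW]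
    unfold Wt rho
    beta_reduce
    rw [show 2 * ((θ + φ)/2) = θ + φ by ring, show 2 * ((θ - φ)/2) = θ - φ by ring,
      cos_sub_cos, cos_add_cos]
    set x := (θ + φ)/2
    set y := (θ - φ)/2
    have e1 : |(-2) * sin x * sin y| ^ (2*α+1) = (2:ℝ) ^ (2*α+1) * (|sin x| ^ (2*α+1) * |sin y| ^ (2*α+1)) := by
      rw [abs_mul, abs_mul, show |(-2:ℝ)| = 2 by norm_num, mul_rpow (by positivity) (by positivity), mul_rpow (by positivity) (by positivity), mul_assoc]
    have e2 : |2 * cos x * cos y| ^ (2*β+1) = (2:ℝ) ^ (2*β+1) * (|cos x| ^ (2*β+1) * |cos y| ^ (2*β+1)) := by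
      rw [abs_mul, abs_mul, show |(2:ℝ)| = 2 by norm_num, mul_rpow (by positivity) (by positivity), mul_rpow (by positivity) (by positivity), mul_assoc]
    have e3 : (2:ℝ) ^ (α + 1/2 + (β + 1/2)) * (2:ℝ) ^ (α + 1/2 + (β + 1/2)) = (2:ℝ) ^ (2*α+1) * (2:ℝ) ^ (2*β+1) := by
      rw [← rpow_add (by norm_num), ← rpow_add (by norm_num)]; congr 1; ring
    rw [e1, e2, show 2 * (α + 1/2) = 2*α+1 by ring, show 2 * (β + 1/2) = 2*β+1 by ring]
    generalize (2:ℝ) ^ (α + 1/2 + (β + 1/2)) = t at e3 ⊢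
    generalize |sin x| ^ (2*α+1) = A1
    generalize |sin y| ^ (2*α+1) = A2
    generalize |cos x| ^ (2*β+1) = B1
    generalize |cos y| ^ (2*β+1) = B2
    generalize ψ (cos (θ - φ)) = p1
    generalize ψ (cos (θ + φ)) = p2
    generalize (2:ℝ) ^ (2*α+1) = t1 at e3 ⊢
    generalize (2:ℝ) ^ (2*β+1) = t2 at e3 ⊢
    field_simp
    linear_combination (-(A1 * A2 * B1 * B2 * p1 * p2)) * e3
  refine ⟨hg, ?_, ?_, hid⟩
  · have er : (volume.restrict sqDom : Measure (ℝ × ℝ)) = volume.restrict (Ioo (-1:ℝ) 1 ×ˢ Ioo (-1:ℝ) 1) := by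
      unfold sqDom
      rw [Measure.volume_eq_prod, ← Measure.prod_restrict, ← Measure.prod_restrict, restrict_Ioo_eq_restrict_Icc]
    rw [er]
    have Gm : Measurable fun q : ℝ × ℝ => W ((arccos q.1 + arccos q.2)/2) * W ((arccos q.1 - arccos q.2)/2) / (sin (arccos q.1) * sin (arccos q.2)) := by
      have := hg.meas
      have a1 : Measurable fun q : ℝ × ℝ => arccos q.1 := (continuous_arccos.comp continuous_fst).measurable
      have a2 : Measurable fun q : ℝ × ℝ => arccos q.2 := (continuous_arccos.comp continuous_snd).measurable
      fun_prop
    refine Gm.aemeasurable.congr (ae_restrict_of_forall_mem (measurableSet_Ioo.prod measurableSet_Ioo) ?_)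
    rintro ⟨u, v⟩ ⟨hu, hv⟩
    simp only at hu hv ⊢
    have m1 : arccos u ∈ Ioo 0 π := ⟨arccos_pos.2 hu.2, arccos_lt_pi.2 hu.1⟩
    have m2 : arccos v ∈ Ioo 0 π := ⟨arccos_pos.2 hv.2, arccos_lt_pi.2 hv.1⟩
    have := hid _ m1 _ m2
    rw [← this, cos_arccos hu.1.le hu.2.le, cos_arccos hv.1.le hv.2.le]
    have s1 := sin_pos_of_mem_Ioo m1
    have s2 := sin_pos_of_mem_Ioo m2
    field_simp
  · rintro ⟨u, v⟩ ⟨hu, hv⟩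
    simp only at hu hv
    rw [hCW]
    have := hΨ (arccos u) (arccos v) ⟨arccos_nonneg _, arccos_le_pi _⟩ ⟨arccos_nonneg _, arccos_le_pi _⟩
    rw [cos_arccos hu.1 hu.2, cos_arccos hv.1 hv.2] at this
    rw [this]
    have p1 := hψ0 _ ⟨neg_one_le_cos (arccos u - arccos v), cos_le_one _⟩
    have p2 := hψ0 _ ⟨neg_one_le_cos (arccos u + arccos v), cos_le_one _⟩
    have q1 : 0 ≤ 1 - u^2 := by nlinarith [hu.1, hu.2]
    have q2 : 0 ≤ 1 - v^2 := by nlinarith [hv.1, hv.2]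
    simp only
    have r1 := rpow_nonneg q1 (-(1/2))
    have r2 := rpow_nonneg q2 (-(1/2))
    positivity

lemma par_aux {A e c : ℝ} (hA : 0 ≤ A) (h1 : (2 - e) * (A + 1) < 1) (h2 : A * (e - 2) < 1) (hc : -(1/2) < c) (hcA : c ≤ A) :
    1 < e ∧ c * (e - 2) < 1 ∧ c * (2 - e) < e - 1 := by
  have he : 1 < e := by nlinarith
  refine ⟨he, ?_, ?_⟩
  · rcases le_total 2 e with h | h <;> nlinarith
  · rcases le_total 2 e with h | h <;> nlinarith

lemma par_main {M e : ℝ} (hM : -1 < M) (he1 : 2 - 2 / (2 * M + 3) < e) (he2 : e < 2 + 2 / (2 * M + 1)) :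
    0 ≤ M + 1/2 ∧ (2 - e) * (M + 1/2 + 1) < 1 ∧ (M + 1/2) * (e - 2) < 1 := by
  have h3 : 0 < 2 * M + 3 := by linarith
  have k1 : (2 - e) * (M + 1/2 + 1) < 1 := by
    have : 2 - e < 2 / (2 * M + 3) := by linarith
    rw [lt_div_iff₀ h3] at this
    linarith
  have hA : 0 ≤ M + 1/2 := by
    by_contra hn
    push Not at hn
    have hneg : 2 * M + 1 < 0 := by linarith
    have : e - 2 < 2 / (2 * M + 1) := by linarith
    rw [lt_div_iff_of_neg hneg] at this
    nlinarith
  refine ⟨hA, k1, ?_⟩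
  rcases hA.eq_or_lt with h | h
  · rw [← h]; norm_num
  · have hp : 0 < 2 * M + 1 := by linarith
    have : e - 2 < 2 / (2 * M + 1) := by linarith
    rw [lt_div_iff₀ hp] at this
    linarith

/-- `L^p` boundedness of the partial sums `S_n(𝒲_{α,β})` on the
square for `p` in the Pollard-type range. -/
theorem stmt_18
    (ψ : ℝ → ℝ) (hψ0 : ∀ x ∈ Icc (-1:ℝ) 1, 0 < ψ x)
    (hψd : ContDiffOn ℝ 1 ψ (Icc (-1:ℝ) 1))
    (Ψ : ℝ × ℝ → ℝ)
    (hΨ : ∀ θ φ : ℝ, θ ∈ Icc (0:ℝ) π → φ ∈ Icc (0:ℝ) π →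
      Ψ (Real.cos θ, Real.cos φ) = ψ (Real.cos (θ - φ)) * ψ (Real.cos (θ + φ)))
    (α β : ℝ) (hα : -1 < α) (hβ : -1 < β)
    (CW : ℝ × ℝ → ℝ)
    (hCW : ∀ q : ℝ × ℝ, CW q
      = Ψ q * |q.1 - q.2| ^ (2*α+1) * |q.1 + q.2| ^ (2*β+1)
        * (1 - q.1^2) ^ (-(1/2) : ℝ) * (1 - q.2^2) ^ (-(1/2) : ℝ))
    (e : ℝ) (he1 : 2 - 2 / (2 * max α β + 3) < e) (he2 : e < 2 + 2 / (2 * max α β + 1))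
    (K : ℕ → (ℝ × ℝ) → (ℝ × ℝ) → ℝ)
    (hK : ∀ n, IsRK sqDom CW n (K n)) :
    ∃ c : ℝ, 0 < c ∧ ∀ n : ℕ, ∀ f : ℝ × ℝ → ℝ, Measurable f →
      lpnormD sqDom CW e f < ⊤ →
      lpnormD sqDom CW e (fun x => ∫ y in sqDom, f y * K n x y * CW y)
        ≤ ENNReal.ofReal c * lpnormD sqDom CW e f := by
  have hM : -1 < max α β := lt_max_of_lt_left hα
  obtain ⟨hA, k1, k2⟩ := par_main hM he1 he2
  obtain ⟨e1, a1, a2⟩ := par_aux hA k1 k2 (c := α + 1/2) (by linarith) (by linarith [le_max_left α β])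
  obtain ⟨-, b1, b2⟩ := par_aux hA k1 k2 (c := β + 1/2) (by linarith) (by linarith [le_max_right α β])
  have hab : 0 ≤ α + 1/2 ∨ 0 ≤ β + 1/2 := by
    rcases max_choice α β with h | h
    · left; rw [h] at hA; exact hA
    · right; rw [h] at hA; exact hA
  obtain ⟨c0, c1, Λ, hP⟩ := mk_PF hψ0 hψd (c := (2:ℝ) ^ (α + 1/2 + (β + 1/2))) (by positivity)
  have hg := hP.gw (a := α + 1/2) (b := β + 1/2) (by linarith) (by linarith)
  have hV := mk_VW hψ0 hΨ hCW hg
  obtain ⟨C, hC, H⟩ := thm1D hP (Real.HolderConjugate.conjExponent e1) (a := α + 1/2) (b := β + 1/2) (by linarith) (by linarith) a1 a2 b1 b2 hab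
  have e0 : 0 < e := by linarith
  have hCC : (C * C) ^ (1/e) ≠ ⊤ := ENNReal.rpow_ne_top_of_nonneg (by positivity) (ENNReal.mul_ne_top hC hC)
  refine ⟨((C * C) ^ (1/e)).toReal + 1, by positivity, fun n f hf hfin => ?_⟩
  have hfinV := hV.fin
  have Sm : Measurable fun x : ℝ × ℝ => ∫ y, f y * K n x y ∂(nuV CW) := by
    have : Measurable fun t : (ℝ × ℝ) × (ℝ × ℝ) => f t.2 * K n t.1 t.2 := (hf.comp measurable_snd).mul (IsRK_meas (hK n))
    exact this.stronglyMeasurable.integral_prod_right.measurable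
  have es : (fun x => ∫ y in sqDom, f y * K n x y * CW y) = fun x => ∫ y, f y * K n x y ∂(nuV CW) := by
    funext x; rw [nu_integral hV]
  rw [es]
  unfold lpnormD at hfin ⊢
  rw [nu_lp hV e0 hf] at hfin ⊢
  rw [nu_lp hV e0 Sm]
  have hne : ∫⁻ q, ‖f q‖ₑ ^ e ∂(nuV CW) ≠ ⊤ := by
    intro h
    rw [h, ENNReal.top_rpow_of_pos (by positivity)] at hfin
    exact lt_irrefl _ hfin
  calc _ ≤ (C * C * ∫⁻ q, ‖f q‖ₑ ^ e ∂(nuV CW)) ^ (1/e) :=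
        ENNReal.rpow_le_rpow (boundV hV e1 (H n) (hK n) hf hne) (by positivity)
    _ = (C * C) ^ (1/e) * (∫⁻ q, ‖f q‖ₑ ^ e ∂(nuV CW)) ^ (1/e) := ENNReal.mul_rpow_of_nonneg _ _ (by positivity)
    _ ≤ _ := by
        gcongr
        rw [← ENNReal.ofReal_toReal hCC]
        apply ENNReal.ofReal_le_ofReal
        rw [ENNReal.toReal_ofReal (by positivity)]
        linarith
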